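/- Fix an integer d ≥ 3, and let α* and α̂ be the unique solutions in ((d−1)/(d−2), ∞) of f(α) = 0 and f(α) = 1 respectively, where f(α) = α·log((d−2)·α/(d−1)) − α + 1/(d−2). For each even-product n (i.e., n such that d·n is even and n ≥ d+1), let G be a uniformly random simple d-regular graph on the vertex set {1,…,n}, and, independently of G and of each other, let each edge e of G carry an exponential weight w_e of rate 1. For vertices a, b define dist_w(a,b) as the minimum over all paths from a to b of the sum of the edge weights along the path, and let |π(a,b)| be the number of edges of the (almost surely unique) path attaining this minimum. Then, as n → ∞: (i) max_{j ∈ {1,…,n}} |π(1,j)| / log n converges in probability to α*, and (ii) max_{i,j ∈ {1,…,n}} |π(i,j)| / log n converges in probability to α̂; i.e., for every ε > 0 the probability that these ratios differ from α* (resp. α̂) by more than ε tends to 0. -/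

import Mathlib

open MeasureTheory ProbabilityTheory Filter
open scoped Classical ENNReal

noncomputable section

instance simpleGraphMeasurableSpace {n : ℕ} : MeasurableSpace (SimpleGraph (Fin n)) := ⊤

/-- The total weight of a walk `p` of `G`, for edge weights `w` (indexed by unordered pairs
of vertices). -/
def walkWeight {V : Type*} {G : SimpleGraph V} (w : Sym2 V → ℝ) {a b : V}
    (p : G.Walk a b) : ℝ :=
  (p.edges.map w).sum

/-- `dist_w(a,b)`: the minimum over all paths from `a` to `b` of the sum of the edge weights
along the path. -/
def wDist {V : Type*} (G : SimpleGraph V) (w : Sym2 V → ℝ) (a b : V) : ℝ :=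
  sInf {x : ℝ | ∃ p : G.Walk a b, p.IsPath ∧ walkWeight w p = x}

/-- `|π(a,b)|`: the number of edges of the weight-minimizing path from `a` to `b` (taking, to
be definite, the minimal length among weight-minimizing paths in case of non-uniqueness). -/
def hopCount {V : Type*} (G : SimpleGraph V) (w : Sym2 V → ℝ) (a b : V) : ℕ :=
  sInf {L : ℕ | ∃ p : G.Walk a b, p.IsPath ∧ walkWeight w p = wDist G w a b ∧ p.length = L}

/-- The uniform probability measure on the (finite) set of simple `d`-regular graphs on
`{1,…,n}` (the zero measure if there are none). -/
def regularUniform (n d : ℕ) : Measure (SimpleGraph (Fin n)) :=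
  ((Finset.univ.filter fun G : SimpleGraph (Fin n) => G.IsRegularOfDegree d).card : ℝ≥0∞)⁻¹ •
    ∑ G ∈ Finset.univ.filter fun G : SimpleGraph (Fin n) => G.IsRegularOfDegree d,
      Measure.dirac G

/-- The law of the first-passage-percolation model: a uniformly random simple `d`-regular
graph on `{1,…,n}` together with (independent) i.i.d. rate-one exponential weights indexed by
the unordered pairs of vertices (the weight of an edge `e` of the graph being `w e`). -/
def fppMeasure (n d : ℕ) : Measure (SimpleGraph (Fin n) × (Sym2 (Fin n) → ℝ)) :=
  (regularUniform n d).prod (Measure.pi fun _ : Sym2 (Fin n) => expMeasure 1)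

set_option linter.unusedSectionVars false

namespace FPP

section lists
variable {V : Type*}

/-- consecutive edges of a list of vertices -/
def edgesL : List V → List (Sym2 V)
  | [] => []
  | [_] => []
  | a :: b :: l => s(a, b) :: edgesL (b :: l)

@[simp] lemma edgesL_nil : edgesL ([] : List V) = [] := rfl
@[simp] lemma edgesL_singleton (a : V) : edgesL [a] = [] := rfl
@[simp] lemma edgesL_cons_cons (a b : V) (l : List V) :
    edgesL (a :: b :: l) = s(a, b) :: edgesL (b :: l) := rfl

lemma length_edgesL (l : List V) : (edgesL l).length = l.length - 1 := by
  induction l with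
  | nil => rfl
  | cons a l ih =>
    cases l with
    | nil => rfl
    | cons b l => simp [ih]

lemma edgesL_append (l l' : List V) (v : V) :
    edgesL (l ++ v :: l') = edgesL (l ++ [v]) ++ edgesL (v :: l') := by
  induction l with
  | nil => simp
  | cons a l ih =>
    cases l with
    | nil => simp
    | cons b l => simpa using ih

lemma edgesL_reverse (l : List V) : edgesL l.reverse = (edgesL l).reverse := by
  induction l with
  | nil => rfl
  | cons a l ih =>
    cases l with
    | nil => rfl
    | cons b l =>
      have : (a :: b :: l).reverse = l.reverse ++ b :: [a] := by simp
      rw [this, edgesL_append]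
      have h2 : (b :: l).reverse = l.reverse ++ [b] := by simp
      rw [← h2, ih]
      simp [Sym2.eq_swap]

lemma mem_of_mem_edgesL {l : List V} {e : Sym2 V} (he : e ∈ edgesL l) {x : V} (hx : x ∈ e) :
    x ∈ l := by
  induction l with
  | nil => simp at he
  | cons a l ih =>
    cases l with
    | nil => simp at he
    | cons b l =>
      simp only [edgesL_cons_cons, List.mem_cons] at he
      rcases he with rfl | he
      · simp only [Sym2.mem_iff] at hx
        rcases hx with rfl | rfl <;> simp
      · exact List.mem_cons_of_mem _ (ih he)

lemma nodup_edgesL {l : List V} (h : l.Nodup) : (edgesL l).Nodup := by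
  induction l with
  | nil => simp
  | cons a l ih =>
    cases l with
    | nil => simp
    | cons b l =>
      simp only [edgesL_cons_cons, List.nodup_cons]
      rw [List.nodup_cons] at h
      refine ⟨fun hm => h.1 (mem_of_mem_edgesL hm (by simp)), ih h.2⟩

lemma not_isDiag_of_mem_edgesL {l : List V} (h : l.Nodup) {e : Sym2 V} (he : e ∈ edgesL l) :
    ¬ e.IsDiag := by
  induction l with
  | nil => simp at he
  | cons a l ih =>
    cases l with
    | nil => simp at he
    | cons b l =>
      simp only [edgesL_cons_cons, List.mem_cons] at he
      rw [List.nodup_cons] at h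
      rcases he with rfl | he
      · simp only [Sym2.mk_isDiag_iff]
        rintro rfl
        simp at h
      · exact ih h.2 he

lemma edgesL_infix {l l' : List V} (h : l <:+: l') : edgesL l <:+: edgesL l' := by
  obtain ⟨s, t, rfl⟩ := h
  cases l with
  | nil => simp
  | cons a l =>
    rcases List.eq_nil_or_concat t with rfl | _
    · rw [List.append_nil, edgesL_append]
      exact (List.suffix_append _ _).isInfix
    · rw [List.append_assoc, List.cons_append, edgesL_append]
      have : ∀ t : List V, edgesL (a :: l) <+: edgesL (a :: l ++ t) := by
        intro t
        induction l generalizing a with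
        | nil => simp
        | cons b l ih =>
          simp only [List.cons_append, edgesL_cons_cons, List.prefix_cons_inj]
          exact ih b
      exact (this t).isInfix.trans (List.suffix_append _ _).isInfix

/-- weight of a list of vertices -/
def wt (w : Sym2 V → ℝ) (l : List V) : ℝ := ((edgesL l).map w).sum

@[simp] lemma wt_nil (w : Sym2 V → ℝ) : wt w [] = 0 := rfl
@[simp] lemma wt_singleton (w : Sym2 V → ℝ) (a : V) : wt w [a] = 0 := rfl
@[simp] lemma wt_cons_cons (w : Sym2 V → ℝ) (a b : V) (l : List V) :
    wt w (a :: b :: l) = w s(a, b) + wt w (b :: l) := by simp [wt]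

lemma wt_append (w : Sym2 V → ℝ) (l l' : List V) (v : V) :
    wt w (l ++ v :: l') = wt w (l ++ [v]) + wt w (v :: l') := by
  simp only [wt]
  rw [edgesL_append]; simp

lemma wt_reverse (w : Sym2 V → ℝ) (l : List V) : wt w l.reverse = wt w l := by
  simp only [wt]
  rw [edgesL_reverse, List.map_reverse, List.sum_reverse]

lemma wt_nonneg {w : Sym2 V → ℝ} (hw : ∀ e, 0 ≤ w e) (l : List V) : 0 ≤ wt w l := by
  apply List.sum_nonneg
  simp only [List.mem_map]
  rintro _ ⟨e, _, rfl⟩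
  exact hw e

lemma wt_infix {w : Sym2 V → ℝ} (hw : ∀ e, 0 ≤ w e) {l l' : List V} (h : l <:+: l') :
    wt w l ≤ wt w l' := by
  have := (edgesL_infix h).sublist.map w
  apply List.Sublist.sum_le_sum this
  simp only [List.mem_map]
  rintro _ ⟨e, _, rfl⟩
  exact hw e

/-- simple paths of `G`, as lists of vertices -/
def IsP (G : SimpleGraph V) (l : List V) : Prop := l.IsChain G.Adj ∧ l.Nodup

lemma isChain_iff_edges (G : SimpleGraph V) (l : List V) :
    l.IsChain G.Adj ↔ ∀ e ∈ edgesL l, e ∈ G.edgeSet := by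
  induction l with
  | nil => simp
  | cons a l ih =>
    cases l with
    | nil => simp
    | cons b l => simp [List.isChain_cons_cons, ih]

lemma IsP.infix {G : SimpleGraph V} {l l' : List V} (h : IsP G l') (hi : l <:+: l') : IsP G l :=
  ⟨h.1.infix hi, hi.sublist.nodup h.2⟩

lemma IsP.reverse {G : SimpleGraph V} {l : List V} (h : IsP G l) : IsP G l.reverse := by
  refine ⟨?_, List.nodup_reverse.2 h.2⟩
  rw [isChain_iff_edges, edgesL_reverse]
  simpa using (isChain_iff_edges G l).1 h.1

lemma IsP.edge_mem {G : SimpleGraph V} {l : List V} (h : IsP G l) {e : Sym2 V}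
    (he : e ∈ edgesL l) : e ∈ G.edgeSet := (isChain_iff_edges G l).1 h.1 e he

end lists

end FPP

namespace FPP

section walks
variable {V : Type*} {G : SimpleGraph V}

/-- the list `l` goes from `a` to `b` -/
def Conn (l : List V) (a b : V) : Prop := l.head? = some a ∧ l.getLast? = some b

lemma edgesL_support {a b : V} (p : G.Walk a b) : edgesL p.support = p.edges := by
  induction p with
  | nil => rfl
  | cons h p ih =>
    cases p with
    | nil => rfl
    | cons h' p => simpa using ih

lemma walkWeight_eq (w : Sym2 V → ℝ) {a b : V} (p : G.Walk a b) :
    walkWeight w p = wt w p.support := by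
  simp [walkWeight, wt, edgesL_support]

lemma isP_support {a b : V} {p : G.Walk a b} (h : p.IsPath) : IsP G p.support :=
  ⟨p.isChain_adj_support, h.support_nodup⟩

lemma conn_support {a b : V} (p : G.Walk a b) : Conn p.support a b := by
  constructor
  · cases p <;> simp
  · rw [List.getLast?_eq_getLast_of_ne_nil p.support_ne_nil, p.getLast_support]

lemma exists_walk {l : List V} {a b : V} (hc : l.IsChain G.Adj) (h : Conn l a b) :
    ∃ p : G.Walk a b, p.support = l := by
  induction l generalizing a with
  | nil => simp [Conn] at h
  | cons x l ih =>
    obtain ⟨h1, h2⟩ := h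
    simp only [List.head?_cons, Option.some.injEq] at h1
    subst h1
    cases l with
    | nil =>
      simp at h2
      subst h2
      exact ⟨.nil, rfl⟩
    | cons y l =>
      rw [List.isChain_cons_cons] at hc
      obtain ⟨p, hp⟩ := ih hc.2 (a := y) ⟨rfl, by simpa using h2⟩
      exact ⟨.cons hc.1 p, by simp [hp]⟩

lemma exists_path {l : List V} {a b : V} (hc : IsP G l) (h : Conn l a b) :
    ∃ p : G.Walk a b, p.IsPath ∧ p.support = l := by
  obtain ⟨p, hp⟩ := exists_walk hc.1 h
  exact ⟨p, SimpleGraph.Walk.IsPath.mk' (hp ▸ hc.2), hp⟩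

/-- if a path is the unique one with weight at most its own, it determines `hopCount` -/
lemma hopCount_eq_of_unique {w : Sym2 V → ℝ} {l : List V} {a b : V} (hl : IsP G l)
    (hc : Conn l a b)
    (hu : ∀ l', IsP G l' → Conn l' a b → wt w l' ≤ wt w l → l' = l) :
    hopCount G w a b = l.length - 1 := by
  obtain ⟨p, hp, hpl⟩ := exists_path hl hc
  have hmin : ∀ x ∈ {x : ℝ | ∃ p : G.Walk a b, p.IsPath ∧ walkWeight w p = x}, wt w l ≤ x := by
    rintro x ⟨q, hq, rfl⟩
    by_contra hlt
    push Not at hlt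
    rw [walkWeight_eq] at hlt
    have := hu _ (isP_support hq) (conn_support q) hlt.le
    rw [this] at hlt
    exact lt_irrefl _ hlt
  have hD : wDist G w a b = wt w l := by
    apply le_antisymm
    · exact csInf_le ⟨wt w l, hmin⟩ ⟨p, hp, by rw [walkWeight_eq, hpl]⟩
    · exact le_csInf ⟨_, p, hp, rfl⟩ hmin
  have hset : {L : ℕ | ∃ p : G.Walk a b, p.IsPath ∧ walkWeight w p = wDist G w a b ∧ p.length = L}
      = {l.length - 1} := by
    ext L
    simp only [Set.mem_ofPred_eq, Set.mem_singleton_iff]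
    constructor
    · rintro ⟨q, hq, h1, rfl⟩
      have := hu _ (isP_support hq) (conn_support q) (by rw [← walkWeight_eq, h1, hD])
      rw [← this]; simp
    · rintro rfl
      exact ⟨p, hp, by rw [hD, walkWeight_eq, hpl], by rw [← hpl]; simp⟩
  rw [hopCount, hset]
  simp

/-- from a chain, extract a path of no larger weight -/
lemma exists_isP_of_chain {w : Sym2 V → ℝ} (hw : ∀ e, 0 ≤ w e) {l : List V} {a b : V}
    (hl : l.IsChain G.Adj) (hc : Conn l a b) :
    ∃ l', IsP G l' ∧ Conn l' a b ∧ wt w l' ≤ wt w l := by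
  induction l generalizing a with
  | nil => simp [Conn] at hc
  | cons x l ih =>
    obtain ⟨h1, h2⟩ := hc
    simp only [List.head?_cons, Option.some.injEq] at h1
    subst h1
    cases l with
    | nil => exact ⟨[x], ⟨by simp, by simp⟩, ⟨rfl, h2⟩, le_rfl⟩
    | cons y l =>
      rw [List.isChain_cons_cons] at hl
      obtain ⟨l', h3, h4, h5⟩ := ih hl.2 (a := y) ⟨rfl, by simpa using h2⟩
      have hx := hw s(x, y)
      by_cases hm : x ∈ l'
      · obtain ⟨s, t, rfl⟩ := List.append_of_mem hm
        refine ⟨x :: t, h3.infix (List.suffix_append _ _).isInfix, ⟨rfl, ?_⟩, ?_⟩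
        · have := h4.2
          rw [List.getLast?_append_of_ne_nil _ (by simp)] at this
          exact this
        · rw [wt_cons_cons]
          have := wt_infix hw (List.suffix_append s (x :: t)).isInfix
          linarith
      · cases l' with
        | nil => simp [Conn] at h4
        | cons z l' =>
          obtain ⟨h6, h7⟩ := h4
          simp only [List.head?_cons, Option.some.injEq] at h6
          subst h6
          refine ⟨x :: z :: l', ⟨?_, List.nodup_cons.2 ⟨hm, h3.2⟩⟩, ⟨rfl, by simpa using h7⟩, ?_⟩
          · rw [List.isChain_cons_cons]; exact ⟨hl.1, h3.1⟩
          · rw [wt_cons_cons, wt_cons_cons]; linarith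

/-- a geodesic list: each segment is at most any other connecting chain -/
def Geo (G : SimpleGraph V) (w : Sym2 V → ℝ) (l : List V) : Prop :=
  ∀ σ, σ <:+: l → ∀ a b, Conn σ a b → ∀ R : List V, R.IsChain G.Adj → Conn R a b → wt w σ ≤ wt w R

lemma exists_geo {w : Sym2 V → ℝ} [Finite V] (hw : ∀ e, 0 ≤ w e) {a b : V} {k : ℕ}
    (hk : 0 < k) (h : k ≤ hopCount G w a b) :
    ∃ l, IsP G l ∧ l.head? = some a ∧ l.length = k + 1 ∧ Geo G w l := by
  have hne : {L : ℕ | ∃ p : G.Walk a b, p.IsPath ∧ walkWeight w p = wDist G w a b ∧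
      p.length = L}.Nonempty := by
    by_contra hcon
    rw [Set.not_nonempty_iff_eq_empty] at hcon
    rw [hopCount, hcon] at h
    simp at h
    omega
  obtain ⟨p, hp, hpw, hpl⟩ := Nat.sInf_mem hne
  have hpl' : p.length = hopCount G w a b := hpl
  set l := p.support with hl
  have hmin : ∀ R : List V, R.IsChain G.Adj → Conn R a b → wt w l ≤ wt w R := by
    intro R hR hRc
    obtain ⟨R', h1, h2, h3⟩ := exists_isP_of_chain hw hR hRc
    obtain ⟨q, hq, hqR⟩ := exists_path h1 h2
    have : wDist G w a b ≤ walkWeight w q := by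
      apply csInf_le
      · refine ⟨0, ?_⟩
        rintro _ ⟨q, _, rfl⟩
        rw [walkWeight_eq]; exact wt_nonneg hw _
      · exact ⟨q, hq, rfl⟩
    rw [← hpw, walkWeight_eq, walkWeight_eq, hqR] at this
    exact this.trans h3
  have hgeo : Geo G w l := by
    rintro σ ⟨A, B, hAB⟩ x y hσ R hR hRc
    have hσ0 := hσ
    obtain ⟨h1, h2⟩ := hσ
    obtain ⟨h3, h4⟩ := hRc
    -- weights of concatenations
    have key : ∀ τ : List V, Conn τ x y →
        wt w (A ++ τ ++ B) = wt w (A ++ [x]) + wt w τ + wt w (y :: B) := by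
      rintro τ ⟨h5, h6⟩
      have e1 : wt w (A ++ τ ++ B) = wt w (A ++ [x]) + wt w (τ ++ B) := by
        cases τ with
        | nil => simp at h5
        | cons z τ =>
          simp at h5; subst h5
          rw [List.append_assoc, List.cons_append, wt_append]
      have e2 : wt w (τ ++ B) = wt w τ + wt w (y :: B) := by
        rcases List.eq_nil_or_concat τ with rfl | ⟨τ', z, rfl⟩
        · simp at h5
        · simp at h6; subst h6
          rw [List.concat_eq_append, List.append_assoc, List.singleton_append, wt_append]
      rw [e1, e2]; ring
    have hconn : Conn (A ++ R ++ B) a b ∧ (A ++ R ++ B).IsChain G.Adj := by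
      have hc0 := conn_support p
      have hch := p.isChain_adj_support
      rw [← hl, ← hAB] at hc0 hch
      constructor
      · constructor
        · have := hc0.1
          simp only [List.head?_append, h1, h3] at this ⊢
          exact this
        · have := hc0.2
          simp only [List.getLast?_append, h2, h4] at this ⊢
          exact this
      · rw [List.append_assoc, List.isChain_append] at hch ⊢
        obtain ⟨i1, i2, i3⟩ := hch
        rw [List.isChain_append] at i2 ⊢
        refine ⟨i1, ⟨hR, i2.2.1, ?_⟩, ?_⟩
        · rw [h4, ← h2]; exact i2.2.2
        · intro u hu v hv
          apply i3 u hu v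
          simp only [List.head?_append, h1, h3] at hv ⊢
          exact hv
    have := hmin _ hconn.2 hconn.1
    rw [← hAB, key σ hσ0, key R ⟨h3, h4⟩] at this
    linarith
  have hlen : k + 1 ≤ l.length := by
    rw [hl, SimpleGraph.Walk.length_support]; omega
  refine ⟨l.take (k+1), (isP_support hp).infix (List.take_prefix _ _).isInfix, ?_, ?_, ?_⟩
  · rw [List.head?_take]; simp [(conn_support p).1, hl]
  · simp [hlen]
  · intro σ hσ
    exact hgeo σ (hσ.trans (List.take_prefix _ _).isInfix)

end walks

section iso
variable {V : Type*}

/-- no excursion from `P` of weight at most `t` -/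
def Iso (G : SimpleGraph V) (w : Sym2 V → ℝ) (t : ℝ) (P : List V) : Prop :=
  ∀ (u v : V) (mid : List V), u ∈ P → v ∈ P → (∀ x ∈ mid, x ∉ P) →
    IsP G (u :: (mid ++ [v])) → wt w (u :: (mid ++ [v])) ≤ t → mid = [] ∧ s(u, v) ∈ edgesL P

lemma first_mem {p : V → Prop} (τ : List V) (h : ∃ x ∈ τ, p x) :
    ∃ mid v rest, τ = mid ++ v :: rest ∧ p v ∧ ∀ x ∈ mid, ¬ p x := by
  induction τ with
  | nil => simp at h
  | cons a τ ih =>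
    by_cases ha : p a
    · exact ⟨[], a, τ, rfl, ha, by simp⟩
    · obtain ⟨x, hx, hpx⟩ := h
      have : x ∈ τ := by
        rcases List.mem_cons.1 hx with rfl | h
        · exact absurd hpx ha
        · exact h
      obtain ⟨mid, v, rest, h1, h2, h3⟩ := ih ⟨x, this, hpx⟩
      refine ⟨a :: mid, v, rest, by simp [h1], h2, ?_⟩
      intro y hy
      rcases List.mem_cons.1 hy with rfl | h
      · exact ha
      · exact h3 y h

lemma Iso.edges {G : SimpleGraph V} {w : Sym2 V → ℝ} {t : ℝ} {P : List V} (hP : Iso G w t P)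
    (hw : ∀ e, 0 ≤ w e) (m : ℕ) : ∀ (u z : V) (σ : List V), σ.length ≤ m → u ∈ P → z ∈ P →
    (u :: σ).getLast? = some z → IsP G (u :: σ) → wt w (u :: σ) ≤ t →
    ∀ e ∈ edgesL (u :: σ), e ∈ edgesL P := by
  induction m with
  | zero =>
    intro u z σ hm _ _ _ _ _ e he
    have : σ = [] := by simpa using hm
    subst this
    simp at he
  | succ m ih =>
    intro u z σ hm hu hz hlast hσ hwt e he
    cases σ with
    | nil => simp at he
    | cons a σ =>
      have hzm : z ∈ a :: σ := by
        rw [List.getLast?_cons_cons] at hlast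
        exact List.mem_of_getLast? hlast
      obtain ⟨mid, v, rest, h1, h2, h3⟩ := first_mem (p := (· ∈ P)) (a :: σ) ⟨z, hzm, hz⟩
      rw [h1] at hσ hwt he hlast hm
      have hpre : u :: (mid ++ [v]) <:+: u :: (mid ++ v :: rest) := by
        refine ⟨[], rest, by simp⟩
      have hsuf : v :: rest <:+: u :: (mid ++ v :: rest) := ⟨u :: mid, [], by simp⟩
      obtain ⟨h4, h5⟩ := hP u v mid hu h2 h3 (hσ.infix hpre) ((wt_infix hw hpre).trans hwt)
      subst h4
      simp only [List.nil_append, edgesL_cons_cons, List.mem_cons] at he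
      rcases he with rfl | he
      · exact h5
      · refine ih v z rest ?_ h2 hz ?_ (hσ.infix hsuf) ((wt_infix hw hsuf).trans hwt) e he
        · simp at hm; omega
        · simpa [List.getLast?_cons_cons] using hlast

lemma edge_pos {X Z : List V} {a b : V} (h : (X ++ b :: Z).Nodup)
    (he : s(a, b) ∈ edgesL (X ++ b :: Z)) :
    (∃ X', X = X' ++ [a]) ∨ ∃ Z', Z = a :: Z' := by
  induction X with
  | nil =>
    right
    cases Z with
    | nil => simp at he
    | cons c Z =>
      simp only [List.nil_append, edgesL_cons_cons, List.mem_cons] at he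
      rcases he with he | he
      · have : a = c := by
          simp only [Sym2.eq_iff] at he
          rcases he with ⟨h1, h2⟩ | ⟨h1, h2⟩
          · rw [h1, h2]
          · exact h1
        exact ⟨Z, by rw [this]⟩
      · exact absurd (mem_of_mem_edgesL he (x := b) (by simp)) (by simpa using (List.nodup_cons.1 h).1)
  | cons c X ih =>
    cases X with
    | nil =>
      simp only [List.cons_append, List.nil_append, edgesL_cons_cons, List.mem_cons] at he
      rcases he with he | he
      · left
        have : a = c := by
          simp only [Sym2.eq_iff] at he
          rcases he with ⟨h1, h2⟩ | ⟨h1, h2⟩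
          · exact h1
          · rw [h1, h2]
        exact ⟨[], by simp [this]⟩
      · rcases ih (by simpa using (List.nodup_cons.1 h).2) he with ⟨X', hX⟩ | h
        · simp at hX
        · exact Or.inr h
    | cons c' X =>
      simp only [List.cons_append, edgesL_cons_cons, List.mem_cons] at he
      have h' := (List.nodup_cons.1 h)
      have key : s(a, b) ∈ edgesL (c' :: X ++ b :: Z) := by
        simp only [List.cons_append]
        rcases he with he | he
        · exfalso
          have hb : b ∈ s(c, c') := by rw [← he]; simp
          simp only [Sym2.mem_iff] at hb
          rcases hb with rfl | rfl
          · apply h'.1; simp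
          · have := (List.nodup_cons.1 h'.2).1; simp at this
        · exact he
      rcases ih h'.2 key with ⟨X', hX⟩ | h
      · exact Or.inl ⟨c :: X', by simp [hX]⟩
      · exact Or.inr h

lemma infix_of_edges {P : List V} (hP : P.Nodup) {σ : List V} (hσ : σ.Nodup) (hne : σ ≠ [])
    (hh : ∀ x ∈ σ, x ∈ P) (he : ∀ e ∈ edgesL σ, e ∈ edgesL P) :
    σ <:+: P ∨ σ <:+: P.reverse := by
  induction σ with
  | nil => simp at hne
  | cons a σ ih =>
    cases σ with
    | nil =>
      left
      have := hh a (by simp)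
      obtain ⟨s, t, h⟩ := List.append_of_mem this
      exact ⟨s, t, by simp [h]⟩
    | cons b τ =>
      have hstep : ∀ P : List V, P.Nodup → s(a, b) ∈ edgesL P → b :: τ <:+: P →
          (a :: b :: τ <:+: P ∨ a :: b :: τ <:+: P.reverse) := by
        rintro P hP hab ⟨X, Y, rfl⟩
        have e1 : X ++ b :: τ ++ Y = X ++ b :: (τ ++ Y) := by simp
        rw [e1] at hP hab
        rcases edge_pos hP hab with ⟨X', rfl⟩ | ⟨Z', hZ⟩
        · left; exact ⟨X', Y, by simp⟩
        · cases τ with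
          | nil =>
            simp only [List.nil_append] at hZ
            subst hZ
            right
            exact ⟨Z'.reverse, X.reverse, by simp⟩
          | cons c τ =>
            simp only [List.cons_append, List.cons.injEq] at hZ
            exfalso
            rw [List.nodup_cons] at hσ
            apply hσ.1
            simp [hZ.1]
      have hab := he s(a, b) (by simp)
      rcases ih (List.nodup_cons.1 hσ).2 (by simp) (fun x hx => hh x (List.mem_cons_of_mem _ hx))
        (fun e h => he e (by simp [h])) with h | h
      · exact hstep P hP hab h
      · have := hstep P.reverse (List.nodup_reverse.2 hP) (by rw [edgesL_reverse]; simpa using hab) h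
        rw [List.reverse_reverse] at this
        exact this.symm

/-- structure of a light path relative to an isolated path -/
lemma Iso.structure {G : SimpleGraph V} {w : Sym2 V → ℝ} {t : ℝ} {P : List V} (hP : Iso G w t P)
    (hPn : P.Nodup) (hw : ∀ e, 0 ≤ w e) {Q : List V} (hQ : IsP G Q) (hwt : wt w Q ≤ t)
    (hne : ∃ x ∈ Q, x ∈ P) :
    ∃ A σ B, Q = A ++ σ ++ B ∧ σ ≠ [] ∧ (σ <:+: P ∨ σ <:+: P.reverse) ∧
      (∀ x ∈ A, x ∉ P) ∧ (∀ x ∈ B, x ∉ P) := by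
  obtain ⟨A, u, rest, h1, h2, h3⟩ := first_mem (p := (· ∈ P)) Q hne
  obtain ⟨Br, z, σr, h4, h5, h6⟩ := first_mem (p := (· ∈ P)) (u :: rest).reverse
    ⟨u, by simp, h2⟩
  have h7 : u :: rest = σr.reverse ++ [z] ++ Br.reverse := by
    have := congrArg List.reverse h4
    rw [List.reverse_reverse] at this
    rw [this]; simp
  refine ⟨A, σr.reverse ++ [z], Br.reverse, ?_, by simp, ?_, h3, by simpa using h6⟩
  · rw [h1, h7]; simp
  have hinf : σr.reverse ++ [z] <:+: Q := ⟨A, Br.reverse, by rw [h1, h7]; simp⟩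
  obtain ⟨τ, hτ⟩ : ∃ τ, σr.reverse ++ [z] = u :: τ := by
    cases hh : σr.reverse with
    | nil =>
      rw [hh] at h7; simp at h7
      exact ⟨[], by simp [h7.1]⟩
    | cons c s =>
      rw [hh] at h7; simp at h7
      exact ⟨s ++ [z], by simp [h7.1]⟩
  have hed : ∀ e ∈ edgesL (u :: τ), e ∈ edgesL P := by
    apply hP.edges hw τ.length u z τ le_rfl h2 h5
    · rw [← hτ]; simp
    · rw [← hτ]; exact hQ.infix hinf
    · rw [← hτ]; exact (wt_infix hw hinf).trans hwt
  have hnod : (u :: τ).Nodup := by rw [← hτ]; exact (hQ.infix hinf).2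
  rw [hτ]
  apply infix_of_edges hPn hnod (by simp) _ hed
  -- all vertices on P
  have hv : ∀ (l : List V), (∀ e ∈ edgesL l, e ∈ edgesL P) → (∀ y, l.head? = some y → y ∈ P) →
      ∀ x ∈ l, x ∈ P := by
    intro l
    induction l with
    | nil => simp
    | cons a l ih =>
      intro h8 h9 x hx
      rcases List.mem_cons.1 hx with rfl | hx
      · exact h9 x rfl
      · cases l with
        | nil => simp at hx
        | cons b l =>
          refine ih (fun e he => h8 e (by simp [he])) ?_ x hx
          intro y hy
          simp at hy; subst hy
          exact mem_of_mem_edgesL (h8 s(a, b) (by simp)) (by simp)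
  exact hv _ hed (by simpa using h2)

/-- an isolated path of weight at most `t` is the unique geodesic -/
lemma Iso.unique {G : SimpleGraph V} {w : Sym2 V → ℝ} {t : ℝ} {P : List V} (hP : Iso G w t P)
    (hPp : IsP G P) (hw : ∀ e, 0 ≤ w e) {Q : List V} (hQ : IsP G Q) (hwt : wt w Q ≤ t) {a b : V}
    (hab : a ≠ b)
    (hcP : Conn P a b) (hcQ : Conn Q a b) : Q = P := by
  have haP : a ∈ P := List.mem_of_head? hcP.1
  have haQ : a ∈ Q := List.mem_of_head? hcQ.1
  have hbP : b ∈ P := List.mem_of_getLast? hcP.2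
  obtain ⟨A, σ, B, h1, h2, h3, h4, h5⟩ := hP.structure hPp.2 hw hQ hwt ⟨a, haQ, haP⟩
  have hA : A = [] := by
    cases A with
    | nil => rfl
    | cons x A =>
      exfalso
      have := hcQ.1
      rw [h1] at this
      simp at this
      exact h4 x (by simp) (this ▸ haP)
  have hB : B = [] := by
    rcases List.eq_nil_or_concat B with h | ⟨B', x, rfl⟩
    · exact h
    · exfalso
      have := hcQ.2
      rw [h1] at this
      simp at this
      exact h5 x (by simp) (this ▸ hbP)
  subst hA hB
  simp only [List.nil_append, List.append_nil] at h1
  subst h1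
  rcases h3 with ⟨X, Y, h⟩ | ⟨X, Y, h⟩
  · have hX : X = [] := by
      cases X with
      | nil => rfl
      | cons x X =>
        exfalso
        have h6 := hcP.1
        have h7 := hPp.2
        rw [← h] at h6 h7
        simp at h6
        subst h6
        simp only [List.cons_append, List.nodup_cons] at h7
        apply h7.1
        simp [haQ]
    have hY : Y = [] := by
      rcases List.eq_nil_or_concat Y with h | ⟨Y', x, rfl⟩
      · exact h
      · exfalso
        have h6 := hcP.2
        have h7 := hPp.2
        rw [← h] at h6 h7
        simp at h6
        subst h6
        rw [List.nodup_append] at h7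
        exact h7.2.2 x (by simp [List.mem_of_getLast? hcQ.2]) x (by simp) rfl
    subst hX hY
    simpa using h
  · exfalso
    have hr : Conn P.reverse b a := ⟨by simpa using hcP.2, by simpa using hcP.1⟩
    have hn := List.nodup_reverse.2 hPp.2
    rw [← h] at hr hn
    -- Q starts with a and ends with b; in the reverse, b is first
    obtain ⟨Q', rfl⟩ : ∃ Q', Q = a :: Q' := by
      cases Q with
      | nil => simp at h2
      | cons x Q => have := hcQ.1; simp at this; exact ⟨Q, by rw [this]⟩
    have hbQ : b ∈ Q' := by
      have := List.mem_of_getLast? hcQ.2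
      rcases List.mem_cons.1 this with h | h
      · exact absurd h.symm hab
      · exact h
    cases X with
    | nil =>
      have := hr.1; simp at this; exact hab this
    | cons x X =>
      have := hr.1; simp at this; subst this
      simp only [List.cons_append, List.nodup_cons] at hn
      apply hn.1; simp [hbQ]

end iso
end FPP

namespace FPP

/-- the set of `d`-regular graphs -/
def Reg (n d : ℕ) : Finset (SimpleGraph (Fin n)) :=
  Finset.univ.filter fun G : SimpleGraph (Fin n) => G.IsRegularOfDegree d

/-- neighbours -/
def nb {n : ℕ} (G : SimpleGraph (Fin n)) (v : Fin n) : Finset (Fin n) :=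
  Finset.univ.filter (G.Adj v)

section
variable {n d : ℕ} {G : SimpleGraph (Fin n)}

@[simp] lemma mem_nb {v x : Fin n} : x ∈ nb G v ↔ G.Adj v x := by simp [nb]

lemma mem_Reg : G ∈ Reg n d ↔ ∀ v, (nb G v).card = d := by
  rw [Reg, Finset.mem_filter]
  simp only [Finset.mem_univ, true_and, SimpleGraph.IsRegularOfDegree]
  apply forall_congr'
  intro v
  have : nb G v = G.neighborFinset v := by ext x; simp
  rw [this, SimpleGraph.card_neighborFinset_eq_degree]

/-- directed edges -/
def dart (G : SimpleGraph (Fin n)) : Finset (Fin n × Fin n) :=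
  Finset.univ.filter fun p => G.Adj p.1 p.2

lemma mem_dart {p : Fin n × Fin n} : p ∈ dart G ↔ G.Adj p.1 p.2 := by simp [dart]

lemma card_dart (hG : G ∈ Reg n d) : (dart G).card = n * d := by
  have h : dart G = (Finset.univ : Finset (Fin n)).biUnion (fun v => (nb G v).image (fun x => (v, x))) := by
    ext ⟨a, b⟩; simp [dart]
  rw [h, Finset.card_biUnion]
  · rw [Finset.sum_congr rfl (fun v _ => by
      rw [Finset.card_image_of_injective _ (Prod.mk_right_injective v), mem_Reg.1 hG v])]
    simp
  · intro a _ b _ hab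
    rw [Function.onFun, Finset.disjoint_left]
    rintro ⟨x, y⟩ h1 h2
    simp at h1 h2
    exact hab (h1.2.trans h2.2.symm)

lemma card_dart_fst (hG : G ∈ Reg n d) (s : Finset (Fin n)) :
    ((dart G).filter (fun p => p.1 ∈ s)).card = s.card * d := by
  have h : (dart G).filter (fun p => p.1 ∈ s) = s.biUnion (fun v => (nb G v).image (fun x => (v, x))) := by
    ext ⟨a, b⟩; simp [dart, and_comm]
  rw [h, Finset.card_biUnion]
  · rw [Finset.sum_congr rfl (fun v _ => by
      rw [Finset.card_image_of_injective _ (Prod.mk_right_injective v), mem_Reg.1 hG v])]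
    simp
  · intro a _ b _ hab
    rw [Function.onFun, Finset.disjoint_left]
    rintro ⟨x, y⟩ h1 h2
    simp at h1 h2
    exact hab (h1.2.trans h2.2.symm)

lemma card_dart_snd (hG : G ∈ Reg n d) (s : Finset (Fin n)) :
    ((dart G).filter (fun p => p.2 ∈ s)).card = s.card * d := by
  rw [← card_dart_fst hG s]
  apply Finset.card_bij' (fun p _ => p.swap) (fun p _ => p.swap)
  all_goals simp [dart, SimpleGraph.adj_comm]

lemma card_dart_edge (F : Finset (Sym2 (Fin n))) :
    ((dart G).filter (fun p => s(p.1, p.2) ∈ F)).card ≤ 2 * F.card := by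
  have : ∀ e ∈ F, (((dart G).filter (fun p => s(p.1, p.2) ∈ F)).filter
      (fun p => s(p.1, p.2) = e)).card ≤ 2 := by
    intro e _
    induction e with
    | h a b =>
      apply (Finset.card_le_card (t := {(a, b), (b, a)}) _).trans Finset.card_le_two
      rintro ⟨x, y⟩ hp
      simp only [Finset.mem_filter, Sym2.eq_iff] at hp
      simp only [Finset.mem_insert, Finset.mem_singleton, Prod.mk.injEq]
      exact hp.2
  have h := Finset.card_le_mul_card_image_of_maps_to
    (s := (dart G).filter (fun p => s(p.1, p.2) ∈ F)) (t := F) (f := fun p => s(p.1, p.2))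
    (fun p hp => (Finset.mem_filter.1 hp).2) 2 this
  exact h

/-- edge switching -/
def sw (G : SimpleGraph (Fin n)) (a x b y : Fin n) : SimpleGraph (Fin n) :=
  SimpleGraph.fromEdgeSet ((G.edgeSet \ {s(a, x), s(b, y)}) ∪ {s(a, b), s(x, y)})

/-- admissible switchings -/
structure Sw (G : SimpleGraph (Fin n)) (a x b y : Fin n) : Prop where
  ab : a ≠ b
  ay : a ≠ y
  xb : x ≠ b
  xy : x ≠ y
  hax : G.Adj a x
  hby : G.Adj b y
  hab : ¬ G.Adj a b
  hxy : ¬ G.Adj x y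

lemma sw_adj {a x b y u v : Fin n} (h : Sw G a x b y) : (sw G a x b y).Adj u v ↔
    (G.Adj u v ∧ s(u, v) ≠ s(a, x) ∧ s(u, v) ≠ s(b, y)) ∨ s(u, v) = s(a, b) ∨ s(u, v) = s(x, y) := by
  simp only [sw, SimpleGraph.fromEdgeSet_adj, Set.mem_union, Set.mem_sdiff, SimpleGraph.mem_edgeSet,
    Set.mem_insert_iff, Set.mem_singleton_iff, not_or]
  constructor
  · rintro ⟨h1, h2⟩; exact h1
  · intro h1
    refine ⟨h1, ?_⟩
    rintro rfl
    rcases h1 with h1 | h1 | h1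
    · exact G.loopless.irrefl _ h1.1
    · simp only [Sym2.eq_iff] at h1; apply h.ab; rcases h1 with ⟨rfl, rfl⟩ | ⟨rfl, rfl⟩ <;> rfl
    · simp only [Sym2.eq_iff] at h1; apply h.xy; rcases h1 with ⟨rfl, rfl⟩ | ⟨rfl, rfl⟩ <;> rfl

lemma mem_sw_edgeSet {a x b y : Fin n} {e : Sym2 (Fin n)} (h : Sw G a x b y) :
    e ∈ (sw G a x b y).edgeSet ↔
    (e ∈ G.edgeSet ∧ e ≠ s(a, x) ∧ e ≠ s(b, y)) ∨ e = s(a, b) ∨ e = s(x, y) := by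
  induction e with
  | h u v => simp only [SimpleGraph.mem_edgeSet, sw_adj h]

lemma Sw.symm1 {a x b y : Fin n} (h : Sw G a x b y) : Sw G x a y b :=
  ⟨h.xy, h.xb, h.ay, h.ab, h.hax.symm, h.hby.symm, h.hxy, h.hab⟩

lemma Sw.symm2 {a x b y : Fin n} (h : Sw G a x b y) : Sw G b y a x :=
  ⟨h.ab.symm, h.xb.symm, h.ay.symm, h.xy.symm, h.hby, h.hax, fun h' => h.hab h'.symm,
    fun h' => h.hxy h'.symm⟩

lemma sw_symm1 (a x b y : Fin n) : sw G x a y b = sw G a x b y := by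
  unfold sw
  congr 1
  rw [Sym2.eq_swap (a := x) (b := a), Sym2.eq_swap (a := y) (b := b),
    Set.pair_comm s(x, y)]

lemma sw_symm2 (a x b y : Fin n) : sw G b y a x = sw G a x b y := by
  unfold sw
  congr 1
  rw [Sym2.eq_swap (a := b) (b := a), Sym2.eq_swap (a := y) (b := x), Set.pair_comm s(b, y)]

lemma Sw.inv {a x b y : Fin n} (h : Sw G a x b y) : Sw (sw G a x b y) a b x y := by
  have hne := h.hax.ne
  have hne2 := h.hby.ne
  refine ⟨hne, h.ay, h.xb.symm, hne2, ?_, ?_, ?_, ?_⟩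
  · rw [sw_adj h]; simp
  · rw [sw_adj h]; simp
  · rw [sw_adj h]
    rintro (h1 | h1 | h1)
    · exact h1.2.1 rfl
    · simp only [Sym2.eq_iff] at h1
      rcases h1 with ⟨h1, h2⟩ | ⟨h1, h2⟩
      · exact h.xb h2
      · exact h.ab h1
    · simp only [Sym2.eq_iff] at h1
      rcases h1 with ⟨h1, h2⟩ | ⟨h1, h2⟩
      · exact hne h1
      · exact h.ay h1
  · rw [sw_adj h]
    rintro (h1 | h1 | h1)
    · exact h1.2.2 rfl
    · simp only [Sym2.eq_iff] at h1
      rcases h1 with ⟨h1, h2⟩ | ⟨h1, h2⟩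
      · exact h.ab h1.symm
      · exact h.ay h2.symm
    · simp only [Sym2.eq_iff] at h1
      rcases h1 with ⟨h1, h2⟩ | ⟨h1, h2⟩
      · exact h.xb h1.symm
      · exact h.xy h2.symm

lemma sw_sw {a x b y : Fin n} (h : Sw G a x b y) : sw (sw G a x b y) a b x y = G := by
  rw [← SimpleGraph.edgeSet_inj]
  ext e
  rw [mem_sw_edgeSet h.inv, mem_sw_edgeSet h]
  constructor
  · rintro (⟨h1 | h1 | h1, h2, h3⟩ | h1 | h1)
    · exact h1.1
    · exact absurd h1 h2
    · exact absurd h1 h3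
    · rw [h1]; exact h.hax
    · rw [h1]; exact h.hby
  · intro he
    by_cases h1 : e = s(a, x)
    · simp [h1]
    by_cases h2 : e = s(b, y)
    · simp [h2]
    left
    refine ⟨Or.inl ⟨he, h1, h2⟩, ?_, ?_⟩
    · rintro rfl; exact h.hab he
    · rintro rfl; exact h.hxy he

lemma nb_sw_a {a x b y : Fin n} (h : Sw G a x b y) :
    nb (sw G a x b y) a = insert b ((nb G a).erase x) := by
  ext v
  simp only [mem_nb, sw_adj h, Finset.mem_insert, Finset.mem_erase]
  have hne := h.hax.ne
  have := h.ab
  have := h.ay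
  simp only [Sym2.eq_iff, ne_eq]
  constructor
  · rintro (h1 | h1 | h1)
    · right; refine ⟨?_, h1.1⟩; rintro rfl; simp at h1
    · left; rcases h1 with h1 | h1
      · exact h1.2
      · exact absurd h1.1 h.ab
    · rcases h1 with h1 | h1
      · exact absurd h1.1 hne
      · exact absurd h1.1 h.ay
  · rintro (rfl | h1)
    · simp
    · left; refine ⟨h1.2, ?_, ?_⟩
      · rintro (h2 | h2)
        · exact h1.1 h2.2
        · exact hne h2.1
      · rintro (h2 | h2)
        · exact h.ab h2.1
        · exact h.ay h2.1

lemma card_nb_sw_a {a x b y : Fin n} (h : Sw G a x b y) :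
    (nb (sw G a x b y) a).card = (nb G a).card := by
  rw [nb_sw_a h, Finset.card_insert_of_notMem (by simp [h.hab]), Finset.card_erase_of_mem (by simp [h.hax])]
  have : 0 < (nb G a).card := Finset.card_pos.2 ⟨x, by simp [h.hax]⟩
  omega

lemma nb_sw_other {a x b y v : Fin n} (h : Sw G a x b y) (h1 : v ≠ a) (h2 : v ≠ x) (h3 : v ≠ b)
    (h4 : v ≠ y) : nb (sw G a x b y) v = nb G v := by
  ext u
  simp only [mem_nb, sw_adj h, Sym2.eq_iff, ne_eq]
  simp [h1, h2, h3, h4]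

lemma sw_mem_Reg {a x b y : Fin n} (h : Sw G a x b y) (hG : G ∈ Reg n d) :
    sw G a x b y ∈ Reg n d := by
  rw [mem_Reg] at hG ⊢
  intro v
  rw [← hG v]
  by_cases h1 : v = a
  · rw [h1]; exact card_nb_sw_a h
  by_cases h2 : v = x
  · rw [h2, ← sw_symm1]; exact card_nb_sw_a h.symm1
  by_cases h3 : v = b
  · rw [h3, ← sw_symm2]; exact card_nb_sw_a h.symm2
  by_cases h4 : v = y
  · rw [h4, ← sw_symm2, ← sw_symm1]; exact card_nb_sw_a h.symm2.symm1
  rw [nb_sw_other h h1 h2 h3 h4]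

/-- regular graphs containing an edge set -/
def RegF (n d : ℕ) (F : Finset (Sym2 (Fin n))) : Finset (SimpleGraph (Fin n)) :=
  (Reg n d).filter fun G => ∀ e ∈ F, e ∈ G.edgeSet

lemma mem_RegF {F : Finset (Sym2 (Fin n))} :
    G ∈ RegF n d F ↔ G ∈ Reg n d ∧ ∀ e ∈ F, e ∈ G.edgeSet := by simp [RegF]

lemma RegF_mono {F F' : Finset (Sym2 (Fin n))} (h : F ⊆ F') : RegF n d F' ⊆ RegF n d F := by
  intro G
  simp only [mem_RegF]
  exact fun h1 => ⟨h1.1, fun e he => h1.2 e (h he)⟩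

/-- number of admissible switchings keeping `F` -/
lemma card_switch_lower (hG : G ∈ Reg n d) (F : Finset (Sym2 (Fin n))) {u v : Fin n}
    (huv : G.Adj u v) :
    n * d ≤ ((dart G).filter (fun p => s(p.1, p.2) ∉ F ∧ Sw G u v p.1 p.2)).card
      + (2 * F.card + 4 * d + 2 * d ^ 2) := by
  have hsub : dart G ⊆ (dart G).filter (fun p => s(p.1, p.2) ∉ F ∧ Sw G u v p.1 p.2) ∪
      ((dart G).filter (fun p => s(p.1, p.2) ∈ F) ∪
      ((dart G).filter (fun p => p.1 ∈ ({u, v} : Finset (Fin n))) ∪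
      ((dart G).filter (fun p => p.2 ∈ ({u, v} : Finset (Fin n))) ∪
      ((dart G).filter (fun p => p.1 ∈ nb G u) ∪ (dart G).filter (fun p => p.2 ∈ nb G v))))) := by
    intro p hp
    simp only [Finset.mem_union, Finset.mem_filter, hp, true_and, mem_nb, Finset.mem_insert,
      Finset.mem_singleton]
    by_contra hcon
    push Not at hcon
    obtain ⟨h1, h2, h3, h4, h5, h6⟩ := hcon
    exact h1 h2 ⟨h3.1.symm, h4.1.symm, h3.2.symm, h4.2.symm, huv, mem_dart.1 hp, h5, h6⟩
  have h0 := Finset.card_le_card hsub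
  rw [card_dart hG] at h0
  have c1 := card_dart_edge (G := G) F
  have c2 := card_dart_fst hG {u, v}
  have c3 := card_dart_snd hG {u, v}
  have c4 := card_dart_fst hG (nb G u)
  have c5 := card_dart_snd hG (nb G v)
  rw [mem_Reg.1 hG] at c4 c5
  have h2 : ({u, v} : Finset (Fin n)).card = 2 := Finset.card_pair huv.ne
  rw [h2] at c2 c3
  refine h0.trans ?_
  refine (Finset.card_union_le _ _).trans (Nat.add_le_add_left ?_ _)
  refine (Finset.card_union_le _ _).trans ?_
  have u1 := Finset.card_union_le ((dart G).filter (fun p => p.1 ∈ ({u, v} : Finset (Fin n))))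
    ((dart G).filter (fun p => p.2 ∈ ({u, v} : Finset (Fin n))) ∪
      ((dart G).filter (fun p => p.1 ∈ nb G u) ∪ (dart G).filter (fun p => p.2 ∈ nb G v)))
  have u2 := Finset.card_union_le ((dart G).filter (fun p => p.2 ∈ ({u, v} : Finset (Fin n))))
      ((dart G).filter (fun p => p.1 ∈ nb G u) ∪ (dart G).filter (fun p => p.2 ∈ nb G v))
  have u3 := Finset.card_union_le ((dart G).filter (fun p => p.1 ∈ nb G u))
    ((dart G).filter (fun p => p.2 ∈ nb G v))
  rw [c2] at u1
  rw [c3] at u2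
  rw [c4, c5] at u3
  nlinarith

/-- Lemma A: adding one edge costs a factor `2d/n` -/
lemma switch_bound (hd : 0 < d) {F : Finset (Sym2 (Fin n))} {e : Sym2 (Fin n)} (he : e ∉ F)
    (hF : 8 * F.card ≤ n * d) (hn : 16 + 8 * d ≤ n) :
    n * (RegF n d (insert e F)).card ≤ 2 * d * (RegF n d F).card := by
  induction e with
  | h u v =>
  set X := RegF n d (insert s(u, v) F)
  set Y := RegF n d F
  set S : Finset (Σ _ : SimpleGraph (Fin n), Fin n × Fin n) := X.sigma
    (fun G => (dart G).filter (fun p => s(p.1, p.2) ∉ F ∧ Sw G u v p.1 p.2))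
  set T : Finset (Σ _ : SimpleGraph (Fin n), Fin n × Fin n) := Y.sigma
    (fun G => nb G u ×ˢ nb G v)
  have hST : S.card ≤ T.card := by
    apply Finset.card_le_card_of_injOn (fun q => ⟨sw q.1 u v q.2.1 q.2.2, q.2⟩)
    · rintro ⟨G, b, y⟩ hq
      simp only [S, Finset.coe_sigma, Set.mem_sigma_iff, Finset.mem_coe, Finset.mem_filter] at hq
      obtain ⟨hX, _, h2, h3⟩ := hq
      simp only [X, mem_RegF] at hX
      simp only [T, Finset.coe_sigma, Set.mem_sigma_iff, Finset.mem_coe, Finset.mem_product, mem_nb,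
        Y, mem_RegF]
      refine ⟨⟨sw_mem_Reg h3 hX.1, ?_⟩, ?_, ?_⟩
      · intro f hf
        rw [mem_sw_edgeSet h3]
        left
        refine ⟨hX.2 f (Finset.mem_insert_of_mem hf), ?_, ?_⟩
        · rintro rfl; exact he hf
        · rintro rfl; exact h2 hf
      · rw [sw_adj h3]; simp
      · rw [sw_adj h3]; simp
    · rintro ⟨G, b, y⟩ hq ⟨G', b', y'⟩ hq' heq
      simp only [S, Finset.coe_sigma, Set.mem_sigma_iff, Finset.mem_coe, Finset.mem_filter] at hq hq'
      simp only [Sigma.mk.injEq, heq_eq_eq] at heq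
      obtain ⟨h1, h2⟩ := heq
      simp only [Prod.mk.injEq] at h2
      obtain ⟨rfl, rfl⟩ := h2
      have : G = G' := by
        rw [← sw_sw hq.2.2.2, ← sw_sw hq'.2.2.2]
        exact congrArg (fun H => sw H u b v y) h1
      rw [this]
  have hTc : T.card = Y.card * d ^ 2 := by
    rw [Finset.card_sigma, Finset.sum_congr rfl (g := fun _ => d ^ 2)]
    · simp
    · intro G hG
      have := (mem_RegF.1 hG).1
      rw [Finset.card_product, mem_Reg.1 this, mem_Reg.1 this, sq]
  have hSc : X.card * (n * d) ≤ S.card + X.card * (2 * F.card + 4 * d + 2 * d ^ 2) := by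
    rw [Finset.card_sigma, ← smul_eq_mul, ← smul_eq_mul (a := X.card), ← Finset.sum_const,
      ← Finset.sum_const, ← Finset.sum_add_distrib]
    apply Finset.sum_le_sum
    intro G hG
    have := mem_RegF.1 hG
    exact card_switch_lower this.1 F (this.2 s(u, v) (Finset.mem_insert_self _ _))
  have h1 : X.card * (n * d) ≤ Y.card * d ^ 2 + X.card * (2 * F.card + 4 * d + 2 * d ^ 2) := by
    rw [← hTc]; exact hSc.trans (Nat.add_le_add_right hST _)
  have h2 : 2 * (2 * F.card + 4 * d + 2 * d ^ 2) ≤ n * d := by nlinarith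
  have h3 : X.card * (2 * (2 * F.card + 4 * d + 2 * d ^ 2)) ≤ X.card * (n * d) :=
    Nat.mul_le_mul_left _ h2
  have h4 : d * (n * X.card) ≤ d * (2 * d * Y.card) := by nlinarith
  exact Nat.le_of_mul_le_mul_left h4 hd

lemma card_RegF_le (F : Finset (Sym2 (Fin n))) : (RegF n d F).card ≤ (Reg n d).card :=
  Finset.card_le_card (Finset.filter_subset _ _)

/-- Lemma A, adding a set of edges -/
lemma switch_bound_set (hd : 0 < d) {F R : Finset (Sym2 (Fin n))} (hdis : Disjoint F R)
    (hF : 8 * (F.card + R.card) ≤ n * d) (hn : 16 + 8 * d ≤ n) :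
    n ^ R.card * (RegF n d (F ∪ R)).card ≤ (2 * d) ^ R.card * (RegF n d F).card := by
  induction R using Finset.induction_on with
  | empty => simp
  | insert e R heR ih =>
    rw [Finset.disjoint_insert_right] at hdis
    rw [Finset.card_insert_of_notMem heR] at hF ⊢
    have h1 := ih hdis.2 (by omega)
    have h2 : e ∉ F ∪ R := by simp [hdis.1, heR]
    have h3 := switch_bound hd h2 (by
      have := Finset.card_union_le F R
      omega) hn
    rw [Finset.union_insert, pow_succ, pow_succ]
    calc n ^ R.card * n * (RegF n d (insert e (F ∪ R))).card
        = n ^ R.card * (n * (RegF n d (insert e (F ∪ R))).card) := by ring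
      _ ≤ n ^ R.card * (2 * d * (RegF n d (F ∪ R)).card) := Nat.mul_le_mul_left _ h3
      _ = 2 * d * (n ^ R.card * (RegF n d (F ∪ R)).card) := by ring
      _ ≤ 2 * d * ((2 * d) ^ R.card * (RegF n d F).card) := Nat.mul_le_mul_left _ h1
      _ = _ := by ring

/-- Lemma A for families of templates -/
lemma template_bound {ι : Type*} (hd : 0 < d) (hn : 16 + 8 * d ≤ n) (T : Finset ι)
    (F : ι → Finset (Sym2 (Fin n))) (e : ι → Sym2 (Fin n)) (he : ∀ τ ∈ T, e τ ∉ F τ)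
    (hF : ∀ τ ∈ T, 8 * (F τ).card ≤ n * d) :
    n * ∑ G ∈ Reg n d, (T.filter fun τ => ∀ f ∈ insert (e τ) (F τ), f ∈ G.edgeSet).card ≤
      2 * d * ∑ G ∈ Reg n d, (T.filter fun τ => ∀ f ∈ F τ, f ∈ G.edgeSet).card := by
  have key : ∀ H : ι → Finset (Sym2 (Fin n)),
      ∑ G ∈ Reg n d, (T.filter fun τ => ∀ f ∈ H τ, f ∈ G.edgeSet).card
        = ∑ τ ∈ T, (RegF n d (H τ)).card := by
    intro H
    simp only [RegF, Finset.card_filter]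
    rw [Finset.sum_comm]
  rw [key, key (fun τ => F τ), Finset.mul_sum, Finset.mul_sum]
  exact Finset.sum_le_sum fun τ hτ => switch_bound hd (he τ hτ) (hF τ hτ) hn

end
end FPP

namespace FPP

instance : IsProbabilityMeasure (expMeasure 1) := isProbabilityMeasure_expMeasure one_pos

/-- density of the exponential law -/
def edens (x : ℝ) : ℝ≥0∞ := if 0 ≤ x then ENNReal.ofReal (Real.exp (-x)) else 0

lemma edens_meas : Measurable edens := by
  unfold edens
  exact Measurable.ite measurableSet_Ici (by fun_prop) measurable_const

lemma exp_eq : expMeasure 1 = volume.withDensity edens := by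
  have : edens = gammaPDF 1 1 := by
    ext x
    have h := exponentialPDF_eq 1 x
    have h2 : exponentialPDF 1 x = gammaPDF 1 1 x := rfl
    rw [← h2, h, edens]
    split_ifs <;> simp
  rw [expMeasure, gammaMeasure, this]

lemma lint_exp {f : ℝ → ℝ≥0∞} (hf : Measurable f) :
    ∫⁻ s, f s ∂(expMeasure 1) = ∫⁻ s, edens s * f s := by
  rw [exp_eq, lintegral_withDensity_eq_lintegral_mul _ edens_meas hf]
  rfl

lemma exp_apply {S : Set ℝ} (hS : MeasurableSet S) :
    expMeasure 1 S = ∫⁻ s, edens s * S.indicator 1 s := by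
  rw [← lint_exp (measurable_one.indicator hS), lintegral_indicator_one hS]

lemma laplace {θ : ℝ} (hθ : -1 < θ) :
    ∫⁻ s, ENNReal.ofReal (Real.exp (-(θ * s))) ∂(expMeasure 1) = ENNReal.ofReal (1 / (1 + θ)) := by
  have h0 : 0 < 1 + θ := by linarith
  have h1 := lintegral_exponentialPDF_eq_one h0
  rw [lint_exp (by fun_prop)]
  have h2 : ∀ x, exponentialPDF (1 + θ) x = ENNReal.ofReal (1 + θ) *
      (edens x * ENNReal.ofReal (Real.exp (-(θ * x)))) := by
    intro x
    rw [exponentialPDF_eq, edens]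
    split_ifs
    · rw [← ENNReal.ofReal_mul (by positivity), ← ENNReal.ofReal_mul (by positivity),
        ← Real.exp_add]
      congr 3; ring
    · simp
  simp only [h2] at h1
  have hm' : Measurable (fun x => edens x * ENNReal.ofReal (Real.exp (-(θ * x)))) :=
    edens_meas.mul (by fun_prop)
  rw [lintegral_const_mul _ hm'] at h1
  have h3 : ENNReal.ofReal (1 / (1 + θ)) = (ENNReal.ofReal (1 + θ))⁻¹ := by
    rw [one_div, ENNReal.ofReal_inv_of_pos h0]
  rw [h3]
  exact ENNReal.eq_inv_of_mul_eq_one_left (by rw [mul_comm]; exact h1)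

lemma exp_nonneg_ae : ∀ᵐ s ∂(expMeasure 1), 0 ≤ s := by
  rw [ae_iff]
  have : {a : ℝ | ¬ 0 ≤ a} = Set.Iio 0 := by ext; simp
  rw [this, exp_apply measurableSet_Iio]
  have hm' : Measurable (fun x => edens x * (Set.Iio (0:ℝ)).indicator 1 x) :=
    edens_meas.mul (measurable_one.indicator measurableSet_Iio)
  rw [lintegral_eq_zero_iff hm']
  filter_upwards with x
  simp only [Pi.zero_apply, edens, Set.indicator, Set.mem_Iio]
  split_ifs <;> simp <;> linarith

lemma memoryless1 {s : ℝ} (hs : 0 ≤ s) {S : Set ℝ} (hS : MeasurableSet S) :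
    expMeasure 1 {y | s ≤ y ∧ y - s ∈ S} = ENNReal.ofReal (Real.exp (-s)) * expMeasure 1 S := by
  have hm : MeasurableSet {y : ℝ | s ≤ y ∧ y - s ∈ S} :=
    measurableSet_Ici.inter ((measurable_id.sub_const s) hS)
  have hm' : Measurable (fun x => edens x * S.indicator 1 x) :=
    edens_meas.mul (measurable_one.indicator hS)
  rw [exp_apply hm, exp_apply hS, ← lintegral_const_mul _ hm',
    ← lintegral_sub_right_eq_self (fun y => ENNReal.ofReal (Real.exp (-s)) * (edens y * S.indicator 1 y)) s]
  apply lintegral_congr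
  intro y
  simp only [edens, Set.indicator, Set.mem_ofPred_eq, sub_nonneg]
  by_cases h1 : s ≤ y
  · have h2 : 0 ≤ y := hs.trans h1
    by_cases h3 : y - s ∈ S
    · simp only [h1, h2, h3, and_self, if_true, Pi.one_apply, mul_one]
      rw [← ENNReal.ofReal_mul (by positivity), ← Real.exp_add]
      congr 2; ring
    · simp [h3]
  · simp [h1]

lemma exp_Ici {s : ℝ} (hs : 0 ≤ s) : expMeasure 1 (Set.Ici s) = ENNReal.ofReal (Real.exp (-s)) := by
  have := memoryless1 hs MeasurableSet.univ
  simp only [Set.mem_univ, and_true, measure_univ, mul_one] at this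
  exact this

/-- i.i.d. exponential weights -/
def mu (ι : Type*) [Fintype ι] : Measure (ι → ℝ) := Measure.pi fun _ => expMeasure 1

section
variable {ι : Type*} [Fintype ι]

instance : IsProbabilityMeasure (mu ι) := by unfold mu; infer_instance

lemma mu_nonneg_ae : ∀ᵐ w ∂(mu ι), ∀ e, 0 ≤ w e := by
  rw [ae_all_iff]
  intro e
  have h := (measurePreserving_eval (fun _ : ι => expMeasure 1) e)
  exact h.quasiMeasurePreserving.ae (p := fun x => 0 ≤ x) exp_nonneg_ae

lemma mu_indepFun : iIndepFun (fun (i : ι) (w : ι → ℝ) => w i) (mu ι) :=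
  iIndepFun_pi (X := fun _ ↦ id) (fun _ ↦ aemeasurable_id)

/-- `A` depends only on coordinates in `S` -/
def DepOn (S : Finset ι) (A : Set (ι → ℝ)) : Prop :=
  ∀ w w' : ι → ℝ, (∀ i ∈ S, w i = w' i) → (w ∈ A ↔ w' ∈ A)

lemma indep_events {S T : Finset ι} (hST : Disjoint S T) {A B : Set (ι → ℝ)}
    (hA : MeasurableSet A) (hB : MeasurableSet B) (hAS : DepOn S A) (hBT : DepOn T B) :
    mu ι (A ∩ B) = mu ι A * mu ι B := by
  have hind := (mu_indepFun (ι := ι)).indepFun_finset S T hST (fun i => measurable_pi_apply i)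
  let ext (S : Finset ι) (f : S → ℝ) : ι → ℝ := fun i => if h : i ∈ S then f ⟨i, h⟩ else 0
  have hext : ∀ S : Finset ι, Measurable (ext S) := by
    intro S
    rw [measurable_pi_iff]
    intro i
    by_cases h : i ∈ S
    · simp only [ext, h, dif_pos]; exact measurable_pi_apply _
    · simp only [ext, h, dif_neg, not_false_eq_true]; exact measurable_const
  have key : ∀ (S : Finset ι) (A : Set (ι → ℝ)), DepOn S A →
      (fun (w : ι → ℝ) (i : S) => w i) ⁻¹' (ext S ⁻¹' A) = A := by
    intro S A h
    ext w
    simp only [Set.mem_preimage]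
    apply h
    intro i hi
    simp [ext, hi]
  have := hind.measure_inter_preimage_eq_mul (ext S ⁻¹' A) (ext T ⁻¹' B) (hext S hA) (hext T hB)
  rw [key S A hAS, key T B hBT] at this
  exact this

/-- resampling one coordinate -/
lemma mp_update (e : ι) : MeasurePreserving (fun p : ℝ × (ι → ℝ) => Function.update p.2 e p.1)
    ((expMeasure 1).prod (mu ι)) (mu ι) := by
  have hm : Measurable (fun p : ℝ × (ι → ℝ) => Function.update p.2 e p.1) := by
    rw [measurable_pi_iff]
    intro i
    by_cases h : i = e
    · subst h; simp; exact measurable_fst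
    · simp [h]; fun_prop
  refine ⟨hm, ?_⟩
  unfold mu
  symm
  apply Measure.pi_eq
  intro s hs
  rw [Measure.map_apply hm (MeasurableSet.univ_pi hs)]
  have : (fun p : ℝ × (ι → ℝ) => Function.update p.2 e p.1) ⁻¹' (Set.univ.pi s) =
      s e ×ˢ (Set.univ.pi (Function.update s e Set.univ)) := by
    ext ⟨x, w⟩
    simp only [Set.mem_preimage, Set.mem_pi, Set.mem_univ, true_implies, Set.mem_prod]
    constructor
    · intro h
      refine ⟨by simpa using h e, fun i => ?_⟩
      by_cases hi : i = e
      · subst hi; simp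
      · simpa [hi] using h i
    · rintro ⟨h1, h2⟩ i
      by_cases hi : i = e
      · subst hi; simpa using h1
      · simpa [hi] using h2 i
  rw [this, Measure.prod_prod, Measure.pi_pi, ← Finset.mul_prod_erase Finset.univ _ (Finset.mem_univ e)]
  congr 1
  rw [← Finset.mul_prod_erase Finset.univ _ (Finset.mem_univ e)]
  simp only [Function.update_self, measure_univ, one_mul]
  congr 1
  apply Finset.prod_congr rfl
  intro i hi
  rw [Function.update_of_ne (Finset.ne_of_mem_erase hi)]

lemma mu_update (e : ι) {A : Set (ι → ℝ)} (hA : MeasurableSet A) :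
    mu ι A = ∫⁻ s, mu ι {w | Function.update w e s ∈ A} ∂(expMeasure 1) := by
  have h := mp_update (ι := ι) e
  rw [← h.measure_preimage hA.nullMeasurableSet, Measure.prod_apply (h.measurable hA)]
  rfl

/-- memorylessness -/
lemma memoryless (D : Finset ι) {s : ℝ} (hs : 0 ≤ s) {A : Set (ι → ℝ)} (hA : MeasurableSet A) :
    mu ι {w | (∀ f ∈ D, s ≤ w f) ∧ (fun i => if i ∈ D then w i - s else w i) ∈ A} =
      ENNReal.ofReal (Real.exp (-(s * D.card))) * mu ι A := by
  set T : (ι → ℝ) → (ι → ℝ) := fun w i => if i ∈ D then w i - s else w i with hT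
  set C : Set (ι → ℝ) := {w | ∀ f ∈ D, s ≤ w f} with hC
  have hTm : Measurable T := by
    rw [measurable_pi_iff]
    intro i
    by_cases h : i ∈ D
    · simp only [hT, h, if_true]; fun_prop
    · simp only [hT, h, if_false]; fun_prop
  have hCm : MeasurableSet C := by
    have : C = ⋂ f ∈ D, {w | s ≤ w f} := by ext; simp [C]
    rw [this]
    exact D.measurableSet_biInter fun f _ => measurable_pi_apply f measurableSet_Ici
  set c : ℝ≥0∞ := ENNReal.ofReal (Real.exp (s * D.card)) with hc
  have hpi : mu ι = c • ((mu ι).restrict C).map T := by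
    conv_lhs => unfold mu
    apply Measure.pi_eq
    intro S hS
    rw [Measure.smul_apply, Measure.map_apply hTm (MeasurableSet.univ_pi hS),
      Measure.restrict_apply (hTm (MeasurableSet.univ_pi hS))]
    have : T ⁻¹' (Set.univ.pi S) ∩ C =
        Set.univ.pi (fun i => if i ∈ D then {y | s ≤ y ∧ y - s ∈ S i} else S i) := by
      ext w
      simp only [Set.mem_inter_iff, Set.mem_preimage, Set.mem_pi, Set.mem_univ, true_implies, hT, hC,
        Set.mem_ofPred_eq]
      constructor
      · rintro ⟨h1, h2⟩ i
        have := h1 i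
        by_cases h : i ∈ D
        · simp only [h, if_true] at this ⊢; exact ⟨h2 i h, this⟩
        · simpa only [h, if_false] using this
      · intro h1
        refine ⟨fun i => ?_, fun i h => ?_⟩
        · have := h1 i
          by_cases h : i ∈ D
          · simp only [h, if_true] at this ⊢; exact this.2
          · simpa only [h, if_false] using this
        · have := h1 i
          simp only [h, if_true] at this
          exact this.1
    rw [this]
    unfold mu
    rw [Measure.pi_pi]
    have h2 : ∀ i, expMeasure 1 (if i ∈ D then {y | s ≤ y ∧ y - s ∈ S i} else S i) =
        (if i ∈ D then ENNReal.ofReal (Real.exp (-s)) else 1) * expMeasure 1 (S i) := by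
      intro i
      split_ifs
      · exact memoryless1 hs (hS i)
      · simp
    simp only [h2]
    rw [Finset.prod_mul_distrib, Finset.prod_ite_mem, Finset.univ_inter, Finset.prod_const,
      ← ENNReal.ofReal_pow (by positivity), smul_eq_mul, ← mul_assoc, hc,
      ← ENNReal.ofReal_mul (by positivity), ← Real.exp_nat_mul, ← Real.exp_add]
    have : s * D.card + D.card * -s = 0 := by ring
    rw [this]; simp
  have h3 : mu ι A = c * mu ι (T ⁻¹' A ∩ C) := by
    conv_lhs => rw [hpi]
    rw [Measure.smul_apply, Measure.map_apply hTm hA, Measure.restrict_apply (hTm hA), smul_eq_mul]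
  rw [h3, ← mul_assoc, hc, ← ENNReal.ofReal_mul (by positivity), ← Real.exp_add]
  simp only [neg_add_cancel, Real.exp_zero, ENNReal.ofReal_one, one_mul]
  congr 1
  ext w
  simp only [Set.mem_inter_iff, Set.mem_preimage, hC, Set.mem_ofPred_eq, and_comm]
  exact Iff.rfl

end

end FPP

namespace FPP

/-- law of a sum of `q` exponentials -/
def pS : ℕ → Set ℝ → ℝ≥0∞
  | 0, S => S.indicator 1 0
  | q + 1, S => ∫⁻ s, pS q {y | s + y ∈ S} ∂(expMeasure 1)

section
variable {ι : Type*} [Fintype ι]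

lemma meas_sum (E : List ι) : Measurable (fun w : ι → ℝ => (E.map w).sum) := by
  induction E with
  | nil => simp
  | cons e E ih => simp only [List.map_cons, List.sum_cons]; exact (measurable_pi_apply e).add ih

lemma mu_sum {E : List ι} (hE : E.Nodup) {S : Set ℝ} (hS : MeasurableSet S) :
    mu ι {w | (E.map w).sum ∈ S} = pS E.length S := by
  induction E generalizing S with
  | nil =>
    by_cases h : (0 : ℝ) ∈ S <;> simp [pS, h]
  | cons e E ih =>
    rw [List.nodup_cons] at hE
    have hm' : MeasurableSet {w : ι → ℝ | ((e :: E).map w).sum ∈ S} := meas_sum (e :: E) hS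
    rw [mu_update e hm']
    simp only [List.length_cons, pS]
    apply lintegral_congr
    intro s
    rw [← ih hE.2 (S := {y | s + y ∈ S}) ((measurable_const_add s) hS)]
    congr 1
    ext w
    have : E.map (Function.update w e s) = E.map w := by
      apply List.map_congr_left
      intro a ha
      rw [Function.update_of_ne]
      rintro rfl; exact hE.1 ha
    have h2 : ∀ w' : ι → ℝ, w' ∈ {w : ι → ℝ | ((e :: E).map w).sum ∈ S} ↔
      w' e + (E.map w').sum ∈ S := by intro w'; simp
    rw [Set.mem_ofPred_eq, h2, this]
    simp
end

lemma Iic_shift (s t : ℝ) : {y | s + y ∈ Set.Iic t} = Set.Iic (t - s) := by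
  ext y; simp only [Set.mem_ofPred_eq, Set.mem_Iic]; constructor <;> intro h <;> linarith

lemma Ioi_shift (s t : ℝ) : {y | s + y ∈ Set.Ioi t} = Set.Ioi (t - s) := by
  ext y; simp only [Set.mem_ofPred_eq, Set.mem_Ioi]; constructor <;> intro h <;> linarith

lemma pS_le_one (q : ℕ) (S : Set ℝ) : pS q S ≤ 1 := by
  induction q generalizing S with
  | zero => simp only [pS, Set.indicator]; split_ifs <;> simp
  | succ q ih =>
    simp only [pS]
    calc _ ≤ ∫⁻ _, 1 ∂(expMeasure 1) := lintegral_mono fun s => ih _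
      _ = 1 := by simp

lemma pS_chernoff {θ : ℝ} (hθ : 0 ≤ θ) (q : ℕ) (t : ℝ) :
    pS q (Set.Iic t) ≤ ENNReal.ofReal (Real.exp (θ * t) * (1 / (1 + θ)) ^ q) := by
  induction q generalizing t with
  | zero =>
    simp only [pS, Set.indicator, Set.mem_Iic, pow_zero, mul_one]
    split_ifs with h
    · simp only [Pi.one_apply, ENNReal.one_le_ofReal, Real.one_le_exp_iff]; positivity
    · simp
  | succ q ih =>
    simp only [pS, Iic_shift]
    calc ∫⁻ s, pS q (Set.Iic (t - s)) ∂(expMeasure 1)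
        ≤ ∫⁻ s, ENNReal.ofReal (Real.exp (θ * t) * (1 / (1 + θ)) ^ q) *
            ENNReal.ofReal (Real.exp (-(θ * s))) ∂(expMeasure 1) := by
          apply lintegral_mono
          intro s
          refine (ih (t - s)).trans (le_of_eq ?_)
          beta_reduce
          rw [← ENNReal.ofReal_mul (by positivity)]
          congr 1
          rw [mul_sub, sub_eq_add_neg, Real.exp_add]; ring
      _ = _ := by
          rw [lintegral_const_mul _ (by fun_prop), laplace (by linarith),
            ← ENNReal.ofReal_mul (by positivity), pow_succ, mul_assoc]

lemma pS_upper (q : ℕ) (t : ℝ) :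
    pS q (Set.Ioi t) ≤ ENNReal.ofReal (Real.exp (-(t / 2)) * 2 ^ q) := by
  induction q generalizing t with
  | zero =>
    simp only [pS, Set.indicator, Set.mem_Ioi, pow_zero, mul_one]
    split_ifs with h
    · simp only [Pi.one_apply, ENNReal.one_le_ofReal, Real.one_le_exp_iff]; linarith
    · simp
  | succ q ih =>
    simp only [pS, Ioi_shift]
    calc ∫⁻ s, pS q (Set.Ioi (t - s)) ∂(expMeasure 1)
        ≤ ∫⁻ s, ENNReal.ofReal (Real.exp (-(t / 2)) * 2 ^ q) *
            ENNReal.ofReal (Real.exp (-(-(1/2) * s))) ∂(expMeasure 1) := by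
          apply lintegral_mono
          intro s
          refine (ih (t - s)).trans (le_of_eq ?_)
          beta_reduce
          rw [← ENNReal.ofReal_mul (by positivity)]
          congr 1
          have : -((t - s) / 2) = -(t/2) + -(-(1/2) * s) := by ring
          rw [this, Real.exp_add]; ring
      _ = _ := by
          rw [lintegral_const_mul _ (by fun_prop), laplace (by norm_num),
            ← ENNReal.ofReal_mul (by positivity), pow_succ, mul_assoc]
          norm_num

lemma pS_lower (q : ℕ) {y : ℝ} (hy : 0 ≤ y) :
    ENNReal.ofReal (y ^ q * Real.exp (-y) / q.factorial) ≤ pS q (Set.Iic y) := by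
  induction q generalizing y with
  | zero =>
    simp only [pS, Set.indicator, Set.mem_Iic, hy, if_true, Pi.one_apply, pow_zero, one_mul,
      Nat.factorial_zero, Nat.cast_one, div_one]
    rw [← ENNReal.ofReal_one]
    exact ENNReal.ofReal_le_ofReal (by simpa using hy)
  | succ q ih =>
    simp only [pS, Iic_shift]
    set g : ℝ → ℝ≥0∞ := fun s => (Set.Ioc 0 y).indicator
      (fun s => ENNReal.ofReal ((y - s) ^ q * Real.exp (-(y - s)) / q.factorial)) s with hg
    have hgm : Measurable g := Measurable.indicator (by fun_prop) measurableSet_Ioc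
    calc ENNReal.ofReal (y ^ (q+1) * Real.exp (-y) / (q+1).factorial)
        = ENNReal.ofReal (∫ s in (0:ℝ)..y, (y - s) ^ q * Real.exp (-y) / q.factorial) := by
          congr 1
          have : ∀ s : ℝ, (y - s) ^ q * Real.exp (-y) / q.factorial =
            (y - s) ^ q * (Real.exp (-y) / q.factorial) := by intro s; ring
          simp only [this]
          rw [intervalIntegral.integral_mul_const]
          rw [intervalIntegral.integral_comp_sub_left (fun s => s ^ q) y]
          simp only [sub_self, sub_zero, integral_pow]
          rw [Nat.factorial_succ]
          push_cast
          have : (q.factorial : ℝ) ≠ 0 := by positivity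
          field_simp
          ring
      _ = ∫⁻ s, edens s * g s := by
          rw [intervalIntegral.integral_of_le hy, ofReal_integral_eq_lintegral_ofReal]
          · rw [← lintegral_indicator measurableSet_Ioc]
            apply lintegral_congr
            intro s
            simp only [hg, Set.indicator]
            split_ifs with h
            · rw [edens, if_pos h.1.le, ← ENNReal.ofReal_mul (by positivity)]
              congr 1
              rw [mul_div_assoc', mul_left_comm, ← Real.exp_add]
              congr 3; ring
            · simp
          · exact (by fun_prop : Continuous fun s : ℝ => (y - s) ^ q * Real.exp (-y) / q.factorial).integrableOn_Ioc
          · rw [EventuallyLE, ae_restrict_iff' measurableSet_Ioc]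
            filter_upwards with s hs
            have : 0 ≤ y - s := by linarith [hs.2]
            simp only [Pi.zero_apply]
            positivity
      _ = ∫⁻ s, g s ∂(expMeasure 1) := (lint_exp hgm).symm
      _ ≤ _ := by
          apply lintegral_mono
          intro s
          simp only [hg, Set.indicator]
          split_ifs with h
          · exact ih (by linarith [h.2])
          · simp

/-- real version of the distribution function -/
def pL (q : ℕ) (t : ℝ) : ℝ := (pS q (Set.Iic t)).toReal

lemma pL_nonneg (q : ℕ) (t : ℝ) : 0 ≤ pL q t := ENNReal.toReal_nonneg

lemma pL_le_one (q : ℕ) (t : ℝ) : pL q t ≤ 1 := by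
  have := pS_le_one q (Set.Iic t)
  exact ENNReal.toReal_le_of_le_ofReal zero_le_one (by simpa using this)

lemma pL_chernoff {θ : ℝ} (hθ : 0 ≤ θ) (q : ℕ) (t : ℝ) :
    pL q t ≤ Real.exp (θ * t) * (1 / (1 + θ)) ^ q :=
  ENNReal.toReal_le_of_le_ofReal (by positivity) (pS_chernoff hθ q t)

lemma pL_lower (q : ℕ) {y : ℝ} (hy : 0 ≤ y) :
    y ^ q * Real.exp (-y) / q.factorial ≤ pL q y := by
  have := pS_lower q hy
  rw [ENNReal.ofReal_le_iff_le_toReal (ne_top_of_le_ne_top ENNReal.one_ne_top (pS_le_one _ _))] at this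
  exact this

lemma pL_zero {t : ℝ} (ht : 0 ≤ t) : pL 0 t = 1 := by
  simp [pL, pS, ht]

section
variable {ι : Type*} [Fintype ι]

lemma mu_real_sum {E : List ι} (hE : E.Nodup) (t : ℝ) :
    (mu ι).real {w | (E.map w).sum ≤ t} = pL E.length t := by
  have := mu_sum hE (measurableSet_Iic (a := t))
  simp only [Set.mem_Iic] at this
  rw [measureReal_def, this, pL]

lemma mu_sum_gt {E : List ι} (hE : E.Nodup) (t : ℝ) :
    (mu ι).real {w | t < (E.map w).sum} ≤ Real.exp (-(t / 2)) * 2 ^ E.length := by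
  have := mu_sum hE (measurableSet_Ioi (a := t))
  simp only [Set.mem_Ioi] at this
  rw [measureReal_def, this]
  exact ENNReal.toReal_le_of_le_ofReal (by positivity) (pS_upper _ _)

/-- the event that all the listed edge sums are below their thresholds -/
def Ev (cs : List (List ι × ℝ)) : Set (ι → ℝ) := {w | ∀ c ∈ cs, (c.1.map w).sum ≤ c.2}

lemma Ev_cons (c : List ι × ℝ) (cs : List (List ι × ℝ)) :
    Ev (c :: cs) = {w | (c.1.map w).sum ≤ c.2} ∩ Ev cs := by
  ext w; simp [Ev]

lemma Ev_meas (cs : List (List ι × ℝ)) : MeasurableSet (Ev cs) := by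
  induction cs with
  | nil => simp [Ev]
  | cons c cs ih =>
    rw [Ev_cons]
    exact (measurableSet_le (meas_sum _) measurable_const).inter ih

lemma mu_Ev {cs : List (List ι × ℝ)} (h : (cs.flatMap Prod.fst).Nodup) :
    (mu ι).real (Ev cs) = (cs.map fun c => pL c.1.length c.2).prod := by
  induction cs with
  | nil => simp [Ev]
  | cons c cs ih =>
    rw [List.flatMap_cons, List.nodup_append] at h
    rw [Ev_cons, measureReal_def, indep_events (S := c.1.toFinset)
      (T := (cs.flatMap Prod.fst).toFinset) ?_ (measurableSet_le (meas_sum _) measurable_const)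
      (Ev_meas cs) ?_ ?_, ENNReal.toReal_mul, ← measureReal_def, ← measureReal_def, ih h.2.1,
      mu_real_sum h.1]
    · simp
    · rw [Finset.disjoint_left]
      intro a h1 h2
      exact h.2.2 a (by simpa using h1) a (by simpa using h2) rfl
    · intro w w' hw
      have : c.1.map w = c.1.map w' := List.map_congr_left fun a ha => hw a (by simpa using ha)
      simp [this]
    · intro w w' hw
      simp only [Ev, Set.mem_ofPred_eq]
      apply forall₂_congr
      intro c hc
      have : c.1.map w = c.1.map w' := List.map_congr_left fun a ha => hw a (by
        simp only [List.mem_toFinset, List.mem_flatMap]; exact ⟨c, hc, ha⟩)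
      rw [this]
end

end FPP

namespace FPP

/-- weights on the pairs of vertices -/
abbrev W (n : ℕ) := Sym2 (Fin n) → ℝ
/-- the law of the weights -/
def muE (n : ℕ) : Measure (W n) := Measure.pi fun _ : Sym2 (Fin n) => expMeasure 1

lemma muE_eq (n : ℕ) : muE n = mu (Sym2 (Fin n)) := rfl

instance (n : ℕ) : IsProbabilityMeasure (muE n) := by rw [muE_eq]; infer_instance

/-- averaged probability -/
def PPr (n d : ℕ) (E : SimpleGraph (Fin n) → W n → Prop) : ℝ :=
  (∑ G ∈ Reg n d, (muE n).real {w | E G w}) / (Reg n d).card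

section
variable {n d : ℕ}

lemma PPr_nonneg (E : SimpleGraph (Fin n) → W n → Prop) : 0 ≤ PPr n d E := by
  unfold PPr; positivity

lemma fpp_le (E : SimpleGraph (Fin n) → W n → Prop) :
    fppMeasure n d {x | E x.1 x.2} ≤ ENNReal.ofReal (PPr n d E) := by
  by_cases h0 : (Reg n d).card = 0
  · have h1 : Reg n d = ∅ := by simpa using h0
    have : regularUniform n d = 0 := by
      unfold regularUniform
      have h2 : (Finset.univ.filter fun G : SimpleGraph (Fin n) => G.IsRegularOfDegree d) = ∅ := h1
      rw [h2]; simp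
    rw [fppMeasure, this]
    simp
  have hreg : regularUniform n d = ((Reg n d).card : ℝ≥0∞)⁻¹ • ∑ G ∈ Reg n d, Measure.dirac G := rfl
  have : SFinite (regularUniform n d) := by
    rw [hreg]; infer_instance
  have hsub : {x : SimpleGraph (Fin n) × W n | E x.1 x.2} ⊆
      ⋃ G : SimpleGraph (Fin n), ({G} : Set (SimpleGraph (Fin n))) ×ˢ {w | E G w} := by
    rintro ⟨G, w⟩ h
    simp only [Set.mem_iUnion, Set.mem_prod]
    exact ⟨G, rfl, h⟩
  have hsing : ∀ G : SimpleGraph (Fin n), regularUniform n d {G} =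
      if G ∈ Reg n d then ((Reg n d).card : ℝ≥0∞)⁻¹ else 0 := by
    intro G
    rw [hreg, Measure.smul_apply, Measure.finsetSum_apply]
    have : ∀ H : SimpleGraph (Fin n), (Measure.dirac H) ({G} : Set (SimpleGraph (Fin n))) =
        if H = G then 1 else 0 := by
      intro H
      rw [Measure.dirac_apply' _ (show MeasurableSet ({G} : Set (SimpleGraph (Fin n))) from trivial)]
      simp only [Set.indicator, Set.mem_singleton_iff, Pi.one_apply]
    simp only [this, Finset.sum_ite_eq', smul_eq_mul, mul_ite, mul_one, mul_zero]
  calc fppMeasure n d {x | E x.1 x.2}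
      ≤ ∑ G : SimpleGraph (Fin n), fppMeasure n d (({G} : Set (SimpleGraph (Fin n))) ×ˢ {w | E G w}) :=
        (measure_mono hsub).trans (measure_iUnion_fintype_le _ _)
    _ = ∑ G ∈ Reg n d, ((Reg n d).card : ℝ≥0∞)⁻¹ * (muE n) {w | E G w} := by
        rw [← Finset.sum_filter_add_sum_filter_not Finset.univ (· ∈ Reg n d)]
        rw [Finset.sum_eq_zero (s := Finset.univ.filter (· ∉ Reg n d)), add_zero]
        · rw [Finset.filter_univ_mem]
          apply Finset.sum_congr rfl
          intro G hG
          rw [fppMeasure, Measure.prod_prod, hsing, if_pos hG]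
          rfl
        · intro G hG
          rw [fppMeasure, Measure.prod_prod, hsing, if_neg (Finset.mem_filter.1 hG).2, zero_mul]
    _ = ENNReal.ofReal (PPr n d E) := by
        rw [← Finset.mul_sum, PPr, ENNReal.ofReal_div_of_pos (by positivity),
          ENNReal.ofReal_sum_of_nonneg (fun _ _ => measureReal_nonneg), ENNReal.div_eq_inv_mul]
        congr 1
        · simp
        · apply Finset.sum_congr rfl
          intro G _
          rw [ofReal_measureReal]

lemma real_mono_ae {S T : Set (W n)} (h : ∀ w : W n, (∀ e, 0 ≤ w e) → w ∈ S → w ∈ T) :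
    (muE n).real S ≤ (muE n).real T := by
  rw [measureReal_def, measureReal_def]
  apply ENNReal.toReal_mono (measure_ne_top _ _)
  apply measure_mono_ae
  have := mu_nonneg_ae (ι := Sym2 (Fin n))
  rw [← muE_eq] at this
  filter_upwards [this] with w hw
  exact h w hw

lemma PPr_mono {E E' : SimpleGraph (Fin n) → W n → Prop}
    (h : ∀ G ∈ Reg n d, ∀ w : W n, (∀ e, 0 ≤ w e) → E G w → E' G w) : PPr n d E ≤ PPr n d E' := by
  unfold PPr
  exact div_le_div_of_nonneg_right (Finset.sum_le_sum fun G hG => real_mono_ae (h G hG)) (by positivity)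

lemma PPr_or (E E' : SimpleGraph (Fin n) → W n → Prop) :
    PPr n d (fun G w => E G w ∨ E' G w) ≤ PPr n d E + PPr n d E' := by
  unfold PPr
  rw [← add_div, ← Finset.sum_add_distrib]
  gcongr with G hG
  exact measureReal_union_le {w | E G w} {w | E' G w}

lemma PPr_le_sum {E E1 E2 : SimpleGraph (Fin n) → W n → Prop}
    (h : ∀ G ∈ Reg n d, ∀ w : W n, (∀ e, 0 ≤ w e) → E G w → E1 G w ∨ E2 G w) :
    PPr n d E ≤ PPr n d E1 + PPr n d E2 := (PPr_mono h).trans (PPr_or _ _)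

lemma real_exists_le {ι : Type*} (s : Finset ι) (A : ι → Set (W n)) :
    (muE n).real {w | ∃ i ∈ s, w ∈ A i} ≤ ∑ i ∈ s, (muE n).real (A i) := by
  have : {w | ∃ i ∈ s, w ∈ A i} = ⋃ i ∈ s, A i := by ext; simp
  rw [this]
  exact measureReal_biUnion_finset_le s A

lemma PPr_exists {ι : Type*} (s : Finset ι) (E : ι → SimpleGraph (Fin n) → W n → Prop) :
    PPr n d (fun G w => ∃ i ∈ s, E i G w) ≤ ∑ i ∈ s, PPr n d (E i) := by
  unfold PPr
  rw [← Finset.sum_div, Finset.sum_comm]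
  gcongr with G hG
  exact real_exists_le s (fun i => {w | E i G w})

lemma PPr_le {E : SimpleGraph (Fin n) → W n → Prop} {b : ℝ} (hb : 0 ≤ b)
    (h : ∑ G ∈ Reg n d, (muE n).real {w | E G w} ≤ (Reg n d).card * b) : PPr n d E ≤ b := by
  unfold PPr
  by_cases h0 : (Reg n d).card = 0
  · simp [h0, hb]
  · rw [div_le_iff₀ (by positivity), mul_comm]; exact h

lemma PPr_le_of_forall {E : SimpleGraph (Fin n) → W n → Prop} {b : ℝ} (hb : 0 ≤ b)
    (h : ∀ G ∈ Reg n d, (muE n).real {w | E G w} ≤ b) : PPr n d E ≤ b := by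
  apply PPr_le hb
  calc _ ≤ ∑ G ∈ Reg n d, b := Finset.sum_le_sum h
    _ = _ := by simp

/-- second moment inequality -/
lemma second_moment {ι : Type*} (s : Finset ι) (A : ι → Set (W n))
    (hA : ∀ i ∈ s, MeasurableSet (A i)) (c : ℝ) :
    (muE n).real {w | ∀ i ∈ s, w ∉ A i} * c ^ 2 + 2 * c * ∑ i ∈ s, (muE n).real (A i) ≤
      ∑ i ∈ s, ∑ j ∈ s, (muE n).real (A i ∩ A j) + c ^ 2 := by
  set Z : W n → ℝ := fun w => ∑ i ∈ s, (A i).indicator 1 w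
  set B : Set (W n) := {w | ∀ i ∈ s, w ∉ A i}
  have hB : MeasurableSet B := by
    have : B = ⋂ i ∈ s, (A i)ᶜ := by ext; simp [B]
    rw [this]
    exact Finset.measurableSet_biInter _ fun i hi => (hA i hi).compl
  have hind : ∀ S : Set (W n), MeasurableSet S → Integrable (S.indicator (1 : W n → ℝ)) (muE n) :=
    fun S hS => (integrable_const (1:ℝ)).indicator hS
  have hsq : ∀ w, Z w ^ 2 = ∑ i ∈ s, ∑ j ∈ s, (A i ∩ A j).indicator 1 w := by
    intro w
    simp only [Z, sq]
    rw [Finset.sum_mul_sum]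
    simp only [Set.inter_indicator_one, Pi.mul_apply]
  have hZ1 : ∫ w, Z w ∂(muE n) = ∑ i ∈ s, (muE n).real (A i) := by
    simp only [Z]
    rw [integral_finsetSum _ (fun i hi => hind _ (hA i hi))]
    exact Finset.sum_congr rfl fun i hi => integral_indicator_one (hA i hi)
  have hZi : Integrable Z (muE n) := integrable_finsetSum _ (fun i hi => hind _ (hA i hi))
  have hZ2 : ∫ w, Z w ^ 2 ∂(muE n) = ∑ i ∈ s, ∑ j ∈ s, (muE n).real (A i ∩ A j) := by
    simp only [hsq]
    rw [integral_finsetSum _ (fun i hi => integrable_finsetSum _ fun j hj =>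
      hind _ ((hA i hi).inter (hA j hj)))]
    refine Finset.sum_congr rfl fun i hi => ?_
    rw [integral_finsetSum _ (fun j hj => hind _ ((hA i hi).inter (hA j hj)))]
    exact Finset.sum_congr rfl fun j hj => integral_indicator_one ((hA i hi).inter (hA j hj))
  have hZ2i : Integrable (fun w => Z w ^ 2) (muE n) := by
    simp only [hsq]
    exact integrable_finsetSum _ (fun i hi => integrable_finsetSum _ fun j hj =>
      hind _ ((hA i hi).inter (hA j hj)))
  have hBi := (hind B hB).mul_const (c ^ 2)
  have hle : ∫ w, (B.indicator 1 w * c ^ 2 + 2 * c * Z w) ∂(muE n) ≤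
      ∫ w, (Z w ^ 2 + c ^ 2) ∂(muE n) := by
    apply integral_mono (hBi.add (hZi.const_mul _)) (hZ2i.add (integrable_const _))
    intro w
    simp only [Pi.add_apply]
    by_cases hw : w ∈ B
    · have : Z w = 0 := Finset.sum_eq_zero fun i hi => by simp [hw i hi]
      simp [hw, this]
    · simp only [Set.indicator_of_notMem hw]
      nlinarith [sq_nonneg (Z w - c)]
  rw [integral_add hBi (hZi.const_mul _), integral_add hZ2i (integrable_const _),
    integral_mul_const, integral_const_mul, integral_indicator_one hB, hZ1, hZ2] at hle
  simpa using hle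

end

/-- all lists of a given length -/
def listsLen (n k : ℕ) : Finset (List (Fin n)) :=
  (Finset.univ : Finset (Fin k → Fin n)).image List.ofFn

@[simp] lemma mem_listsLen {n k : ℕ} {l : List (Fin n)} : l ∈ listsLen n k ↔ l.length = k := by
  simp only [listsLen, Finset.mem_image, Finset.mem_univ, true_and]
  constructor
  · rintro ⟨f, rfl⟩; simp
  · rintro rfl; exact ⟨l.get, List.ofFn_get l⟩

section
variable {n d : ℕ} {G : SimpleGraph (Fin n)}

/-- simple paths extending `l₀` by `k` further vertices -/
def exts (G : SimpleGraph (Fin n)) (k : ℕ) (l₀ : List (Fin n)) : Finset (List (Fin n)) :=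
  (listsLen n (l₀.length + k)).filter fun l => IsP G l ∧ l₀ <:+ l

lemma mem_exts {k : ℕ} {l₀ l : List (Fin n)} :
    l ∈ exts G k l₀ ↔ l.length = l₀.length + k ∧ IsP G l ∧ l₀ <:+ l := by
  simp [exts]

/-- one-step extensions -/
def ext1 (G : SimpleGraph (Fin n)) (l : List (Fin n)) : Finset (Fin n) :=
  Finset.univ.filter fun x => IsP G (x :: l)

lemma isP_cons_cons {x h : Fin n} {t : List (Fin n)} :
    IsP G (x :: h :: t) ↔ G.Adj x h ∧ x ∉ h :: t ∧ IsP G (h :: t) := by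
  simp only [IsP, List.isChain_cons_cons, List.nodup_cons]; tauto

lemma card_exts_succ (k : ℕ) (l₀ : List (Fin n)) :
    (exts G (k + 1) l₀).card = ∑ l ∈ exts G k l₀, (ext1 G l).card := by
  have h : exts G (k + 1) l₀ = (exts G k l₀).biUnion (fun l => (ext1 G l).image (fun x => x :: l)) := by
    ext l
    simp only [mem_exts, Finset.mem_biUnion, Finset.mem_image, ext1, Finset.mem_filter,
      Finset.mem_univ, true_and]
    constructor
    · rintro ⟨h1, h2, h3⟩
      cases l with
      | nil => simp at h1
      | cons x l =>
        refine ⟨l, ⟨?_, h2.infix (List.suffix_cons _ _).isInfix, ?_⟩, x, h2, rfl⟩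
        · simp at h1; omega
        · rcases List.suffix_cons_iff.1 h3 with h | h
          · exfalso; rw [h] at h1; simp at h1
          · exact h
    · rintro ⟨l', ⟨h1, h2, h3⟩, x, h4, rfl⟩
      exact ⟨by simp [h1]; omega, h4, h3.trans (List.suffix_cons _ _)⟩
  rw [h, Finset.card_biUnion]
  · refine Finset.sum_congr rfl fun l _ => Finset.card_image_of_injective _ fun a b hab => ?_
    simpa using hab
  · intro a _ b _ hab
    rw [Function.onFun, Finset.disjoint_left]
    intro x h1 h2
    simp only [Finset.mem_image] at h1 h2
    obtain ⟨u, _, rfl⟩ := h1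
    obtain ⟨v, _, h3⟩ := h2
    simp at h3
    exact hab h3.2.symm

lemma ext1_le (hG : G ∈ Reg n d) {h : Fin n} {t : List (Fin n)} : (ext1 G (h :: t)).card ≤ d := by
  rw [← mem_Reg.1 hG h]
  apply Finset.card_le_card
  intro x hx
  simp only [ext1, Finset.mem_filter, isP_cons_cons] at hx
  simpa using hx.2.1.symm

lemma ext1_le' (hG : G ∈ Reg n d) {h s : Fin n} {t : List (Fin n)} :
    (ext1 G (h :: s :: t)).card ≤ d - 1 := by
  by_cases hP : IsP G (h :: s :: t)
  · have hs : s ∈ nb G h := by simpa using (isP_cons_cons.1 hP).1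
    rw [← mem_Reg.1 hG h, ← Finset.card_erase_of_mem hs]
    apply Finset.card_le_card
    intro x hx
    simp only [ext1, Finset.mem_filter, isP_cons_cons] at hx
    simp only [Finset.mem_erase, mem_nb]
    refine ⟨?_, hx.2.1.symm⟩
    rintro rfl
    simp at hx
  · have : ext1 G (h :: s :: t) = ∅ := by
      rw [ext1, Finset.filter_eq_empty_iff]
      intro x _ hx
      exact hP (hx.infix (List.suffix_cons _ _).isInfix)
    simp [this]

lemma card_exts_le' (hG : G ∈ Reg n d) (k : ℕ) {l₀ : List (Fin n)} (hl : 2 ≤ l₀.length) :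
    (exts G k l₀).card ≤ (d - 1) ^ k := by
  induction k with
  | zero =>
    rw [pow_zero, Finset.card_le_one]
    intro a ha b hb
    rw [mem_exts] at ha hb
    rw [← ha.2.2.eq_of_length (by simpa using ha.1.symm), ← hb.2.2.eq_of_length (by simpa using hb.1.symm)]
  | succ k ih =>
    rw [card_exts_succ, pow_succ]
    calc _ ≤ ∑ l ∈ exts G k l₀, (d - 1) := by
          apply Finset.sum_le_sum
          intro l hl'
          rw [mem_exts] at hl'
          match l, hl' with
          | [], h => simp at h; omega
          | [a], h => simp at h; omega
          | a :: b :: t, _ => exact ext1_le' hG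
      _ = (exts G k l₀).card * (d - 1) := by simp
      _ ≤ _ := Nat.mul_le_mul_right _ ih

/-- number of non-backtracking extensions -/
def NN (d : ℕ) : ℕ → ℕ
  | 0 => 1
  | k + 1 => d * (d - 1) ^ k

lemma card_exts_zero (l₀ : List (Fin n)) (h : IsP G l₀) : (exts G 0 l₀).card = 1 := by
  have : exts G 0 l₀ = {l₀} := by
    ext l
    rw [mem_exts, Finset.mem_singleton]
    constructor
    · intro h; exact (h.2.2.eq_of_length (by simpa using h.1.symm)).symm
    · rintro rfl; exact ⟨rfl, h, List.suffix_refl _⟩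
  simp [this]

lemma isP_singleton (v : Fin n) : IsP G [v] := ⟨by simp, by simp⟩

lemma card_exts_le (hG : G ∈ Reg n d) (k : ℕ) (v : Fin n) :
    (exts G k [v]).card ≤ NN d k := by
  induction k with
  | zero => rw [card_exts_zero _ (isP_singleton v)]; simp [NN]
  | succ k ih =>
    rw [card_exts_succ]
    cases k with
    | zero =>
      calc _ ≤ ∑ l ∈ exts G 0 [v], d := by
            apply Finset.sum_le_sum
            intro l hl'
            rw [mem_exts] at hl'
            match l, hl' with
            | [], h => simp at h
            | a :: t, _ => exact ext1_le hG
        _ = d := by simp [card_exts_zero _ (isP_singleton (G := G) v)]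
        _ = NN d (0+1) := by simp [NN]
    | succ k =>
      calc _ ≤ ∑ l ∈ exts G (k+1) [v], (d - 1) := by
            apply Finset.sum_le_sum
            intro l hl'
            rw [mem_exts] at hl'
            match l, hl' with
            | [], h => simp at h
            | [a], h => simp at h
            | a :: b :: t, _ => exact ext1_le' hG
        _ = (exts G (k+1) [v]).card * (d - 1) := by simp
        _ ≤ NN d (k+1) * (d - 1) := Nat.mul_le_mul_right _ ih
        _ = _ := by simp [NN, pow_succ, mul_assoc]

lemma NN_succ_succ (d k : ℕ) : NN d (k + 2) = (d - 1) * NN d (k + 1) := by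
  simp [NN, pow_succ]; ring

/-- chords from the head of the list -/
def chord (l : List (Fin n)) : Finset (Fin n) :=
  l.toFinset.filter fun x => ∀ h, l.head? = some h → x ≠ h ∧ s(x, h) ∉ edgesL l

lemma ext1_lower (hG : G ∈ Reg n d) {h s : Fin n} {t : List (Fin n)} (hP : IsP G (h :: s :: t)) :
    d - 1 ≤ (ext1 G (h :: s :: t)).card +
      ((chord (h :: s :: t)).filter fun x => G.Adj x h).card := by
  have hs : s ∈ nb G h := by simpa using (isP_cons_cons.1 hP).1
  rw [← mem_Reg.1 hG h, ← Finset.card_erase_of_mem hs]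
  refine (Finset.card_le_card ?_).trans (Finset.card_union_le _ _)
  intro x hx
  simp only [Finset.mem_erase, mem_nb] at hx
  simp only [Finset.mem_union, ext1, Finset.mem_filter, Finset.mem_univ, true_and, isP_cons_cons]
  by_cases hm : x ∈ h :: s :: t
  · right
    refine ⟨?_, hx.2.symm⟩
    simp only [chord, Finset.mem_filter, List.mem_toFinset]
    refine ⟨hm, fun h' hh => ?_⟩
    simp at hh; subst hh
    refine ⟨hx.2.symm.ne, fun he => ?_⟩
    have := edge_pos (X := []) (a := x) (b := h) (Z := s :: t) (by simpa using hP.2) (by simpa using he)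
    rcases this with ⟨X', h1⟩ | ⟨Z', h1⟩
    · simp at h1
    · simp at h1; exact hx.1 h1.1.symm
  · left
    exact ⟨hx.2.symm, hm, by simpa [isP_cons_cons] using hP⟩

lemma ext1_singleton (hG : G ∈ Reg n d) (v : Fin n) : (ext1 G [v]).card = d := by
  rw [← mem_Reg.1 hG v]
  congr 1
  ext x
  simp only [ext1, Finset.mem_filter, Finset.mem_univ, true_and, isP_cons_cons, mem_nb]
  constructor
  · intro h; exact h.1.symm
  · intro h; exact ⟨h.symm, by simpa using h.symm.ne, isP_singleton v⟩

lemma sum_chords (hd : 0 < d) (hn : 16 + 8 * d ≤ n) (k : ℕ) (hk : 8 * k ≤ n) (v : Fin n) :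
    n * ∑ G ∈ Reg n d, ∑ l ∈ exts G k [v],
      ((chord l).filter fun x => ∀ h, l.head? = some h → G.Adj x h).card ≤
    2 * d * ((k + 1) * ∑ G ∈ Reg n d, (exts G k [v]).card) := by
  set T : Finset (List (Fin n) × Fin n) := (listsLen n (k+1) ×ˢ Finset.univ).filter
    (fun τ => τ.1.Nodup ∧ [v] <:+ τ.1 ∧ τ.2 ∈ chord τ.1) with hT
  set F : List (Fin n) × Fin n → Finset (Sym2 (Fin n)) := fun τ => (edgesL τ.1).toFinset
  set e : List (Fin n) × Fin n → Sym2 (Fin n) := fun τ => s(τ.2, τ.1.headD v)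
  have hhead : ∀ τ ∈ T, τ.1.head? = some (τ.1.headD v) := by
    rintro ⟨l, x⟩ hτ
    simp only [hT, Finset.mem_filter, Finset.mem_product, mem_listsLen] at hτ
    cases l with
    | nil => simp at hτ
    | cons a l => simp
  have hb := template_bound hd hn T F e (by
    intro τ hτ
    have hh := hhead τ hτ
    simp only [hT, Finset.mem_filter, chord] at hτ
    simp only [F, e, List.mem_toFinset]
    exact (hτ.2.2.2.2 _ hh).2) (by
    rintro ⟨l, x⟩ hτ
    simp only [hT, Finset.mem_filter, Finset.mem_product, mem_listsLen] at hτ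
    have := (edgesL l).toFinset_card_le
    rw [length_edgesL, hτ.1.1] at this
    simp only [F]
    have h3 : n ≤ n * d := Nat.le_mul_of_pos_right _ hd
    omega)
  have hmem : ∀ G : SimpleGraph (Fin n), ∀ l : List (Fin n), l ∈ exts G k [v] ↔
      (l.length = k + 1 ∧ l.Nodup ∧ [v] <:+ l) ∧ ∀ f ∈ edgesL l, f ∈ G.edgeSet := by
    intro G l
    rw [mem_exts, IsP, isChain_iff_edges]
    simp only [List.length_singleton, add_comm 1 k]
    tauto
  refine le_trans (le_of_eq ?_) (hb.trans ?_)
  · congr 1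
    refine Finset.sum_congr rfl fun G _ => ?_
    rw [← Finset.card_sigma]
    refine Finset.card_bij' (fun τ _ => (τ.1, τ.2)) (fun τ _ => ⟨τ.1, τ.2⟩) ?_ ?_ ?_ ?_
    · rintro ⟨l, x⟩ h
      simp only [Finset.mem_sigma, hmem, Finset.mem_filter] at h
      obtain ⟨⟨h1, h2⟩, h3, h4⟩ := h
      have hτ : (l, x) ∈ T := by
        simp only [hT, Finset.mem_filter, Finset.mem_product, mem_listsLen]
        exact ⟨⟨h1.1, Finset.mem_univ _⟩, h1.2.1, h1.2.2, h3⟩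
      rw [Finset.mem_filter]
      refine ⟨hτ, ?_⟩
      intro f hf
      rw [Finset.mem_insert] at hf
      rcases hf with rfl | hf
      · exact h4 _ (hhead _ hτ)
      · exact h2 f (by simpa [F] using hf)
    · rintro ⟨l, x⟩ h
      rw [Finset.mem_filter] at h
      obtain ⟨hτ, h2⟩ := h
      have hh := hhead _ hτ
      simp only [hT, Finset.mem_filter, Finset.mem_product, mem_listsLen] at hτ
      simp only [Finset.mem_sigma, hmem, Finset.mem_filter]
      refine ⟨⟨⟨hτ.1.1, hτ.2.1, hτ.2.2.1⟩, fun f hf => h2 f (by simp [F, hf])⟩, hτ.2.2.2, ?_⟩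
      intro h' hh'
      have := h2 (e (l, x)) (by simp)
      simp only at hh
      rw [hh] at hh'
      simp only [Option.some.injEq] at hh'
      rw [← hh']
      exact this
    · rintro ⟨l, x⟩ _; rfl
    · rintro ⟨l, x⟩ _; rfl
  · apply Nat.mul_le_mul_left
    rw [Finset.mul_sum]
    apply Finset.sum_le_sum
    intro G _
    have : T.filter (fun τ => ∀ f ∈ F τ, f ∈ G.edgeSet) ⊆
        (exts G k [v]).biUnion (fun l => l.toFinset.image (fun x => (l, x))) := by
      rintro ⟨l, x⟩ h
      simp only [hT, Finset.mem_filter, Finset.mem_product, mem_listsLen, chord, F] at h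
      simp only [Finset.mem_biUnion, hmem, Finset.mem_image]
      refine ⟨l, ⟨⟨h.1.1.1, h.1.2.1, h.1.2.2.1⟩, fun f hf => h.2 f (by simpa using hf)⟩, x, ?_, rfl⟩
      exact h.1.2.2.2.1
    refine (Finset.card_le_card this).trans (Finset.card_biUnion_le.trans ?_)
    calc _ ≤ ∑ l ∈ exts G k [v], (k + 1) := by
          apply Finset.sum_le_sum
          intro l hl
          refine Finset.card_image_le.trans ?_
          rw [mem_exts] at hl
          refine (List.toFinset_card_le l).trans ?_
          rw [hl.1]; simp [add_comm]
      _ = _ := by simp [mul_comm]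

/-- first moment lower bound -/
lemma sum_exts_lower (hd : 2 ≤ d) (hn : 16 + 8 * d ≤ n) (v : Fin n) (k : ℕ) (hk : 8 * k ≤ n) :
    ((Reg n d).card : ℝ) * NN d k * (1 - 2 * d * k ^ 2 / n) ≤
      ∑ G ∈ Reg n d, ((exts G k [v]).card : ℝ) := by
  have hn0 : (0 : ℝ) < n := by
    have : 0 < n := by omega
    exact_mod_cast this
  induction k with
  | zero =>
    simp only [card_exts_zero _ (isP_singleton v), NN]
    simp
  | succ k ih =>
    have ih := ih (by omega)
    rcases Nat.eq_zero_or_pos k with rfl | hk0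
    · have : ∀ G ∈ Reg n d, ((exts G (0+1) [v]).card : ℝ) = d := by
        intro G hG
        rw [card_exts_succ]
        have : exts G 0 [v] = {[v]} := by
          ext l
          rw [mem_exts, Finset.mem_singleton]
          constructor
          · intro h; exact (h.2.2.eq_of_length (by simpa using h.1.symm)).symm
          · rintro rfl; exact ⟨rfl, isP_singleton v, List.suffix_refl _⟩
        rw [this, Finset.sum_singleton, ext1_singleton hG]
      rw [Finset.sum_congr rfl this]
      simp only [NN, Finset.sum_const, nsmul_eq_mul]
      push_cast
      have h1 : (0:ℝ) ≤ 2 * d * (0 + 1) ^ 2 / n := by positivity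
      have h2 : (0:ℝ) ≤ (Reg n d).card * d := by positivity
      simp only [pow_zero, mul_one]
      nlinarith
    · obtain ⟨j, rfl⟩ : ∃ j, k = j + 1 := ⟨k - 1, by omega⟩
      set R : ℝ := ((Reg n d).card : ℝ) with hR
      set a : ℝ := ∑ G ∈ Reg n d, ((exts G (j+1) [v]).card : ℝ) with ha
      set C : ℝ := ∑ G ∈ Reg n d, ∑ l ∈ exts G (j+1) [v],
        (((chord l).filter fun x => ∀ h, l.head? = some h → G.Adj x h).card : ℝ) with hC
      have hup : a ≤ R * NN d (j+1) := by
        rw [ha, hR]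
        calc _ ≤ ∑ G ∈ Reg n d, (NN d (j+1) : ℝ) := by
              apply Finset.sum_le_sum
              intro G hG
              exact_mod_cast card_exts_le hG (j+1) v
          _ = _ := by simp
      have hch : n * C ≤ 2 * d * ((j + 1 + 1) * a) := by
        have := sum_chords (by omega) hn (j+1) (by omega) v (d := d)
        rw [hC, ha]
        exact_mod_cast this
      have hrec : (d - 1) * a ≤ (∑ G ∈ Reg n d, ((exts G (j+1+1) [v]).card : ℝ)) + C := by
        rw [ha, hC, Finset.mul_sum, ← Finset.sum_add_distrib]
        apply Finset.sum_le_sum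
        intro G hG
        rw [card_exts_succ (j+1), Nat.cast_sum, ← Finset.sum_add_distrib]
        have : (d - 1 : ℝ) * ((exts G (j+1) [v]).card : ℝ) = ∑ l ∈ exts G (j+1) [v], (d - 1 : ℝ) := by
          rw [Finset.sum_const, nsmul_eq_mul, mul_comm]
        rw [this]
        apply Finset.sum_le_sum
        intro l hl
        rw [mem_exts] at hl
        match l, hl with
        | [], h => simp at h
        | [a], h => simp at h
        | x :: y :: t, h =>
          have h1 := ext1_lower hG h.2.1
          have h2 : ((chord (x :: y :: t)).filter fun z => ∀ h, (x :: y :: t).head? = some h → G.Adj z h)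
            = ((chord (x :: y :: t)).filter fun z => G.Adj z x) := by simp
          rw [h2]
          have h3 : ((d - 1 : ℕ) : ℝ) ≤ _ := Nat.cast_le.2 h1
          rw [Nat.cast_sub (by omega)] at h3
          push_cast at h3
          exact h3
      have hC' : C ≤ 2 * d * (j + 2) / n * (R * NN d (j+1)) := by
        rw [div_mul_eq_mul_div, le_div_iff₀ hn0, mul_comm]
        refine hch.trans ?_
        have : (0:ℝ) ≤ 2 * d * (j + 2) := by positivity
        nlinarith [mul_le_mul_of_nonneg_left hup this]
      have hNN : (NN d (j + 1 + 1) : ℝ) = (d - 1) * NN d (j+1) := by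
        rw [NN_succ_succ]; push_cast; rw [Nat.cast_sub (by omega)]; simp
      rw [hNN]
      have hd1 : (1:ℝ) ≤ d - 1 := by
        have : (2:ℝ) ≤ d := by exact_mod_cast hd
        linarith
      have hpos : (0:ℝ) ≤ R * NN d (j+1) := by positivity
      have e1 : (d - 1) * (R * NN d (j+1) * (1 - 2 * d * ((j + 1 : ℕ):ℝ) ^ 2 / n)) ≤ (d - 1) * a :=
        mul_le_mul_of_nonneg_left ih (by linarith)
      have e2 : 2 * d * (j + 2) / n * (R * NN d (j+1)) ≤
          (d - 1) * (R * NN d (j+1)) * (2 * d * (j + 2) / n) := by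
        have : (0:ℝ) ≤ 2 * d * (j + 2) / n * (R * NN d (j+1)) := by positivity
        nlinarith
      have e3 : (2 * d * ((j + 1 + 1 : ℕ):ℝ) ^ 2 / n) ≥ 2 * d * ((j + 1 : ℕ):ℝ) ^ 2 / n
          + 2 * d * (j + 2) / n := by
        rw [← add_div]
        apply div_le_div_of_nonneg_right _ hn0.le
        push_cast
        have : (0:ℝ) ≤ d := by positivity
        have hj : (0:ℝ) ≤ j := by positivity
        nlinarith [mul_nonneg this hj]
      have hpos2 : (0:ℝ) ≤ (d - 1) * (R * NN d (j+1)) := mul_nonneg (by linarith) hpos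
      have e4 := mul_le_mul_of_nonneg_left e3 hpos2
      nlinarith

end

end FPP

namespace FPP

section chunks
variable {ι : Type*}

/-- cut the first `m * L` entries of a list into chunks of length `L` -/
def chunks (L : ℕ) : ℕ → List ι → List (List ι)
  | 0, _ => []
  | m + 1, E => E.take L :: chunks L m (E.drop L)

lemma chunks_flatten (L m : ℕ) (E : List ι) : (chunks L m E).flatten = E.take (m * L) := by
  induction m generalizing E with
  | zero => simp [chunks]
  | succ m ih => rw [chunks, List.flatten_cons, ih, add_mul, one_mul, add_comm (m*L), List.take_add]

lemma length_chunks (L m : ℕ) (E : List ι) : (chunks L m E).length = m := by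
  induction m generalizing E with
  | zero => rfl
  | succ m ih => simp [chunks, ih]

lemma length_of_mem_chunks {L m : ℕ} {E : List ι} (h : m * L ≤ E.length) :
    ∀ c ∈ chunks L m E, c.length = L := by
  induction m generalizing E with
  | zero => simp [chunks]
  | succ m ih =>
    have h' : m * L + L ≤ E.length := by rw [add_mul, one_mul] at h; exact h
    intro c hc
    rw [chunks, List.mem_cons] at hc
    rcases hc with rfl | hc
    · rw [List.length_take]; omega
    · exact ih (by rw [List.length_drop]; omega) c hc

/-- number of chunks avoiding `S` -/
def cleanC (L m : ℕ) (E S : List ι) : ℕ := (chunks L m E).countP (fun c => ∀ e ∈ c, e ∉ S)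

lemma cleanC_le (L m : ℕ) (E S : List ι) : cleanC L m E S ≤ m :=
  List.countP_le_length.trans (length_chunks _ _ _).le

lemma cleanC_succ (L m : ℕ) (E S : List ι) : cleanC L (m+1) E S =
    cleanC L m (E.drop L) S + (if (∀ e ∈ E.take L, e ∉ S) then 1 else 0) := by
  simp [cleanC, chunks, List.countP_cons]

lemma cleanC_all {L m : ℕ} {E S : List ι} (h : ∀ e ∈ E, e ∉ S) : cleanC L m E S = m := by
  induction m generalizing E with
  | zero => rfl
  | succ m ih =>
    rw [cleanC_succ, ih (fun e he => h e (List.mem_of_mem_drop he)),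
      if_pos (fun e he => h e (List.mem_of_mem_take he))]

lemma cleanC_prefix {L m : ℕ} {E1 E2 S : List ι} (h : ∀ e ∈ E1, e ∉ S) (hL : 0 < L) :
    m * L ≤ cleanC L m (E1 ++ E2) S * L + (m * L - E1.length) + (L - 1) ∧
    (m * L ≤ E1.length → cleanC L m (E1 ++ E2) S = m) := by
  induction m generalizing E1 with
  | zero => simp [cleanC, chunks]
  | succ m ih =>
    rw [cleanC_succ]
    by_cases hl : L ≤ E1.length
    · rw [List.take_append_of_le_length hl, List.drop_append_of_le_length hl,
        if_pos (fun e he => h e (List.mem_of_mem_take he))]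
      obtain ⟨h1, h2⟩ := ih (E1 := E1.drop L) (fun e he => h e (List.mem_of_mem_drop he))
      rw [List.length_drop] at h1 h2
      constructor
      · rw [add_mul, add_mul, one_mul]; omega
      · intro h3
        rw [h2 (by rw [add_mul] at h3; omega)]
    · constructor
      · rw [add_mul m, one_mul]; omega
      · intro h3; exfalso; rw [add_mul] at h3; omega

lemma cleanC_mid {L m : ℕ} {E1 E2 E3 S : List ι} (h1 : ∀ e ∈ E1, e ∉ S) (h3 : ∀ e ∈ E3, e ∉ S)
    (hL : 0 < L) :
    m * L ≤ cleanC L m (E1 ++ E2 ++ E3) S * L + E2.length + 2 * (L - 1) := by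
  have key : ∀ (m : ℕ) (E2 : List ι), m * L ≤ cleanC L m (E2 ++ E3) S * L + E2.length + (L - 1) := by
    intro m
    induction m with
    | zero => simp
    | succ m ih =>
      intro E2
      rw [cleanC_succ]
      by_cases hl : L ≤ E2.length
      · rw [List.drop_append_of_le_length hl]
        have := ih (E2.drop L)
        rw [List.length_drop] at this
        rw [add_mul, add_mul, one_mul]; omega
      · rcases Nat.eq_zero_or_pos E2.length with h0 | h0
        · have : E2 = [] := List.length_eq_zero_iff.1 h0
          subst this
          rw [List.nil_append, if_pos (fun e he => h3 e (List.mem_of_mem_take he)),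
            cleanC_all (fun e he => h3 e (List.mem_of_mem_drop he))]
          simp
        · rw [List.drop_append, List.drop_eq_nil_of_le (by omega), List.nil_append,
            cleanC_all (fun e he => h3 e (List.mem_of_mem_drop he))]
          rw [add_mul, add_mul, one_mul]; omega
  induction m generalizing E1 with
  | zero => simp
  | succ m ih =>
    by_cases hl : L ≤ E1.length
    · rw [cleanC_succ, List.append_assoc, List.take_append_of_le_length hl,
        List.drop_append_of_le_length hl, if_pos (fun e he => h1 e (List.mem_of_mem_take he)),
        ← List.append_assoc]
      have := ih (E1 := E1.drop L) (fun e he => h1 e (List.mem_of_mem_drop he))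
      rw [add_mul, add_mul, one_mul]; omega
    · rcases Nat.eq_zero_or_pos E1.length with h0 | h0
      · have : E1 = [] := List.length_eq_zero_iff.1 h0
        subst this
        have := key (m+1) E2
        rw [List.nil_append]; omega
      · rw [cleanC_succ, List.append_assoc, List.drop_append, List.drop_eq_nil_of_le (by omega),
          List.nil_append]
        have hs : ∃ E2', (E2 ++ E3).drop (L - E1.length) = E2' ++ E3 ∧ E2'.length + (L - E1.length) ≤ E2.length ∨
            cleanC L m ((E2 ++ E3).drop (L - E1.length)) S = m := by
          by_cases h5 : L - E1.length ≤ E2.length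
          · exact ⟨E2.drop (L - E1.length), Or.inl ⟨List.drop_append_of_le_length h5, by rw [List.length_drop]; omega⟩⟩
          · refine ⟨[], Or.inr (cleanC_all ?_)⟩
            rw [List.drop_append, List.drop_eq_nil_of_le (by omega), List.nil_append]
            exact fun e he => h3 e (List.mem_of_mem_drop he)
        rw [add_mul, add_mul, one_mul]
        obtain ⟨E2', h | h⟩ := hs
        · rw [h.1]
          have := key m E2'
          omega
        · rw [h]; omega

end chunks

section good
variable {ι : Type*} [Fintype ι]

lemma Ev_append (a b : List (List ι × ℝ)) : Ev (a ++ b) = Ev a ∩ Ev b := by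
  ext w; simp only [Ev, Set.mem_ofPred_eq, List.mem_append, Set.mem_inter_iff]
  exact ⟨fun h => ⟨fun c hc => h c (Or.inl hc), fun c hc => h c (Or.inr hc)⟩,
    fun h c hc => hc.elim (h.1 c) (h.2 c)⟩

/-- the parameters of the constraint list -/
def csL (L m : ℕ) (y c0 : ℝ) (E : List ι) : List (List ι × ℝ) :=
  (chunks L m E).map (fun c => (c, y)) ++ [(E.drop (m * L), c0)]

/-- goodness of a list of edges -/
def good (L m : ℕ) (y c0 : ℝ) (E : List ι) : Set (ι → ℝ) := Ev (csL L m y c0 E)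

lemma good_meas (L m : ℕ) (y c0 : ℝ) (E : List ι) : MeasurableSet (good L m y c0 E) := Ev_meas _

lemma flat_map_fst (l : List (List ι)) (y : ℝ) :
    ((l.map (fun c => (c, y))).flatMap Prod.fst) = l.flatten := by
  rw [List.flatMap_map]
  simp only
  induction l with
  | nil => rfl
  | cons a l ih => simp [ih]

lemma csL_flat (L m : ℕ) (y c0 : ℝ) (E : List ι) : (csL L m y c0 E).flatMap Prod.fst = E := by
  rw [csL, List.flatMap_append, flat_map_fst, chunks_flatten]
  simp

lemma prod_chunks {L m : ℕ} (y : ℝ) {E : List ι} (h : m * L ≤ E.length) (p : List ι → Bool) :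
    ((((chunks L m E).filter p).map (fun c => (c, y))).map fun c => pL c.1.length c.2).prod =
      pL L y ^ (chunks L m E).countP p := by
  rw [List.map_map, List.countP_eq_length_filter]
  have : ∀ c ∈ (chunks L m E).filter p, ((fun c : List ι × ℝ => pL c.1.length c.2) ∘ fun c => (c, y)) c = pL L y := by
    intro c hc
    simp only [Function.comp]
    rw [length_of_mem_chunks h c (List.mem_of_mem_filter hc)]
  rw [List.map_congr_left this]
  simp

lemma prod_csL {L m r0 : ℕ} (y c0 : ℝ) {E : List ι} (h : E.length = m * L + r0) :
    ((csL L m y c0 E).map fun c => pL c.1.length c.2).prod = pL L y ^ m * pL r0 c0 := by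
  have h1 := prod_chunks (L := L) (m := m) y (E := E) (by omega) (fun _ => true)
  rw [List.filter_true, List.countP_true, length_chunks] at h1
  rw [csL, List.map_append, List.prod_append, h1]
  simp [h]

lemma mu_good {L m r0 : ℕ} (y c0 : ℝ) {E : List ι} (hE : E.Nodup) (h : E.length = m * L + r0) :
    (mu ι).real (good L m y c0 E) = pL L y ^ m * pL r0 c0 := by
  rw [good, mu_Ev (by rwa [csL_flat]), prod_csL y c0 h]

lemma mu_good_extra {L m r0 : ℕ} (y c0 t : ℝ) {E X : List ι} (hE : E.Nodup) (hX : X.Nodup)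
    (hd : ∀ e ∈ X, e ∉ E) (h : E.length = m * L + r0) :
    (mu ι).real (good L m y c0 E ∩ {w | (X.map w).sum ≤ t}) =
      pL L y ^ m * pL r0 c0 * pL X.length t := by
  have : good L m y c0 E ∩ {w | (X.map w).sum ≤ t} = Ev (csL L m y c0 E ++ [(X, t)]) := by
    rw [Ev_append, good]; congr 1; ext w; simp [Ev]
  rw [this, mu_Ev, List.map_append, List.prod_append, prod_csL y c0 h]
  · simp
  · rw [List.flatMap_append, csL_flat]
    simp only [List.flatMap_cons, List.flatMap_nil, List.append_nil]
    exact List.nodup_append'.2 ⟨hE, hX, fun a h1 h2 => hd a h2 h1⟩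

lemma mu_good_good {L m r0 : ℕ} (y c0 : ℝ) {E E' : List ι} (hE : E.Nodup) (hE' : E'.Nodup)
    (h : E.length = m * L + r0) (h' : m * L ≤ E'.length) :
    (mu ι).real (good L m y c0 E ∩ good L m y c0 E') ≤
      pL L y ^ m * pL r0 c0 * pL L y ^ cleanC L m E' E := by
  set X := (((chunks L m E').filter (fun c => ∀ e ∈ c, e ∉ E)).map (fun c => (c, y)))
  have hsub : good L m y c0 E ∩ good L m y c0 E' ⊆ Ev (csL L m y c0 E ++ X) := by
    rw [Ev_append]
    refine Set.inter_subset_inter_right _ ?_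
    intro w hw c hc
    apply hw c
    rw [csL, List.mem_append]
    left
    simp only [X, List.mem_map] at hc ⊢
    obtain ⟨a, ha, rfl⟩ := hc
    exact ⟨a, List.mem_of_mem_filter ha, rfl⟩
  refine (measureReal_mono hsub).trans ?_
  rw [mu_Ev, List.map_append, List.prod_append, prod_csL y c0 h, prod_chunks y h']
  · unfold cleanC; apply le_of_eq; congr!
  · rw [List.flatMap_append, csL_flat, flat_map_fst]
    refine List.nodup_append'.2 ⟨hE, ?_, ?_⟩
    · have h1 : ((chunks L m E').filter (fun c => ∀ e ∈ c, e ∉ E)).flatten.Sublist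
          (chunks L m E').flatten := List.Sublist.flatten List.filter_sublist
      refine h1.nodup ?_
      rw [chunks_flatten]
      exact (List.take_sublist _ _).nodup hE'
    · intro a h1 h2
      rw [List.mem_flatten] at h2
      obtain ⟨c, hc, hac⟩ := h2
      have := (List.mem_filter.1 hc).2
      simp only [decide_eq_true_eq] at this
      exact this a hac h1

/-- good lists are light -/
lemma good_sum {L m : ℕ} {y c0 : ℝ} {E : List ι} {w : ι → ℝ} (hw : w ∈ good L m y c0 E) :
    (E.map w).sum ≤ c0 + m * y := by
  have key : ∀ (cs : List (List ι × ℝ)), w ∈ Ev cs →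
      ((cs.flatMap Prod.fst).map w).sum ≤ (cs.map Prod.snd).sum := by
    intro cs
    induction cs with
    | nil => simp
    | cons c cs ih =>
      intro h
      have h1 := h c (by simp)
      have h2 := ih (fun c' hc' => h c' (by simp [hc']))
      rw [List.flatMap_cons, List.map_append, List.sum_append, List.map_cons, List.sum_cons]
      linarith
  have := key _ hw
  rw [csL_flat] at this
  refine this.trans (le_of_eq ?_)
  have h3 : ((chunks L m E).map fun _ => y).sum = m * y := by
    rw [List.map_const', List.sum_replicate, length_chunks, nsmul_eq_mul]
  rw [csL, List.map_append, List.sum_append, List.map_map]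
  simp only [Function.comp_def, List.map_cons, List.map_nil, List.sum_cons, List.sum_nil, h3]
  ring

end good

end FPP

namespace FPP

section first
variable {n d : ℕ} {G : SimpleGraph (Fin n)}

/-- simple paths with `k` edges ending in `St` -/
def Pa (G : SimpleGraph (Fin n)) (k : ℕ) (St : Finset (Fin n)) : Finset (List (Fin n)) :=
  (listsLen n (k + 1)).filter fun l => IsP G l ∧ ∃ v ∈ St, [v] <:+ l

lemma mem_Pa {k : ℕ} {St : Finset (Fin n)} {l : List (Fin n)} :
    l ∈ Pa G k St ↔ l.length = k + 1 ∧ IsP G l ∧ ∃ v ∈ St, [v] <:+ l := by simp [Pa]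

lemma Pa_eq (k : ℕ) (St : Finset (Fin n)) : Pa G k St = St.biUnion fun v => exts G k [v] := by
  ext l
  simp only [mem_Pa, Finset.mem_biUnion, mem_exts, List.length_singleton, add_comm 1 k]
  constructor
  · rintro ⟨h1, h2, v, hv, h3⟩; exact ⟨v, hv, h1, h2, h3⟩
  · rintro ⟨v, hv, h1, h2, h3⟩; exact ⟨h1, h2, v, hv, h3⟩

lemma suffix_singleton_unique {V : Type*} {v v' : V} {l : List V} (h : [v] <:+ l) (h' : [v'] <:+ l) :
    v = v' := by
  obtain ⟨s, rfl⟩ := h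
  obtain ⟨s', h'⟩ := h'
  have := congrArg List.getLast? h'
  simpa using this.symm

lemma card_Pa (k : ℕ) (St : Finset (Fin n)) :
    (Pa G k St).card = ∑ v ∈ St, (exts G k [v]).card := by
  rw [Pa_eq, Finset.card_biUnion]
  intro a _ b _ hab
  rw [Function.onFun, Finset.disjoint_left]
  intro l h1 h2
  rw [mem_exts] at h1 h2
  exact hab (suffix_singleton_unique h1.2.2 h2.2.2)

lemma card_Pa_le (hG : G ∈ Reg n d) (k : ℕ) (St : Finset (Fin n)) :
    (Pa G k St).card ≤ St.card * NN d k := by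
  rw [card_Pa]
  calc _ ≤ ∑ v ∈ St, NN d k := Finset.sum_le_sum fun v _ => card_exts_le hG k v
    _ = _ := by simp

lemma sum_Pa_lower (hd : 2 ≤ d) (hn : 16 + 8 * d ≤ n) (St : Finset (Fin n)) (k : ℕ) (hk : 8 * k ≤ n) :
    ((Reg n d).card : ℝ) * (St.card * NN d k) * (1 - 2 * d * k ^ 2 / n) ≤
      ∑ G ∈ Reg n d, ((Pa G k St).card : ℝ) := by
  simp only [card_Pa, Nat.cast_sum]
  rw [Finset.sum_comm]
  calc _ = ∑ v ∈ St, ((Reg n d).card : ℝ) * NN d k * (1 - 2 * d * k ^ 2 / n) := by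
        simp; ring
    _ ≤ _ := Finset.sum_le_sum fun v _ => sum_exts_lower hd hn v k hk

/-- short shortcuts with `j` edges -/
def shorts (G : SimpleGraph (Fin n)) (P : List (Fin n)) (j : ℕ) : Finset (List (Fin n)) :=
  (listsLen n (j + 1)).filter fun l => IsP G l ∧ (∃ a ∈ P, l.head? = some a) ∧ (∃ b ∈ P, [b] <:+ l) ∧
    ∀ e ∈ edgesL l, e ∉ edgesL P

/-- long shortcuts, truncated after `J` edges -/
def longs (G : SimpleGraph (Fin n)) (P : List (Fin n)) (J : ℕ) : Finset (List (Fin n)) :=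
  (listsLen n (J + 1)).filter fun l => IsP G l ∧ (∃ b ∈ P, [b] <:+ l) ∧
    ∀ e ∈ edgesL l, e ∉ edgesL P

lemma edges_mid {P mid : List (Fin n)} {u v : Fin n} (hm : ∀ x ∈ mid, x ∉ P)
    (h : ¬ (mid = [] ∧ s(u, v) ∈ edgesL P)) : ∀ e ∈ edgesL (u :: (mid ++ [v])), e ∉ edgesL P := by
  cases mid with
  | nil =>
    intro e he
    simp at he h
    rw [he]; exact h
  | cons a mid =>
    have key : ∀ (mid : List (Fin n)), (∀ x ∈ mid, x ∉ P) → mid ≠ [] →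
        ∀ e ∈ edgesL (mid ++ [v]), e ∉ edgesL P := by
      intro mid
      induction mid with
      | nil => simp
      | cons b mid ih =>
        intro hb _ e he hP
        cases mid with
        | nil =>
          simp at he
          exact hb b (by simp) (mem_of_mem_edgesL hP (by simp [he]))
        | cons c mid =>
          simp only [List.cons_append, edgesL, List.mem_cons] at he
          rcases he with rfl | he
          · exact hb b (by simp) (mem_of_mem_edgesL hP (by simp))
          · exact ih (fun x hx => hb x (by simp [hx])) (by simp) e (by simpa using he) hP
    intro e he hP
    simp only [List.cons_append, edgesL, List.mem_cons] at he
    rcases he with rfl | he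
    · exact hm a (by simp) (mem_of_mem_edgesL hP (by simp))
    · exact key (a :: mid) hm (by simp) e he hP

lemma notiso_cover {w : W n} (hw : ∀ e, 0 ≤ w e) {t : ℝ} {P : List (Fin n)} (J : ℕ)
    (h : ¬ Iso G w t P) :
    (∃ j ∈ Finset.Icc 1 J, ∃ l ∈ shorts G P j, wt w l ≤ t) ∨ (∃ l ∈ longs G P J, wt w l ≤ t) := by
  unfold Iso at h
  push Not at h
  obtain ⟨u, v, mid, hu, hv, hm, hP, hwt, hne⟩ := h
  have hdis := edges_mid hm (fun hh => hne hh.1 hh.2)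
  by_cases hj : mid.length + 1 ≤ J
  · left
    refine ⟨mid.length + 1, by simp [hj], u :: (mid ++ [v]), ?_, hwt⟩
    simp only [shorts, Finset.mem_filter, mem_listsLen]
    refine ⟨by simp, hP, ⟨u, hu, by simp⟩, ⟨v, hv, ⟨u :: mid, by simp⟩⟩, hdis⟩
  · right
    set Q := u :: (mid ++ [v]) with hQ
    have hl : Q.length = mid.length + 2 := by simp [hQ]
    have hsuf : Q.drop (mid.length + 1 - J) <:+ Q := List.drop_suffix _ _
    refine ⟨Q.drop (mid.length + 1 - J), ?_, (wt_infix hw hsuf.isInfix).trans hwt⟩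
    simp only [longs, Finset.mem_filter, mem_listsLen, List.length_drop]
    refine ⟨by omega, hP.infix hsuf.isInfix, ⟨v, hv, ?_⟩, fun e he =>
      hdis e ((edgesL_infix hsuf.isInfix).subset he)⟩
    refine List.suffix_of_suffix_length_le (l₃ := Q) ⟨u :: mid, by simp [hQ]⟩ hsuf ?_
    simp [hl]; omega

lemma card_longs (hG : G ∈ Reg n d) {P : List (Fin n)} {k : ℕ} (hP : P.length = k + 1) (J : ℕ) :
    (longs G P J).card ≤ (k + 1) * NN d J := by
  have : longs G P J ⊆ P.toFinset.biUnion fun b => exts G J [b] := by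
    intro l
    simp only [longs, Finset.mem_filter, mem_listsLen, Finset.mem_biUnion, List.mem_toFinset, mem_exts]
    rintro ⟨h1, h2, ⟨b, hb, h3⟩, _⟩
    exact ⟨b, hb, by simp [h1, add_comm], h2, h3⟩
  refine (Finset.card_le_card this).trans (Finset.card_biUnion_le.trans ?_)
  calc _ ≤ ∑ b ∈ P.toFinset, NN d J := Finset.sum_le_sum fun b _ => card_exts_le hG J b
    _ = P.toFinset.card * NN d J := by simp
    _ ≤ _ := Nat.mul_le_mul_right _ (by rw [← hP]; exact List.toFinset_card_le P)

lemma sum_shorts (hd : 0 < d) (hn : 16 + 8 * d ≤ n) (k j : ℕ) (hk : 8 * (k + j) ≤ n) (hj : 1 ≤ j)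
    (St : Finset (Fin n)) :
    n * ∑ G ∈ Reg n d, ∑ P ∈ Pa G k St, (shorts G P j).card ≤
    2 * d * ((k + 1) * ((k + 1) * NN d (j - 1)) * ∑ G ∈ Reg n d, (Pa G k St).card) := by
  have hn0 : 0 < n := by omega
  set v0 : Fin n := ⟨0, hn0⟩
  set T : Finset (List (Fin n) × List (Fin n)) := (listsLen n (k+1) ×ˢ listsLen n (j+1)).filter
    (fun τ => τ.1.Nodup ∧ (∃ v ∈ St, [v] <:+ τ.1) ∧ τ.2.Nodup ∧ (∃ a ∈ τ.1, τ.2.head? = some a) ∧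
      (∃ b ∈ τ.1, [b] <:+ τ.2) ∧ ∀ e ∈ edgesL τ.2, e ∉ edgesL τ.1) with hT
  set F : List (Fin n) × List (Fin n) → Finset (Sym2 (Fin n)) :=
    fun τ => (edgesL τ.1 ++ edgesL τ.2.tail).toFinset with hF
  set e : List (Fin n) × List (Fin n) → Sym2 (Fin n) := fun τ => (edgesL τ.2).headD s(v0, v0) with he
  have hb := template_bound hd hn T F e (by
    rintro ⟨P, l⟩ hτ
    simp only [hT, Finset.mem_filter, Finset.mem_product, mem_listsLen] at hτ
    obtain ⟨⟨h1, h2⟩, h3, h4, h5, h6, h7, h8⟩ := hτ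
    match l, h2 with
    | [], h => simp at h
    | [a], h => simp at h; omega
    | a :: b :: l', h =>
      simp only [he, hF, edgesL, List.headD_cons, List.tail_cons, List.mem_toFinset, List.mem_append]
      rintro (h9 | h9)
      · exact h8 _ (by simp) h9
      · rw [List.nodup_cons] at h5
        exact h5.1 (mem_of_mem_edgesL h9 (by simp))) (by
    rintro ⟨P, l⟩ hτ
    simp only [hT, Finset.mem_filter, Finset.mem_product, mem_listsLen] at hτ
    have := (edgesL P ++ edgesL l.tail).toFinset_card_le
    rw [List.length_append, length_edgesL, length_edgesL, List.length_tail, hτ.1.1, hτ.1.2] at this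
    simp only [hF]
    have h3 : n ≤ n * d := Nat.le_mul_of_pos_right _ hd
    omega)
  refine le_trans ?_ (hb.trans ?_)
  · apply Nat.mul_le_mul_left
    refine Finset.sum_le_sum fun G _ => ?_
    rw [← Finset.card_sigma]
    refine Finset.card_le_card_of_injOn (fun τ => (τ.1, τ.2)) ?_ ?_
    · rintro ⟨P, l⟩ h
      simp only [Finset.coe_sigma, Set.mem_sigma_iff, Finset.mem_coe, mem_Pa, shorts,
        Finset.mem_filter, mem_listsLen] at h
      obtain ⟨⟨h1, h2, h3⟩, h4, h5, h6, h7, h8⟩ := h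
      simp only [Finset.mem_coe, Finset.mem_filter, hT, Finset.mem_product, mem_listsLen]
      refine ⟨⟨⟨h1, h4⟩, h2.2, h3, h5.2, h6, h7, h8⟩, ?_⟩
      intro f hf
      match l, h4 with
      | [], h => simp at h
      | [a], h => simp at h; omega
      | a :: b :: l', h =>
        simp only [he, hF, edgesL, List.headD_cons, List.tail_cons, List.mem_toFinset, List.mem_append,
          Finset.mem_insert] at hf
        rcases hf with rfl | hf | hf
        · exact h5.edge_mem (by simp)
        · exact h2.edge_mem hf
        · exact h5.edge_mem (by simp [hf])
    · rintro ⟨P, l⟩ _ ⟨P', l'⟩ _ h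
      simp only [Prod.mk.injEq] at h
      obtain ⟨rfl, rfl⟩ := h
      rfl
  · apply Nat.mul_le_mul_left
    rw [Finset.mul_sum]
    apply Finset.sum_le_sum
    intro G hG
    have : T.filter (fun τ => ∀ f ∈ F τ, f ∈ G.edgeSet) ⊆
        (Pa G k St).biUnion (fun P => P.toFinset.biUnion fun a => P.toFinset.biUnion fun b =>
          (exts G (j - 1) [b]).image (fun l => (P, a :: l))) := by
      rintro ⟨P, l⟩ h
      simp only [hT, Finset.mem_filter, Finset.mem_product, mem_listsLen] at h
      obtain ⟨⟨⟨h1, h2⟩, h3, h4, h5, ⟨a', ha', h6⟩, ⟨b', hb', h7⟩, h8⟩, h9⟩ := h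
      simp only [hF, List.mem_toFinset, List.mem_append] at h9
      match l, h2 with
      | [], h => simp at h
      | [a], h => simp at h; omega
      | a :: b :: l', h =>
        simp at h6; subst h6
        simp only [Finset.mem_biUnion, Finset.mem_image, mem_Pa, List.mem_toFinset, mem_exts]
        refine ⟨P, ⟨h1, ⟨?_, h3⟩, h4⟩, a, ha', b', hb', b :: l', ⟨?_, ⟨?_, ?_⟩, ?_⟩, rfl⟩
        · rw [isChain_iff_edges]; exact fun f hf => h9 f (Or.inl hf)
        · simp at h ⊢; omega
        · rw [isChain_iff_edges]; exact fun f hf => h9 f (Or.inr hf)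
        · exact (List.nodup_cons.1 h5).2
        · rcases List.suffix_cons_iff.1 h7 with h | h
          · simp at h
          · exact h
    refine (Finset.card_le_card this).trans (Finset.card_biUnion_le.trans ?_)
    calc _ ≤ ∑ P ∈ Pa G k St, (k + 1) * ((k + 1) * NN d (j - 1)) := by
          apply Finset.sum_le_sum
          intro P hP
          rw [mem_Pa] at hP
          have hc : P.toFinset.card ≤ k + 1 := by rw [← hP.1]; exact List.toFinset_card_le P
          refine Finset.card_biUnion_le.trans ?_
          calc _ ≤ ∑ a ∈ P.toFinset, (k + 1) * NN d (j - 1) := by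
                apply Finset.sum_le_sum
                intro a _
                refine Finset.card_biUnion_le.trans ?_
                calc _ ≤ ∑ b ∈ P.toFinset, NN d (j - 1) := Finset.sum_le_sum fun b _ =>
                      Finset.card_image_le.trans (card_exts_le hG _ b)
                  _ = P.toFinset.card * NN d (j - 1) := by simp
                  _ ≤ _ := Nat.mul_le_mul_right _ hc
            _ = P.toFinset.card * ((k + 1) * NN d (j - 1)) := by simp
            _ ≤ _ := Nat.mul_le_mul_right _ hc
      _ = _ := by simp [mul_comm]

lemma wt_meas (l : List (Fin n)) : Measurable (fun w : W n => wt w l) := meas_sum _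

lemma iso_meas (t : ℝ) (P : List (Fin n)) : MeasurableSet {w : W n | Iso G w t P} := by
  have : {w : W n | Iso G w t P} = ⋂ (u : Fin n) (v : Fin n) (mid : List (Fin n)),
      {w : W n | u ∈ P → v ∈ P → (∀ x ∈ mid, x ∉ P) →
    IsP G (u :: (mid ++ [v])) → wt w (u :: (mid ++ [v])) ≤ t → mid = [] ∧ s(u, v) ∈ edgesL P} := by
    ext w; simp only [Iso, Set.mem_iInter, Set.mem_ofPred_eq]
  rw [this]
  refine MeasurableSet.iInter fun u => MeasurableSet.iInter fun v => MeasurableSet.iInter fun mid => ?_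
  by_cases h : (u ∈ P ∧ v ∈ P ∧ (∀ x ∈ mid, x ∉ P) ∧ IsP G (u :: (mid ++ [v])) ∧
    ¬ (mid = [] ∧ s(u, v) ∈ edgesL P))
  · have : {w : W n | u ∈ P → v ∈ P → (∀ x ∈ mid, x ∉ P) →
        IsP G (u :: (mid ++ [v])) → wt w (u :: (mid ++ [v])) ≤ t → mid = [] ∧ s(u, v) ∈ edgesL P}
        = {w : W n | wt w (u :: (mid ++ [v])) ≤ t}ᶜ := by
      ext w; simp only [Set.mem_ofPred_eq, Set.mem_compl_iff]; tauto
    rw [this]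
    exact (measurableSet_le (wt_meas _) measurable_const).compl
  · convert MeasurableSet.univ
    ext w; simp only [Set.mem_ofPred_eq, Set.mem_univ]; tauto

/-- the event that `P` is good and isolated -/
def ok (G : SimpleGraph (Fin n)) (L m : ℕ) (y c0 t : ℝ) (P : List (Fin n)) : Set (W n) :=
  good L m y c0 (edgesL P) ∩ {w | Iso G w t P}

lemma ok_meas (L m : ℕ) (y c0 t : ℝ) (P : List (Fin n)) : MeasurableSet (ok G L m y c0 t P) :=
  (good_meas _ _ _ _ _).inter (iso_meas _ _)

lemma ok_lower {L m r0 J : ℕ} {y c0 t : ℝ} {P : List (Fin n)} (hP : IsP G P)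
    (hl : P.length = m * L + r0 + 1) :
    pL L y ^ m * pL r0 c0 * (1 - (∑ j ∈ Finset.Icc 1 J, (shorts G P j).card * pL j t)
        - (longs G P J).card * pL J t) ≤ (muE n).real (ok G L m y c0 t P) := by
  set g := pL L y ^ m * pL r0 c0
  set Gd := good L m y c0 (edgesL P)
  have hE := nodup_edgesL hP.2
  have hEl : (edgesL P).length = m * L + r0 := by rw [length_edgesL, hl]; rfl
  have h1 : (muE n).real Gd ≤ (muE n).real (ok G L m y c0 t P ∪
      ({w | ∃ j ∈ Finset.Icc 1 J, w ∈ {w | ∃ l ∈ shorts G P j, w ∈ Gd ∩ {w | wt w l ≤ t}}} ∪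
      {w | ∃ l ∈ longs G P J, w ∈ Gd ∩ {w | wt w l ≤ t}})) := by
    apply real_mono_ae
    intro w hw hg
    by_cases hi : Iso G w t P
    · left; exact ⟨hg, hi⟩
    · right
      rcases notiso_cover hw J hi with ⟨j, hj, l, hl, h⟩ | ⟨l, hl, h⟩
      · left; exact ⟨j, hj, l, hl, hg, h⟩
      · right; exact ⟨l, hl, hg, h⟩
  have h2 : (muE n).real Gd = g := mu_good y c0 hE hEl
  have hprob : ∀ l : List (Fin n), ∀ j, l.length = j + 1 → l.Nodup → (∀ e ∈ edgesL l, e ∉ edgesL P) →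
      (muE n).real (Gd ∩ {w | wt w l ≤ t}) = g * pL j t := by
    intro l j hlj hln hdis
    have := mu_good_extra (L := L) (m := m) y c0 t hE (nodup_edgesL hln) hdis hEl
    rw [length_edgesL, hlj] at this
    exact this
  have h3 := h1.trans ((measureReal_union_le _ _).trans (add_le_add le_rfl (measureReal_union_le _ _)))
  have h4 : (muE n).real {w | ∃ j ∈ Finset.Icc 1 J, w ∈ {w | ∃ l ∈ shorts G P j, w ∈ Gd ∩ {w | wt w l ≤ t}}}
      ≤ ∑ j ∈ Finset.Icc 1 J, (shorts G P j).card * (g * pL j t) := by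
    refine (real_exists_le _ _).trans (Finset.sum_le_sum fun j _ => (real_exists_le _ _).trans ?_)
    rw [← nsmul_eq_mul, ← Finset.sum_const]
    refine Finset.sum_le_sum fun l hl' => ?_
    simp only [shorts, Finset.mem_filter, mem_listsLen] at hl'
    exact (hprob l j hl'.1 hl'.2.1.2 hl'.2.2.2.2).le
  have h5 : (muE n).real {w | ∃ l ∈ longs G P J, w ∈ Gd ∩ {w | wt w l ≤ t}}
      ≤ (longs G P J).card * (g * pL J t) := by
    refine (real_exists_le _ _).trans ?_
    rw [← nsmul_eq_mul, ← Finset.sum_const]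
    refine Finset.sum_le_sum fun l hl' => ?_
    simp only [longs, Finset.mem_filter, mem_listsLen] at hl'
    exact (hprob l J hl'.1 hl'.2.1.2 hl'.2.2.2).le
  have h6 : ∑ j ∈ Finset.Icc 1 J, ((shorts G P j).card : ℝ) * (g * pL j t) =
      g * ∑ j ∈ Finset.Icc 1 J, (shorts G P j).card * pL j t := by
    rw [Finset.mul_sum]; exact Finset.sum_congr rfl fun _ _ => by ring
  rw [h6] at h4
  rw [h2] at h3
  linarith

end first

end FPP

namespace FPP

section second
variable {n d : ℕ} {G : SimpleGraph (Fin n)}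

lemma NN_le_pow (hd : 3 ≤ d) (j : ℕ) : (NN d j : ℝ) ≤ (d - 1 : ℝ) ^ (j + 1) := by
  have h3 : (3:ℝ) ≤ d := by exact_mod_cast hd
  cases j with
  | zero => simp [NN]; linarith
  | succ j =>
    simp only [NN]; push_cast
    rw [Nat.cast_sub (by omega), Nat.cast_one]
    have : (0:ℝ) ≤ (d - 1 : ℝ) ^ j := pow_nonneg (by linarith) _
    calc (d : ℝ) * (d - 1) ^ j ≤ (d - 1) ^ 2 * (d - 1) ^ j := by
          apply mul_le_mul_of_nonneg_right _ this; nlinarith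
      _ = _ := by ring

lemma NN_le_pow' (hd : 1 ≤ d) (j : ℕ) : (NN d j : ℝ) ≤ (d : ℝ) ^ j := by
  cases j with
  | zero => simp [NN]
  | succ j =>
    simp only [NN]; push_cast
    rw [Nat.cast_sub hd, Nat.cast_one, pow_succ']
    have h1 : (1:ℝ) ≤ d := by exact_mod_cast hd
    gcongr
    linarith

lemma NN_ge_pow (hd : 1 ≤ d) (j : ℕ) : (d - 1 : ℝ) ^ j ≤ NN d j := by
  have h1 : (1:ℝ) ≤ d := by exact_mod_cast hd
  cases j with
  | zero => simp [NN]
  | succ j =>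
    simp only [NN]; push_cast
    rw [Nat.cast_sub hd, Nat.cast_one, pow_succ']
    have : (0:ℝ) ≤ (d - 1 : ℝ) ^ j := pow_nonneg (by linarith) _
    apply mul_le_mul_of_nonneg_right _ this; linarith

/-- error term of the first moment -/
def err1 (n d k J : ℕ) (t : ℝ) : ℝ := 2 * d * k ^ 2 / n +
  J * (2 * d * (k + 1) ^ 2 * Real.exp ((d - 2) * t) / n) +
  (k + 1) * (Real.exp ((2 * d - 1) * t) * (1 / 2) ^ J)

set_option maxHeartbeats 1000000 in
lemma first_total (hd : 3 ≤ d) (hn : 16 + 8 * d ≤ n) {L m r0 J : ℕ} {y c0 t : ℝ}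
    (hk : 8 * (m * L + r0 + J) ≤ n) (St : Finset (Fin n)) :
    ((Reg n d).card : ℝ) * (St.card * NN d (m * L + r0)) * (pL L y ^ m * pL r0 c0) *
      (1 - err1 n d (m * L + r0) J t) ≤
    ∑ G ∈ Reg n d, ∑ P ∈ Pa G (m * L + r0) St, (muE n).real (ok G L m y c0 t P) := by
  set k := m * L + r0 with hkdef
  set g := pL L y ^ m * pL r0 c0
  have hg : 0 ≤ g := mul_nonneg (pow_nonneg (pL_nonneg _ _) _) (pL_nonneg _ _)
  set R : ℝ := ((Reg n d).card : ℝ) with hR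
  set N : ℝ := St.card * NN d k with hN
  have hd3 : (3:ℝ) ≤ d := by exact_mod_cast hd
  have hn0 : (0:ℝ) < n := by
    have : 0 < n := by omega
    exact_mod_cast this
  have hR0 : 0 ≤ R := Nat.cast_nonneg _
  have hN0 : 0 ≤ N := mul_nonneg (Nat.cast_nonneg _) (Nat.cast_nonneg _)
  set S : ℝ := ∑ G ∈ Reg n d, ((Pa G k St).card : ℝ) with hS
  have hSl : R * N * (1 - 2 * d * k ^ 2 / n) ≤ S := sum_Pa_lower (by omega) hn St k (by omega)
  have hSu : S ≤ R * N := by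
    rw [hS, hR]
    calc _ ≤ ∑ G ∈ Reg n d, N := by
          apply Finset.sum_le_sum
          intro G hG
          rw [hN]
          exact_mod_cast card_Pa_le hG k St
      _ = _ := by simp
  have h1 : ∑ G ∈ Reg n d, ∑ P ∈ Pa G k St, g * (1 - (∑ j ∈ Finset.Icc 1 J, (shorts G P j).card * pL j t)
        - (longs G P J).card * pL J t) ≤
      ∑ G ∈ Reg n d, ∑ P ∈ Pa G k St, (muE n).real (ok G L m y c0 t P) := by
    refine Finset.sum_le_sum fun G hG => Finset.sum_le_sum fun P hP => ?_
    rw [mem_Pa] at hP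
    exact ok_lower hP.2.1 hP.1
  refine le_trans ?_ h1
  have e1 : ∑ G ∈ Reg n d, ∑ P ∈ Pa G k St, g * (1 - (∑ j ∈ Finset.Icc 1 J, (shorts G P j).card * pL j t)
        - (longs G P J).card * pL J t) = g * (S -
        (∑ j ∈ Finset.Icc 1 J, (∑ G ∈ Reg n d, ∑ P ∈ Pa G k St, ((shorts G P j).card : ℝ)) * pL j t)
        - (∑ G ∈ Reg n d, ∑ P ∈ Pa G k St, ((longs G P J).card : ℝ)) * pL J t) := by
    simp only [← Finset.mul_sum, Finset.sum_sub_distrib]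
    congr 1
    congr 1
    · congr 1
      · rw [hS]; simp
      · simp only [Finset.sum_mul]
        rw [Finset.sum_comm (s := Finset.Icc 1 J) (t := Reg n d)]
        refine Finset.sum_congr rfl fun G _ => ?_
        rw [Finset.sum_comm]
    · simp only [Finset.sum_mul]
  rw [e1]
  have e2 : ∀ j ∈ Finset.Icc 1 J, (∑ G ∈ Reg n d, ∑ P ∈ Pa G k St, ((shorts G P j).card : ℝ)) * pL j t ≤
      R * N * (2 * d * (k + 1) ^ 2 * Real.exp ((d - 2) * t) / n) := by
    intro j hj
    rw [Finset.mem_Icc] at hj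
    have h2 := sum_shorts (n := n) (d := d) (by omega) hn k j (by omega) hj.1 St
    have h3 : (n : ℝ) * ∑ G ∈ Reg n d, ∑ P ∈ Pa G k St, ((shorts G P j).card : ℝ) ≤
        2 * d * ((k + 1) * ((k + 1) * NN d (j - 1)) * S) := by
      rw [hS]; exact_mod_cast h2
    have h4 := pL_chernoff (θ := d - 2) (by linarith) j t
    have h5 : (NN d (j - 1) : ℝ) * (1 / (1 + (d - 2))) ^ j ≤ 1 := by
      have := NN_le_pow hd (j - 1)
      rw [Nat.sub_add_cancel hj.1] at this
      have h6 : (1 + ((d:ℝ) - 2)) = d - 1 := by ring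
      rw [h6, one_div, inv_pow, ← div_eq_mul_inv]
      exact div_le_one_of_le₀ this (pow_nonneg (by linarith) _)
    set X : ℝ := ∑ G ∈ Reg n d, ∑ P ∈ Pa G k St, ((shorts G P j).card : ℝ)
    have hX : 0 ≤ X := Finset.sum_nonneg fun _ _ => Finset.sum_nonneg fun _ _ => Nat.cast_nonneg _
    clear_value X S
    rw [mul_div_assoc', le_div_iff₀ hn0]
    have hpl := pL_nonneg j t
    calc X * pL j t * n = (n * X) * pL j t := by ring
      _ ≤ (2 * d * ((k + 1) * ((k + 1) * NN d (j - 1)) * S)) * pL j t := by gcongr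
      _ ≤ (2 * d * ((k + 1) * ((k + 1) * NN d (j - 1)) * (R * N))) *
          (Real.exp ((d - 2) * t) * (1 / (1 + (d - 2))) ^ j) := by gcongr
      _ = (2 * d * ((k + 1) * (k + 1)) * (R * N) * Real.exp ((d - 2) * t)) *
          (NN d (j - 1) * (1 / (1 + (d - 2))) ^ j) := by ring
      _ ≤ (2 * d * ((k + 1) * (k + 1)) * (R * N) * Real.exp ((d - 2) * t)) * 1 := by gcongr
      _ = _ := by ring
  have e3 : (∑ G ∈ Reg n d, ∑ P ∈ Pa G k St, ((longs G P J).card : ℝ)) * pL J t ≤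
      R * N * ((k + 1) * (Real.exp ((2 * d - 1) * t) * (1 / 2) ^ J)) := by
    have h2 : ∑ G ∈ Reg n d, ∑ P ∈ Pa G k St, ((longs G P J).card : ℝ) ≤ (R * N) * ((k + 1) * d ^ J) := by
      calc _ ≤ ∑ G ∈ Reg n d, ∑ P ∈ Pa G k St, (((k:ℝ) + 1) * d ^ J) := by
            refine Finset.sum_le_sum fun G hG => Finset.sum_le_sum fun P hP => ?_
            rw [mem_Pa] at hP
            have h3 := card_longs hG hP.1 J
            have h4 : ((longs G P J).card : ℝ) ≤ (k + 1) * NN d J := by exact_mod_cast h3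
            refine h4.trans ?_
            gcongr
            exact NN_le_pow' (by omega) J
        _ = S * ((k + 1) * d ^ J) := by
            rw [hS, Finset.sum_mul]
            simp
        _ ≤ _ := by gcongr
    have h4 := pL_chernoff (θ := 2 * d - 1) (by linarith) J t
    have hpl := pL_nonneg J t
    calc _ ≤ (R * N) * ((k + 1) * d ^ J) * (Real.exp ((2 * d - 1) * t) * (1 / (1 + (2 * d - 1))) ^ J) := by
          gcongr
      _ = R * N * ((k + 1) * (Real.exp ((2 * d - 1) * t) * (d ^ J * (1 / (1 + (2 * d - 1))) ^ J))) := by ring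
      _ = _ := by
          rw [← mul_pow]
          have : (d:ℝ) * (1 / (1 + (2 * d - 1))) = 1 / 2 := by
            rw [show (1 + (2 * (d:ℝ) - 1)) = 2 * d by ring]
            field_simp
          rw [this]
  have e4 := Finset.sum_le_sum e2
  rw [Finset.sum_const, nsmul_eq_mul, Nat.card_Icc, Nat.add_sub_cancel] at e4
  have e5 : R * N * (1 - err1 n d k J t) ≤ S -
        (∑ j ∈ Finset.Icc 1 J, (∑ G ∈ Reg n d, ∑ P ∈ Pa G k St, ((shorts G P j).card : ℝ)) * pL j t)
        - (∑ G ∈ Reg n d, ∑ P ∈ Pa G k St, ((longs G P J).card : ℝ)) * pL J t := by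
    unfold err1
    have : R * N * (1 - (2 * d * k ^ 2 / n + J * (2 * d * (k + 1) ^ 2 * Real.exp ((d - 2) * t) / n) +
      (k + 1) * (Real.exp ((2 * d - 1) * t) * (1 / 2) ^ J))) = R * N * (1 - 2 * d * k ^ 2 / n)
      - J * (R * N * (2 * d * (k + 1) ^ 2 * Real.exp ((d - 2) * t) / n))
      - R * N * ((k + 1) * (Real.exp ((2 * d - 1) * t) * (1 / 2) ^ J)) := by ring
    rw [this]
    linarith
  calc _ = g * (R * N * (1 - err1 n d k J t)) := by ring
    _ ≤ _ := mul_le_mul_of_nonneg_left e5 hg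

/-- averaged second moment method -/
lemma second_total (hd : 3 ≤ d) (hn : 16 + 8 * d ≤ n) {L m r0 J : ℕ} {y c0 t : ℝ}
    (hk : 8 * (m * L + r0 + J) ≤ n) (St : Finset (Fin n)) (hSt : St.Nonempty)
    (hg : 0 < pL L y ^ m * pL r0 c0) {ε2 : ℝ} (hε : 0 ≤ ε2)
    (h2 : ∀ G ∈ Reg n d, ∀ P ∈ Pa G (m * L + r0) St, ∑ Q ∈ Pa G (m * L + r0) St,
      (muE n).real (ok G L m y c0 t P ∩ ok G L m y c0 t Q) ≤ (pL L y ^ m * pL r0 c0) *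
        ((St.card * NN d (m * L + r0)) * (pL L y ^ m * pL r0 c0) * (1 + ε2))) :
    PPr n d (fun G w => ∀ P ∈ Pa G (m * L + r0) St, w ∉ ok G L m y c0 t P) ≤
      2 * err1 n d (m * L + r0) J t + ε2 := by
  have hft := first_total hd hn (y := y) (c0 := c0) (t := t) hk St
  set k := m * L + r0 with hkdef
  set g := pL L y ^ m * pL r0 c0
  set R : ℝ := ((Reg n d).card : ℝ) with hR
  set N : ℝ := St.card * NN d k with hN
  have hNpos : 0 < N := by
    have h1 : 0 < St.card := Finset.card_pos.2 hSt
    have h3 : (0:ℝ) < (d - 1 : ℝ) ^ k := by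
      have : (3:ℝ) ≤ d := by exact_mod_cast hd
      apply pow_pos; linarith
    have h4 : (0:ℝ) < NN d k := h3.trans_le (NN_ge_pow (by omega) k)
    rw [hN]; positivity
  set c := N * g
  have hc : 0 < c := mul_pos hNpos hg
  have hR0 : 0 ≤ R := by positivity
  have hsm : ∀ G ∈ Reg n d, (muE n).real {w | ∀ P ∈ Pa G k St, w ∉ ok G L m y c0 t P} * c ^ 2 +
      2 * c * ∑ P ∈ Pa G k St, (muE n).real (ok G L m y c0 t P) ≤ c ^ 2 * (1 + ε2) + c ^ 2 := by
    intro G hG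
    refine (second_moment (Pa G k St) (ok G L m y c0 t) (fun P _ => ok_meas _ _ _ _ _ _) c).trans ?_
    gcongr
    calc _ ≤ ∑ P ∈ Pa G k St, g * (N * g * (1 + ε2)) := Finset.sum_le_sum (h2 G hG)
      _ = (Pa G k St).card * (g * (N * g * (1 + ε2))) := by simp
      _ ≤ N * (g * (N * g * (1 + ε2))) := by
          gcongr
          rw [hN]; exact_mod_cast card_Pa_le hG k St
      _ = _ := by simp only [c]; ring
  have hsum := Finset.sum_le_sum hsm
  rw [Finset.sum_add_distrib, ← Finset.sum_mul, ← Finset.mul_sum, Finset.sum_const, nsmul_eq_mul, ← hR] at hsum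
  by_cases hR1 : R = 0
  · have : PPr n d (fun G w => ∀ P ∈ Pa G k St, w ∉ ok G L m y c0 t P) = 0 := by
      unfold PPr; rw [← hR, hR1]; simp
    rw [this]
    have : 0 ≤ err1 n d k J t := by unfold err1; positivity
    positivity
  have hRpos : 0 < R := lt_of_le_of_ne hR0 (Ne.symm hR1)
  unfold PPr
  rw [← hR, div_le_iff₀ hRpos]
  have h5 := mul_le_mul_of_nonneg_left hft (show (0:ℝ) ≤ 2 * c by positivity)
  have h6 : (∑ G ∈ Reg n d, (muE n).real {w | ∀ P ∈ Pa G k St, w ∉ ok G L m y c0 t P}) * c ^ 2 ≤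
      ((2 * err1 n d k J t + ε2) * R) * c ^ 2 := by
    have : 2 * c * (R * N * g * (1 - err1 n d k J t)) = 2 * c ^ 2 * R * (1 - err1 n d k J t) := by
      simp only [c]; ring
    rw [this] at h5
    nlinarith
  exact le_of_mul_le_mul_right h6 (by positivity)

lemma edges_left {P : List (Fin n)} {v : Fin n} : ∀ (A : List (Fin n)), (∀ x ∈ A, x ∉ P) →
    ∀ e ∈ edgesL (A ++ [v]), e ∉ edgesL P := by
  intro mid
  induction mid with
  | nil => simp
  | cons b mid ih =>
    intro hb e he hP
    cases mid with
    | nil =>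
      simp at he
      exact hb b (by simp) (mem_of_mem_edgesL hP (by simp [he]))
    | cons c mid =>
      simp only [List.cons_append, edgesL, List.mem_cons] at he
      rcases he with rfl | he
      · exact hb b (by simp) (mem_of_mem_edgesL hP (by simp))
      · exact ih (fun x hx => hb x (by simp [hx])) e (by simpa using he) hP

lemma edges_right {P : List (Fin n)} {v : Fin n} (A : List (Fin n)) (hA : ∀ x ∈ A, x ∉ P) :
    ∀ e ∈ edgesL (v :: A), e ∉ edgesL P := by
  intro e he
  apply edges_left (v := v) A.reverse (by simpa using hA)
  have : A.reverse ++ [v] = (v :: A).reverse := by simp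
  rw [this, edgesL_reverse]
  simpa using he

lemma edges_split {A σ B : List (Fin n)} (hσ : σ ≠ []) : ∃ x z,
    edgesL (A ++ σ ++ B) = edgesL (A ++ [x]) ++ edgesL σ ++ edgesL (z :: B) := by
  obtain ⟨x, τ, rfl⟩ := List.exists_cons_of_ne_nil hσ
  rcases List.eq_nil_or_concat (x :: τ) with h | ⟨τ', z, h⟩
  · simp at h
  refine ⟨x, z, ?_⟩
  have h1 : A ++ x :: τ ++ B = A ++ x :: (τ ++ B) := by simp
  rw [h1, edgesL_append, List.append_assoc]
  congr 1
  have h2 : x :: (τ ++ B) = τ' ++ z :: B := by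
    have : x :: (τ ++ B) = (x :: τ) ++ B := rfl
    rw [this, h, List.concat_eq_append]; simp
  rw [h2, edgesL_append, h, List.concat_eq_append]

lemma ok_pair_le {L m r0 : ℕ} {y c0 t : ℝ} {P Q : List (Fin n)} (hP : IsP G P) (hQ : IsP G Q)
    (hPl : P.length = m * L + r0 + 1) (hQl : Q.length = m * L + r0 + 1) :
    (muE n).real (ok G L m y c0 t P ∩ ok G L m y c0 t Q) ≤
      pL L y ^ m * pL r0 c0 * pL L y ^ cleanC L m (edgesL Q) (edgesL P) := by
  refine le_trans (measureReal_mono (Set.inter_subset_inter (Set.inter_subset_left)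
    (Set.inter_subset_left))) ?_
  apply mu_good_good y c0 (nodup_edgesL hP.2) (nodup_edgesL hQ.2)
  · rw [length_edgesL, hPl]; rfl
  · rw [length_edgesL, hQl]; omega

/-- structure of pairs with positive probability -/
lemma ok_pair_struct {L m : ℕ} {y c0 : ℝ} {P Q : List (Fin n)} (hP : IsP G P) (hQ : IsP G Q)
    (hne : ((¬ ∃ x ∈ Q, x ∈ P) ∨ ∃ A σ B, Q = A ++ σ ++ B ∧ σ ≠ [] ∧ (σ <:+: P ∨ σ <:+: P.reverse) ∧
      (∀ x ∈ A, x ∉ P) ∧ (∀ x ∈ B, x ∉ P)) → False) :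
    (muE n).real (ok G L m y c0 (c0 + m * y) P ∩ ok G L m y c0 (c0 + m * y) Q) = 0 := by
  apply le_antisymm _ measureReal_nonneg
  have : (muE n).real (∅ : Set (W n)) = 0 := measureReal_empty
  rw [← this]
  apply real_mono_ae
  rintro w hw ⟨hp, hq⟩
  apply hne
  by_cases h : ∃ x ∈ Q, x ∈ P
  · right
    exact hp.2.structure hP.2 hw hQ (good_sum hq.1) h
  · left; exact h

lemma pow_count {p : ℝ} (hp : 0 < p) (hp1 : p ≤ 1) {m c L s e : ℕ} (hL : 0 < L)
    (hc : m * L ≤ c * L + s + e * (L - 1)) : p ^ c ≤ p ^ m * (1 / p) ^ (s / L + e) := by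
  have h1 : m ≤ c + (s / L + e) := by
    have h2 : s < L * (s / L) + L := by
      have := Nat.div_add_mod s L
      have := Nat.mod_lt s hL
      omega
    rcases Nat.eq_zero_or_pos e with rfl | he
    · simp only [zero_mul, add_zero] at hc ⊢
      by_contra hlt
      push Not at hlt
      have h3 : (c + s / L + 1) * L ≤ m * L := Nat.mul_le_mul_right _ hlt
      have : (c + s / L + 1) * L = c * L + L * (s / L) + L := by ring
      omega
    · by_contra hlt
      push Not at hlt
      have h3 : (c + (s / L + e) + 1) * L ≤ m * L := Nat.mul_le_mul_right _ hlt
      have h4 : (c + (s / L + e) + 1) * L = c * L + L * (s / L) + e * L + L := by ring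
      have h5 : e * (L - 1) ≤ e * L := Nat.mul_le_mul_left _ (by omega)
      omega
  rw [one_div, inv_pow, ← div_eq_mul_inv, le_div_iff₀ (by positivity), ← pow_add]
  exact pow_le_pow_of_le_one hp.le hp1 h1

end second

end FPP

namespace FPP

section pair
variable {n d : ℕ} {G : SimpleGraph (Fin n)}

lemma suffix_of_infix_last {V : Type*} {P σ : List V} {v : V} (hP : P.Nodup) (h1 : σ <:+: P) (h2 : [v] <:+ P)
    (h3 : [v] <:+ σ) : σ <:+ P := by
  obtain ⟨s, u, hu⟩ := h1
  rcases List.eq_nil_or_concat u with rfl | ⟨u', z, rfl⟩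
  · exact ⟨s, by simpa using hu⟩
  · exfalso
    obtain ⟨τ, rfl⟩ := h3
    obtain ⟨τ', rfl⟩ := h2
    rw [List.concat_eq_append, ← List.append_assoc] at hu
    have h4 := List.append_inj_right' hu rfl
    have h5 := List.append_inj_left' hu rfl
    simp only [List.cons.injEq, and_true] at h4
    subst h4
    rw [← h5] at hP
    have := List.nodup_append.1 hP
    exact this.2.2 z (by simp) z (by simp) rfl

lemma suffix_of_infix_rev {V : Type*} {P σ : List V} {v : V} (hP : P.Nodup) (h1 : σ <:+: P.reverse) (h2 : [v] <:+ P)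
    (h3 : [v] <:+ σ) : σ <:+ P := by
  obtain ⟨s, u, hu⟩ := h1
  obtain ⟨τ, rfl⟩ := h3
  obtain ⟨τ', rfl⟩ := h2
  have hP' := List.nodup_reverse.2 hP
  rw [← hu] at hP'
  rw [List.reverse_append] at hu
  cases hs : s ++ τ with
  | nil =>
    have : τ = [] := (List.append_eq_nil_iff.1 hs).2
    subst this
    exact ⟨τ', rfl⟩
  | cons z r =>
    exfalso
    rw [← List.append_assoc, hs] at hu hP'
    simp only [List.cons_append, List.reverse_cons, List.reverse_nil, List.nil_append,
      List.cons.injEq] at hu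
    obtain ⟨rfl, -⟩ := hu
    simp at hP'

lemma pair_i (hd : 3 ≤ d) (hG : G ∈ Reg n d) {L m r0 : ℕ} (hL : 0 < L) {y c0 : ℝ} {v : Fin n}
    (hp : 0 < pL L y) (hρ : 1 ≤ (d - 1 : ℝ) ^ L * pL L y)
    {P : List (Fin n)} (hP : P ∈ Pa G (m * L + r0) {v}) :
    ∑ Q ∈ Pa G (m * L + r0) {v}, (muE n).real (ok G L m y c0 (c0 + m * y) P ∩ ok G L m y c0 (c0 + m * y) Q) ≤
      (pL L y ^ m * pL r0 c0) * (pL L y ^ m * (NN d (m * L + r0) +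
        (m * L + r0) * ((d - 1 : ℝ) ^ (m * L) / pL L y))) := by
  set k := m * L + r0 with hk
  set p := pL L y with hpd
  set g := p ^ m * pL r0 c0 with hgd
  have hp1 : p ≤ 1 := pL_le_one _ _
  have hg0 : 0 ≤ g := mul_nonneg (pow_nonneg hp.le _) (pL_nonneg _ _)
  have hd3 : (3:ℝ) ≤ d := by exact_mod_cast hd
  have hD : (0:ℝ) < d - 1 := by linarith
  have hPm := hP
  rw [mem_Pa] at hPm
  obtain ⟨hPl, hPp, v', hv', hvP⟩ := hPm
  rw [Finset.mem_singleton] at hv'; subst v'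
  -- per-Q bound
  have key : ∀ Q ∈ Pa G k {v}, (muE n).real (ok G L m y c0 (c0 + m * y) P ∩ ok G L m y c0 (c0 + m * y) Q) ≤
      g * p ^ m + ∑ r ∈ Finset.Ioc r0 k, if Q ∈ exts G (k - r) (P.drop (k - r)) then
        g * (p ^ m * (1 / p) ^ ((r - r0) / L + 1)) else 0 := by
    intro Q hQ
    rw [mem_Pa] at hQ
    obtain ⟨hQl, hQp, v', hv', hvQ⟩ := hQ
    rw [Finset.mem_singleton] at hv'; subst v'
    have hsum0 : 0 ≤ ∑ r ∈ Finset.Ioc r0 k, if Q ∈ exts G (k - r) (P.drop (k - r)) then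
        g * (p ^ m * (1 / p) ^ ((r - r0) / L + 1)) else 0 := by
      apply Finset.sum_nonneg; intro r _; split_ifs <;> positivity
    by_cases hst : ((¬ ∃ x ∈ Q, x ∈ P) ∨ ∃ A σ B, Q = A ++ σ ++ B ∧ σ ≠ [] ∧ (σ <:+: P ∨ σ <:+: P.reverse) ∧
      (∀ x ∈ A, x ∉ P) ∧ (∀ x ∈ B, x ∉ P))
    swap
    · rw [ok_pair_struct hPp hQp hst]; positivity
    rcases hst with hst | ⟨A, σ, B, hQe, hσ, hσP, hA, hB⟩
    · exact absurd ⟨v, hvQ.subset (by simp), hvP.subset (by simp)⟩ hst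
    have hBn : B = [] := by
      rcases List.eq_nil_or_concat B with rfl | ⟨B', z, rfl⟩
      · rfl
      · exfalso
        obtain ⟨τ, hτ⟩ := hvQ
        rw [hQe, List.concat_eq_append, ← List.append_assoc] at hτ
        have h4 := List.append_inj_right' hτ rfl
        simp only [List.cons.injEq, and_true] at h4
        exact hB v (by simp [h4]) (hvP.subset (by simp))
    subst hBn
    rw [List.append_nil] at hQe
    have hvσ : [v] <:+ σ := by
      obtain ⟨σ', z, rfl⟩ : ∃ σ' z, σ = σ' ++ [z] := by
        rcases List.eq_nil_or_concat σ with h | ⟨a, b, h⟩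
        · exact absurd h hσ
        · exact ⟨a, b, by simpa using h⟩
      obtain ⟨τ, hτ⟩ := hvQ
      rw [hQe, ← List.append_assoc] at hτ
      have h4 := List.append_inj_right' hτ rfl
      rw [h4]; exact ⟨σ', rfl⟩
    have hσs : σ <:+ P := by
      rcases hσP with h | h
      · exact suffix_of_infix_last hPp.2 h hvP hvσ
      · exact suffix_of_infix_rev hPp.2 h hvP hvσ
    have hσl : 0 < σ.length := List.length_pos_of_ne_nil hσ
    have hσle := hσs.length_le
    obtain ⟨r, hr⟩ : ∃ r, σ.length = r + 1 := ⟨σ.length - 1, by omega⟩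
    have hrk : r ≤ k := by omega
    have hσd : σ = P.drop (k - r) := by
      obtain ⟨s, rfl⟩ := hσs
      rw [List.length_append] at hPl
      have : k - r = s.length := by omega
      rw [this, List.drop_left]
    have hAl : A.length = k - r := by
      rw [hQe, List.length_append] at hQl; omega
    obtain ⟨x, z, hE⟩ := edges_split (A := A) (B := []) hσ
    rw [List.append_nil] at hE
    have hE' : edgesL Q = edgesL (A ++ [x]) ++ edgesL σ := by
      rw [hQe, hE]; simp
    have hcl := cleanC_prefix (L := L) (m := m) (E1 := edgesL (A ++ [x])) (E2 := edgesL σ) (S := edgesL P)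
      (edges_left A hA) hL
    rw [← hE', length_edgesL] at hcl
    have hlen : (A ++ [x]).length - 1 = k - r := by simp [hAl]
    rw [hlen] at hcl
    have hpair := ok_pair_le (y := y) (c0 := c0) (t := c0 + m * y) hPp hQp hPl hQl
    refine hpair.trans ?_
    by_cases hr0 : r ≤ r0
    · rw [hcl.2 (by omega)]
      linarith
    · push Not at hr0
      have hmem : Q ∈ exts G (k - r) (P.drop (k - r)) := by
        rw [mem_exts, ← hσd]
        exact ⟨by omega, hQp, ⟨A, hQe.symm⟩⟩
      have h1 : g * p ^ cleanC L m (edgesL Q) (edgesL P) ≤ g * (p ^ m * (1 / p) ^ ((r - r0) / L + 1)) := by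
        apply mul_le_mul_of_nonneg_left _ hg0
        apply pow_count hp hp1 hL
        have := hcl.1
        have e : m * L - (k - r) = r - r0 := by omega
        rw [e] at this
        omega
      refine h1.trans ?_
      have h2 : g * (p ^ m * (1 / p) ^ ((r - r0) / L + 1)) ≤ ∑ r ∈ Finset.Ioc r0 k, if Q ∈ exts G (k - r) (P.drop (k - r)) then
        g * (p ^ m * (1 / p) ^ ((r - r0) / L + 1)) else 0 := by
        have := Finset.single_le_sum (s := Finset.Ioc r0 k) (f := fun r => if Q ∈ exts G (k - r) (P.drop (k - r)) then
          g * (p ^ m * (1 / p) ^ ((r - r0) / L + 1)) else 0)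
          (fun r _ => by split_ifs <;> positivity) (Finset.mem_Ioc.2 ⟨hr0, hrk⟩)
        simpa only [hmem, if_true] using this
      have : 0 ≤ g * p ^ m := by positivity
      linarith
  refine (Finset.sum_le_sum key).trans ?_
  rw [Finset.sum_add_distrib, Finset.sum_const, nsmul_eq_mul, Finset.sum_comm]
  have hcard : ((Pa G k {v}).card : ℝ) ≤ NN d k := by
    have := card_Pa_le hG k {v}
    simp only [Finset.card_singleton, one_mul] at this
    exact_mod_cast this
  have hcls : ∀ r ∈ Finset.Ioc r0 k, (∑ Q ∈ Pa G k {v}, if Q ∈ exts G (k - r) (P.drop (k - r)) then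
        g * (p ^ m * (1 / p) ^ ((r - r0) / L + 1)) else 0) ≤ g * (p ^ m * ((d - 1 : ℝ) ^ (m * L) / p)) := by
    intro r hr
    rw [Finset.mem_Ioc] at hr
    rw [← Finset.sum_filter, Finset.sum_const, nsmul_eq_mul]
    have h1 : (((Pa G k {v}).filter (fun Q => Q ∈ exts G (k - r) (P.drop (k - r)))).card : ℝ) ≤ (d - 1 : ℝ) ^ (k - r) := by
      have h2 := card_exts_le' hG (k - r) (l₀ := P.drop (k - r)) (by rw [List.length_drop]; omega)
      have h3 : ((Pa G k {v}).filter (fun Q => Q ∈ exts G (k - r) (P.drop (k - r)))).card ≤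
          (exts G (k - r) (P.drop (k - r))).card := Finset.card_le_card fun Q hQ => (Finset.mem_filter.1 hQ).2
      have h4 : (((d - 1 : ℕ) : ℝ)) = d - 1 := by rw [Nat.cast_sub (by omega)]; simp
      rw [← h4]
      exact_mod_cast h3.trans h2
    set s := r - r0 with hs
    have h5 : (d - 1 : ℝ) ^ (k - r) * (1 / p) ^ (s / L) ≤ (d - 1 : ℝ) ^ (m * L) := by
      have e : m * L = (k - r) + s := by omega
      rw [e, pow_add]
      apply mul_le_mul_of_nonneg_left _ (by positivity)
      rw [one_div, inv_pow, inv_le_iff_one_le_mul₀ (by positivity)]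
      calc (1:ℝ) ≤ ((d - 1 : ℝ) ^ L * p) ^ (s / L) := one_le_pow₀ hρ
        _ = (d - 1 : ℝ) ^ (L * (s / L)) * p ^ (s / L) := by rw [mul_pow, pow_mul]
        _ ≤ (d - 1 : ℝ) ^ s * p ^ (s / L) := by
            gcongr
            · linarith
            · exact Nat.mul_div_le _ _
        _ = _ := by ring
    calc _ ≤ (d - 1 : ℝ) ^ (k - r) * (g * (p ^ m * (1 / p) ^ (s / L + 1))) := by gcongr
      _ = g * (p ^ m * (((d - 1 : ℝ) ^ (k - r) * (1 / p) ^ (s / L)) / p)) := by rw [pow_succ]; ring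
      _ ≤ _ := by gcongr
  have hs2 := Finset.sum_le_sum hcls
  rw [Finset.sum_const, nsmul_eq_mul, Nat.card_Ioc] at hs2
  have hkr : ((k - r0 : ℕ) : ℝ) ≤ m * L + r0 := by
    have : k - r0 ≤ m * L + r0 := by omega
    exact_mod_cast this
  have hX : 0 ≤ g * (p ^ m * ((d - 1 : ℝ) ^ (m * L) / p)) := by positivity
  calc _ ≤ (NN d k : ℝ) * (g * p ^ m) + (m * L + r0) * (g * (p ^ m * ((d - 1 : ℝ) ^ (m * L) / p))) := by
        apply add_le_add
        · gcongr
        · exact hs2.trans (by gcongr)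
    _ = _ := by ring

/-- all lists `A ++ σ ++ B` -/
lemma card_mid (hd : 3 ≤ d) (hG : G ∈ Reg n d) (T : Finset (List (Fin n))) (σ : List (Fin n)) (a k : ℕ)
    (hσ : 2 ≤ σ.length) (ha : a + σ.length ≤ k + 1)
    (hT : ∀ Q ∈ T, Q.length = k + 1 ∧ IsP G Q ∧ ∃ A B, Q = A ++ σ ++ B ∧ A.length = a) :
    (T.card : ℝ) ≤ (d - 1 : ℝ) ^ (k + 1 - σ.length) := by
  set b := k + 1 - σ.length - a with hb
  have h1 : T.card ≤ (exts G a σ ×ˢ exts G b σ.reverse).card := by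
    apply Finset.card_le_card_of_injOn (fun Q => (Q.take (a + σ.length), (Q.drop a).reverse))
    · intro Q hQ
      obtain ⟨hl, hp, A, B, rfl, hA⟩ := hT Q hQ
      have e1 : (A ++ σ ++ B).take (a + σ.length) = A ++ σ := by
        rw [← hA, ← List.length_append, List.take_left]
      have e2 : (A ++ σ ++ B).drop a = σ ++ B := by
        rw [← hA, List.append_assoc, List.drop_left]
      simp only [List.length_append] at hl
      simp only [Finset.coe_product, Set.mem_prod, Finset.mem_coe, mem_exts, e1, e2]
      refine ⟨⟨by simp [hA, add_comm], hp.infix ⟨[], B, by simp⟩, ⟨A, rfl⟩⟩,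
        ⟨?_, (hp.infix ⟨A, [], by simp⟩).reverse, ?_⟩⟩
      · simp; omega
      · rw [List.reverse_append]; exact ⟨_, rfl⟩
    · intro Q hQ Q' hQ' he
      obtain ⟨hl, hp, A, B, rfl, hA⟩ := hT Q hQ
      obtain ⟨hl', hp', A', B', rfl, hA'⟩ := hT Q' hQ'
      simp only [Prod.mk.injEq, List.reverse_inj] at he
      have e1 : (A ++ σ ++ B).take (a + σ.length) = A ++ σ := by
        rw [← hA, ← List.length_append, List.take_left]
      have e2 : (A ++ σ ++ B).drop a = σ ++ B := by
        rw [← hA, List.append_assoc, List.drop_left]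
      have e1' : (A' ++ σ ++ B').take (a + σ.length) = A' ++ σ := by
        rw [← hA', ← List.length_append, List.take_left]
      have e2' : (A' ++ σ ++ B').drop a = σ ++ B' := by
        rw [← hA', List.append_assoc, List.drop_left]
      rw [e1, e1', e2, e2'] at he
      rw [List.append_left_inj, List.append_right_inj] at he
      rw [he.1, he.2]
  rw [Finset.card_product] at h1
  have h2 := card_exts_le' hG a hσ
  have h3 := card_exts_le' hG b (l₀ := σ.reverse) (by simpa using hσ)
  have h4 : T.card ≤ (d - 1) ^ (k + 1 - σ.length) := by
    refine h1.trans ((Nat.mul_le_mul h2 h3).trans ?_)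
    rw [← pow_add]
    have : a + b = k + 1 - σ.length := by omega
    rw [this]
  have h5 : (((d - 1 : ℕ) : ℝ)) = d - 1 := by rw [Nat.cast_sub (by omega)]; simp
  rw [← h5]
  exact_mod_cast h4

lemma pair_ii (hd : 3 ≤ d) (hG : G ∈ Reg n d) {L m : ℕ} (hL : 0 < L) {y M : ℝ}
    (hp : 0 < pL L y) (hM : ∀ s ≤ m, 1 ≤ M * ((d - 1 : ℝ) ^ L * pL L y) ^ s)
    {P : List (Fin n)} (hP : P ∈ Pa G (m * L + 0) Finset.univ) :
    ∑ Q ∈ Pa G (m * L + 0) Finset.univ, (muE n).real (ok G L m y 0 (0 + m * y) P ∩ ok G L m y 0 (0 + m * y) Q) ≤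
      (pL L y ^ m * pL 0 0) * (pL L y ^ m * (n * NN d (m * L + 0) +
        2 * (m * L + 1) ^ 3 * ((d - 1 : ℝ) ^ (m * L) * M / pL L y ^ 2))) := by
  set k := m * L + 0 with hk
  set p := pL L y with hpd
  set g := p ^ m * pL 0 0 with hgd
  have hp1 : p ≤ 1 := pL_le_one _ _
  have hg0 : 0 ≤ g := mul_nonneg (pow_nonneg hp.le _) (pL_nonneg _ _)
  have hd3 : (3:ℝ) ≤ d := by exact_mod_cast hd
  have hD : (0:ℝ) < d - 1 := by linarith
  have hM1 : 1 ≤ M := by simpa using hM 0 (by omega)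
  have hPm := hP
  rw [mem_Pa] at hPm
  obtain ⟨hPl, hPp, -⟩ := hPm
  set sg : Bool → ℕ → ℕ → List (Fin n) := fun β i r => ((if β then P else P.reverse).drop i).take (r + 1) with hsg
  set Cl : Bool × ℕ × ℕ × ℕ → List (Fin n) → Prop := fun z Q =>
    ∃ A B, Q = A ++ sg z.1 z.2.1 z.2.2.1 ++ B ∧ A.length = z.2.2.2 ∧ (sg z.1 z.2.1 z.2.2.1).length = z.2.2.1 + 1 ∧
     1 ≤ z.2.2.1 with hCl
  set I : Finset (Bool × ℕ × ℕ × ℕ) := Finset.univ ×ˢ Finset.range (k+1) ×ˢ Finset.range (k+1) ×ˢ Finset.range (k+1) with hI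
  set F : Bool × ℕ × ℕ × ℕ → ℝ := fun z => g * (p ^ m * (1 / p) ^ (z.2.2.1 / L + 2)) with hF
  have hF0 : ∀ z, 0 ≤ F z := fun z => by simp only [hF]; positivity
  have key : ∀ Q ∈ Pa G k Finset.univ, (muE n).real (ok G L m y 0 (0 + m * y) P ∩ ok G L m y 0 (0 + m * y) Q) ≤
      g * p ^ m + ∑ z ∈ I, if Cl z Q then F z else 0 := by
    intro Q hQ
    rw [mem_Pa] at hQ
    obtain ⟨hQl, hQp, -⟩ := hQ
    have hsum0 : 0 ≤ ∑ z ∈ I, if Cl z Q then F z else 0 := by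
      apply Finset.sum_nonneg; intro z _; split_ifs
      · exact hF0 z
      · exact le_rfl
    have hpair := ok_pair_le (r0 := 0) (y := y) (c0 := 0) (t := 0 + m * y) hPp hQp hPl hQl
    by_cases hst : ((¬ ∃ x ∈ Q, x ∈ P) ∨ ∃ A σ B, Q = A ++ σ ++ B ∧ σ ≠ [] ∧ (σ <:+: P ∨ σ <:+: P.reverse) ∧
      (∀ x ∈ A, x ∉ P) ∧ (∀ x ∈ B, x ∉ P))
    swap
    · rw [ok_pair_struct hPp hQp hst]; positivity
    rcases hst with hst | ⟨A, σ, B, hQe, hσ, hσP, hA, hB⟩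
    · rw [cleanC_all (S := edgesL P)] at hpair
      · linarith
      · intro e he he'
        apply hst
        obtain ⟨x, y, rfl⟩ : ∃ x y, e = s(x, y) := by
          induction e using Sym2.ind with | _ x y => exact ⟨x, y, rfl⟩
        exact ⟨x, mem_of_mem_edgesL he (by simp), mem_of_mem_edgesL he' (by simp)⟩
    obtain ⟨x, z, hE⟩ := edges_split (A := A) (B := B) hσ
    rw [← hQe] at hE
    have hσl : 0 < σ.length := List.length_pos_of_ne_nil hσ
    obtain ⟨r, hr⟩ : ∃ r, σ.length = r + 1 := ⟨σ.length - 1, by omega⟩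
    have hlen := hQl
    rw [hQe] at hlen
    simp only [List.length_append] at hlen
    rcases Nat.eq_zero_or_pos r with rfl | hrpos
    · rw [cleanC_all (S := edgesL P)] at hpair
      · linarith
      · intro e he
        rw [hE] at he
        have : edgesL σ = [] := by
          apply List.eq_nil_of_length_eq_zero; rw [length_edgesL, hr]
        rw [this, List.append_nil, List.mem_append] at he
        rcases he with he | he
        · exact edges_left A hA e he
        · exact edges_right B hB e he
    have hmid := cleanC_mid (L := L) (m := m) (E2 := edgesL σ) (edges_left (v := x) A hA) (edges_right (v := z) B hB) hL
    rw [← hE, length_edgesL, hr] at hmid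
    have h1 : g * p ^ cleanC L m (edgesL Q) (edgesL P) ≤ g * (p ^ m * (1 / p) ^ (r / L + 2)) := by
      apply mul_le_mul_of_nonneg_left _ hg0
      apply pow_count hp hp1 hL
      simpa using hmid
    refine hpair.trans (h1.trans ?_)
    -- find class
    obtain ⟨β, i, hi, hσe⟩ : ∃ β : Bool, ∃ i, i < k + 1 ∧ σ = sg β i r := by
      have aux : ∀ R : List (Fin n), R.length = k + 1 → σ <:+: R → ∃ i, i < k + 1 ∧ σ = (R.drop i).take (r + 1) := by
        rintro R hR ⟨s, u, rfl⟩
        refine ⟨s.length, ?_, ?_⟩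
        · simp only [List.length_append] at hR; omega
        · rw [List.append_assoc, List.drop_left, ← hr, List.take_left]
      rcases hσP with h | h
      · obtain ⟨i, hi, he⟩ := aux P (by omega) h
        exact ⟨true, i, hi, by simpa [hsg] using he⟩
      · obtain ⟨i, hi, he⟩ := aux P.reverse (by simpa using hPl) h
        exact ⟨false, i, hi, by simpa [hsg] using he⟩
    have hmem : (β, i, r, A.length) ∈ I := by
      simp only [hI, Finset.mem_product, Finset.mem_univ, Finset.mem_range, true_and]
      omega
    have hcl : Cl (β, i, r, A.length) Q := ⟨A, B, by rw [← hσe]; exact hQe, rfl, by rw [← hσe]; exact hr, hrpos⟩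
    have h2 := Finset.single_le_sum (s := I) (f := fun z => if Cl z Q then F z else 0)
      (fun z _ => by
        split_ifs
        · exact hF0 z
        · exact le_rfl) hmem
    simp only [hcl, if_true] at h2
    have h3 : F (β, i, r, A.length) = g * (p ^ m * (1 / p) ^ (r / L + 2)) := rfl
    have : 0 ≤ g * p ^ m := by positivity
    linarith
  refine (Finset.sum_le_sum key).trans ?_
  rw [Finset.sum_add_distrib, Finset.sum_const, nsmul_eq_mul, Finset.sum_comm]
  have hcard : ((Pa G k Finset.univ).card : ℝ) ≤ n * NN d k := by
    have := card_Pa_le hG k Finset.univ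
    simp only [Finset.card_univ, Fintype.card_fin] at this
    exact_mod_cast this
  have hcls : ∀ z ∈ I, (∑ Q ∈ Pa G k Finset.univ, if Cl z Q then F z else 0) ≤
      g * (p ^ m * ((d - 1 : ℝ) ^ (m * L) * M / p ^ 2)) := by
    rintro ⟨β, i, r, a⟩ hz
    rw [← Finset.sum_filter, Finset.sum_const, nsmul_eq_mul]
    have hrhs : 0 ≤ g * (p ^ m * ((d - 1 : ℝ) ^ (m * L) * M / p ^ 2)) := by positivity
    rcases Finset.eq_empty_or_nonempty ((Pa G k Finset.univ).filter (fun Q => Cl (β, i, r, a) Q)) with h0 | ⟨Q, hQ⟩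
    · rw [h0]; simpa using hrhs
    rw [Finset.mem_filter, mem_Pa] at hQ
    obtain ⟨⟨hQl, hQp, -⟩, A, B, hQe, hAl, hσl, hr⟩ := hQ
    dsimp only at hQe hAl hσl hr
    have hlen := hQl
    rw [hQe] at hlen
    simp only [List.length_append] at hlen
    have h1 := card_mid hd hG ((Pa G k Finset.univ).filter (fun Q => Cl (β, i, r, a) Q)) (sg β i r) a k (by omega)
      (by omega) (by
        intro Q hQ
        rw [Finset.mem_filter, mem_Pa] at hQ
        obtain ⟨⟨hQl, hQp, -⟩, A, B, hQe, hAl, hσl, hr⟩ := hQ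
        exact ⟨hQl, hQp, A, B, hQe, hAl⟩)
    rw [hσl] at h1
    have hrk : r ≤ m * L := by omega
    have e1 : k + 1 - (r + 1) = m * L - r := by omega
    rw [e1] at h1
    have h5 : (d - 1 : ℝ) ^ (m * L - r) * (1 / p) ^ (r / L) ≤ (d - 1 : ℝ) ^ (m * L) * M := by
      have e : (d - 1 : ℝ) ^ (m * L) = (d - 1 : ℝ) ^ (m * L - r) * (d - 1 : ℝ) ^ r := by
        rw [← pow_add]; congr 1; omega
      rw [e, mul_assoc]
      apply mul_le_mul_of_nonneg_left _ (by positivity)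
      rw [one_div, inv_pow, inv_le_iff_one_le_mul₀ (by positivity)]
      have hsm : r / L ≤ m := Nat.div_le_of_le_mul (by linarith [mul_comm m L])
      calc (1:ℝ) ≤ M * ((d - 1 : ℝ) ^ L * p) ^ (r / L) := hM _ hsm
        _ = M * ((d - 1 : ℝ) ^ (L * (r / L)) * p ^ (r / L)) := by rw [mul_pow, pow_mul]
        _ ≤ M * ((d - 1 : ℝ) ^ r * p ^ (r / L)) := by
            gcongr
            · linarith
            · exact Nat.mul_div_le _ _
        _ = _ := by ring
    calc _ ≤ (d - 1 : ℝ) ^ (m * L - r) * (g * (p ^ m * (1 / p) ^ (r / L + 2))) := by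
          apply mul_le_mul_of_nonneg_right h1 (hF0 (β, i, r, a))
      _ = g * (p ^ m * (((d - 1 : ℝ) ^ (m * L - r) * (1 / p) ^ (r / L)) / p ^ 2)) := by
          rw [pow_add, one_div, inv_pow, inv_pow]; ring
      _ ≤ _ := by gcongr
  have hs2 := Finset.sum_le_sum hcls
  rw [Finset.sum_const, nsmul_eq_mul] at hs2
  have hIc : (I.card : ℝ) = 2 * (m * L + 1) ^ 3 := by
    simp only [hI, Finset.card_product, Finset.card_range, Finset.card_univ, Fintype.card_bool, hk]
    push_cast; ring
  rw [hIc] at hs2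
  calc _ ≤ (n * NN d k : ℝ) * (g * p ^ m) + 2 * (m * L + 1) ^ 3 * (g * (p ^ m * ((d - 1 : ℝ) ^ (m * L) * M / p ^ 2))) := by
        apply add_le_add
        · gcongr
        · exact hs2
    _ = _ := by ring

end pair

end FPP

namespace FPP

section lower
variable {n d : ℕ} {G : SimpleGraph (Fin n)}

lemma ok_hop {L m k : ℕ} {y c0 : ℝ} {St : Finset (Fin n)} {P : List (Fin n)} (hk : 0 < k) {w : W n}
    (hw : ∀ e, 0 ≤ w e) (hP : P ∈ Pa G k St) (hok : w ∈ ok G L m y c0 (c0 + m * y) P) :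
    ∃ v ∈ St, ∃ j, hopCount G w v j = k := by
  rw [mem_Pa] at hP
  obtain ⟨hPl, hPp, v, hv, τ, hτ⟩ := hP
  have hwt : wt w P ≤ c0 + m * y := good_sum hok.1
  obtain ⟨b, P', hP'⟩ : ∃ b P', P = b :: P' := by
    cases P with
    | nil => simp at hPl
    | cons b P' => exact ⟨b, P', rfl⟩
  have hc : Conn P b v := by
    refine ⟨by rw [hP']; rfl, by rw [← hτ]; simp⟩
  have hbv : b ≠ v := by
    rintro rfl
    rw [← hτ] at hP' hPp hPl
    cases τ with
    | nil => simp at hPl; omega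
    | cons c τ =>
      simp only [List.cons_append, List.cons.injEq] at hP'
      have := hPp.2
      rw [hP'.1] at this
      simp at this
  refine ⟨v, hv, b, ?_⟩
  have hrc : ∀ {l : List (Fin n)} {a c}, Conn l a c → Conn l.reverse c a := by
    rintro l a c ⟨h1, h2⟩
    exact ⟨by simpa using h2, by simpa using h1⟩
  have := hopCount_eq_of_unique (w := w) hPp.reverse (hrc hc) (by
    intro l' hl' hc' hwt'
    rw [wt_reverse] at hwt'
    have h1 := hok.2.unique hPp hw hl'.reverse (by rw [wt_reverse]; exact hwt'.trans hwt) hbv hc (hrc hc')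
    rw [← h1, List.reverse_reverse])
  rw [this, List.length_reverse, hPl]; rfl

lemma factorial_le (L : ℕ) (hL : 1 ≤ L) :
    (L.factorial : ℝ) ≤ Real.exp 1 * L * (L / Real.exp 1) ^ L := by
  induction L, hL using Nat.le_induction with
  | base =>
    simp only [Nat.factorial_one, Nat.cast_one, mul_one, pow_one]
    rw [mul_one_div_cancel (Real.exp_pos 1).ne']
  | succ L hL ih =>
    have hL0 : (0:ℝ) < L := by exact_mod_cast hL
    have he := Real.exp_pos 1
    rw [Nat.factorial_succ]; push_cast
    have h1 : Real.exp 1 ≤ ((L + 1 : ℝ) / L) ^ (L + 1) := by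
      have h2 : 1 / (L + 1 : ℝ) ≤ Real.log ((L + 1 : ℝ) / L) := by
        have := Real.log_le_sub_one_of_pos (show (0:ℝ) < L / (L + 1) by positivity)
        have h3 : Real.log ((L + 1 : ℝ) / L) = - Real.log (L / (L + 1)) := by
          rw [← Real.log_inv, inv_div]
        rw [h3]
        have : (L:ℝ) / (L + 1) - 1 = - (1 / (L + 1)) := by field_simp; ring
        linarith
      rw [← Real.exp_log (show (0:ℝ) < ((L + 1 : ℝ) / L) ^ (L + 1) by positivity), Real.exp_le_exp, Real.log_pow]
      push_cast
      calc (1:ℝ) = (L + 1) * (1 / (L + 1)) := by field_simp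
        _ ≤ _ := by gcongr
    calc ((L:ℝ) + 1) * L.factorial ≤ (L + 1) * (Real.exp 1 * L * (L / Real.exp 1) ^ L) := by gcongr
      _ = (L + 1) * L * (L / Real.exp 1) ^ L * Real.exp 1 := by ring
      _ ≤ (L + 1) * L * (L / Real.exp 1) ^ L * ((L + 1 : ℝ) / L) ^ (L + 1) := by gcongr
      _ = Real.exp 1 * (L + 1) * ((L + 1) / Real.exp 1) ^ (L + 1) := by
          rw [div_pow, div_pow, div_pow, pow_succ (Real.exp 1), pow_succ (L:ℝ)]
          field_simp

/-- the rate function -/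
def ff (d : ℕ) (α : ℝ) : ℝ := α * Real.log (((d : ℝ) - 2) * α / ((d : ℝ) - 1)) - α + 1 / ((d : ℝ) - 2)

lemma exists_params (hd : 3 ≤ d) {α β : ℝ} (hα : 0 < α) (hβ : ff d α < α * β) :
    ∃ x : ℝ, 0 < x ∧ x * ((d - 2) * α) < 1 ∧ ∃ L : ℕ, 0 < L ∧
      Real.exp (- (β * L)) ≤ (d - 1 : ℝ) ^ L * pL L (x * L) := by
  have hd3 : (3:ℝ) ≤ d := by exact_mod_cast hd
  have hD : (0:ℝ) < d - 2 := by linarith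
  have hD1 : (0:ℝ) < d - 1 := by linarith
  set x0 : ℝ := 1 / ((d - 2) * α) with hx0
  have hx0p : 0 < x0 := by positivity
  have hcont : ContinuousAt (fun x : ℝ => Real.log ((d - 1) * x) + 1 - x) x0 := by
    apply ContinuousAt.sub _ continuousAt_id
    apply ContinuousAt.add _ continuousAt_const
    apply ContinuousAt.log (by fun_prop)
    positivity
  have h0 : - β < Real.log ((d - 1) * x0) + 1 - x0 := by
    have h1 : Real.log ((d - 1) * x0) = - Real.log (((d : ℝ) - 2) * α / ((d : ℝ) - 1)) := by
      rw [← Real.log_inv, inv_div, hx0]; congr 1; ring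
    rw [h1]
    unfold ff at hβ
    have h2 : α * x0 = 1 / (d - 2) := by rw [hx0]; field_simp
    by_contra hc
    push Not at hc
    have := mul_le_mul_of_nonneg_left hc hα.le
    nlinarith
  have hev := hcont.eventually (lt_mem_nhds h0)
  rw [Metric.eventually_nhds_iff] at hev
  obtain ⟨e, he, hev⟩ := hev
  set x := max (x0 - e / 2) (x0 / 2) with hx
  have hxlt : x < x0 := max_lt (by linarith) (by linarith)
  have hxp : 0 < x := lt_of_lt_of_le (by linarith) (le_max_right _ _)
  have hxh := hev (y := x) (by
    rw [Real.dist_eq, abs_lt]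
    have := le_max_left (x0 - e / 2) (x0 / 2)
    constructor <;> linarith)
  set h := Real.log ((d - 1) * x) + 1 - x with hh
  refine ⟨x, hxp, ?_, ?_⟩
  · have := mul_lt_mul_of_pos_right hxlt (show 0 < (d - 2 : ℝ) * α by positivity)
    rwa [hx0, one_div_mul_cancel (by positivity)] at this
  -- choose L
  have hlim : Tendsto (fun L : ℕ => Real.exp (-(h + β) * L) * L) atTop (nhds 0) := by
    have h1 := (tendsto_rpow_mul_exp_neg_mul_atTop_nhds_zero 1 (h + β) (by linarith)).comp (tendsto_natCast_atTop_atTop (R := ℝ))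
    refine h1.congr fun L => ?_
    simp [mul_comm]
  have hev2 := hlim.eventually (gt_mem_nhds (show (0:ℝ) < 1 / Real.exp 1 by positivity))
  obtain ⟨L, hL1, hL⟩ := ((hev2.and (eventually_ge_atTop 1)).exists)
  refine ⟨L, hL, ?_⟩
  have hL0 : (0:ℝ) < L := by exact_mod_cast hL
  have hlow := pL_lower L (y := x * L) (by positivity)
  have hfac := factorial_le L hL
  have hfp : (0:ℝ) < L.factorial := by exact_mod_cast L.factorial_pos
  have e1 : (d - 1 : ℝ) ^ L * ((x * L) ^ L * Real.exp (-(x * L))) = Real.exp (h * L) * (L / Real.exp 1) ^ L := by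
    have : (d - 1 : ℝ) ^ L * (x * L) ^ L = Real.exp (Real.log ((d - 1) * x) * L) * L ^ L := by
      rw [mul_comm (Real.log _) (L:ℝ), Real.exp_nat_mul, Real.exp_log (by positivity)]
      rw [mul_pow, mul_pow]; ring
    rw [← mul_assoc, this, hh, div_pow, ← Real.exp_nat_mul, mul_one]
    rw [mul_right_comm, ← Real.exp_add, mul_div_assoc', mul_div_right_comm, ← Real.exp_sub]
    congr 2
    ring
  have hpow : 0 < ((L:ℝ) / Real.exp 1) ^ L := by positivity
  calc Real.exp (-(β * L)) ≤ Real.exp (h * L) / (Real.exp 1 * L) := by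
        rw [le_div_iff₀ (by positivity)]
        rw [lt_div_iff₀ (Real.exp_pos 1)] at hL1
        have : Real.exp (-(β * L)) = Real.exp (h * L) * Real.exp (-(h + β) * L) := by
          rw [← Real.exp_add]; congr 1; ring
        rw [this]
        have hp := Real.exp_pos (h * L)
        nlinarith
    _ = Real.exp (h * L) * (L / Real.exp 1) ^ L / (Real.exp 1 * L * (L / Real.exp 1) ^ L) := by
        field_simp
    _ ≤ Real.exp (h * L) * (L / Real.exp 1) ^ L / L.factorial := by gcongr
    _ = (d - 1 : ℝ) ^ L * ((x * L) ^ L * Real.exp (-(x * L)) / L.factorial) := by rw [← e1]; ring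
    _ ≤ _ := by gcongr

lemma ev_poly (K : ℝ) (a : ℕ) {b ε : ℝ} (hb : 0 < b) (hε : 0 < ε) :
    ∀ᶠ n : ℕ in atTop, K * (Real.log n) ^ a * Real.exp (-(b * Real.log n)) ≤ ε := by
  have h1 := (tendsto_rpow_mul_exp_neg_mul_atTop_nhds_zero a b hb).comp
    (Real.tendsto_log_atTop.comp (tendsto_natCast_atTop_atTop (R := ℝ)))
  have h2 := h1.const_mul K
  rw [mul_zero] at h2
  filter_upwards [h2.eventually (gt_mem_nhds hε)] with n hn
  simp only [Function.comp, Real.rpow_natCast, neg_mul] at hn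
  rw [mul_assoc]; exact hn.le

lemma ev_log (C : ℝ) : ∀ᶠ n : ℕ in atTop, C ≤ Real.log n :=
  (Real.tendsto_log_atTop.comp (tendsto_natCast_atTop_atTop (R := ℝ))).eventually_ge_atTop C

lemma err1_small (hd : 3 ≤ d) {δ C ε : ℝ} (hδ : 0 < δ) (hδ1 : δ ≤ 1) (hC : 0 ≤ C) (hε : 0 < ε) : ∀ᶠ n : ℕ in atTop,
    ∀ k : ℕ, (k : ℝ) ≤ C * Real.log n → ∀ t : ℝ, t ≤ (1 - δ) * Real.log n / (d - 2) →
      err1 n d k ⌈2 * (2 * d + 1) * Real.log n⌉₊ t ≤ ε := by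
  have hd3 : (3:ℝ) ≤ d := by exact_mod_cast hd
  set K : ℝ := 2 * d * C ^ 2 + (2 * (2 * d + 1) + 1) * (2 * d * (C + 1) ^ 2) + (C + 1) with hK
  filter_upwards [ev_poly K 3 hδ hε, ev_log 1, eventually_gt_atTop 0] with n hn hl hn0 k hk t ht
  refine le_trans ?_ hn
  set ℓ := Real.log n with hℓ
  have hnp : (0:ℝ) < n := by exact_mod_cast hn0
  have hne : (n:ℝ) = Real.exp ℓ := (Real.exp_log hnp).symm
  have hk0 : (0:ℝ) ≤ k := Nat.cast_nonneg k
  set J := ⌈2 * (2 * d + 1) * ℓ⌉₊ with hJ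
  have hJ1 : 2 * (2 * d + 1) * ℓ ≤ J := Nat.le_ceil _
  have hJ2 : (J:ℝ) ≤ (2 * (2 * d + 1) + 1) * ℓ := by
    have := (Nat.ceil_lt_add_one (show 0 ≤ 2 * (2 * (d:ℝ) + 1) * ℓ by positivity)).le
    rw [← hJ] at this; nlinarith
  have hD : (0:ℝ) < d - 2 := by linarith
  have hDt : (d - 2) * t ≤ (1 - δ) * ℓ := by
    rw [le_div_iff₀ hD] at ht; linarith
  have htl : t ≤ ℓ := by nlinarith
  have ee : Real.exp (-ℓ) ≤ Real.exp (-(δ * ℓ)) := by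
    apply Real.exp_le_exp.2; nlinarith
  have hk1 : (k:ℝ) + 1 ≤ (C + 1) * ℓ := by nlinarith
  have hEp := Real.exp_pos (-(δ * ℓ))
  have t1 : 2 * d * (k:ℝ) ^ 2 / n ≤ 2 * d * C ^ 2 * ℓ ^ 3 * Real.exp (-(δ * ℓ)) := by
    rw [hne, div_eq_mul_inv, ← Real.exp_neg]
    have : (k:ℝ) ^ 2 ≤ C ^ 2 * ℓ ^ 3 := by
      calc (k:ℝ) ^ 2 ≤ (C * ℓ) ^ 2 := by gcongr
        _ = C ^ 2 * ℓ ^ 2 := by ring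
        _ ≤ C ^ 2 * ℓ ^ 3 := by gcongr <;> simp [hl]
    calc _ ≤ 2 * d * (C ^ 2 * ℓ ^ 3) * Real.exp (-(δ * ℓ)) := by gcongr
      _ = _ := by ring
  have t2 : J * (2 * d * ((k:ℝ) + 1) ^ 2 * Real.exp ((d - 2) * t) / n) ≤
      (2 * (2 * d + 1) + 1) * (2 * d * (C + 1) ^ 2) * ℓ ^ 3 * Real.exp (-(δ * ℓ)) := by
    have e1 : Real.exp ((d - 2) * t) / n ≤ Real.exp (-(δ * ℓ)) := by
      rw [hne, ← Real.exp_sub]; apply Real.exp_le_exp.2; linarith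
    calc _ = J * (2 * d * ((k:ℝ) + 1) ^ 2 * (Real.exp ((d - 2) * t) / n)) := by ring
      _ ≤ ((2 * (2 * d + 1) + 1) * ℓ) * (2 * d * ((C + 1) * ℓ) ^ 2 * Real.exp (-(δ * ℓ))) := by gcongr
      _ = _ := by ring
  have t3 : ((k:ℝ) + 1) * (Real.exp ((2 * d - 1) * t) * (1 / 2) ^ J) ≤ (C + 1) * ℓ ^ 3 * Real.exp (-(δ * ℓ)) := by
    have e1 : ((1:ℝ) / 2) ^ J ≤ Real.exp (-((2 * d + 1) * ℓ)) := by
      have h2 : (1:ℝ) / 2 ≤ Real.exp (-(1/2)) := by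
        have := Real.add_one_le_exp (-(1/2:ℝ)); linarith
      calc ((1:ℝ) / 2) ^ J ≤ Real.exp (-(1/2)) ^ J := by gcongr
        _ = Real.exp (J * (-(1/2))) := by rw [Real.exp_nat_mul]
        _ ≤ _ := by apply Real.exp_le_exp.2; linarith
    have e2 : Real.exp ((2 * d - 1) * t) ≤ Real.exp ((2 * d - 1) * ℓ) := by
      apply Real.exp_le_exp.2
      apply mul_le_mul_of_nonneg_left htl; linarith
    calc _ ≤ ((C + 1) * ℓ) * (Real.exp ((2 * d - 1) * ℓ) * Real.exp (-((2 * d + 1) * ℓ))) := by gcongr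
      _ = ((C + 1) * ℓ ^ 1) * Real.exp (-(2 * ℓ)) := by
          rw [← Real.exp_add]
          have : (2 * (d:ℝ) - 1) * ℓ + -((2 * d + 1) * ℓ) = - (2 * ℓ) := by ring
          rw [this]; ring
      _ ≤ (C + 1) * ℓ ^ 3 * Real.exp (-(δ * ℓ)) := by
          have : Real.exp (-(2 * ℓ)) ≤ Real.exp (-(δ * ℓ)) := by apply Real.exp_le_exp.2; nlinarith
          gcongr
          norm_num
  unfold err1
  calc _ ≤ _ := add_le_add (add_le_add t1 t2) t3
    _ = _ := by rw [hK]; ring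

end lower

end FPP

namespace FPP

section lowerb
variable {d : ℕ}

lemma pL_two (r : ℕ) : 1 - Real.exp (-(r / 4 : ℝ)) ≤ pL r (2 * r) := by
  have h1 := mu_real_sum (ι := Fin r) (List.nodup_finRange r) (2 * r)
  have h2 := mu_sum_gt (ι := Fin r) (List.nodup_finRange r) (2 * r)
  rw [List.length_finRange] at h1 h2
  have hm : MeasurableSet {w : Fin r → ℝ | ((List.finRange r).map w).sum ≤ 2 * r} := by
    apply measurableSet_le _ measurable_const
    exact meas_sum _
  have h3 := measureReal_compl (μ := mu (Fin r)) hm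
  have h4 : {w : Fin r → ℝ | ((List.finRange r).map w).sum ≤ 2 * r}ᶜ =
      {w | 2 * (r:ℝ) < ((List.finRange r).map w).sum} := by ext w; simp
  rw [h4, h1] at h3
  have h5 : (mu (Fin r)).real Set.univ = 1 := by simp
  rw [h5] at h3
  have h6 : Real.exp (-(2 * (r:ℝ) / 2)) * 2 ^ r ≤ Real.exp (-(r / 4 : ℝ)) := by
    have : (2:ℝ) ≤ Real.exp (3/4) := by
      rw [← Real.log_le_iff_le_exp (by norm_num)]
      have := Real.log_two_lt_d9; linarith
    calc _ ≤ Real.exp (-(2 * (r:ℝ) / 2)) * Real.exp (3/4) ^ r := by gcongr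
      _ = _ := by
        rw [← Real.exp_nat_mul, ← Real.exp_add]; congr 1; ring
  linarith

set_option maxHeartbeats 2000000 in
lemma lower_i (hd : 3 ≤ d) {α : ℝ} (hα : 0 < α) (hf : ff d α < 0) {ε : ℝ} (hε : 0 < ε) :
    ∀ᶠ n : ℕ in atTop, ∀ h : 0 < n,
      PPr n d (fun G w => ∀ j, (hopCount G w ⟨0, h⟩ j : ℝ) < α * Real.log n) ≤ ε := by
  obtain ⟨x, hx, hxα, L, hL, hρ⟩ := exists_params hd (β := 0) hα (by simpa using hf)
  have hρ1 : 1 ≤ (d - 1 : ℝ) ^ L * pL L (x * L) := by simpa using hρ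
  have hd3 : (3:ℝ) ≤ d := by exact_mod_cast hd
  have hD : (0:ℝ) < d - 2 := by linarith
  have hD1 : (0:ℝ) < d - 1 := by linarith
  set p := pL L (x * L) with hpdef
  have hp : 0 < p := by
    by_contra hc
    push Not at hc
    have : (d - 1 : ℝ) ^ L * p ≤ 0 := mul_nonpos_of_nonneg_of_nonpos (by positivity) hc
    linarith
  set δ1 := 1 - x * ((d - 2) * α) with hδ1
  have hδ1p : 0 < δ1 := by rw [hδ1]; linarith
  have hδ1l : δ1 ≤ 1 := by
    rw [hδ1]; have : 0 < x * ((d - 2) * α) := by positivity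
    linarith
  set δ2 := δ1 / (8 * (d - 2)) with hδ2
  have hδ2p : 0 < δ2 := by positivity
  have hδ2e : δ2 * (d - 2) = δ1 / 8 := by rw [hδ2]; field_simp
  have hL0 : (0:ℝ) < L := by exact_mod_cast hL
  set C := α + L + δ2 with hC
  have hCp : 0 ≤ C := by positivity
  set B : ℝ := 8 + 8 * C + 8 * (2 * (2 * d + 1) + 1) with hB
  have hE4 : Real.exp (1/4) ≤ 2 := by
    have h1 := Real.exp_bound_div_one_sub_of_interval (x := 1/4) (by norm_num) (by norm_num)
    norm_num at h1 ⊢; linarith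
  filter_upwards [err1_small hd (δ := δ1 / 2) (C := C) (ε := ε / 8) (by linarith) (by linarith) hCp (by linarith),
    ev_log 1, ev_log (x * L * (4 * (d - 2)) / δ1), eventually_ge_atTop (16 + 8 * d),
    ev_poly 8 0 (b := δ2 / 4) (ε := ε / 4) (by positivity) (by positivity),
    ev_poly 2 0 (b := δ2 / 4) (ε := 1 / 2) (by positivity) (by positivity),
    ev_poly (4 * C / p) 1 (b := δ2 / 4) (ε := ε / 4) (by positivity) (by positivity),
    ev_poly B 1 (b := 1) (ε := 1) (by norm_num) (by norm_num)] with n herr hl1 hl2 hn16 hq1 hq2 hq3 hbig hn0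
  set ℓ := Real.log n with hℓ
  have hnp : (0:ℝ) < n := by exact_mod_cast hn0
  have hne : (n:ℝ) = Real.exp ℓ := (Real.exp_log hnp).symm
  set m := ⌈α * ℓ / L⌉₊ with hm
  set r0 := ⌊δ2 * ℓ⌋₊ with hr0
  set J := ⌈2 * (2 * d + 1) * ℓ⌉₊ with hJ
  set v : Fin n := ⟨0, hn0⟩
  have hm1 : α * ℓ ≤ m * L := by
    have := Nat.le_ceil (α * ℓ / L)
    rwa [div_le_iff₀ hL0] at this
  have hm2 : (m * L : ℝ) ≤ α * ℓ + L := by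
    have := (Nat.ceil_lt_add_one (show 0 ≤ α * ℓ / L by positivity)).le
    rw [← hm] at this
    calc (m * L : ℝ) ≤ (α * ℓ / L + 1) * L := by gcongr
      _ = _ := by field_simp
  have hr1 : (r0:ℝ) ≤ δ2 * ℓ := Nat.floor_le (by positivity)
  have hr2 : δ2 * ℓ - 1 ≤ r0 := by have := (Nat.lt_floor_add_one (δ2 * ℓ)).le; linarith
  have hkC : ((m * L + r0 : ℕ) : ℝ) ≤ C * ℓ := by
    push_cast; rw [hC]; nlinarith
  have hJ2 : (J:ℝ) ≤ (2 * (2 * d + 1) + 1) * ℓ := by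
    have := (Nat.ceil_lt_add_one (show 0 ≤ 2 * (2 * (d:ℝ) + 1) * ℓ by positivity)).le
    rw [← hJ] at this; nlinarith
  set t : ℝ := 2 * r0 + m * (x * L) with ht
  have htle : t ≤ (1 - δ1 / 2) * ℓ / (d - 2) := by
    rw [le_div_iff₀ hD, ht]
    rw [div_le_iff₀ hδ1p] at hl2
    have e1 : m * (x * L) ≤ x * (α * ℓ + L) := by
      calc _ = x * (m * L) := by ring
        _ ≤ _ := by gcongr
    have e2 : x * (α * ℓ + L) * (d - 2) = (1 - δ1) * ℓ + x * L * (d - 2) := by rw [hδ1]; ring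
    have e3 : (r0:ℝ) * (d - 2) ≤ δ1 / 8 * ℓ := by
      calc (r0:ℝ) * (d - 2) ≤ δ2 * ℓ * (d - 2) := by gcongr
        _ = δ2 * (d - 2) * ℓ := by ring
        _ = _ := by rw [hδ2e]
    have e4 : m * (x * L) * (d - 2) ≤ x * (α * ℓ + L) * (d - 2) := by gcongr
    nlinarith
  have herr' := herr (m * L + r0) hkC t htle
  set q := pL r0 (2 * r0) with hq
  have hexp : Real.exp (-(r0 / 4 : ℝ)) ≤ 2 * Real.exp (-(δ2 / 4 * ℓ)) := by
    calc Real.exp (-(r0 / 4 : ℝ)) ≤ Real.exp (1/4 + -(δ2 / 4 * ℓ)) := by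
          apply Real.exp_le_exp.2; linarith
      _ = Real.exp (1/4) * Real.exp (-(δ2 / 4 * ℓ)) := Real.exp_add _ _
      _ ≤ _ := by gcongr
  simp only [pow_zero, mul_one, pow_one] at hq1 hq2 hq3 hbig
  have hq_low : 1 - 2 * Real.exp (-(δ2 / 4 * ℓ)) ≤ q := by have := pL_two r0; linarith
  have hqh : 1 / 2 ≤ q := by linarith
  have hqp : 0 < q := by linarith
  have hq1' : q ≤ 1 := pL_le_one _ _
  set κ := (m * L + r0 : ℝ) / ((d - 1 : ℝ) ^ r0 * p) with hκ
  have hκ0 : 0 ≤ κ := by positivity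
  set ε2 := (1 + κ) / q - 1 with hε2
  have hε20 : 0 ≤ ε2 := by
    rw [hε2, sub_nonneg, le_div_iff₀ hqp]; linarith
  have hκle : κ ≤ ε / 8 := by
    have e1 : ((d - 1 : ℝ) ^ r0)⁻¹ ≤ 2 * Real.exp (-(δ2 / 4 * ℓ)) := by
      refine le_trans ?_ hexp
      rw [inv_le_comm₀ (by positivity) (Real.exp_pos _), ← Real.exp_neg, neg_neg]
      calc Real.exp (r0 / 4 : ℝ) = Real.exp (1 / 4) ^ r0 := by rw [← Real.exp_nat_mul]; congr 1; ring
        _ ≤ _ := by gcongr; linarith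
    push_cast at hkC
    calc κ = (m * L + r0 : ℝ) * ((d - 1 : ℝ) ^ r0)⁻¹ / p := by rw [hκ]; field_simp
      _ ≤ (C * ℓ) * (2 * Real.exp (-(δ2 / 4 * ℓ))) / p := by gcongr
      _ = (4 * C / p * ℓ * Real.exp (-(δ2 / 4 * ℓ))) / 2 := by ring
      _ ≤ _ := by linarith
  have hε2le : ε2 ≤ ε * (3/4) := by
    rw [hε2, sub_le_iff_le_add, div_le_iff₀ hqp]
    nlinarith
  have hbd : 8 * (m * L + r0 + J) ≤ n := by
    have h1 : (8 * (m * L + r0 + J) : ℝ) ≤ n := by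
      have e1 : B * ℓ ≤ n := by
        rw [one_mul] at hbig
        rw [hne]
        have := mul_le_mul_of_nonneg_right hbig (Real.exp_pos ℓ).le
        rw [mul_assoc, ← Real.exp_add] at this
        simpa using this
      push_cast at hkC
      rw [hB] at e1
      nlinarith
    exact_mod_cast h1
  have hmain := second_total (n := n) hd hn16 (L := L) (m := m) (r0 := r0) (J := J) (y := x * L) (c0 := 2 * r0) (t := t)
    hbd {v} (by simp) (by positivity) hε20 (by
      intro G hG P hP
      refine (pair_i hd hG hL hp hρ1 hP).trans ?_
      apply mul_le_mul_of_nonneg_left _ (by positivity)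
      have e1 : (1 : ℝ) + ε2 = (1 + κ) / q := by rw [hε2]; ring
      rw [e1, Finset.card_singleton, Nat.cast_one, one_mul]
      have e2 : (NN d (m * L + r0) : ℝ) * (p ^ m * q) * ((1 + κ) / q) = p ^ m * (NN d (m * L + r0) * (1 + κ)) := by
        field_simp
      rw [e2]
      apply mul_le_mul_of_nonneg_left _ (by positivity)
      rw [mul_add, mul_one]
      apply add_le_add le_rfl
      have e3 : (m * L + r0 : ℝ) * ((d - 1 : ℝ) ^ (m * L) / p) = (d - 1 : ℝ) ^ (m * L + r0) * κ := by
        rw [hκ, pow_add]; field_simp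
      rw [e3]
      apply mul_le_mul_of_nonneg_right _ hκ0
      exact NN_ge_pow (by omega) _)
  refine le_trans (PPr_mono ?_) (hmain.trans ?_)
  · intro G hG w hw hall P hP hok
    have hkpos : 0 < m * L + r0 := by
      have : 0 < m * L := by
        have : (0:ℝ) < m * L := lt_of_lt_of_le (by positivity) hm1
        exact_mod_cast this
      omega
    obtain ⟨v', hv', j, hj⟩ := ok_hop hkpos hw hP hok
    rw [Finset.mem_singleton] at hv'
    subst hv'
    have := hall j
    rw [hj] at this
    push_cast at this
    have : (0:ℝ) ≤ r0 := Nat.cast_nonneg _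
    linarith
  · linarith

set_option maxHeartbeats 2000000 in
lemma lower_ii (hd : 3 ≤ d) {α : ℝ} (hα : 0 < α) (hf : ff d α < 1) {ε : ℝ} (hε : 0 < ε) :
    ∀ᶠ n : ℕ in atTop,
      PPr n d (fun G w => ∀ i j, (hopCount G w i j : ℝ) < α * Real.log n) ≤ ε := by
  obtain ⟨γ, hγ1, hγ2⟩ : ∃ γ, max (ff d α) 0 < γ ∧ γ < 1 := exists_between (max_lt hf zero_lt_one)
  have hγ0 : 0 < γ := lt_of_le_of_lt (le_max_right _ _) hγ1
  have hγf : ff d α < γ := lt_of_le_of_lt (le_max_left _ _) hγ1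
  set β := γ / α with hβ
  have hβ0 : 0 < β := by positivity
  have hβα : α * β = γ := by rw [hβ]; field_simp
  obtain ⟨x, hx, hxα, L, hL, hρ⟩ := exists_params hd (β := β) hα (by rw [hβα]; exact hγf)
  have hd3 : (3:ℝ) ≤ d := by exact_mod_cast hd
  have hD : (0:ℝ) < d - 2 := by linarith
  have hD1 : (0:ℝ) < d - 1 := by linarith
  set p := pL L (x * L) with hpdef
  have hp : 0 < p := by
    by_contra hc
    push Not at hc
    have : (d - 1 : ℝ) ^ L * p ≤ 0 := mul_nonpos_of_nonneg_of_nonpos (by positivity) hc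
    have := Real.exp_pos (-(β * L))
    linarith
  set δ1 := 1 - x * ((d - 2) * α) with hδ1
  have hδ1p : 0 < δ1 := by rw [hδ1]; linarith
  have hδ1l : δ1 ≤ 1 := by
    rw [hδ1]; have : 0 < x * ((d - 2) * α) := by positivity
    linarith
  have hL0 : (0:ℝ) < L := by exact_mod_cast hL
  set C := α + L with hC
  have hCp : 0 ≤ C := by positivity
  set B : ℝ := 8 * C + 8 * (2 * (2 * d + 1) + 1) with hB
  filter_upwards [err1_small hd (δ := δ1 / 2) (C := C) (ε := ε / 8) (by linarith) (by linarith) hCp (by linarith),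
    ev_log 1, ev_log (x * L * (4 * (d - 2)) / δ1), eventually_ge_atTop (16 + 8 * d),
    ev_poly (2 * (C + 1) ^ 3 * Real.exp (β * L) / p ^ 2) 3 (b := 1 - γ) (ε := ε / 4) (by linarith) (by positivity),
    ev_poly B 1 (b := 1) (ε := 1) (by norm_num) (by norm_num)] with n herr hl1 hl2 hn16 hq3 hbig
  have hn0 : 0 < n := by omega
  set ℓ := Real.log n with hℓ
  have hnp : (0:ℝ) < n := by exact_mod_cast hn0
  have hne : (n:ℝ) = Real.exp ℓ := (Real.exp_log hnp).symm
  set m := ⌈α * ℓ / L⌉₊ with hm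
  set J := ⌈2 * (2 * d + 1) * ℓ⌉₊ with hJ
  have hm1 : α * ℓ ≤ m * L := by
    have := Nat.le_ceil (α * ℓ / L)
    rwa [div_le_iff₀ hL0] at this
  have hm2 : (m * L : ℝ) ≤ α * ℓ + L := by
    have := (Nat.ceil_lt_add_one (show 0 ≤ α * ℓ / L by positivity)).le
    rw [← hm] at this
    calc (m * L : ℝ) ≤ (α * ℓ / L + 1) * L := by gcongr
      _ = _ := by field_simp
  have hkC : ((m * L + 0 : ℕ) : ℝ) ≤ C * ℓ := by
    push_cast; rw [hC]; nlinarith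
  have hJ2 : (J:ℝ) ≤ (2 * (2 * d + 1) + 1) * ℓ := by
    have := (Nat.ceil_lt_add_one (show 0 ≤ 2 * (2 * (d:ℝ) + 1) * ℓ by positivity)).le
    rw [← hJ] at this; nlinarith
  set t : ℝ := 0 + m * (x * L) with ht
  have htle : t ≤ (1 - δ1 / 2) * ℓ / (d - 2) := by
    rw [le_div_iff₀ hD, ht]
    rw [div_le_iff₀ hδ1p] at hl2
    have e1 : m * (x * L) ≤ x * (α * ℓ + L) := by
      calc _ = x * (m * L) := by ring
        _ ≤ _ := by gcongr
    have e2 : x * (α * ℓ + L) * (d - 2) = (1 - δ1) * ℓ + x * L * (d - 2) := by rw [hδ1]; ring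
    have e4 : m * (x * L) * (d - 2) ≤ x * (α * ℓ + L) * (d - 2) := by gcongr
    nlinarith
  have herr' := herr (m * L + 0) hkC t htle
  set M := Real.exp (β * (m * L)) with hM
  have hMle : M ≤ Real.exp (γ * ℓ) * Real.exp (β * L) := by
    rw [hM, ← Real.exp_add]; apply Real.exp_le_exp.2
    calc β * (m * L) ≤ β * (α * ℓ + L) := by gcongr
      _ = (α * β) * ℓ + β * L := by ring
      _ = _ := by rw [hβα]
  have hMρ : ∀ s ≤ m, 1 ≤ M * ((d - 1 : ℝ) ^ L * pL L (x * L)) ^ s := by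
    intro s hs
    have hs' : (s:ℝ) ≤ m := by exact_mod_cast hs
    calc (1:ℝ) ≤ Real.exp (β * (m * L) + s * (-(β * L))) := by
          apply Real.one_le_exp
          have : 0 ≤ β * L * (m - s) := by
            apply mul_nonneg (by positivity); linarith
          nlinarith
      _ = M * Real.exp (-(β * L)) ^ s := by rw [Real.exp_add, Real.exp_nat_mul]
      _ ≤ _ := by gcongr
  set ε2 := 2 * (m * L + 1 : ℝ) ^ 3 * M / (n * p ^ 2) with hε2
  have hε20 : 0 ≤ ε2 := by positivity
  have hε2le : ε2 ≤ ε / 4 := by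
    refine le_trans ?_ hq3
    have e1 : (m * L + 1 : ℝ) ≤ (C + 1) * ℓ := by
      push_cast at hkC; nlinarith
    calc ε2 ≤ 2 * ((C + 1) * ℓ) ^ 3 * (Real.exp (γ * ℓ) * Real.exp (β * L)) / (n * p ^ 2) := by
          rw [hε2]; gcongr
      _ = 2 * (C + 1) ^ 3 * Real.exp (β * L) / p ^ 2 * ℓ ^ 3 * (Real.exp (γ * ℓ) / n) := by field_simp
      _ = _ := by
          rw [hne, ← Real.exp_sub]; congr 2; ring
  have hbd : 8 * (m * L + 0 + J) ≤ n := by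
    have h1 : (8 * (m * L + J) : ℝ) ≤ n := by
      have e1 : B * ℓ ≤ n := by
        simp only [pow_one, one_mul] at hbig
        rw [hne]
        have := mul_le_mul_of_nonneg_right hbig (Real.exp_pos ℓ).le
        rw [mul_assoc, ← Real.exp_add] at this
        simpa using this
      push_cast at hkC
      rw [hB] at e1
      nlinarith
    exact_mod_cast h1
  have hp00 : pL 0 0 = 1 := pL_zero le_rfl
  have hmain := second_total (n := n) hd hn16 (L := L) (m := m) (r0 := 0) (J := J) (y := x * L) (c0 := 0) (t := t)
    hbd Finset.univ ⟨⟨0, hn0⟩, Finset.mem_univ _⟩ (by rw [hp00]; positivity) hε20 (by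
      intro G hG P hP
      refine (pair_ii hd hG hL hp hMρ hP).trans ?_
      rw [hp00, mul_one]
      apply mul_le_mul_of_nonneg_left _ (by positivity)
      rw [Finset.card_univ, Fintype.card_fin]
      have e2 : (n * NN d (m * L + 0) : ℝ) * p ^ m * (1 + ε2) = p ^ m * (n * NN d (m * L + 0) + n * NN d (m * L + 0) * ε2) := by
        ring
      rw [e2]
      apply mul_le_mul_of_nonneg_left _ (by positivity)
      apply add_le_add le_rfl
      have e3 : 2 * (m * L + 1 : ℝ) ^ 3 * ((d - 1 : ℝ) ^ (m * L) * M / p ^ 2) = n * (d - 1 : ℝ) ^ (m * L + 0) * ε2 := by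
        rw [hε2, add_zero]; field_simp
      rw [e3]
      apply mul_le_mul_of_nonneg_right _ hε20
      apply mul_le_mul_of_nonneg_left _ hnp.le
      exact NN_ge_pow (by omega) _)
  refine le_trans (PPr_mono ?_) (hmain.trans ?_)
  · intro G hG w hw hall P hP hok
    have hkpos : 0 < m * L + 0 := by
      have : 0 < m * L := by
        have : (0:ℝ) < m * L := lt_of_lt_of_le (by positivity) hm1
        exact_mod_cast this
      omega
    obtain ⟨v', hv', j, hj⟩ := ok_hop hkpos hw hP hok
    have := hall v' j
    rw [hj] at this
    push_cast at this
    linarith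
  · linarith

end lowerb

end FPP

namespace FPP

section grown
variable {n d : ℕ} {G : SimpleGraph (Fin n)}

/-- vertex sets obtained from a single vertex by successively adding neighbours -/
inductive Grown (G : SimpleGraph (Fin n)) : Finset (Fin n) → Prop
  | single (v : Fin n) : Grown G {v}
  | step {B : Finset (Fin n)} {x y : Fin n} : Grown G B → x ∈ B → y ∉ B → G.Adj x y →
      Grown G (insert y B)

/-- edges inside `B` -/
def eIn (G : SimpleGraph (Fin n)) (B : Finset (Fin n)) : Finset (Sym2 (Fin n)) :=
  Finset.univ.filter fun e => e ∈ G.edgeSet ∧ ∀ v ∈ e, v ∈ B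

/-- boundary edges -/
def bd (G : SimpleGraph (Fin n)) (B : Finset (Fin n)) : Finset (Sym2 (Fin n)) :=
  Finset.univ.filter fun e => ∃ x y, e = s(x, y) ∧ G.Adj x y ∧ x ∈ B ∧ y ∉ B

/-- edges incident to `B` -/
def inc (G : SimpleGraph (Fin n)) (B : Finset (Fin n)) : Finset (Sym2 (Fin n)) :=
  Finset.univ.filter fun e => e ∈ G.edgeSet ∧ ∃ v ∈ e, v ∈ B

lemma mem_bd {B : Finset (Fin n)} {e : Sym2 (Fin n)} :
    e ∈ bd G B ↔ ∃ x y, e = s(x, y) ∧ G.Adj x y ∧ x ∈ B ∧ y ∉ B := by simp [bd]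

lemma mem_eIn {B : Finset (Fin n)} {e : Sym2 (Fin n)} :
    e ∈ eIn G B ↔ e ∈ G.edgeSet ∧ ∀ v ∈ e, v ∈ B := by simp [eIn]

lemma mem_inc {B : Finset (Fin n)} {e : Sym2 (Fin n)} :
    e ∈ inc G B ↔ e ∈ G.edgeSet ∧ ∃ v ∈ e, v ∈ B := by simp [inc]

lemma degree_sum (hG : G ∈ Reg n d) (B : Finset (Fin n)) :
    B.card * d ≤ 2 * (eIn G B).card + (bd G B).card := by
  rw [← card_dart_fst hG B]
  have h1 : ((dart G).filter (fun p => p.1 ∈ B)) ⊆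
      ((dart G).filter (fun p => s(p.1, p.2) ∈ eIn G B)) ∪
      ((dart G).filter (fun p => p.1 ∈ B ∧ p.2 ∉ B)) := by
    rintro ⟨x, y⟩ h
    simp only [Finset.mem_filter, mem_dart, Finset.mem_union, mem_eIn, SimpleGraph.mem_edgeSet] at h ⊢
    by_cases hy : y ∈ B
    · left
      refine ⟨h.1, h.1, ?_⟩
      intro v hv
      rcases Sym2.mem_iff.1 hv with rfl | rfl
      · exact h.2
      · exact hy
    · exact Or.inr ⟨h.1, h.2, hy⟩
  refine (Finset.card_le_card h1).trans ((Finset.card_union_le _ _).trans ?_)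
  refine add_le_add (card_dart_edge _) ?_
  apply Finset.card_le_card_of_injOn (fun p => s(p.1, p.2))
  · rintro ⟨x, y⟩ h
    simp only [Finset.coe_filter, Set.mem_ofPred_eq, mem_dart] at h
    exact mem_bd.2 ⟨x, y, rfl, h.1, h.2.1, h.2.2⟩
  · rintro ⟨x, y⟩ h ⟨x', y'⟩ h' he
    simp only [Finset.coe_filter, Set.mem_ofPred_eq, mem_dart] at h h'
    rcases Sym2.eq_iff.1 he with ⟨rfl, rfl⟩ | ⟨rfl, rfl⟩
    · rfl
    · exact absurd h.2.1 h'.2.2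

lemma card_inc_le (hG : G ∈ Reg n d) (B : Finset (Fin n)) : (inc G B).card ≤ B.card * d := by
  rw [← card_dart_fst hG B]
  have : inc G B ⊆ ((dart G).filter (fun p => p.1 ∈ B)).image (fun p => s(p.1, p.2)) := by
    intro e he
    obtain ⟨h1, v, hv, hB⟩ := mem_inc.1 he
    obtain ⟨u, rfl⟩ := Sym2.mem_iff_exists.1 hv
    rw [Finset.mem_image]
    exact ⟨(v, u), by simpa [mem_dart] using ⟨h1, hB⟩, rfl⟩
  exact (Finset.card_le_card this).trans Finset.card_image_le

lemma eIn_insert {B : Finset (Fin n)} {y : Fin n} (hy : y ∉ B) :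
    (eIn G B).card + (nb G y ∩ B).card ≤ (eIn G (insert y B)).card := by
  have hd : Disjoint (eIn G B) ((nb G y ∩ B).image (fun x => s(y, x))) := by
    rw [Finset.disjoint_left]
    intro e he h
    obtain ⟨x, hx, rfl⟩ := Finset.mem_image.1 h
    exact hy ((mem_eIn.1 he).2 y (Sym2.mem_mk_left _ _))
  have hc : ((nb G y ∩ B).image (fun x => s(y, x))).card = (nb G y ∩ B).card := by
    apply Finset.card_image_of_injective
    intro a b h
    exact Sym2.congr_right.1 h
  rw [← hc, ← Finset.card_union_of_disjoint hd]
  apply Finset.card_le_card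
  intro e he
  rcases Finset.mem_union.1 he with h | h
  · rw [mem_eIn] at h ⊢
    exact ⟨h.1, fun v hv => Finset.mem_insert_of_mem (h.2 v hv)⟩
  · obtain ⟨x, hx, rfl⟩ := Finset.mem_image.1 h
    rw [Finset.mem_inter, mem_nb] at hx
    rw [mem_eIn]
    refine ⟨hx.1, fun v hv => ?_⟩
    rcases Sym2.mem_iff.1 hv with rfl | rfl
    · simp
    · simp [hx.2]

lemma Grown.eIn_ge {B : Finset (Fin n)} (h : Grown G B) : B.card ≤ (eIn G B).card + 1 := by
  induction h with
  | single v => simp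
  | @step B x y hB hx hy hxy ih =>
    have h1 := eIn_insert (G := G) hy
    have h2 : 1 ≤ (nb G y ∩ B).card := Finset.card_pos.2 ⟨x, by simp [hx, hxy.symm]⟩
    rw [Finset.card_insert_of_notMem hy]
    omega

lemma Grown.nonempty {B : Finset (Fin n)} (h : Grown G B) : B.Nonempty := by
  induction h with
  | single v => simp
  | step => simp

lemma Grown.code {B : Finset (Fin n)} (h : Grown G B) : ∃ l : List (Fin n), l.IsChain G.Adj ∧
    l.toFinset = B ∧ l.length + 1 = 2 * B.card ∧ (edgesL l).toFinset.card + 1 ≤ B.card := by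
  induction h with
  | single v => exact ⟨[v], by simp⟩
  | @step B x y hB hx hy hxy ih =>
    obtain ⟨l, h1, h2, h3, h4⟩ := ih
    have hxl : x ∈ l := by rw [← List.mem_toFinset, h2]; exact hx
    obtain ⟨l1, l2, rfl⟩ := List.append_of_mem hxl
    have he : (edgesL (l1 ++ x :: y :: x :: l2)).toFinset ⊆
        insert s(x, y) (edgesL (l1 ++ x :: l2)).toFinset := by
      rw [edgesL_append, edgesL_append l1 l2]
      intro e he
      simp only [edgesL_cons_cons, List.toFinset_append, List.toFinset_cons, Finset.mem_union,
        Finset.mem_insert, List.mem_toFinset, Sym2.eq_swap (a := y) (b := x)] at he ⊢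
      tauto
    refine ⟨l1 ++ x :: y :: x :: l2, ?_, ?_, ?_, ?_⟩
    · rw [isChain_iff_edges] at h1 ⊢
      intro e h
      have := he (List.mem_toFinset.2 h)
      rw [Finset.mem_insert] at this
      rcases this with rfl | h
      · exact hxy
      · exact h1 e (List.mem_toFinset.1 h)
    · rw [← h2]
      ext v
      simp only [List.mem_toFinset, List.mem_append, List.mem_cons, Finset.mem_insert]
      tauto
    · rw [Finset.card_insert_of_notMem hy]
      simp only [List.length_append, List.length_cons] at h3 ⊢
      omega
    · rw [Finset.card_insert_of_notMem hy]
      have := (Finset.card_le_card he).trans (Finset.card_insert_le _ _)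
      omega

lemma Grown.of_path {l : List (Fin n)} (h : IsP G l) (hl : l ≠ []) : Grown G l.toFinset := by
  induction l with
  | nil => exact absurd rfl hl
  | cons a l ih =>
    cases l with
    | nil => simpa using Grown.single a
    | cons b l =>
      have h' : IsP G (b :: l) := h.infix ⟨[a], [], by simp⟩
      have := ih h' (by simp)
      rw [List.toFinset_cons]
      apply Grown.step (x := b) this (by simp)
      · have := h.2
        rw [List.nodup_cons] at this
        rw [List.mem_toFinset]; exact this.1
      · have := h.1
        rw [List.isChain_cons_cons] at this
        exact this.1.symm

/-- adding a set of neighbours -/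
lemma Grown.union {B Z : Finset (Fin n)} (h : Grown G B) (hZ : ∀ z ∈ Z, z ∉ B ∧ 2 ≤ (nb G z ∩ B).card) :
    Grown G (B ∪ Z) ∧ (eIn G B).card + 2 * Z.card ≤ (eIn G (B ∪ Z)).card := by
  induction Z using Finset.induction_on with
  | empty => simpa using h
  | insert z Z hz ih =>
    obtain ⟨ih1, ih2⟩ := ih (fun v hv => hZ v (by simp [hv]))
    obtain ⟨hzB, hz2⟩ := hZ z (by simp)
    have hzn : z ∉ B ∪ Z := by simp [hzB, hz]
    rw [Finset.union_insert]
    have h2 : (nb G z ∩ B).card ≤ (nb G z ∩ (B ∪ Z)).card :=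
      Finset.card_le_card (Finset.inter_subset_inter_left Finset.subset_union_left)
    constructor
    · obtain ⟨x, hx⟩ : (nb G z ∩ B).Nonempty := by rw [← Finset.card_pos]; omega
      rw [Finset.mem_inter, mem_nb] at hx
      exact ih1.step (x := x) (by simp [hx.2]) hzn hx.1.symm
    · have := eIn_insert (G := G) hzn
      rw [Finset.card_insert_of_notMem hz]
      omega

/-- chains with a given number of vertices -/
def chs (G : SimpleGraph (Fin n)) (k : ℕ) : Finset (List (Fin n)) :=
  (listsLen n k).filter fun l => l.IsChain G.Adj

lemma mem_chs {k : ℕ} {l : List (Fin n)} : l ∈ chs G k ↔ l.length = k ∧ l.IsChain G.Adj := by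
  simp [chs]

lemma card_chs (hG : G ∈ Reg n d) (k : ℕ) : (chs G (k + 1)).card ≤ n * d ^ k := by
  induction k with
  | zero =>
    have : chs G 1 ⊆ (Finset.univ : Finset (Fin n)).image (fun v => [v]) := by
      intro l hl
      obtain ⟨h1, h2⟩ := mem_chs.1 hl
      obtain ⟨v, rfl⟩ := List.length_eq_one_iff.1 h1
      simp
    refine (Finset.card_le_card this).trans (Finset.card_image_le.trans ?_)
    simp
  | succ k ih =>
    have : chs G (k + 2) ⊆ (chs G (k + 1)).biUnion (fun t =>
        (Finset.univ.filter fun x => ∀ v ∈ t.head?, G.Adj v x).image (fun x => x :: t)) := by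
      intro l hl
      obtain ⟨h1, h2⟩ := mem_chs.1 hl
      match l, h1, h2 with
      | x :: y :: l, h1, h2 =>
        rw [List.isChain_cons_cons] at h2
        simp only [Finset.mem_biUnion, Finset.mem_image, Finset.mem_filter]
        refine ⟨y :: l, mem_chs.2 ⟨by simpa using h1, h2.2⟩, x, ⟨by simp, ?_⟩, rfl⟩
        intro v hv
        simp at hv
        subst hv
        exact h2.1.symm
    refine (Finset.card_le_card this).trans (Finset.card_biUnion_le.trans ?_)
    calc _ ≤ ∑ t ∈ chs G (k + 1), d := by
          apply Finset.sum_le_sum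
          intro t ht
          refine Finset.card_image_le.trans ?_
          obtain ⟨h1, h2⟩ := mem_chs.1 ht
          match t, h1 with
          | v :: t, h1 =>
            rw [← mem_Reg.1 hG v]
            apply Finset.card_le_card
            intro x hx
            simpa using hx
      _ = (chs G (k + 1)).card * d := by simp
      _ ≤ n * d ^ k * d := Nat.mul_le_mul_right _ ih
      _ = _ := by ring

/-- `G` has a grown set of size `m` with at least `m + r` inner edges -/
lemma count_dense (hd : 0 < d) (hn : 16 + 8 * d ≤ n) (m r : ℕ) (hm : 1 ≤ m) (hmr : 8 * (m + r) ≤ n * d) :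
    n ^ r * ((Reg n d).filter fun G => ∃ B, Grown G B ∧ B.card = m ∧ m + r ≤ (eIn G B).card + 1).card ≤
      (Reg n d).card * (n * d ^ (2 * m) * ((m ^ 2).choose r * (2 * d) ^ r)) := by
  set L := listsLen n (2 * m - 2 + 1) with hL
  set T : Finset (List (Fin n) × Finset (Sym2 (Fin n))) := (L ×ˢ Finset.univ).filter fun p =>
    p.1.toFinset.card = m ∧ (edgesL p.1).toFinset.card + 1 ≤ m ∧
    p.2 ⊆ (p.1.toFinset ×ˢ p.1.toFinset).image (fun q => s(q.1, q.2)) ∧ p.2.card = r ∧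
      Disjoint (edgesL p.1).toFinset p.2 with hT
  have h1 : ((Reg n d).filter fun G => ∃ B, Grown G B ∧ B.card = m ∧ m + r ≤ (eIn G B).card + 1).card ≤
      ∑ τ ∈ T, (RegF n d ((edgesL τ.1).toFinset ∪ τ.2)).card := by
    refine le_trans (Finset.card_le_card (t := T.biUnion fun τ => RegF n d ((edgesL τ.1).toFinset ∪ τ.2)) ?_)
      Finset.card_biUnion_le
    intro G hG
    obtain ⟨hG, B, hB, hBm, hBr⟩ := Finset.mem_filter.1 hG
    obtain ⟨l, l1, l2, l3, l4⟩ := hB.code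
    have hr : r ≤ (eIn G B \ (edgesL l).toFinset).card := by
      have := Finset.le_card_sdiff (edgesL l).toFinset (eIn G B)
      omega
    obtain ⟨R, hR1, hR2⟩ := Finset.exists_subset_card_eq hr
    rw [Finset.mem_biUnion]
    refine ⟨(l, R), ?_, ?_⟩
    · rw [hT, Finset.mem_filter, Finset.mem_product, hL, mem_listsLen]
      refine ⟨⟨by simp only; omega, by simp⟩, by simp only [l2, hBm], by simp only; omega, ?_, hR2, ?_⟩
      · intro e he
        have := mem_eIn.1 (Finset.mem_sdiff.1 (hR1 he)).1
        simp only [l2]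
        induction e with
        | h a b =>
          rw [Finset.mem_image]
          exact ⟨(a, b), by simpa using ⟨this.2 a (by simp), this.2 b (by simp)⟩, rfl⟩
      · exact Finset.disjoint_of_subset_right hR1 Finset.disjoint_sdiff
    · rw [mem_RegF]
      refine ⟨hG, ?_⟩
      intro e he
      rcases Finset.mem_union.1 he with h | h
      · exact (isChain_iff_edges G l).1 l1 e (List.mem_toFinset.1 h)
      · exact (mem_eIn.1 (Finset.mem_sdiff.1 (hR1 h)).1).1
  have h2 : ∀ τ ∈ T, n ^ r * (RegF n d ((edgesL τ.1).toFinset ∪ τ.2)).card ≤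
      (2 * d) ^ r * (RegF n d (edgesL τ.1).toFinset).card := by
    intro τ hτ
    rw [hT, Finset.mem_filter] at hτ
    obtain ⟨-, -, h3, -, h5, h6⟩ := hτ
    have := switch_bound_set (n := n) hd h6 (by omega) hn
    rwa [h5] at this
  have h3 : ∑ τ ∈ T, (RegF n d (edgesL τ.1).toFinset).card ≤
      ∑ l ∈ L, (m ^ 2).choose r * (RegF n d (edgesL l).toFinset).card := by
    have hsub : T ⊆ L.biUnion (fun l => (if l.toFinset.card = m then
        (((l.toFinset ×ˢ l.toFinset).image (fun q => s(q.1, q.2))).powersetCard r).image (fun R => (l, R))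
        else ∅)) := by
      rintro ⟨l, R⟩ h
      rw [hT, Finset.mem_filter] at h
      obtain ⟨k1, k2, k3, k4, k5, k6⟩ := h
      rw [Finset.mem_biUnion]
      refine ⟨l, (Finset.mem_product.1 k1).1, ?_⟩
      simp only at k2
      rw [if_pos k2, Finset.mem_image]
      exact ⟨R, Finset.mem_powersetCard.2 ⟨k4, k5⟩, rfl⟩
    refine (Finset.sum_le_sum_of_subset hsub).trans ?_
    rw [Finset.sum_biUnion (by
      intro a _ b _ hab
      rw [Function.onFun, Finset.disjoint_left]
      rintro ⟨x, R⟩ h1 h2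
      split_ifs at h1 h2 with c1 c2
      · simp only [Finset.mem_image, Prod.mk.injEq] at h1 h2
        obtain ⟨_, _, e1, _⟩ := h1
        obtain ⟨_, _, e2, _⟩ := h2
        exact hab (e1.trans e2.symm)
      all_goals simp at h1 h2)]
    apply Finset.sum_le_sum
    intro l hl
    split_ifs with hc
    · rw [Finset.sum_image (by intro a _ b _ h; simpa using h)]
      simp only [Finset.sum_const, Finset.card_powersetCard, smul_eq_mul]
      apply Nat.mul_le_mul_right
      apply Nat.choose_le_choose
      refine Finset.card_image_le.trans ?_
      rw [Finset.card_product, hc, sq]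
    · simp
  have h4 : ∑ l ∈ L, (RegF n d (edgesL l).toFinset).card = ∑ G ∈ Reg n d, (chs G (2 * m - 2 + 1)).card := by
    simp only [RegF, Finset.card_filter, chs, hL]
    rw [Finset.sum_comm]
    apply Finset.sum_congr rfl
    intro G hG
    apply Finset.sum_congr rfl
    intro l hl
    simp only [isChain_iff_edges, List.mem_toFinset]
  have h5 : ∑ G ∈ Reg n d, (chs G (2 * m - 2 + 1)).card ≤ (Reg n d).card * (n * d ^ (2 * m)) := by
    calc _ ≤ ∑ G ∈ Reg n d, n * d ^ (2 * m) := by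
          apply Finset.sum_le_sum
          intro G hG
          refine (card_chs hG _).trans (Nat.mul_le_mul_left _ (Nat.pow_le_pow_right hd (by omega)))
      _ = _ := by simp
  calc _ ≤ n ^ r * ∑ τ ∈ T, (RegF n d ((edgesL τ.1).toFinset ∪ τ.2)).card := Nat.mul_le_mul_left _ h1
    _ ≤ ∑ τ ∈ T, (2 * d) ^ r * (RegF n d (edgesL τ.1).toFinset).card := by
        rw [Finset.mul_sum]; exact Finset.sum_le_sum h2
    _ ≤ (2 * d) ^ r * ∑ l ∈ L, (m ^ 2).choose r * (RegF n d (edgesL l).toFinset).card := by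
        rw [← Finset.mul_sum]; exact Nat.mul_le_mul_left _ h3
    _ = (2 * d) ^ r * (m ^ 2).choose r * ∑ l ∈ L, (RegF n d (edgesL l).toFinset).card := by
        rw [← Finset.mul_sum]; ring
    _ ≤ (2 * d) ^ r * (m ^ 2).choose r * ((Reg n d).card * (n * d ^ (2 * m))) := by
        rw [h4]; exact Nat.mul_le_mul_left _ h5
    _ = _ := by ring

/-- no grown set of intermediate size is dense -/
def PA (ε : ℝ) (K M : ℕ) (G : SimpleGraph (Fin n)) : Prop :=
  ∀ B, Grown G B → K ≤ B.card → B.card ≤ M → ((eIn G B).card : ℝ) ≤ (1 + ε) * B.card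

lemma choose_bound (m r : ℕ) (ε : ℝ) (hε : 0 < ε) (hr : ε * m ≤ r) (hm : 1 ≤ m) :
    (((m ^ 2).choose r : ℕ) : ℝ) ≤ (Real.exp 1 * m / ε) ^ r := by
  have hm' : (1:ℝ) ≤ m := by exact_mod_cast hm
  have hr0 : (0:ℝ) < r := lt_of_lt_of_le (by positivity) hr
  have h1 := Nat.choose_le_pow_div (α := ℝ) r (m ^ 2)
  have h2 := Real.pow_div_factorial_le_exp (r : ℝ) hr0.le r
  have hf : (0:ℝ) < r.factorial := by exact_mod_cast r.factorial_pos
  refine h1.trans ?_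
  rw [div_le_iff₀ hf]
  have h3 : Real.exp (r:ℝ) = Real.exp 1 ^ r := by rw [← Real.exp_nat_mul, mul_one]
  rw [div_le_iff₀ hf, h3] at h2
  have h4 : (m:ℝ) / ε * r ≥ (m:ℝ) ^ 2 := by
    rw [ge_iff_le, div_mul_eq_mul_div, le_div_iff₀ hε]
    nlinarith
  push_cast
  calc ((m:ℝ) ^ 2) ^ r ≤ ((m:ℝ) / ε * r) ^ r := by gcongr
    _ = (m / ε) ^ r * (r:ℝ) ^ r := by rw [mul_pow]
    _ ≤ (m / ε) ^ r * (Real.exp 1 ^ r * r.factorial) := by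
        apply mul_le_mul_of_nonneg_left h2 (by positivity)
    _ = _ := by rw [← mul_assoc, ← mul_pow]; ring_nf

lemma PA_fail (hd : 0 < d) (hn : 16 + 8 * d ≤ n) (ε : ℝ) (hε : 0 < ε) (hε1 : ε ≤ 1) (K M : ℕ) (hK : 1 ≤ K)
    (hM : 24 * M ≤ n * d) (q : ℝ) (hq0 : 0 < q) (hq : 2 * d * (Real.exp 1 * M / ε) / n ≤ q) (hq1 : q ≤ 1)
    (hz : d ^ 2 * q ^ ε ≤ 1) :
    PPr n d (fun G _ => ¬ PA ε K M G) ≤ M * (n * (d ^ 2 * q ^ ε) ^ K) := by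
  have hn0 : 0 < n := by omega
  have step : ∀ m ∈ Finset.Icc K M, PPr n d (fun G _ => ∃ B, Grown G B ∧ B.card = m ∧
      m + ⌈ε * m⌉₊ ≤ (eIn G B).card + 1) ≤ n * (d ^ 2 * q ^ ε) ^ K := by
    intro m hm
    rw [Finset.mem_Icc] at hm
    set r := ⌈ε * m⌉₊ with hr
    have hrm : r ≤ m := by
      rw [hr]; apply Nat.ceil_le.2
      nlinarith [Nat.cast_nonneg (α := ℝ) m]
    have hr' : ε * m ≤ r := Nat.le_ceil _
    have h1 := count_dense (n := n) hd hn m r (by omega) (by omega)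
    apply PPr_le (by positivity)
    have hconst : ∀ p : Prop, (muE n).real {_w : W n | p} = if p then 1 else 0 := by
      intro p
      have : IsProbabilityMeasure (muE n) := by rw [muE_eq]; infer_instance
      by_cases hp : p <;> simp [hp]
    have hsum : ∑ G ∈ Reg n d, (muE n).real {_w : W n | ∃ B, Grown G B ∧ B.card = m ∧
        m + r ≤ (eIn G B).card + 1} = (((Reg n d).filter fun G => ∃ B, Grown G B ∧ B.card = m ∧
        m + r ≤ (eIn G B).card + 1).card : ℝ) := by
      rw [Finset.card_filter]
      push_cast
      refine Finset.sum_congr rfl fun G _ => ?_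
      rw [hconst]
      congr!
    rw [hsum]
    have hnr : (0:ℝ) < (n:ℝ) ^ r := by positivity
    rw [← mul_le_mul_iff_right₀ hnr]
    have h1' : (n:ℝ) ^ r * (((Reg n d).filter fun G => ∃ B, Grown G B ∧ B.card = m ∧
        m + r ≤ (eIn G B).card + 1).card : ℝ) ≤
      (Reg n d).card * (n * d ^ (2 * m) * (((m ^ 2).choose r : ℕ) * (2 * d) ^ r)) := by exact_mod_cast h1
    refine h1'.trans ?_
    rw [mul_left_comm ((n:ℝ) ^ r)]
    apply mul_le_mul_of_nonneg_left _ (Nat.cast_nonneg _)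
    rw [mul_left_comm ((n:ℝ) ^ r), mul_assoc]
    apply mul_le_mul_of_nonneg_left _ (Nat.cast_nonneg _)
    have hc := choose_bound m r ε hε hr' (by omega)
    have hmM : (m:ℝ) ≤ M := by exact_mod_cast hm.2
    have hn1 : (0:ℝ) < n := by exact_mod_cast hn0
    have e1 : ((((m ^ 2).choose r : ℕ):ℝ) * (2 * d) ^ r) ≤ (n:ℝ) ^ r * q ^ r := by
      calc _ ≤ (Real.exp 1 * m / ε) ^ r * (2 * d) ^ r := by gcongr
        _ = (2 * d * (Real.exp 1 * m / ε)) ^ r := by rw [← mul_pow, mul_comm]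
        _ ≤ (n * q) ^ r := by
            apply pow_le_pow_left₀ (by positivity)
            rw [div_le_iff₀ hn1, mul_comm q] at hq
            refine le_trans ?_ hq
            gcongr
        _ = _ := mul_pow _ _ _
    have e2 : q ^ r ≤ (q ^ ε) ^ m := by
      rw [← Real.rpow_natCast q r, ← Real.rpow_natCast (q ^ ε) m, ← Real.rpow_mul hq0.le]
      exact Real.rpow_le_rpow_of_exponent_ge hq0 hq1 hr'
    calc (d:ℝ) ^ (2 * m) * ((((m ^ 2).choose r : ℕ):ℝ) * (2 * d) ^ r)
        ≤ (d:ℝ) ^ (2 * m) * ((n:ℝ) ^ r * (q ^ ε) ^ m) := by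
          apply mul_le_mul_of_nonneg_left (e1.trans _) (by positivity)
          apply mul_le_mul_of_nonneg_left e2 (by positivity)
      _ = (n:ℝ) ^ r * (d ^ 2 * q ^ ε) ^ m := by rw [mul_pow, pow_mul]; ring
      _ ≤ (n:ℝ) ^ r * (d ^ 2 * q ^ ε) ^ K := by
          apply mul_le_mul_of_nonneg_left _ (by positivity)
          apply pow_le_pow_of_le_one (by positivity) hz hm.1
  calc _ ≤ PPr n d (fun G _ => ∃ m ∈ Finset.Icc K M, ∃ B, Grown G B ∧ B.card = m ∧
      m + ⌈ε * m⌉₊ ≤ (eIn G B).card + 1) := by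
        apply PPr_mono
        intro G hG w hw h
        unfold PA at h
        push Not at h
        obtain ⟨B, h1, h2, h3, h4⟩ := h
        refine ⟨B.card, Finset.mem_Icc.2 ⟨h2, h3⟩, B, h1, rfl, ?_⟩
        have : (⌈ε * B.card⌉₊ : ℝ) < ε * B.card + 1 := Nat.ceil_lt_add_one (by positivity)
        have : ((B.card + ⌈ε * B.card⌉₊ : ℕ) : ℝ) < (((eIn G B).card + 1 : ℕ) : ℝ) := by
          push_cast; linarith
        exact_mod_cast this.le
    _ ≤ ∑ m ∈ Finset.Icc K M, PPr n d (fun G _ => ∃ B, Grown G B ∧ B.card = m ∧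
      m + ⌈ε * m⌉₊ ≤ (eIn G B).card + 1) :=
        PPr_exists (Finset.Icc K M) (fun m G _ => ∃ B, Grown G B ∧ B.card = m ∧
          m + ⌈ε * m⌉₊ ≤ (eIn G B).card + 1)
    _ ≤ ∑ m ∈ Finset.Icc K M, (n * (d ^ 2 * q ^ ε) ^ K : ℝ) := Finset.sum_le_sum step
    _ = ((Finset.Icc K M).card : ℝ) * (n * (d ^ 2 * q ^ ε) ^ K) := by simp
    _ ≤ _ := by
        apply mul_le_mul_of_nonneg_right _ (by positivity)
        rw [Nat.card_Icc]
        exact_mod_cast (by omega)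

lemma PA_ev (hd : 0 < d) (ε : ℝ) (hε : 0 < ε) (hε1 : ε ≤ 1) (K : ℕ) (hK : 7 ≤ ε * K) (M : ℕ → ℕ)
    (hM : ∀ᶠ n : ℕ in atTop, (M n : ℝ) ≤ Real.exp (2 / 3 * Real.log n)) (δ : ℝ) (hδ : 0 < δ) :
    ∀ᶠ n : ℕ in atTop, PPr n d (fun G _ => ¬ PA ε K (M n) G) ≤ δ := by
  set C : ℝ := 2 * d * (Real.exp 1 / ε) with hC
  have hC0 : 0 < C := by positivity
  have hd1 : (1:ℝ) ≤ d := by exact_mod_cast hd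
  have a1 := ev_poly 24 0 (b := 1/3) (ε := 1) (by norm_num) one_pos
  have a2 := ev_poly C 0 (b := 1/3) (ε := 1) (by norm_num) one_pos
  have a3 := ev_poly (d ^ 2 * C ^ ε) 0 (b := ε/3) (ε := 1) (by positivity) one_pos
  have a4 := ev_poly ((d ^ 2 * C ^ ε) ^ K) 0 (b := 2/3) (by norm_num) hδ
  filter_upwards [hM, a1, a2, a3, a4, eventually_ge_atTop (16 + 8 * d)] with n hMn a1 a2 a3 a4 hn
  simp only [pow_zero, mul_one] at a1 a2 a3 a4
  have hn0 : (0:ℝ) < n := by exact_mod_cast (by omega)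
  have hn1 : (n:ℝ) = Real.exp (Real.log n) := (Real.exp_log hn0).symm
  have hlog : 0 ≤ Real.log n := Real.log_nonneg (by exact_mod_cast (by omega))
  set L := Real.log n with hL
  have hsplit : Real.exp (2 / 3 * L) = n * Real.exp (-(1 / 3 * L)) := by
    rw [hn1, ← Real.exp_add]; ring_nf
  set q := C * Real.exp (-(1 / 3 * L)) with hq
  have hqe : q ^ ε = C ^ ε * Real.exp (-(ε / 3 * L)) := by
    rw [hq, Real.mul_rpow hC0.le (Real.exp_pos _).le, ← Real.exp_mul]
    ring_nf
  have hb := PA_fail (n := n) hd hn ε hε hε1 K (M n) (by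
      rcases Nat.eq_zero_or_pos K with h | h
      · rw [h] at hK; norm_num at hK
      · exact h) (by
      have : (24 * (M n : ℝ)) ≤ n * d := by
        calc 24 * (M n : ℝ) ≤ 24 * (n * Real.exp (-(1 / 3 * L))) := by rw [← hsplit]; gcongr
          _ = n * (24 * Real.exp (-(1 / 3 * L))) := by ring
          _ ≤ n * d := by
            apply mul_le_mul_of_nonneg_left _ hn0.le
            linarith
      exact_mod_cast this) q (by positivity) (by
      rw [div_le_iff₀ hn0]
      calc 2 * d * (Real.exp 1 * M n / ε) = C * M n := by rw [hC]; ring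
        _ ≤ C * (n * Real.exp (-(1 / 3 * L))) := by rw [← hsplit]; gcongr
        _ = _ := by rw [hq]; ring) a2 (by
      rw [hqe, ← mul_assoc]; exact a3)
  refine hb.trans ?_
  calc (M n : ℝ) * (n * (d ^ 2 * q ^ ε) ^ K)
      ≤ Real.exp (2/3 * L) * (Real.exp L * ((d ^ 2 * C ^ ε) ^ K * Real.exp (-(7 / 3 * L)))) := by
        rw [← hn1]
        have : (d ^ 2 * q ^ ε) ^ K ≤ (d ^ 2 * C ^ ε) ^ K * Real.exp (-(7 / 3 * L)) := by
          rw [hqe, ← mul_assoc, mul_pow, ← Real.exp_nat_mul]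
          apply mul_le_mul_of_nonneg_left _ (by positivity)
          apply Real.exp_le_exp.2
          nlinarith
        gcongr
    _ = (d ^ 2 * C ^ ε) ^ K * Real.exp (-(2 / 3 * L)) := by
        have : Real.exp (-(2 / 3 * L)) = Real.exp (2/3 * L) * (Real.exp L * Real.exp (-(7 / 3 * L))) := by
          rw [← Real.exp_add, ← Real.exp_add]; ring_nf
        rw [this]; ring
    _ ≤ δ := a4

end grown

end FPP

namespace FPP

section ball
variable {n d : ℕ} {G : SimpleGraph (Fin n)}

/-- chains which start in `S` and never return to it -/
def Arc (G : SimpleGraph (Fin n)) (S : Finset (Fin n)) (l : List (Fin n)) : Prop :=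
  l.IsChain G.Adj ∧ ∃ v post, l = v :: post ∧ v ∈ S ∧ ∀ u ∈ post, u ∉ S

/-- `B` is a first passage ball around `S` of radius at most `T` -/
def Ball (G : SimpleGraph (Fin n)) (w : W n) (S B : Finset (Fin n)) (T : ℝ) : Prop :=
  S ⊆ B ∧ ∀ b ∈ B, ∃ l, Arc G S l ∧ (∀ u ∈ l, u ∈ B) ∧ l.getLast? = some b ∧ wt w l ≤ T ∧
    ∀ r y, Arc G S (r ++ [y]) → (∀ u ∈ r, u ∈ B) → y ∉ B → wt w l < wt w (r ++ [y])

lemma wt_congr {w w' : W n} {l : List (Fin n)} (h : ∀ e ∈ edgesL l, w e = w' e) : wt w l = wt w' l := by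
  unfold wt
  congr 1
  exact List.map_congr_left h

lemma edge_cons {v : Fin n} {post : List (Fin n)} {e : Sym2 (Fin n)} (he : e ∈ edgesL (v :: post)) :
    ∃ u ∈ e, u ∈ post := by
  cases post with
  | nil => simp at he
  | cons u p =>
    rw [edgesL_cons_cons, List.mem_cons] at he
    rcases he with rfl | he
    · exact ⟨u, by simp, by simp⟩
    · induction e with
      | h a b => exact ⟨a, by simp, mem_of_mem_edgesL he (by simp)⟩

lemma Ball.congr_w {w w' : W n} {S B : Finset (Fin n)} {T : ℝ}
    (h : ∀ e, (∃ v ∈ e, v ∉ S) → w e = w' e) (hB : Ball G w S B T) : Ball G w' S B T := by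
  have key : ∀ l, Arc G S l → wt w l = wt w' l := by
    rintro l ⟨-, v, post, rfl, hv, hp⟩
    apply wt_congr
    intro e he
    obtain ⟨u, hu, hup⟩ := edge_cons he
    exact h e ⟨u, hu, hp u hup⟩
  refine ⟨hB.1, fun b hb => ?_⟩
  obtain ⟨l, h1, h2, h3, h4, h5⟩ := hB.2 b hb
  refine ⟨l, h1, h2, h3, by rwa [← key l h1], fun r y hr hr' hy => ?_⟩
  rw [← key l h1, ← key _ hr]
  exact h5 r y hr hr' hy

lemma chain_congr {G' : SimpleGraph (Fin n)} {B : Finset (Fin n)} (h : ∀ x ∈ B, ∀ y, G.Adj x y → G'.Adj x y)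
    (r : List (Fin n)) (y : Fin n) (hr : ∀ u ∈ r, u ∈ B) (hc : (r ++ [y]).IsChain G.Adj) :
    (r ++ [y]).IsChain G'.Adj := by
  induction r with
  | nil => simp
  | cons a r ih =>
    have ih' := ih (fun u hu => hr u (by simp [hu])) (hc.infix ⟨[a], [], by simp⟩)
    cases r with
    | nil =>
      simp only [List.cons_append, List.nil_append, List.isChain_cons_cons] at hc ⊢
      exact ⟨h a (hr a (by simp)) _ hc.1, by simp⟩
    | cons b r =>
      simp only [List.cons_append, List.isChain_cons_cons] at hc ih' ⊢
      exact ⟨h a (hr a (by simp)) _ hc.1, ih'⟩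

lemma Ball.congr_G {G' : SimpleGraph (Fin n)} {w : W n} {S B : Finset (Fin n)} {T : ℝ}
    (h : ∀ x ∈ B, ∀ y, G.Adj x y ↔ G'.Adj x y) (hB : Ball G w S B T) : Ball G' w S B T := by
  refine ⟨hB.1, fun b hb => ?_⟩
  obtain ⟨l, h1, h2, h3, h4, h5⟩ := hB.2 b hb
  refine ⟨l, ⟨?_, h1.2⟩, h2, h3, h4, fun r y hr hr' hy => ?_⟩
  · rcases List.eq_nil_or_concat l with rfl | ⟨r, y, rfl⟩
    · simp
    · rw [List.concat_eq_append] at h1 h2 ⊢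
      exact chain_congr (fun x hx y => (h x hx y).1) r y (fun u hu => h2 u (by simp [hu])) h1.1
  · exact h5 r y ⟨chain_congr (fun x hx y => (h x hx y).2) r y hr' hr.1, hr.2⟩ hr' hy

lemma exit_le {w : W n} (hw : ∀ e, 0 ≤ w e) {S B : Finset (Fin n)} (hS : S ⊆ B) {l : List (Fin n)}
    (hl : Arc G S l) {b : Fin n} (hb : b ∈ l) (hbB : b ∉ B) :
    ∃ r y, Arc G S (r ++ [y]) ∧ (∀ u ∈ r, u ∈ B) ∧ y ∉ B ∧ wt w (r ++ [y]) ≤ wt w l := by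
  obtain ⟨mid, y, rest, rfl, hy, hmid⟩ := first_mem (p := fun x => x ∉ B) l ⟨b, hb, hbB⟩
  have hpre : (mid ++ [y]) <:+: (mid ++ y :: rest) := ⟨[], rest, by simp⟩
  refine ⟨mid, y, ⟨hl.1.infix hpre, ?_⟩, fun u hu => by simpa using hmid u hu, hy, wt_infix hw hpre⟩
  obtain ⟨v, post, h1, h2, h3⟩ := hl.2
  cases mid with
  | nil =>
    simp only [List.nil_append, List.cons.injEq] at h1
    exact absurd (hS (h1.1 ▸ h2)) hy
  | cons a mid =>
    simp only [List.cons_append, List.cons.injEq] at h1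
    obtain ⟨rfl, rfl⟩ := h1
    refine ⟨a, mid ++ [y], rfl, h2, fun u hu => h3 u ?_⟩
    simp only [List.mem_append, List.mem_cons, List.not_mem_nil, or_false] at hu ⊢
    tauto

lemma Ball.unique {w : W n} (hw : ∀ e, 0 ≤ w e) {S B B' : Finset (Fin n)} {T T' : ℝ}
    (h : Ball G w S B T) (h' : Ball G w S B' T') (hc : B.card = B'.card) : B = B' := by
  by_contra hne
  have h1 : ∃ b ∈ B, b ∉ B' := by
    by_contra hcon
    push Not at hcon
    exact hne (Finset.eq_of_subset_of_card_le hcon hc.ge)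
  have h2 : ∃ b ∈ B', b ∉ B := by
    by_contra hcon
    push Not at hcon
    exact hne (Finset.eq_of_subset_of_card_le hcon hc.le).symm
  obtain ⟨b, hb, hb'⟩ := h1
  obtain ⟨c, hc, hc'⟩ := h2
  obtain ⟨l, l1, l2, l3, l4, l5⟩ := h.2 b hb
  obtain ⟨k, k1, k2, k3, k4, k5⟩ := h'.2 c hc
  obtain ⟨r, y, a1, a2, a3, a4⟩ := exit_le hw h'.1 l1 (List.mem_of_getLast? l3) hb'
  obtain ⟨r', y', b1, b2, b3, b4⟩ := exit_le hw h.1 k1 (List.mem_of_getLast? k3) hc'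
  have := k5 r y a1 a2 a3
  have := l5 r' y' b1 b2 b3
  linarith

lemma Ball.base {w : W n} (hw : ∀ e, 0 < w e) (S : Finset (Fin n)) {T : ℝ} (hT : 0 ≤ T) : Ball G w S S T := by
  refine ⟨subset_rfl, fun b hb => ⟨[b], ⟨by simp, b, [], rfl, hb, by simp⟩, by simpa using hb, by simp,
    by simpa using hT, ?_⟩⟩
  rintro r y ⟨-, v, post, h1, h2, h3⟩ h4 h5
  cases r with
  | nil =>
    simp only [List.nil_append, List.cons.injEq] at h1
    exact absurd (h1.1 ▸ h2) h5
  | cons a r =>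
    cases r with
    | nil => simpa using hw _
    | cons c r =>
      simp only [List.cons_append, wt_singleton, wt_cons_cons]
      have := wt_nonneg (fun e => (hw e).le) (c :: (r ++ [y]))
      have := hw s(a, c)
      linarith

lemma Ball.mono {w : W n} {S B : Finset (Fin n)} {T T' : ℝ} (h : Ball G w S B T) (hT : T ≤ T') :
    Ball G w S B T' := by
  refine ⟨h.1, fun b hb => ?_⟩
  obtain ⟨l, h1, h2, h3, h4, h5⟩ := h.2 b hb
  exact ⟨l, h1, h2, h3, h4.trans hT, h5⟩

lemma Ball.step {w1 w2 : W n} (hw1 : ∀ e, 0 ≤ w1 e) (hw2 : ∀ e, 0 ≤ w2 e) {S B : Finset (Fin n)} {T s : ℝ}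
    (hs : 0 ≤ s) {x y : Fin n} (hx : x ∈ S) (hy : y ∉ S) (hxy : G.Adj x y) (hws : w1 s(x, y) = s)
    (hD : ∀ e ∈ bd G S, e ≠ s(x, y) → w1 e = w2 e + s) (hO : ∀ e, (∀ v ∈ e, v ∉ S) → w1 e = w2 e)
    (h : Ball G w2 (insert y S) B T) : Ball G w1 S B (T + s) := by
  have hSB : S ⊆ B := (Finset.subset_insert y S).trans h.1
  have hyB : y ∈ B := h.1 (by simp)
  have hout : ∀ l : List (Fin n), (∀ u ∈ l, u ∉ S) → wt w1 l = wt w2 l := by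
    intro l hl
    apply wt_congr
    intro e he
    exact hO e fun v hv => hl v (mem_of_mem_edgesL he hv)
  have hfirst : ∀ v u p, v ∈ S → (∀ z ∈ u :: p, z ∉ S) → u ≠ y → G.Adj v u →
      wt w1 (v :: u :: p) = wt w2 (v :: u :: p) + s := by
    intro v u p hv hu huy hvu
    have hu' : u ∉ S := hu u (by simp)
    rw [wt_cons_cons, wt_cons_cons, hout (u :: p) hu, hD s(v, u) (mem_bd.2 ⟨v, u, rfl, hvu, hv, hu'⟩)]
    · ring
    · intro hcon
      rcases Sym2.eq_iff.1 hcon with ⟨_, h⟩ | ⟨_, h⟩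
      · exact huy h
      · exact hu' (h ▸ hx)
  have hge : ∀ e ∈ bd G S, s ≤ w1 e := by
    intro e he
    by_cases h : e = s(x, y)
    · rw [h, hws]
    · rw [hD e he h]; linarith [hw2 e]
  refine ⟨hSB, fun b hb => ?_⟩
  obtain ⟨l, ⟨l1, v, post, rfl, hv, hpost⟩, l2, l3, l4, l5⟩ := h.2 b hb
  -- the arc
  have hA : ∃ l', Arc G S l' ∧ (∀ u ∈ l', u ∈ B) ∧ l'.getLast? = some b ∧
      wt w1 l' ≤ wt w2 (v :: post) + s := by
    have hpS : ∀ u ∈ post, u ∉ S := fun u hu hus => hpost u hu (by simp [hus])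
    rw [Finset.mem_insert] at hv
    rcases hv with rfl | hv
    · refine ⟨x :: v :: post, ⟨by rw [List.isChain_cons_cons]; exact ⟨hxy, l1⟩, x, v :: post, rfl, hx, ?_⟩,
        ?_, ?_, ?_⟩
      · intro u hu
        rcases List.mem_cons.1 hu with rfl | hu
        · exact hy
        · exact hpS u hu
      · intro u hu
        rcases List.mem_cons.1 hu with rfl | hu
        · exact hSB hx
        · exact l2 u hu
      · rw [← l3]; simp
      · rw [wt_cons_cons, hws, hout (v :: post)]
        · linarith
        · intro u hu
          rcases List.mem_cons.1 hu with rfl | hu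
          · exact hy
          · exact hpS u hu
    · refine ⟨v :: post, ⟨l1, v, post, rfl, hv, hpS⟩, l2, l3, ?_⟩
      cases post with
      | nil => simpa using hs
      | cons u p =>
        rw [hfirst v u p hv hpS (fun h => hpost u (by simp) (by simp [h])) (List.isChain_cons_cons.1 l1).1]
  obtain ⟨l', k1, k2, k3, k4⟩ := hA
  refine ⟨l', k1, k2, k3, by linarith, ?_⟩
  rintro r z ⟨r1, v', post', hr, hv', hpost'⟩ r2 hz
  -- the exits
  suffices ∃ r2, Arc G (insert y S) (r2 ++ [z]) ∧ (∀ u ∈ r2, u ∈ B) ∧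
      wt w2 (r2 ++ [z]) + s ≤ wt w1 (r ++ [z]) by
    obtain ⟨r', a1, a2, a3⟩ := this
    have := l5 r' z a1 a2 hz
    linarith
  have hzy : z ≠ y := fun h => hz (h ▸ hyB)
  cases r with
  | nil =>
    simp only [List.nil_append, List.cons.injEq] at hr
    exact absurd (hSB (hr.1 ▸ hv')) hz
  | cons a r =>
    simp only [List.cons_append, List.cons.injEq] at hr
    obtain ⟨rfl, rfl⟩ := hr
    by_cases hyr : y ∈ r
    · -- last visit to y
      obtain ⟨as, bs, h1, h2⟩ := List.eq_append_cons_of_mem (List.mem_reverse.2 hyr)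
      have h3 : r = bs.reverse ++ y :: as.reverse := by
        rw [← List.reverse_reverse r, h1]; simp
      set p1 := bs.reverse
      set p2 := as.reverse with hp2
      have h2' : y ∉ p2 := by rw [hp2]; simpa using h2
      have hsuf : (y :: p2 ++ [z]) <:+: (a :: r ++ [z]) := ⟨a :: p1, [], by rw [h3]; simp⟩
      refine ⟨y :: p2, ⟨r1.infix hsuf, y, p2 ++ [z], rfl, by simp, ?_⟩, ?_, ?_⟩
      · intro u hu
        rw [Finset.mem_insert, not_or]
        constructor
        · rintro rfl
          simp only [List.mem_append, List.mem_cons, List.not_mem_nil, or_false] at hu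
          rcases hu with hu | hu
          · exact h2' hu
          · exact hzy hu.symm
        · apply hpost' u
          rw [h3]
          simp only [List.mem_append, List.mem_cons, List.not_mem_nil, or_false] at hu ⊢
          tauto
      · intro u hu
        apply r2 u
        rw [h3]
        simp only [List.mem_append, List.mem_cons] at hu ⊢
        tauto
      · have e1 : a :: r ++ [z] = (a :: p1) ++ y :: (p2 ++ [z]) := by rw [h3]; simp
        rw [e1, wt_append w1 (a :: p1) (p2 ++ [z]) y, ← hout ((y :: p2) ++ [z])]
        · have e2 : s ≤ wt w1 (a :: p1 ++ [y]) := by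
            have hch : (a :: p1 ++ [y]).IsChain G.Adj :=
              r1.infix ⟨[], p2 ++ [z], by rw [h3]; simp⟩
            cases hp1 : p1 with
            | nil =>
              rw [hp1] at hch
              simp only [List.cons_append, List.nil_append, List.isChain_cons_cons] at hch
              simp only [List.cons_append, List.nil_append, wt_cons_cons, wt_singleton, add_zero]
              exact hge _ (mem_bd.2 ⟨a, y, rfl, hch.1, hv', hy⟩)
            | cons c p =>
              rw [hp1] at hch
              simp only [List.cons_append, List.isChain_cons_cons] at hch
              simp only [List.cons_append, wt_cons_cons]
              have hc : c ∉ S := hpost' c (by rw [h3, hp1]; simp)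
              have := hge _ (mem_bd.2 ⟨a, c, rfl, hch.1, hv', hc⟩)
              have := wt_nonneg hw1 (c :: (p ++ [y]))
              linarith
          simp only [List.cons_append] at e2 ⊢
          linarith
        · intro u hu
          apply hpost' u
          rw [h3]
          simp only [List.mem_append, List.mem_cons, List.not_mem_nil, or_false] at hu ⊢
          tauto
    · refine ⟨a :: r, ⟨r1, a, r ++ [z], rfl, by simp [hv'], ?_⟩, r2, ?_⟩
      · intro u hu
        rw [Finset.mem_insert, not_or]
        refine ⟨?_, hpost' u hu⟩
        rintro rfl
        simp only [List.mem_append, List.mem_cons, List.not_mem_nil, or_false] at hu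
        rcases hu with hu | hu
        · exact hyr hu
        · exact hzy hu.symm
      · cases r with
        | nil =>
          simp only [List.cons_append, List.nil_append] at r1 ⊢
          rw [hfirst a z [] hv' (by simpa using hpost') hzy (List.isChain_cons_cons.1 r1).1]
        | cons u p =>
          simp only [List.cons_append] at r1 ⊢
          rw [hfirst a u (p ++ [z]) hv' hpost' (fun h => hyr (by simp [h])) (List.isChain_cons_cons.1 r1).1]

lemma Ball.meas {X : Type*} [MeasurableSpace X] {wf : X → W n} (hwf : Measurable wf) {Tf : X → ℝ}
    (hTf : Measurable Tf) (S B : Finset (Fin n)) : Measurable (fun x => Ball G (wf x) S B (Tf x)) := by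
  have hm : ∀ l, Measurable (fun x => wt (wf x) l) := fun l => (wt_meas l).comp hwf
  unfold Ball
  refine measurable_const.and (Measurable.forall fun b => Measurable.forall fun _ => Measurable.exists fun l =>
    measurable_const.and (measurable_const.and (measurable_const.and (Measurable.and ?_ ?_))))
  · exact measurableSet_setOfPred.1 (measurableSet_le (hm l) hTf)
  · refine Measurable.forall fun r => Measurable.forall fun y => Measurable.forall fun _ =>
      Measurable.forall fun _ => Measurable.forall fun _ => ?_
    exact measurableSet_setOfPred.1 (measurableSet_lt (hm l) (hm _))

end ball

end FPP

namespace FPP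

section growth
variable {n d : ℕ} {G : SimpleGraph (Fin n)}

lemma exp_pos_ae : ∀ᵐ s ∂(expMeasure 1), 0 < s := by
  have h0 : ∀ᵐ s ∂(expMeasure 1), s ≠ 0 := by
    rw [exp_eq]
    apply (withDensity_absolutelyContinuous volume edens).ae_le
    exact Measure.ae_ne volume 0
  filter_upwards [exp_nonneg_ae, h0] with s h1 h2
  exact lt_of_le_of_ne h1 h2.symm

lemma mu_pos_ae {ι : Type*} [Fintype ι] : ∀ᵐ w ∂(mu ι), ∀ e, 0 < w e := by
  rw [ae_all_iff]
  intro e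
  have h := (measurePreserving_eval (fun _ : ι => expMeasure 1) e)
  exact h.quasiMeasurePreserving.ae (p := fun x => 0 < x) exp_pos_ae

/-- there is no ball with `M` vertices within radius `T` -/
def NoBall (G : SimpleGraph (Fin n)) (M : ℕ) (S : Finset (Fin n)) (w : W n) (T : ℝ) : Prop :=
  ¬ ∃ B, Grown G B ∧ B.card = M ∧ Ball G w S B T

lemma NoBall.meas {X : Type*} [MeasurableSpace X] {wf : X → W n} (hwf : Measurable wf) {Tf : X → ℝ}
    (hTf : Measurable Tf) (M : ℕ) (S : Finset (Fin n)) : Measurable (fun x => NoBall G M S (wf x) (Tf x)) := by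
  unfold NoBall
  refine Measurable.not (Measurable.exists fun B => measurable_const.and (measurable_const.and ?_))
  exact Ball.meas hwf hTf S B

lemma cm_step (m M θ' : ℕ) (hm : θ' + 2 ≤ m) :
    (m : ℝ) / (m - θ') * ((M : ℝ) / ((m + 1 : ℕ) - θ' - 1)) ^ θ' ≤ ((M : ℝ) / (m - θ' - 1)) ^ θ' := by
  have hm' : (θ' : ℝ) + 2 ≤ m := by exact_mod_cast hm
  have hu : (0:ℝ) < m - θ' - 1 := by linarith
  have hv : (0:ℝ) < m - θ' := by linarith
  push_cast
  have e1 : ((m:ℝ) + 1 - θ' - 1) = m - θ' := by ring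
  rw [e1]
  have h1 : (m : ℝ) / (m - θ') ≤ ((m - θ') / (m - θ' - 1)) ^ θ' := by
    have hB := one_add_mul_le_pow (a := 1 / ((m:ℝ) - θ' - 1)) (by
      have : 0 < 1 / ((m:ℝ) - θ' - 1) := by positivity
      linarith) θ'
    have e2 : (1 + 1 / ((m:ℝ) - θ' - 1)) = (m - θ') / (m - θ' - 1) := by field_simp; ring
    rw [e2] at hB
    refine le_trans ?_ hB
    have e3 : (m:ℝ) / (m - θ') = 1 + θ' * (1 / (m - θ')) := by field_simp; ring
    rw [e3]
    have : 1 / ((m:ℝ) - θ') ≤ 1 / (m - θ' - 1) := one_div_le_one_div_of_le hu (by linarith)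
    nlinarith [Nat.cast_nonneg (α := ℝ) θ']
  calc (m : ℝ) / (m - θ') * ((M : ℝ) / (m - θ')) ^ θ'
      ≤ ((m - θ') / (m - θ' - 1)) ^ θ' * ((M : ℝ) / (m - θ')) ^ θ' :=
        mul_le_mul_of_nonneg_right h1 (by positivity)
    _ = ((M : ℝ) / (m - θ' - 1)) ^ θ' := by
        rw [← mul_pow]; congr 1; field_simp

set_option maxHeartbeats 2000000 in
lemma growth (M θ' : ℕ) (lam : ℝ) (hlam : 0 < lam)
    (hb : ∀ S, Grown G S → θ' + 2 ≤ S.card → S.card ≤ M → lam * S.card ≤ (bd G S).card) (j : ℕ) :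
    ∀ S, Grown G S → θ' + 2 ≤ S.card → S.card + j = M → ∀ T : ℝ,
      mu (Sym2 (Fin n)) {w | NoBall G M S w T} ≤
        ENNReal.ofReal (Real.exp (-(lam * θ' * T)) * ((M : ℝ) / (S.card - θ' - 1)) ^ θ') := by
  induction j with
  | zero =>
    intro S hS hK hM T
    have hK' : (θ' : ℝ) + 2 ≤ S.card := by exact_mod_cast hK
    by_cases hT : 0 ≤ T
    · have : mu (Sym2 (Fin n)) {w | NoBall G M S w T} = 0 := by
        rw [measure_eq_zero_iff_ae_notMem]
        filter_upwards [mu_pos_ae] with w hw h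
        exact h ⟨S, hS, by omega, Ball.base hw S hT⟩
      rw [this]; exact zero_le
    · refine prob_le_one.trans ?_
      rw [← ENNReal.ofReal_one]
      apply ENNReal.ofReal_le_ofReal
      push Not at hT
      have h1 : 1 ≤ Real.exp (-(lam * θ' * T)) := by
        apply Real.one_le_exp
        have : 0 ≤ lam * θ' := by positivity
        nlinarith
      have h2 : 1 ≤ ((M : ℝ) / (S.card - θ' - 1)) ^ θ' := by
        apply one_le_pow₀
        rw [one_le_div (by linarith)]
        have : (M:ℝ) = S.card := by rw [← hM]; simp
        rw [this]; linarith [Nat.cast_nonneg (α := ℝ) θ']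
      nlinarith
  | succ j ih =>
    intro S hS hK hM T
    have hK' : (θ' : ℝ) + 2 ≤ S.card := by exact_mod_cast hK
    set D := bd G S with hD
    have hbS := hb S hS hK (by omega)
    rw [← hD] at hbS
    set b : ℝ := (D.card : ℝ) with hbdef
    set θ := lam * θ' with hθ
    have hbθ : θ < b := by
      refine lt_of_lt_of_le ?_ hbS
      rw [hθ]; apply mul_lt_mul_of_pos_left _ hlam; linarith
    set c := ((M : ℝ) / ((S.card + 1 : ℕ) - θ' - 1)) ^ θ' with hc
    have hc0 : 0 ≤ c := by
      rw [hc]; apply pow_nonneg; apply div_nonneg (Nat.cast_nonneg _); push_cast; linarith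
    -- endpoints
    have hep : ∀ e : Sym2 (Fin n), ∃ x y, e ∈ D → e = s(x, y) ∧ G.Adj x y ∧ x ∈ S ∧ y ∉ S := by
      intro e
      by_cases he : e ∈ D
      · obtain ⟨x, y, h⟩ := mem_bd.1 he
        exact ⟨x, y, fun _ => h⟩
      · induction e with
        | h a b => exact ⟨a, b, fun h => absurd h he⟩
    choose xx yy hxy using hep
    set sh : Sym2 (Fin n) → W n → W n := fun e w i => if i ∈ D.erase e then w i - w e else w i with hsh
    have hshm : ∀ e, Measurable (sh e) := by
      intro e
      rw [measurable_pi_iff]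
      intro i
      by_cases hi : i ∈ D.erase e
      · simp only [hsh, if_pos hi]; fun_prop
      · simp only [hsh, if_neg hi]; fun_prop
    set A : Sym2 (Fin n) → Set (W n) := fun e => {w | (∀ f ∈ D.erase e, w e ≤ w f) ∧
      NoBall G M (insert (yy e) S) (sh e w) (T - w e)} with hA
    have hAm : ∀ e, MeasurableSet (A e) := by
      intro e
      have h1 : Measurable (fun w : W n => ∀ f ∈ D.erase e, w e ≤ w f) := by
        refine Measurable.forall fun f => Measurable.forall fun _ => ?_
        exact measurableSet_setOfPred.1 (measurableSet_le (by fun_prop) (by fun_prop))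
      exact measurableSet_setOfPred.2 (h1.and (NoBall.meas (hshm e) (by fun_prop) _ _))
    have hcover : mu (Sym2 (Fin n)) {w | NoBall G M S w T} ≤ ∑ e ∈ D, mu (Sym2 (Fin n)) (A e) := by
      refine le_trans (measure_mono_ae ?_) (measure_biUnion_finset_le D A)
      have hae := mu_nonneg_ae (ι := Sym2 (Fin n))
      filter_upwards [hae] with w hw h
      have hDne : D.Nonempty := by
        rw [← Finset.card_pos]
        have : 0 < b := lt_of_le_of_lt (by positivity) hbθ
        rw [hbdef] at this
        exact_mod_cast this
      obtain ⟨e, he, hmin⟩ := Finset.exists_min_image D w hDne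
      have : w ∈ A e := by
        refine ⟨fun f hf => hmin f (Finset.mem_of_mem_erase hf), ?_⟩
        rintro ⟨B, hB1, hB2, hB3⟩
        obtain ⟨e1, e2, e3, e4⟩ := hxy e he
        refine h ⟨B, hB1, hB2, ?_⟩
        have := Ball.step (w1 := w) (w2 := sh e w) hw (by
          intro f
          by_cases hf : f ∈ D.erase e
          · simp only [hsh, if_pos hf]
            linarith [hmin f (Finset.mem_of_mem_erase hf)]
          · simp only [hsh, if_neg hf]; exact hw f) (hw e) e3 e4 e2 (by rw [← e1]) (by
          intro f hf hne
          rw [← e1] at hne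
          have : f ∈ D.erase e := Finset.mem_erase.2 ⟨hne, hf⟩
          simp only [hsh, if_pos this]; ring) (by
          intro f hf
          have : f ∉ D.erase e := by
            intro hcon
            obtain ⟨x, y, rfl, k1, k2, k3⟩ := mem_bd.1 (Finset.mem_of_mem_erase hcon)
            exact hf x (by simp) k2
          simp only [hsh, if_neg this]) hB3
        rwa [sub_add_cancel] at this
      show w ∈ ⋃ e ∈ D, A e
      simp only [Set.mem_iUnion]
      exact ⟨e, he, this⟩
    have hone : ∀ e ∈ D, mu (Sym2 (Fin n)) (A e) ≤
        ENNReal.ofReal (c * Real.exp (-(θ * T)) * (1 / (b - θ))) := by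
      intro e he
      obtain ⟨e1, e2, e3, e4⟩ := hxy e he
      rw [mu_update e (hAm e)]
      have hlap := laplace (θ := b - 1 - θ) (by linarith)
      have e5 : 1 + (b - 1 - θ) = b - θ := by ring
      rw [e5] at hlap
      rw [ENNReal.ofReal_mul (by positivity), ← hlap, ← lintegral_const_mul _ (by fun_prop)]
      apply lintegral_mono_ae
      filter_upwards [exp_nonneg_ae] with s hs
      refine (measure_mono (t := {w | (∀ f ∈ D.erase e, s ≤ w f) ∧ (fun i => if i ∈ D.erase e then w i - s else w i) ∈
            {w | NoBall G M (insert (yy e) S) w (T - s)}}) ?_).trans ?_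
      · intro w hw
        obtain ⟨k1, k2⟩ := hw
        simp only [Function.update_self] at k1 k2
        have hup : ∀ f, f ≠ e → @Function.update (Sym2 (Fin n)) (fun _ => ℝ) (fun a b => Classical.propDecidable (a = b)) w e s f = w f := by
          intro f hf
          simp only [Function.update, dif_neg hf]
        refine ⟨?_, ?_⟩
        · intro f hf
          have := k1 f hf
          exact this.trans (hup f (Finset.ne_of_mem_erase hf)).le
        · rintro ⟨B, hB1, hB2, hB3⟩
          refine k2 ⟨B, hB1, hB2, hB3.congr_w ?_⟩
          rintro f ⟨v, hv, hvS⟩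
          have hfe : f ≠ e := by
            rintro rfl
            rw [e1, Sym2.mem_iff] at hv
            apply hvS
            rcases hv with h | h <;> simp [h, e3]
          by_cases hf : f ∈ D.erase e
          · simp only [hsh, if_pos hf, Function.update_self]
            exact congrArg (· - s) (hup f hfe).symm
          · simp only [hsh, if_neg hf]
            exact (hup f hfe).symm
      have hm1 : MeasurableSet {w : W n | NoBall G M (insert (yy e) S) w (T - s)} :=
        measurableSet_setOfPred.2 (NoBall.meas measurable_id measurable_const _ _)
      have hml := memoryless (D.erase e) hs hm1
      refine (le_of_eq (Eq.trans (by congr!) hml)).trans ?_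
      have hS' : Grown G (insert (yy e) S) := hS.step e3 e4 e2
      have hcard : (insert (yy e) S).card = S.card + 1 := Finset.card_insert_of_notMem e4
      have := ih (insert (yy e) S) hS' (by omega) (by omega) (T - s)
      rw [hcard, ← hc] at this
      refine (mul_le_mul_right this _).trans ?_
      rw [← ENNReal.ofReal_mul (by positivity), ← ENNReal.ofReal_mul (by positivity)]
      apply ENNReal.ofReal_le_ofReal
      apply le_of_eq
      have hce : ((D.erase e).card : ℝ) = b - 1 := by
        rw [Finset.card_erase_of_mem he, Nat.cast_sub (Finset.card_pos.2 ⟨e, he⟩)]; simp [hbdef]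
      rw [hce]
      have : Real.exp (-(s * (b - 1))) * Real.exp (-(θ * (T - s))) =
          Real.exp (-(θ * T)) * Real.exp (-((b - 1 - θ) * s)) := by
        rw [← Real.exp_add, ← Real.exp_add]; congr 1; ring
      rw [← mul_assoc, this]; ring
    refine hcover.trans ((Finset.sum_le_sum hone).trans ?_)
    rw [Finset.sum_const, nsmul_eq_mul, ← ENNReal.ofReal_natCast, ← ENNReal.ofReal_mul (by positivity)]
    apply ENNReal.ofReal_le_ofReal
    have hfin := cm_step S.card M θ' hK
    rw [← hc] at hfin
    have hfrac : b / (b - θ) ≤ (S.card : ℝ) / (S.card - θ') := by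
      rw [div_le_div_iff₀ (by linarith) (by linarith)]
      have : (0:ℝ) ≤ θ' := Nat.cast_nonneg _
      rw [hθ]
      nlinarith
    calc (D.card : ℝ) * (c * Real.exp (-(θ * T)) * (1 / (b - θ)))
        = Real.exp (-(θ * T)) * (b / (b - θ) * c) := by rw [← hbdef]; ring
      _ ≤ Real.exp (-(θ * T)) * ((S.card : ℝ) / (S.card - θ') * c) := by
          apply mul_le_mul_of_nonneg_left _ (Real.exp_pos _).le
          exact mul_le_mul_of_nonneg_right hfrac hc0
      _ ≤ _ := mul_le_mul_of_nonneg_left hfin (Real.exp_pos _).le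

end growth

end FPP

namespace FPP

section switch
variable {n d : ℕ} {G : SimpleGraph (Fin n)} {w : W n} {h T : ℝ} {M s : ℕ} {S S' B B' : Finset (Fin n)}

/-- vertices outside `U` with a light edge to `B` and a neighbour outside `U` -/
def AA (G : SimpleGraph (Fin n)) (w : W n) (h : ℝ) (B U : Finset (Fin n)) : Finset (Fin n) :=
  Finset.univ.filter fun a => a ∉ U ∧ (∃ b ∈ B, G.Adj a b ∧ w s(a, b) ≤ h) ∧ ∃ x, x ∉ U ∧ G.Adj a x

lemma mem_AA {U : Finset (Fin n)} {a : Fin n} : a ∈ AA G w h B U ↔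
    a ∉ U ∧ (∃ b ∈ B, G.Adj a b ∧ w s(a, b) ≤ h) ∧ ∃ x, x ∉ U ∧ G.Adj a x := by simp [AA]

/-- a subset of size `s` -/
def pick (s : ℕ) (A : Finset (Fin n)) : Finset (Fin n) :=
  if h : s ≤ A.card then (Finset.exists_subset_card_eq h).choose else ∅

lemma pick_spec {A : Finset (Fin n)} (hs : s ≤ A.card) : pick s A ⊆ A ∧ (pick s A).card = s := by
  unfold pick
  rw [dif_pos hs]
  exact (Finset.exists_subset_card_eq hs).choose_spec

/-- two balls with large disjoint attachment sets -/
structure Cfg (G : SimpleGraph (Fin n)) (w : W n) (h T : ℝ) (M s : ℕ) (S S' B B' : Finset (Fin n)) : Prop where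
  cB : B.card = M
  cB' : B'.card = M
  bB : Ball G w S B T
  bB' : Ball G w S' B' T
  sA : s ≤ (AA G w h B (B ∪ B')).card
  sA' : s ≤ (AA G w h B' (B ∪ B')).card
  dA : Disjoint (AA G w h B (B ∪ B')) (AA G w h B' (B ∪ B'))

/-- adjacent light pairs -/
def Xp (G : SimpleGraph (Fin n)) (w : W n) (h : ℝ) (s : ℕ) (B B' : Finset (Fin n)) : Finset (Fin n × Fin n) :=
  (pick s (AA G w h B (B ∪ B')) ×ˢ pick s (AA G w h B' (B ∪ B'))).filter
    fun p => G.Adj p.1 p.2 ∧ w s(p.1, p.2) ≤ h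

/-- levels -/
def Lev (n d : ℕ) (w : W n) (h T : ℝ) (M s : ℕ) (S S' : Finset (Fin n)) (k : ℕ) : Finset (SimpleGraph (Fin n)) :=
  (Reg n d).filter fun G => ∃ B B', Cfg G w h T M s S S' B B' ∧ (Xp G w h s B B').card ≤ k

/-- few heavy pairs between disjoint sets of size `s` -/
def LD (w : W n) (h : ℝ) (s : ℕ) : Prop :=
  ∀ (A A' : Finset (Fin n)) (F : Finset (Fin n × Fin n)), Disjoint A A' → A.card = s → A'.card = s →
    F ⊆ A ×ˢ A' → (∀ p ∈ F, h < w s(p.1, p.2)) → 2 * F.card ≤ s * s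

lemma sw_adj_U {U : Finset (Fin n)} {a x b y : Fin n} (hS : Sw G a x b y) (ha : a ∉ U) (hx : x ∉ U) (hb : b ∉ U)
    (hy : y ∉ U) : ∀ u ∈ U, ∀ v, G.Adj u v ↔ (sw G a x b y).Adj u v := by
  intro u hu v
  have h1 : u ≠ a := fun h => ha (h ▸ hu)
  have h2 : u ≠ x := fun h => hx (h ▸ hu)
  have h3 : u ≠ b := fun h => hb (h ▸ hu)
  have h4 : u ≠ y := fun h => hy (h ▸ hu)
  have := nb_sw_other hS h1 h2 h3 h4
  rw [← mem_nb, ← mem_nb, this]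

lemma AA_sw_sub {U : Finset (Fin n)} {a x b y : Fin n} (hS : Sw G a x b y) (ha : a ∉ U) (hx : x ∉ U) (hb : b ∉ U)
    (hy : y ∉ U) (hBU : B ⊆ U) : AA G w h B U ⊆ AA (sw G a x b y) w h B U := by
  intro v hv
  rw [mem_AA] at hv ⊢
  obtain ⟨h1, ⟨c, hc, h2, h3⟩, z, hz, h4⟩ := hv
  refine ⟨h1, ⟨c, hc, ?_, h3⟩, ?_⟩
  · rw [SimpleGraph.adj_comm, ← sw_adj_U hS ha hx hb hy c (hBU hc), SimpleGraph.adj_comm]; exact h2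
  · by_cases e1 : v = a
    · exact ⟨b, hb, by rw [sw_adj hS]; simp [e1]⟩
    by_cases e2 : v = x
    · exact ⟨y, hy, by rw [sw_adj hS]; simp [e2]⟩
    by_cases e3 : v = b
    · exact ⟨a, ha, by rw [sw_adj hS]; simp [e3]⟩
    by_cases e4 : v = y
    · exact ⟨x, hx, by rw [sw_adj hS]; simp [e4]⟩
    refine ⟨z, hz, ?_⟩
    rw [← mem_nb, nb_sw_other hS e1 e2 e3 e4, mem_nb]; exact h4

lemma AA_sw {U : Finset (Fin n)} {a x b y : Fin n} (hS : Sw G a x b y) (ha : a ∉ U) (hx : x ∉ U) (hb : b ∉ U)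
    (hy : y ∉ U) (hBU : B ⊆ U) : AA (sw G a x b y) w h B U = AA G w h B U := by
  apply le_antisymm
  · have := AA_sw_sub (w := w) (h := h) hS.inv ha hb hx hy hBU
    rwa [sw_sw hS] at this
  · exact AA_sw_sub hS ha hx hb hy hBU

lemma Cfg.sw (hC : Cfg G w h T M s S S' B B') {a x b y : Fin n} (hS : Sw G a x b y) (ha : a ∉ B ∪ B')
    (hx : x ∉ B ∪ B') (hb : b ∉ B ∪ B') (hy : y ∉ B ∪ B') : Cfg (sw G a x b y) w h T M s S S' B B' := by
  have e1 := AA_sw (w := w) (h := h) hS ha hx hb hy Finset.subset_union_left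
  have e2 := AA_sw (w := w) (h := h) hS ha hx hb hy Finset.subset_union_right
  have e3 := sw_adj_U hS ha hx hb hy
  refine ⟨hC.cB, hC.cB', hC.bB.congr_G fun u hu => e3 u (Finset.mem_union_left _ hu),
    hC.bB'.congr_G fun u hu => e3 u (Finset.mem_union_right _ hu), ?_, ?_, ?_⟩
  · rw [e1]; exact hC.sA
  · rw [e2]; exact hC.sA'
  · rw [e1, e2]; exact hC.dA

lemma Cfg.Xp_sw {a x b y : Fin n} (hS : Sw G a x b y) (ha : a ∉ B ∪ B')
    (hx : x ∉ B ∪ B') (hb : b ∉ B ∪ B') (hy : y ∉ B ∪ B') :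
    (Xp (FPP.sw G a x b y) w h s B B').card ≤ (Xp G w h s B B').card + 4 := by
  have e1 := AA_sw (w := w) (h := h) hS ha hx hb hy Finset.subset_union_left
  have e2 := AA_sw (w := w) (h := h) hS ha hx hb hy Finset.subset_union_right
  have : Xp (FPP.sw G a x b y) w h s B B' ⊆ Xp G w h s B B' ∪ {(a, b), (b, a), (x, y), (y, x)} := by
    rintro ⟨u, v⟩ hp
    unfold Xp at hp ⊢
    rw [e1, e2, Finset.mem_filter, sw_adj hS] at hp
    obtain ⟨k1, k2 | k2 | k2, k3⟩ := hp
    · exact Finset.mem_union_left _ (Finset.mem_filter.2 ⟨k1, k2.1, k3⟩)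
    · apply Finset.mem_union_right
      simp only [Sym2.eq_iff] at k2
      rcases k2 with ⟨k, k'⟩ | ⟨k, k'⟩ <;> simp [k, k']
    · apply Finset.mem_union_right
      simp only [Sym2.eq_iff] at k2
      rcases k2 with ⟨k, k'⟩ | ⟨k, k'⟩ <;> simp [k, k']
  refine (Finset.card_le_card this).trans ((Finset.card_union_le _ _).trans ?_)
  have := Finset.card_le_four (a := (a, b)) (b := (b, a)) (c := (x, y)) (d := (y, x))
  apply Nat.add_le_add_left
  convert this

set_option maxHeartbeats 1000000 in
lemma forward (hG : G ∈ Reg n d) (hLD : LD w h s) (hs : 4 * (d * d + 2 * d) ≤ s)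
    (hC : Cfg G w h T M s S S' B B') {k : ℕ} (hk : (Xp G w h s B B').card ≤ k) :
    ∃ F : Finset ((Fin n × Fin n) × (Fin n × Fin n)), s * s ≤ 4 * F.card ∧
      ∀ q ∈ F, Sw G q.1.1 q.2.1 q.1.2 q.2.2 ∧ Cfg (sw G q.1.1 q.2.1 q.1.2 q.2.2) w h T M s S S' B B' ∧
        (Xp (sw G q.1.1 q.2.1 q.1.2 q.2.2) w h s B B').card ≤ k + 4 ∧
        q.1 ∈ Xp (sw G q.1.1 q.2.1 q.1.2 q.2.2) w h s B B' := by
  set U := B ∪ B' with hU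
  set A0 := pick s (AA G w h B U) with hA0
  set A0' := pick s (AA G w h B' U) with hA0'
  obtain ⟨p1, p2⟩ := pick_spec hC.sA
  obtain ⟨p1', p2'⟩ := pick_spec hC.sA'
  rw [← hU, ← hA0] at p1 p2
  rw [← hU, ← hA0'] at p1' p2'
  have hdis : Disjoint A0 A0' := Finset.disjoint_of_subset_left p1 (Finset.disjoint_of_subset_right p1' hC.dA)
  have hx : ∀ a, ∃ x, a ∈ A0 ∪ A0' → a ∉ U ∧ x ∉ U ∧ G.Adj a x := by
    intro a
    by_cases ha : a ∈ A0 ∪ A0'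
    · rcases Finset.mem_union.1 ha with ha | ha
      · obtain ⟨h1, -, x, h2, h3⟩ := mem_AA.1 (p1 ha)
        exact ⟨x, fun _ => ⟨h1, h2, h3⟩⟩
      · obtain ⟨h1, -, x, h2, h3⟩ := mem_AA.1 (p1' ha)
        exact ⟨x, fun _ => ⟨h1, h2, h3⟩⟩
    · exact ⟨a, fun h => absurd h ha⟩
  choose x hx using hx
  set adm := (A0 ×ˢ A0').filter fun p => w s(p.1, p.2) ≤ h ∧ Sw G p.1 (x p.1) p.2 (x p.2) with hadm
  set hv := (A0 ×ˢ A0').filter fun p => h < w s(p.1, p.2) with hhv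
  set N : Fin n → Finset (Fin n) := fun a => nb G a ∪ nb G (x a) ∪ (nb G (x a)).biUnion (nb G) with hN
  set ex := A0.biUnion fun a => (N a).image (fun b => (a, b)) with hex
  have hsub : A0 ×ˢ A0' ⊆ adm ∪ hv ∪ ex := by
    rintro ⟨a, b⟩ hp
    by_contra hcon
    simp only [Finset.mem_union, not_or] at hcon
    obtain ⟨⟨c1, c2⟩, c3⟩ := hcon
    obtain ⟨ha, hb⟩ := Finset.mem_product.1 hp
    simp only at ha hb
    have hbN : b ∉ N a := by
      intro hb'
      exact c3 (Finset.mem_biUnion.2 ⟨a, ha, Finset.mem_image.2 ⟨b, hb', rfl⟩⟩)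
    simp only [hN, Finset.mem_union, mem_nb, Finset.mem_biUnion, not_or, not_exists, not_and] at hbN
    obtain ⟨⟨n1, n2⟩, n3⟩ := hbN
    obtain ⟨a1, a2, a3⟩ := hx a (Finset.mem_union_left _ ha)
    obtain ⟨b1, b2, b3⟩ := hx b (Finset.mem_union_right _ hb)
    apply c1
    rw [hadm, Finset.mem_filter]
    refine ⟨hp, ?_, ?_, ?_, ?_, ?_, a3, b3, n1, ?_⟩
    · by_contra hh
      exact c2 (Finset.mem_filter.2 ⟨hp, not_le.1 hh⟩)
    · intro e
      simp only at e
      rw [e] at ha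
      exact Finset.disjoint_left.1 hdis ha hb
    · intro e
      simp only at e
      rw [← e] at b3; exact n1 b3.symm
    · intro e
      simp only at e
      rw [e] at a3; exact n1 a3
    · intro e
      simp only at e
      rw [← e] at b3; exact n2 b3.symm
    · intro e
      exact n3 (x b) e b3.symm
  have hdeg := mem_Reg.1 hG
  have hNc : ∀ a, (N a).card ≤ d * d + 2 * d := by
    intro a
    have t1 := Finset.card_union_le (nb G a ∪ nb G (x a)) ((nb G (x a)).biUnion (nb G))
    have t2 := Finset.card_union_le (nb G a) (nb G (x a))
    have t3 := Finset.card_biUnion_le_card_mul (nb G (x a)) (nb G) d (fun v _ => (hdeg v).le)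
    rw [hdeg] at t2 t3
    rw [hdeg] at t2
    calc _ ≤ _ := t1
      _ ≤ _ := by omega
  have hexc : ex.card ≤ s * (d * d + 2 * d) := by
    rw [← p2]
    exact Finset.card_biUnion_le_card_mul _ _ _ fun a _ => Finset.card_image_le.trans (hNc a)
  have hhvc := hLD A0 A0' hv hdis p2 p2' (Finset.filter_subset _ _) (fun p hp => (Finset.mem_filter.1 hp).2)
  have hcard := (Finset.card_le_card hsub).trans ((Finset.card_union_le _ _).trans
    (Nat.add_le_add_right (Finset.card_union_le _ _) _))
  rw [Finset.card_product, p2, p2'] at hcard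
  have hadmc : s * s ≤ 4 * adm.card := by
    have e2 : 4 * (s * (d * d + 2 * d)) ≤ s * s := by
      calc 4 * (s * (d * d + 2 * d)) = s * (4 * (d * d + 2 * d)) := by ring
        _ ≤ s * s := Nat.mul_le_mul_left _ hs
    omega
  refine ⟨adm.image fun p => (p, (x p.1, x p.2)), ?_, ?_⟩
  · rw [Finset.card_image_of_injective]
    · exact hadmc
    · intro p q e
      exact (Prod.mk.inj e).1
  · intro q hq
    obtain ⟨⟨a, b⟩, hp, rfl⟩ := Finset.mem_image.1 hq
    obtain ⟨hp1, hp2, hSw⟩ := Finset.mem_filter.1 hp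
    obtain ⟨ha, hb⟩ := Finset.mem_product.1 hp1
    simp only at ha hb hSw hp2 ⊢
    obtain ⟨a1, a2, a3⟩ := hx a (Finset.mem_union_left _ ha)
    obtain ⟨b1, b2, b3⟩ := hx b (Finset.mem_union_right _ hb)
    refine ⟨hSw, hC.sw hSw a1 a2 b1 b2, (Cfg.Xp_sw hSw a1 a2 b1 b2).trans (by omega), ?_⟩
    unfold Xp
    rw [AA_sw hSw a1 a2 b1 b2 Finset.subset_union_left, AA_sw hSw a1 a2 b1 b2 Finset.subset_union_right,
      Finset.mem_filter]
    refine ⟨hp1, ?_, hp2⟩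
    rw [sw_adj hSw]; simp

lemma Cfg.unique (hw : ∀ e, 0 ≤ w e) {C C' : Finset (Fin n)} (h1 : Cfg G w h T M s S S' B B')
    (h2 : Cfg G w h T M s S S' C C') : B = C ∧ B' = C' :=
  ⟨h1.bB.unique hw h2.bB (h1.cB.trans h2.cB.symm), h1.bB'.unique hw h2.bB' (h1.cB'.trans h2.cB'.symm)⟩

lemma lev_step (hw : ∀ e, 0 ≤ w e) (hLD : LD w h s) (hs : 4 * (d * d + 2 * d) ≤ s) (k : ℕ) :
    s * s * (Lev n d w h T M s S S' k).card ≤ 4 * ((k + 4) * (n * d)) * (Lev n d w h T M s S S' (k + 4)).card := by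
  have hc : ∀ G : SimpleGraph (Fin n), ∃ c : Finset (Fin n) × Finset (Fin n), ∀ B B',
      Cfg G w h T M s S S' B B' → c = (B, B') := by
    intro G
    by_cases hex : ∃ B B', Cfg G w h T M s S S' B B'
    · obtain ⟨B, B', hB⟩ := hex
      refine ⟨(B, B'), fun C C' hC => ?_⟩
      obtain ⟨e1, e2⟩ := hB.unique hw hC
      rw [e1, e2]
    · exact ⟨(∅, ∅), fun B B' hB => absurd ⟨B, B', hB⟩ hex⟩
  choose c hc using hc
  have hF : ∀ G : SimpleGraph (Fin n), ∃ F : Finset ((Fin n × Fin n) × (Fin n × Fin n)),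
      G ∈ Lev n d w h T M s S S' k → s * s ≤ 4 * F.card ∧
      ∀ q ∈ F, Sw G q.1.1 q.2.1 q.1.2 q.2.2 ∧ sw G q.1.1 q.2.1 q.1.2 q.2.2 ∈ Lev n d w h T M s S S' (k + 4) ∧
        q ∈ (Xp (sw G q.1.1 q.2.1 q.1.2 q.2.2) w h s (c (sw G q.1.1 q.2.1 q.1.2 q.2.2)).1
          (c (sw G q.1.1 q.2.1 q.1.2 q.2.2)).2) ×ˢ dart (sw G q.1.1 q.2.1 q.1.2 q.2.2) := by
    intro G
    by_cases hG : G ∈ Lev n d w h T M s S S' k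
    · obtain ⟨hR, B, B', hC, hk⟩ := Finset.mem_filter.1 hG
      obtain ⟨F, hF1, hF2⟩ := forward hR hLD hs hC hk
      refine ⟨F, fun _ => ⟨hF1, fun q hq => ?_⟩⟩
      obtain ⟨f1, f2, f3, f4⟩ := hF2 q hq
      refine ⟨f1, Finset.mem_filter.2 ⟨sw_mem_Reg f1 hR, B, B', f2, f3⟩, ?_⟩
      rw [Finset.mem_product, hc _ B B' f2, mem_dart, sw_adj f1]
      exact ⟨f4, by simp⟩
    · exact ⟨∅, fun h => absurd h hG⟩
  choose F hF using hF
  have hinj : ((Lev n d w h T M s S S' k).sigma F).card ≤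
      ((Lev n d w h T M s S S' (k + 4)).sigma fun G' => Xp G' w h s (c G').1 (c G').2 ×ˢ dart G').card := by
    apply Finset.card_le_card_of_injOn (fun z => ⟨sw z.1 z.2.1.1 z.2.2.1 z.2.1.2 z.2.2.2, z.2⟩)
    · rintro ⟨G, q⟩ hz
      obtain ⟨z1, z2⟩ := Finset.mem_sigma.1 (Finset.mem_coe.1 hz)
      obtain ⟨f1, f2, f3⟩ := (hF G z1).2 q z2
      exact Finset.mem_coe.2 (Finset.mem_sigma.2 ⟨f2, f3⟩)
    · rintro ⟨G, q⟩ hz ⟨G', q'⟩ hz' e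
      obtain ⟨z1, z2⟩ := Finset.mem_sigma.1 (Finset.mem_coe.1 hz)
      obtain ⟨z1', z2'⟩ := Finset.mem_sigma.1 (Finset.mem_coe.1 hz')
      simp only [Sigma.mk.injEq, heq_eq_eq] at e
      obtain ⟨e1, rfl⟩ := e
      have f1 := ((hF G z1).2 q z2).1
      have f1' := ((hF G' z1').2 q z2').1
      have : G = G' := by
        rw [← sw_sw f1, ← sw_sw f1', e1]
      rw [this]
  rw [Finset.card_sigma, Finset.card_sigma] at hinj
  have h1 : s * s * (Lev n d w h T M s S S' k).card ≤ 4 * ∑ G ∈ Lev n d w h T M s S S' k, (F G).card := by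
    rw [Finset.mul_sum, mul_comm, ← smul_eq_mul, ← Finset.sum_const]
    exact Finset.sum_le_sum fun G hG => (hF G hG).1
  have h2 : ∑ G' ∈ Lev n d w h T M s S S' (k + 4), (Xp G' w h s (c G').1 (c G').2 ×ˢ dart G').card ≤
      (Lev n d w h T M s S S' (k + 4)).card * ((k + 4) * (n * d)) := by
    rw [← smul_eq_mul, ← Finset.sum_const]
    apply Finset.sum_le_sum
    intro G' hG'
    obtain ⟨hR, B, B', hC, hk⟩ := Finset.mem_filter.1 hG'
    rw [Finset.card_product, hc _ B B' hC, card_dart hR]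
    exact Nat.mul_le_mul_right _ hk
  calc _ ≤ _ := h1
    _ ≤ 4 * ((Lev n d w h T M s S S' (k + 4)).card * ((k + 4) * (n * d))) := by omega
    _ = _ := by ring

lemma lev_iter (hw : ∀ e, 0 ≤ w e) (hLD : LD w h s) (hs : 4 * (d * d + 2 * d) ≤ s) (R : ℕ) (j : ℕ) (hj : j ≤ R) :
    (s * s) ^ j * (Lev n d w h T M s S S' 0).card ≤ (16 * R * (n * d)) ^ j * (Lev n d w h T M s S S' (4 * j)).card := by
  induction j with
  | zero => simp
  | succ j ih =>
    have h1 := ih (by omega)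
    have h2 := lev_step (T := T) (M := M) (S := S) (S' := S') (d := d) hw hLD hs (4 * j)
    calc (s * s) ^ (j + 1) * (Lev n d w h T M s S S' 0).card
        = s * s * ((s * s) ^ j * (Lev n d w h T M s S S' 0).card) := by ring
      _ ≤ s * s * ((16 * R * (n * d)) ^ j * (Lev n d w h T M s S S' (4 * j)).card) := Nat.mul_le_mul_left _ h1
      _ = (16 * R * (n * d)) ^ j * (s * s * (Lev n d w h T M s S S' (4 * j)).card) := by ring
      _ ≤ (16 * R * (n * d)) ^ j * (4 * ((4 * j + 4) * (n * d)) * (Lev n d w h T M s S S' (4 * j + 4)).card) :=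
          Nat.mul_le_mul_left _ h2
      _ ≤ (16 * R * (n * d)) ^ j * (16 * R * (n * d) * (Lev n d w h T M s S S' (4 * j + 4)).card) := by
          apply Nat.mul_le_mul_left
          apply Nat.mul_le_mul_right
          calc 4 * ((4 * j + 4) * (n * d)) = 16 * (j + 1) * (n * d) := by ring
            _ ≤ 16 * R * (n * d) := Nat.mul_le_mul_right _ (Nat.mul_le_mul_left _ hj)
      _ = _ := by rw [pow_succ]; ring_nf

lemma lev_zero (hw : ∀ e, 0 ≤ w e) (hLD : LD w h s) (hs : 4 * (d * d + 2 * d) ≤ s) (R : ℕ) :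
    (s * s) ^ R * (Lev n d w h T M s S S' 0).card ≤ (16 * R * (n * d)) ^ R * (Reg n d).card :=
  (lev_iter hw hLD hs R R le_rfl).trans (Nat.mul_le_mul_left _ (Finset.card_le_card (Finset.filter_subset _ _)))

/-- the bad configuration event -/
def Bad (G : SimpleGraph (Fin n)) (w : W n) (h T : ℝ) (M s : ℕ) (S S' : Finset (Fin n)) : Prop :=
  LD w h s ∧ ∃ B B', Cfg G w h T M s S S' B B' ∧ (Xp G w h s B B').card = 0

lemma LD.meas (h : ℝ) (s : ℕ) : Measurable (fun w : W n => LD w h s) := by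
  unfold LD
  refine Measurable.forall fun A => Measurable.forall fun A' => Measurable.forall fun F => measurable_const.imp
    (measurable_const.imp (measurable_const.imp (measurable_const.imp (Measurable.imp ?_ measurable_const))))
  refine Measurable.forall fun p => Measurable.forall fun _ => ?_
  exact measurableSet_setOfPred.1 (measurableSet_lt (by fun_prop) (by fun_prop))

lemma light_meas (h : ℝ) (e : Sym2 (Fin n)) : Measurable (fun w : W n => w e ≤ h) :=
  measurableSet_setOfPred.1 (measurableSet_le (by fun_prop) (by fun_prop))

lemma AA_meas (h : ℝ) (B U A : Finset (Fin n)) : Measurable (fun w : W n => AA G w h B U = A) := by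
  have : (fun w : W n => AA G w h B U = A) = fun w => ∀ a, (a ∉ U ∧ (∃ b ∈ B, G.Adj a b ∧ w s(a, b) ≤ h) ∧ ∃ x, x ∉ U ∧ G.Adj a x) ↔ a ∈ A := by
    funext w
    rw [Finset.ext_iff]
    simp only [mem_AA]
  rw [this]
  refine Measurable.forall fun a => Measurable.iff (measurable_const.and (Measurable.and ?_ measurable_const)) measurable_const
  exact Measurable.exists fun b => measurable_const.and (measurable_const.and (light_meas h _))

lemma Bad_iff : Bad G w h T M s S S' ↔ LD w h s ∧ ∃ B B' A A' : Finset (Fin n), AA G w h B (B ∪ B') = A ∧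
    AA G w h B' (B ∪ B') = A' ∧ B.card = M ∧ B'.card = M ∧ Ball G w S B T ∧ Ball G w S' B' T ∧
    (s ≤ A.card ∧ s ≤ A'.card ∧ Disjoint A A') ∧
    ∀ p ∈ pick s A ×ˢ pick s A', ¬ (G.Adj p.1 p.2 ∧ w s(p.1, p.2) ≤ h) := by
  unfold Bad
  apply and_congr_right
  intro _
  constructor
  · rintro ⟨B, B', hC, hX⟩
    refine ⟨B, B', _, _, rfl, rfl, hC.cB, hC.cB', hC.bB, hC.bB', ⟨hC.sA, hC.sA', hC.dA⟩, ?_⟩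
    rw [Finset.card_eq_zero] at hX
    intro p hp hcon
    have : p ∈ Xp G w h s B B' := Finset.mem_filter.2 ⟨hp, hcon⟩
    rw [hX] at this
    simp at this
  · rintro ⟨B, B', A, A', rfl, rfl, h1, h2, h3, h4, ⟨h5, h6, h7⟩, h8⟩
    refine ⟨B, B', ⟨h1, h2, h3, h4, h5, h6, h7⟩, ?_⟩
    rw [Finset.card_eq_zero]
    exact Finset.filter_eq_empty_iff.2 fun p hp => h8 p hp

lemma Bad_meas (G : SimpleGraph (Fin n)) (h T : ℝ) (M s : ℕ) (S S' : Finset (Fin n)) :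
    MeasurableSet {w : W n | Bad G w h T M s S S'} := by
  simp only [Bad_iff]
  apply measurableSet_setOfPred.2
  refine (LD.meas h s).and (Measurable.exists fun B => Measurable.exists fun B' => Measurable.exists fun A =>
    Measurable.exists fun A' => (AA_meas h _ _ _).and ((AA_meas h _ _ _).and (measurable_const.and
      (measurable_const.and ((Ball.meas measurable_id measurable_const _ _).and
        ((Ball.meas measurable_id measurable_const _ _).and (measurable_const.and ?_)))))))
  exact Measurable.forall fun p => Measurable.forall fun _ => (measurable_const.and (light_meas h _)).not

lemma sum_real_le (E : SimpleGraph (Fin n) → Set (W n)) (hE : ∀ G, MeasurableSet (E G)) (c : ℝ)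
    (hc : ∀ w : W n, (∀ e, 0 ≤ w e) → (((Reg n d).filter fun G => w ∈ E G).card : ℝ) ≤ c) :
    ∑ G ∈ Reg n d, (muE n).real (E G) ≤ c := by
  have h1 : ∀ G, (muE n).real (E G) = ∫ w, (E G).indicator 1 w ∂(muE n) := fun G => (integral_indicator_one (hE G)).symm
  have hintg : ∀ G, Integrable ((E G).indicator (1 : W n → ℝ)) (muE n) := fun G =>
    (integrable_const (1:ℝ)).indicator (hE G)
  simp only [h1]
  rw [← integral_finsetSum _ (fun G _ => hintg G)]
  have h2 : ∫ w, ∑ G ∈ Reg n d, (E G).indicator (1 : W n → ℝ) w ∂(muE n) ≤ ∫ _, c ∂(muE n) := by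
    apply integral_mono_ae (integrable_finsetSum _ fun G _ => hintg G) (integrable_const c)
    have := mu_nonneg_ae (ι := Sym2 (Fin n))
    filter_upwards [this] with w hw
    refine le_trans (le_of_eq ?_) (hc w hw)
    rw [Finset.card_filter]
    push_cast
    apply Finset.sum_congr rfl
    intro G _
    by_cases hG : w ∈ E G <;> simp [hG]
  simpa using h2

lemma Bad_PPr (h T : ℝ) (M : ℕ) (S S' : Finset (Fin n)) (hs0 : 0 < s) (hs : 4 * (d * d + 2 * d) ≤ s) (R : ℕ) :
    PPr n d (fun G w => Bad G w h T M s S S') ≤ (16 * R * (n * d) / (s * s)) ^ R := by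
  apply PPr_le (by positivity)
  apply sum_real_le _ (fun G => Bad_meas G h T M s S S')
  intro w hw
  have hs0' : (0:ℝ) < s := by exact_mod_cast hs0
  by_cases hLD : LD w h s
  · have h1 := lev_zero (T := T) (M := M) (S := S) (S' := S') (n := n) (d := d) hw hLD hs R
    have h2 : ((Reg n d).filter fun G => w ∈ {w : W n | Bad G w h T M s S S'}).card ≤ (Lev n d w h T M s S S' 0).card := by
      apply Finset.card_le_card
      intro G hG
      obtain ⟨g1, g2, B, B', g3, g4⟩ := Finset.mem_filter.1 hG
      exact Finset.mem_filter.2 ⟨g1, B, B', g3, g4.le⟩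
    have h3 : (((s:ℝ) * s) ^ R) * (Lev n d w h T M s S S' 0).card ≤ (16 * R * (n * d)) ^ R * (Reg n d).card := by
      exact_mod_cast h1
    rw [div_pow, mul_div_assoc', le_div_iff₀ (by positivity)]
    calc _ ≤ ((Lev n d w h T M s S S' 0).card : ℝ) * ((s:ℝ) * s) ^ R := by
          apply mul_le_mul_of_nonneg_right _ (by positivity)
          exact_mod_cast h2
      _ ≤ _ := by linarith
  · have : ((Reg n d).filter fun G => w ∈ {w : W n | Bad G w h T M s S S'}) = ∅ :=
      Finset.filter_eq_empty_iff.2 fun G _ hG => hLD hG.1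
    rw [this]
    simp only [Finset.card_empty, Nat.cast_zero]
    positivity

end switch

end FPP

namespace FPP

section heavy
variable {n d : ℕ} {G : SimpleGraph (Fin n)} {h : ℝ} {M s : ℕ}

lemma heavy_prob (hh : 0 ≤ h) (F : Finset (Sym2 (Fin n))) :
    (muE n).real {w | ∀ e ∈ F, h < w e} ≤ Real.exp (-(h * F.card)) := by
  have h1 := memoryless (ι := Sym2 (Fin n)) F hh MeasurableSet.univ
  rw [measure_univ, mul_one] at h1
  rw [measureReal_def, muE_eq]
  apply ENNReal.toReal_le_of_le_ofReal (Real.exp_pos _).le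
  rw [← h1]
  apply measure_mono
  intro w hw
  exact ⟨fun f hf => (hw f hf).le, trivial⟩

/-- few heavy edges at grown sets -/
def HB (G : SimpleGraph (Fin n)) (w : W n) (h ε : ℝ) (M : ℕ) : Prop :=
  ∀ B, Grown G B → B.card = M → (((inc G B).filter fun e => h < w e).card : ℝ) ≤ ε * M

lemma HB_prob (hG : G ∈ Reg n d) (hh : 0 ≤ h) {ε : ℝ} (hM : 0 < M)
    (hc : (d:ℝ) ^ 2 * 2 ^ d * Real.exp (-(h * ε)) ≤ Real.exp (-1)) (hd : 0 < d) :
    (muE n).real {w | ¬ HB G w h ε M} ≤ n * Real.exp (-M) := by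
  set I := (chs G (2 * M - 2 + 1)).sigma fun l => ((inc G l.toFinset).powerset.filter fun F =>
    (F.card ≤ M * d ∧ ε * M < (F.card : ℝ)) ∧ (inc G l.toFinset).card ≤ M * d) with hI
  have h1 : (muE n).real {w | ¬ HB G w h ε M} ≤ (muE n).real {w | ∃ z ∈ I, w ∈ {w : W n | ∀ e ∈ z.2, h < w e}} := by
    apply real_mono_ae
    intro w hw hn
    unfold HB at hn
    simp only [Set.mem_ofPred_eq] at hn
    push Not at hn
    obtain ⟨B, hB, hBM, hlt⟩ := hn
    obtain ⟨l, l1, l2, l3, l4⟩ := hB.code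
    have hic := card_inc_le hG B
    rw [hBM] at hic
    refine ⟨⟨l, (inc G B).filter fun e => h < w e⟩, ?_, ?_⟩
    · rw [hI, Finset.mem_sigma]
      refine ⟨mem_chs.2 ⟨(by omega : l.length = 2 * M - 2 + 1), l1⟩, ?_⟩
      simp only [l2]
      rw [Finset.mem_filter, Finset.mem_powerset]
      exact ⟨Finset.filter_subset _ _, ⟨(Finset.card_filter_le _ _).trans hic, hlt⟩, hic⟩
    · intro e he
      exact (Finset.mem_filter.1 he).2
  have h2 : (I.card : ℝ) ≤ n * d ^ (2 * M - 2) * 2 ^ (M * d) := by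
    rw [hI, Finset.card_sigma]
    have : ∑ l ∈ chs G (2 * M - 2 + 1), ((inc G l.toFinset).powerset.filter fun F =>
        (F.card ≤ M * d ∧ ε * M < (F.card : ℝ)) ∧ (inc G l.toFinset).card ≤ M * d).card ≤
        ∑ l ∈ chs G (2 * M - 2 + 1), 2 ^ (M * d) := by
      apply Finset.sum_le_sum
      intro l _
      by_cases hic : (inc G l.toFinset).card ≤ M * d
      · refine (Finset.card_filter_le _ _).trans ?_
        rw [Finset.card_powerset]
        exact Nat.pow_le_pow_right (by norm_num) hic
      · rw [Finset.filter_eq_empty_iff.2 (fun F _ hF => hic hF.2)]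
        simp
    have h3 := card_chs hG (2 * M - 2)
    rw [Finset.sum_const, smul_eq_mul] at this
    have := this.trans (Nat.mul_le_mul_right _ h3)
    exact_mod_cast this
  have h3 : ∑ z ∈ I, (muE n).real {w : W n | ∀ e ∈ z.2, h < w e} ≤ ∑ z ∈ I, Real.exp (-(h * (ε * M))) := by
    apply Finset.sum_le_sum
    intro z hz
    refine (heavy_prob hh z.2).trans ?_
    rw [hI, Finset.mem_sigma, Finset.mem_filter] at hz
    apply Real.exp_le_exp.2
    have := hz.2.2.1.2
    nlinarith
  rw [Finset.sum_const, nsmul_eq_mul] at h3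
  refine h1.trans ((real_exists_le I _).trans (h3.trans ?_))
  have hd1 : (1:ℝ) ≤ d := by exact_mod_cast hd
  calc (I.card : ℝ) * Real.exp (-(h * (ε * M)))
      ≤ (n * d ^ (2 * M - 2) * 2 ^ (M * d)) * Real.exp (-(h * (ε * M))) :=
        mul_le_mul_of_nonneg_right h2 (Real.exp_pos _).le
    _ ≤ (n * d ^ (2 * M) * 2 ^ (M * d)) * Real.exp (-(h * (ε * M))) := by
        apply mul_le_mul_of_nonneg_right _ (Real.exp_pos _).le
        apply mul_le_mul_of_nonneg_right _ (by positivity)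
        apply mul_le_mul_of_nonneg_left _ (by positivity)
        exact pow_le_pow_right₀ hd1 (by omega)
    _ = n * ((d:ℝ) ^ 2 * 2 ^ d * Real.exp (-(h * ε))) ^ M := by
        rw [mul_pow, mul_pow, ← pow_mul, ← pow_mul, ← Real.exp_nat_mul]
        have : (M:ℝ) * -(h * ε) = -(h * (ε * M)) := by ring
        rw [this, mul_comm M d]; ring
    _ ≤ n * (Real.exp (-1)) ^ M := by
        apply mul_le_mul_of_nonneg_left _ (by positivity)
        exact pow_le_pow_left₀ (by positivity) hc M
    _ = _ := by rw [← Real.exp_nat_mul]; congr 2; ring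

lemma LD_prob (hh : 8 ≤ h) (hs : n ≤ s * s) : (muE n).real {w | ¬ LD w h s} ≤ Real.exp (-(s * s)) := by
  set P : Finset (Finset (Fin n) × Finset (Fin n)) := Finset.univ.filter fun p => p.1.card = s ∧ p.2.card = s ∧ Disjoint p.1 p.2 with hP
  set I := P.sigma fun p => (p.1 ×ˢ p.2).powerset.filter fun F => s * s < 2 * F.card with hI
  have h1 : (muE n).real {w | ¬ LD w h s} ≤ (muE n).real {w | ∃ z ∈ I, w ∈ {w : W n | ∀ e ∈ z.2.image (fun p => s(p.1, p.2)), h < w e}} := by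
    apply real_mono_ae
    intro w hw hn
    unfold LD at hn
    simp only [Set.mem_ofPred_eq] at hn
    push Not at hn
    obtain ⟨A, A', F, c1, c2, c3, c4, c5, c6⟩ := hn
    refine ⟨⟨(A, A'), F⟩, ?_, ?_⟩
    · rw [hI, Finset.mem_sigma, hP, Finset.mem_filter, Finset.mem_filter, Finset.mem_powerset]
      exact ⟨⟨Finset.mem_univ _, c2, c3, c1⟩, c4, c6⟩
    · intro e he
      obtain ⟨p, hp, rfl⟩ := Finset.mem_image.1 he
      exact c5 p hp
  have h2 : (I.card : ℝ) ≤ 2 ^ (3 * (s * s)) := by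
    have : I.card ≤ 2 ^ n * 2 ^ n * 2 ^ (s * s) := by
      rw [hI, Finset.card_sigma]
      calc _ ≤ ∑ p ∈ P, 2 ^ (s * s) := by
            apply Finset.sum_le_sum
            intro p hp
            rw [hP, Finset.mem_filter] at hp
            refine (Finset.card_filter_le _ _).trans ?_
            rw [Finset.card_powerset, Finset.card_product, hp.2.1, hp.2.2.1]
        _ = P.card * 2 ^ (s * s) := by rw [Finset.sum_const, smul_eq_mul]
        _ ≤ _ := by
            apply Nat.mul_le_mul_right
            refine (Finset.card_filter_le _ _).trans ?_
            rw [Finset.card_univ, Fintype.card_prod, Fintype.card_finset, Fintype.card_fin]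
    have h3 : 2 ^ n * 2 ^ n * 2 ^ (s * s) ≤ 2 ^ (3 * (s * s)) := by
      rw [← pow_add, ← pow_add]
      exact Nat.pow_le_pow_right (by norm_num) (by omega)
    exact_mod_cast this.trans h3
  have h3 : ∑ z ∈ I, (muE n).real {w : W n | ∀ e ∈ z.2.image (fun p => s(p.1, p.2)), h < w e} ≤
      ∑ z ∈ I, Real.exp (-(4 * (s * s))) := by
    apply Finset.sum_le_sum
    rintro ⟨⟨A, A'⟩, F⟩ hz
    refine (heavy_prob (by linarith) _).trans ?_
    rw [hI, Finset.mem_sigma, hP, Finset.mem_filter, Finset.mem_filter, Finset.mem_powerset] at hz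
    obtain ⟨⟨-, c2, c3, c1⟩, c4, c5⟩ := hz
    simp only at c1 c2 c3 c4 c5 ⊢
    rw [Finset.card_image_of_injOn]
    · apply Real.exp_le_exp.2
      have c5' : (s:ℝ) * s ≤ 2 * F.card := by exact_mod_cast c5.le
      have : (0:ℝ) ≤ F.card := by positivity
      nlinarith
    · rintro ⟨a, b⟩ hp ⟨a', b'⟩ hq e
      have k1 := Finset.mem_product.1 (c4 hp)
      have k2 := Finset.mem_product.1 (c4 hq)
      simp only [Sym2.eq_iff] at e k1 k2
      rcases e with ⟨rfl, rfl⟩ | ⟨rfl, rfl⟩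
      · rfl
      · exact absurd k2.2 (Finset.disjoint_left.1 c1 k1.1)
  rw [Finset.sum_const, nsmul_eq_mul] at h3
  refine h1.trans ((real_exists_le I _).trans (h3.trans ?_))
  calc (I.card : ℝ) * Real.exp (-(4 * (s * s))) ≤ 2 ^ (3 * (s * s)) * Real.exp (-(4 * (s * s))) :=
        mul_le_mul_of_nonneg_right h2 (Real.exp_pos _).le
    _ ≤ Real.exp 1 ^ (3 * (s * s)) * Real.exp (-(4 * (s * s))) := by
        apply mul_le_mul_of_nonneg_right _ (Real.exp_pos _).le
        apply pow_le_pow_left₀ (by norm_num)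
        have := Real.add_one_le_exp (1:ℝ); linarith
    _ = _ := by
        rw [← Real.exp_nat_mul, ← Real.exp_add]
        congr 1
        push_cast; ring

end heavy

end FPP

namespace FPP

section conn
variable {n d : ℕ} {G : SimpleGraph (Fin n)} {w : W n} {h T : ℝ} {M s : ℕ} {S S' B B' : Finset (Fin n)}

/-- `S` and `S'` are connected within weight `t` -/
def Cn (G : SimpleGraph (Fin n)) (w : W n) (S S' : Finset (Fin n)) (t : ℝ) : Prop :=
  ∃ l : List (Fin n), l.IsChain G.Adj ∧ (∃ a ∈ S, ∃ b ∈ S', Conn l a b) ∧ wt w l ≤ t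

/-- `v` is reached from `S` within weight `t` -/
def Rch (G : SimpleGraph (Fin n)) (w : W n) (S : Finset (Fin n)) (v : Fin n) (t : ℝ) : Prop :=
  ∃ r : List (Fin n), (r ++ [v]).IsChain G.Adj ∧ (∃ a ∈ S, (r ++ [v]).head? = some a) ∧ wt w (r ++ [v]) ≤ t

lemma Rch.step {v u : Fin n} {t : ℝ} (hr : Rch G w S v t) (hvu : G.Adj v u) (hl : w s(v, u) ≤ h) :
    Rch G w S u (t + h) := by
  obtain ⟨r, h1, ⟨a, ha, h2⟩, h3⟩ := hr
  refine ⟨r ++ [v], ?_, ⟨a, ha, ?_⟩, ?_⟩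
  · rw [List.isChain_append]
    refine ⟨h1, by simp, ?_⟩
    intro x hx y hy
    simp at hx hy
    rw [← hx, ← hy]; exact hvu
  · rw [List.head?_append, h2]; rfl
  · rw [List.append_assoc, List.singleton_append, wt_append w r [u] v]
    have : wt w [v, u] = w s(v, u) := by simp [wt, edgesL]
    rw [this]; linarith

lemma Rch.join {v : Fin n} {t t' : ℝ} (h1 : Rch G w S v t) (h2 : Rch G w S' v t') : Cn G w S S' (t + t') := by
  obtain ⟨r, a1, ⟨a, ha, a2⟩, a3⟩ := h1
  obtain ⟨r', b1, ⟨b, hb, b2⟩, b3⟩ := h2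
  refine ⟨r ++ v :: r'.reverse, ?_, ⟨a, ha, b, hb, ?_, ?_⟩, ?_⟩
  · have e : (r' ++ [v]).reverse = v :: r'.reverse := by simp
    have c1 : (v :: r'.reverse).IsChain G.Adj := by
      rw [← e, List.isChain_reverse]
      exact b1.imp fun x y hxy => hxy.symm
    rw [List.isChain_split]
    exact ⟨a1, c1⟩
  · rw [← a2]
    cases r <;> simp
  · have e : (v :: r'.reverse) = (r' ++ [v]).reverse := by simp
    rw [e, List.getLast?_append, List.getLast?_reverse, b2]; rfl
  · rw [wt_append w r r'.reverse v]
    have e : (v :: r'.reverse) = (r' ++ [v]).reverse := by simp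
    rw [e, wt_reverse]; linarith

lemma Ball.rch (hB : Ball G w S B T) {b : Fin n} (hb : b ∈ B) : Rch G w S b T := by
  obtain ⟨l, ⟨l1, v, post, rfl, hv, -⟩, l2, l3, l4, -⟩ := hB.2 b hb
  obtain ⟨r, hr⟩ : ∃ r, v :: post = r ++ [b] := by
    rcases List.eq_nil_or_concat (v :: post) with h0 | ⟨r, y, hr⟩
    · simp at h0
    · rw [List.concat_eq_append] at hr
      rw [hr] at l3
      simp at l3
      exact ⟨r, by rw [hr, l3]⟩
  rw [hr] at l1 l4
  exact ⟨r, l1, ⟨v, hv, by rw [← hr]; simp⟩, l4⟩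

set_option maxHeartbeats 1000000 in
lemma card_AA (hG : G ∈ Reg n d) (hd : 3 ≤ d) {ε : ℝ} (hε : 0 < ε) (hε1 : 100 * d * ε ≤ 1) {K M1 : ℕ}
    (hPA : PA ε K M1 G) (hK : K ≤ M) (hM1 : (d + 1) * M ≤ M1) (hM8 : 8 * d ≤ M) (hHB : HB G w h ε M)
    (hB : Grown G B) (hBM : B.card = M) (hB' : Grown G B') (hBM' : B'.card = M)
    (k1 : ∀ b ∈ B, ∀ a, G.Adj a b → w s(a, b) ≤ h → a ∉ B')
    (k2 : ∀ b ∈ B, ∀ a, G.Adj a b → w s(a, b) ≤ h → ∀ b' ∈ B', G.Adj a b' → h < w s(a, b'))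
    (hs : 4 * d * s ≤ M) : s ≤ (AA G w h B (B ∪ B')).card := by
  have hdeg := mem_Reg.1 hG
  have hd3 : (3:ℝ) ≤ d := by exact_mod_cast hd
  have hM8' : (8:ℝ) * d ≤ M := by exact_mod_cast hM8
  set U := B ∪ B' with hU
  set A1 : Finset (Fin n) := Finset.univ.filter fun a => a ∉ B ∧ ∃ b ∈ B, G.Adj a b ∧ w s(a, b) ≤ h with hA1
  set Q1 : Finset (Fin n) := Finset.univ.filter fun a => a ∉ B' ∧ ∃ b ∈ B', G.Adj a b ∧ h < w s(a, b) with hQ1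
  set Z : Finset (Fin n) := Finset.univ.filter fun a => a ∉ B ∧ ∀ x, G.Adj a x → x ∈ B with hZ
  have hsub : A1 ⊆ AA G w h B U ∪ Q1 ∪ Z := by
    intro a ha
    obtain ⟨-, ha1, b, hb, hab, hl⟩ := Finset.mem_filter.1 ha
    by_contra hcon
    simp only [Finset.mem_union, not_or] at hcon
    obtain ⟨⟨c1, c2⟩, c3⟩ := hcon
    have hB'a := k1 b hb a hab hl
    have haU : a ∉ U := by simp [hU, ha1, hB'a]
    have hall : ∀ x, G.Adj a x → x ∈ U := by
      intro x hx
      by_contra hxU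
      exact c1 (mem_AA.2 ⟨haU, ⟨b, hb, hab, hl⟩, x, hxU, hx⟩)
    have : ∃ x, G.Adj a x ∧ x ∉ B := by
      by_contra hno
      push Not at hno
      exact c3 (Finset.mem_filter.2 ⟨Finset.mem_univ _, ha1, hno⟩)
    obtain ⟨x, hx1, hx2⟩ := this
    have hxB' : x ∈ B' := by
      rcases Finset.mem_union.1 (hall x hx1) with h' | h'
      · exact absurd h' hx2
      · exact h'
    exact c2 (Finset.mem_filter.2 ⟨Finset.mem_univ _, hB'a, x, hxB', hx1, k2 b hb a hab hl x hxB' hx1⟩)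
  have hcard := (Finset.card_le_card hsub).trans ((Finset.card_union_le _ _).trans
    (Nat.add_le_add_right (Finset.card_union_le _ _) _))
  -- Q1
  have hQ1c : (Q1.card : ℝ) ≤ ε * M := by
    refine le_trans ?_ (hHB B' hB' hBM')
    have hch : ∀ a, ∃ b, a ∈ Q1 → a ∉ B' ∧ b ∈ B' ∧ G.Adj a b ∧ h < w s(a, b) := by
      intro a
      by_cases ha : a ∈ Q1
      · obtain ⟨-, a1, b, a2, a3, a4⟩ := Finset.mem_filter.1 ha
        exact ⟨b, fun _ => ⟨a1, a2, a3, a4⟩⟩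
      · exact ⟨a, fun h => absurd h ha⟩
    choose f hf using hch
    have : Q1.card ≤ ((inc G B').filter fun e => h < w e).card := by
      apply Finset.card_le_card_of_injOn (fun a => s(a, f a))
      · intro a ha
        obtain ⟨a1, a2, a3, a4⟩ := hf a ha
        refine Finset.mem_coe.2 (Finset.mem_filter.2 ⟨mem_inc.2 ⟨a3, f a, by simp, a2⟩, a4⟩)
      · intro a ha a' ha' e
        obtain ⟨a1, a2, a3, a4⟩ := hf a ha
        obtain ⟨b1, b2, b3, b4⟩ := hf a' ha'
        simp only [Sym2.eq_iff] at e
        rcases e with e | e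
        · exact e.1
        · exact absurd (e.1 ▸ b2) a1
    exact_mod_cast this
  -- Z
  have hZc1 : Z.card ≤ d * M := by
    have : Z ⊆ B.biUnion (nb G) := by
      intro a ha
      obtain ⟨-, a1, a2⟩ := Finset.mem_filter.1 ha
      have : (nb G a).Nonempty := by rw [← Finset.card_pos, hdeg]; omega
      obtain ⟨x, hx⟩ := this
      rw [mem_nb] at hx
      exact Finset.mem_biUnion.2 ⟨x, a2 x hx, by rw [mem_nb]; exact hx.symm⟩
    refine (Finset.card_le_card this).trans ?_
    have := Finset.card_biUnion_le_card_mul B (nb G) d fun v _ => (hdeg v).le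
    rw [hBM] at this
    linarith
  have hZu := hB.union (Z := Z) (by
    intro z hz
    obtain ⟨-, a1, a2⟩ := Finset.mem_filter.1 hz
    refine ⟨a1, ?_⟩
    have : nb G z ∩ B = nb G z := by
      rw [Finset.inter_eq_left]
      intro x hx
      rw [mem_nb] at hx
      exact a2 x hx
    rw [this, hdeg]; omega)
  have hdisZ : Disjoint B Z := by
    rw [Finset.disjoint_right]
    intro z hz
    exact (Finset.mem_filter.1 hz).2.1
  have hBZ : (B ∪ Z).card = M + Z.card := by rw [Finset.card_union_of_disjoint hdisZ, hBM]
  have hPA1 := hPA (B ∪ Z) hZu.1 (by omega) (by rw [hBZ]; nlinarith)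
  have hge := hB.eIn_ge
  rw [hBM] at hge
  have e1 : (M:ℝ) - 1 + 2 * Z.card ≤ (eIn G (B ∪ Z)).card := by
    have : (M:ℝ) ≤ (eIn G B).card + 1 := by exact_mod_cast hge
    have h2 : ((eIn G B).card : ℝ) + 2 * Z.card ≤ (eIn G (B ∪ Z)).card := by exact_mod_cast hZu.2
    linarith
  rw [hBZ] at hPA1
  push_cast at hPA1
  have hM0 : (0:ℝ) < M := by nlinarith
  have hεs : ε ≤ 1 / 300 := by nlinarith
  have hZc : (Z.card : ℝ) ≤ 2 * ε * M + 2 := by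
    have hz0 : (0:ℝ) ≤ Z.card := by positivity
    have : (Z.card : ℝ) * (1 - ε) ≤ ε * M + 1 := by nlinarith
    nlinarith
  -- A1
  have hPA2 := hPA B hB (by omega) (by rw [hBM]; nlinarith)
  rw [hBM] at hPA2
  have hds : (M:ℝ) * d ≤ 2 * (eIn G B).card + (bd G B).card := by
    have := degree_sum hG B
    rw [hBM] at this
    exact_mod_cast this
  have hbdsub : bd G B ⊆ ((inc G B).filter fun e => h < w e) ∪ A1.biUnion fun a => (nb G a).image fun x => s(a, x) := by
    intro e he
    obtain ⟨x, y, rfl, hxy, hx, hy⟩ := mem_bd.1 he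
    by_cases hl : w s(x, y) ≤ h
    · apply Finset.mem_union_right
      refine Finset.mem_biUnion.2 ⟨y, Finset.mem_filter.2 ⟨Finset.mem_univ _, hy, x, hx, hxy.symm, ?_⟩, ?_⟩
      · rwa [Sym2.eq_swap]
      · exact Finset.mem_image.2 ⟨x, by rw [mem_nb]; exact hxy.symm, Sym2.eq_swap⟩
    · apply Finset.mem_union_left
      exact Finset.mem_filter.2 ⟨mem_inc.2 ⟨hxy, x, by simp, hx⟩, not_le.1 hl⟩
  have hbdc := (Finset.card_le_card hbdsub).trans (Finset.card_union_le _ _)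
  have hA1d := Finset.card_biUnion_le_card_mul A1 (fun a => (nb G a).image fun x => s(a, x)) d
    (fun a _ => Finset.card_image_le.trans (hdeg a).le)
  have hH := hHB B hB hBM
  have hbdR : ((bd G B).card : ℝ) ≤ ε * M + A1.card * d := by
    have : ((bd G B).card : ℝ) ≤ ((inc G B).filter fun e => h < w e).card + A1.card * d := by
      exact_mod_cast hbdc.trans (Nat.add_le_add_left hA1d _)
    linarith
  have hA1R : (M:ℝ) * (1 - 3 * ε) ≤ A1.card * d := by nlinarith
  have hcR : (A1.card : ℝ) ≤ (AA G w h B U).card + Q1.card + Z.card := by exact_mod_cast hcard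
  have hfin : (M:ℝ) * (1 - 3 * ε) ≤ ((AA G w h B U).card + (3 * ε * M + 2)) * d := by
    refine hA1R.trans (mul_le_mul_of_nonneg_right ?_ (by positivity))
    linarith
  have hfin2 : (M:ℝ) / 2 ≤ (AA G w h B U).card * d + 2 * d := by
    have t1 : 3 * ε * M * d ≤ M * (3 / 100) := by nlinarith
    have t2 : M * (3 * ε) ≤ M * (1 / 100) := by nlinarith
    nlinarith
  have hsR : (4:ℝ) * d * s ≤ M := by exact_mod_cast hs
  have : (s:ℝ) * d ≤ (AA G w h B U).card * d := by nlinarith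
  have := le_of_mul_le_mul_right this (by linarith)
  exact_mod_cast this

lemma noconn_bad (hG : G ∈ Reg n d) (hd : 3 ≤ d) {ε : ℝ} (hε : 0 < ε) (hε1 : 100 * d * ε ≤ 1) {K M1 : ℕ}
    (hPA : PA ε K M1 G) (hK : K ≤ M) (hM1 : (d + 1) * M ≤ M1) (hM8 : 8 * d ≤ M) (hHB : HB G w h ε M)
    (hLD : LD w h s) (hh : 0 ≤ h) (hs : 4 * d * s ≤ M) (n1 : ¬ NoBall G M S w T) (n2 : ¬ NoBall G M S' w T)
    (hnc : ¬ Cn G w S S' (2 * T + 3 * h)) : Bad G w h T M s S S' := by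
  unfold NoBall at n1 n2
  push Not at n1 n2
  obtain ⟨B, hB, hBM, hBb⟩ := n1
  obtain ⟨B', hB', hBM', hBb'⟩ := n2
  have key : ∀ v t t', t + t' ≤ 2 * T + 3 * h → Rch G w S v t → Rch G w S' v t' → False := by
    intro v t t' ht r1 r2
    obtain ⟨l, l1, l2, l3⟩ := r1.join r2
    exact hnc ⟨l, l1, l2, l3.trans ht⟩
  have rB : ∀ b ∈ B, ∀ a, G.Adj a b → w s(a, b) ≤ h → Rch G w S a (T + h) := by
    intro b hb a hab hl
    exact (hBb.rch hb).step hab.symm (by rwa [Sym2.eq_swap])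
  have rB' : ∀ b ∈ B', ∀ a, G.Adj a b → w s(a, b) ≤ h → Rch G w S' a (T + h) := by
    intro b hb a hab hl
    exact (hBb'.rch hb).step hab.symm (by rwa [Sym2.eq_swap])
  refine ⟨hLD, B, B', ⟨hBM, hBM', hBb, hBb', ?_, ?_, ?_⟩, ?_⟩
  · apply card_AA hG hd hε hε1 hPA hK hM1 hM8 hHB hB hBM hB' hBM' ?_ ?_ hs
    · intro b hb a hab hl ha
      exact key a _ _ (by linarith) (rB b hb a hab hl) (hBb'.rch ha)
    · intro b hb a hab hl b' hb' hab'
      by_contra hcon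
      exact key a _ _ (by linarith) (rB b hb a hab hl) (rB' b' hb' a hab' (not_lt.1 hcon))
  · rw [Finset.union_comm]
    apply card_AA hG hd hε hε1 hPA hK hM1 hM8 hHB hB' hBM' hB hBM ?_ ?_ hs
    · intro b hb a hab hl ha
      exact key a _ _ (by linarith) (hBb.rch ha) (rB' b hb a hab hl)
    · intro b hb a hab hl b' hb' hab'
      by_contra hcon
      exact key a _ _ (by linarith) (rB b' hb' a hab' (not_lt.1 hcon)) (rB' b hb a hab hl)
  · rw [Finset.disjoint_left]
    intro a ha ha'
    obtain ⟨-, ⟨b, hb, hab, hl⟩, -⟩ := mem_AA.1 ha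
    obtain ⟨-, ⟨b', hb', hab', hl'⟩, -⟩ := mem_AA.1 ha'
    exact key a _ _ (by linarith) (rB b hb a hab hl) (rB' b' hb' a hab' hl')
  · rw [Finset.card_eq_zero, Finset.eq_empty_iff_forall_notMem]
    rintro ⟨a, c⟩ hp
    obtain ⟨hp1, hp2, hp3⟩ := Finset.mem_filter.1 hp
    obtain ⟨ha, hc⟩ := Finset.mem_product.1 hp1
    simp only at ha hc hp2 hp3
    have hpick : ∀ A : Finset (Fin n), pick s A ⊆ A := by
      intro A
      by_cases hA : s ≤ A.card
      · exact (pick_spec hA).1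
      · unfold pick; rw [dif_neg hA]; exact Finset.empty_subset _
    obtain ⟨-, ⟨b, hb, hab, hl⟩, -⟩ := mem_AA.1 (hpick _ ha)
    obtain ⟨-, ⟨b', hb', hab', hl'⟩, -⟩ := mem_AA.1 (hpick _ hc)
    exact key c _ _ (by linarith) ((rB b hb a hab hl).step hp2 hp3) (rB' b' hb' c hab' hl')

end conn

end FPP

namespace FPP

section U
variable {n d : ℕ}

/-- all paths with `K` vertices are within weighted distance `t` -/
def UU (G : SimpleGraph (Fin n)) (w : W n) (K : ℕ) (t : ℝ) : Prop :=
  ∀ l l' : List (Fin n), IsP G l → IsP G l' → l.length = K → l'.length = K → Cn G w l.toFinset l'.toFinset t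

lemma card_listsLen_le (n k : ℕ) : (listsLen n k).card ≤ n ^ k := by
  unfold listsLen
  refine Finset.card_image_le.trans ?_
  simp

lemma noball_prob {G : SimpleGraph (Fin n)} (hG : G ∈ Reg n d) (hd : 3 ≤ d) {ε : ℝ} (hε : 0 < ε)
    (hε1 : 100 * d * ε ≤ 1) (θ' M M1 : ℕ) (T : ℝ) (hK : θ' + 2 ≤ M) (hM1 : M ≤ M1) (hPA : PA ε (θ' + 2) M1 G) :
    (muE n).real {w | ∃ l, IsP G l ∧ l.length = θ' + 2 ∧ NoBall G M l.toFinset w T} ≤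
      n * d ^ (θ' + 1) * (Real.exp (-((d - 2 - 2 * ε) * θ' * T)) * (M:ℝ) ^ θ') := by
  have hd3 : (3:ℝ) ≤ d := by exact_mod_cast hd
  have hlam : 0 < (d:ℝ) - 2 - 2 * ε := by nlinarith
  set I := (chs G (θ' + 1 + 1)).filter fun l => IsP G l with hI
  have h1 : (muE n).real {w | ∃ l, IsP G l ∧ l.length = θ' + 2 ∧ NoBall G M l.toFinset w T} ≤
      (muE n).real {w | ∃ l ∈ I, w ∈ {w : W n | NoBall G M l.toFinset w T}} := by
    apply real_mono_ae
    rintro w hw ⟨l, l1, l2, l3⟩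
    exact ⟨l, Finset.mem_filter.2 ⟨mem_chs.2 ⟨l2, l1.1⟩, l1⟩, l3⟩
  have h2 : ∑ l ∈ I, (muE n).real {w : W n | NoBall G M l.toFinset w T} ≤
      ∑ l ∈ I, (Real.exp (-((d - 2 - 2 * ε) * θ' * T)) * (M:ℝ) ^ θ') := by
    apply Finset.sum_le_sum
    intro l hl
    obtain ⟨l1, l2⟩ := Finset.mem_filter.1 hl
    obtain ⟨l3, -⟩ := mem_chs.1 l1
    have hc : l.toFinset.card = θ' + 2 := by
      rw [List.toFinset_card_of_nodup l2.2]; exact l3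
    have hgr : Grown G l.toFinset := Grown.of_path l2 (by rintro rfl; simp at l3)
    have := growth (G := G) M θ' (d - 2 - 2 * ε) hlam (by
      intro S hS hS1 hS2
      have p1 := hPA S hS hS1 (by omega)
      have p2 : (S.card:ℝ) * d ≤ 2 * (eIn G S).card + (bd G S).card := by exact_mod_cast degree_sum hG S
      nlinarith) (M - (θ' + 2)) l.toFinset hgr (by omega) (by omega) T
    rw [measureReal_def, muE_eq]
    apply ENNReal.toReal_le_of_le_ofReal (by positivity)
    refine this.trans (le_of_eq ?_)
    rw [hc]
    congr 3
    push_cast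
    have : ((θ':ℝ) + 2 - θ' - 1) = 1 := by ring
    rw [this, div_one]
  rw [Finset.sum_const, nsmul_eq_mul] at h2
  refine h1.trans ((real_exists_le I _).trans (h2.trans ?_))
  apply mul_le_mul_of_nonneg_right _ (by positivity)
  have := (Finset.card_filter_le (chs G (θ' + 1 + 1)) (fun l => IsP G l)).trans (card_chs hG (θ' + 1))
  exact_mod_cast this

lemma U_bound (hd : 3 ≤ d) {ε : ℝ} (hε : 0 < ε)
    (hε1 : 100 * d * ε ≤ 1) (θ' M s R : ℕ) (h T : ℝ) (hK : θ' + 2 ≤ M) (hM8 : 8 * d ≤ M) (hs : 4 * d * s ≤ M)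
    (hs0 : 0 < s) (hs1 : 4 * (d * d + 2 * d) ≤ s) (hns : n ≤ s * s) (hh : 8 ≤ h)
    (hc : (d:ℝ) ^ 2 * 2 ^ d * Real.exp (-(h * ε)) ≤ Real.exp (-1)) :
    PPr n d (fun G w => ¬ UU G w (θ' + 2) (2 * T + 3 * h)) ≤
      PPr n d (fun G _ => ¬ PA ε (θ' + 2) ((d + 1) * M) G) + (n * Real.exp (-M) + (Real.exp (-(s * s)) +
      (n * d ^ (θ' + 1) * (Real.exp (-((d - 2 - 2 * ε) * θ' * T)) * (M:ℝ) ^ θ') +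
      (n ^ (θ' + 2)) ^ 2 * (16 * R * (n * d) / (s * s)) ^ R))) := by
  have hM0 : 0 < M := by omega
  refine (PPr_le_sum (E2 := fun G w => ¬ HB G w h ε M ∨ ¬ LD w h s ∨ (PA ε (θ' + 2) ((d + 1) * M) G ∧ ∃ l, IsP G l ∧ l.length = θ' + 2 ∧ NoBall G M l.toFinset w T) ∨ ∃ z ∈ listsLen n (θ' + 2) ×ˢ listsLen n (θ' + 2), Bad G w h T M s z.1.toFinset z.2.toFinset) ?_).trans
    (add_le_add le_rfl ((PPr_or _ _).trans (add_le_add ?_ ((PPr_or _ _).trans (add_le_add ?_ ((PPr_or _ _).trans (add_le_add ?_ ?_)))))))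
  · intro G hG w hw hU
    by_contra hcon
    push Not at hcon
    obtain ⟨c1, c2, c3, c4, c5⟩ := hcon
    unfold UU at hU
    push Not at hU
    obtain ⟨l, l', a1, a2, a3, a4, a5⟩ := hU
    have c4' := c4 c1
    refine c5 (l, l') (by simp [a3, a4]) (noconn_bad hG hd hε hε1 c1 hK le_rfl hM8 c2 c3 (by linarith) hs ?_ ?_ a5)
    · exact c4' l a1 a3
    · exact c4' l' a2 a4
  · apply PPr_le_of_forall (by positivity)
    intro G hG
    exact HB_prob hG (by linarith) hM0 hc (by omega)
  · apply PPr_le_of_forall (by positivity)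
    intro G hG
    exact LD_prob hh hns
  · apply PPr_le_of_forall (by positivity)
    intro G hG
    by_cases hPA : PA ε (θ' + 2) ((d + 1) * M) G
    · refine le_trans (real_mono_ae ?_) (noball_prob hG hd hε hε1 θ' M ((d + 1) * M) T hK (by nlinarith) hPA)
      intro w _ hw
      exact hw.2
    · have : {w : W n | PA ε (θ' + 2) ((d + 1) * M) G ∧ ∃ l, IsP G l ∧ l.length = θ' + 2 ∧ NoBall G M l.toFinset w T} = ∅ := by
        ext w; simp [hPA]
      rw [this]
      simp only [measureReal_empty]
      positivity
  · refine (PPr_exists _ _).trans ?_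
    calc _ ≤ ∑ z ∈ listsLen n (θ' + 2) ×ˢ listsLen n (θ' + 2), ((16:ℝ) * R * (n * d) / (s * s)) ^ R :=
          Finset.sum_le_sum fun z _ => Bad_PPr h T M _ _ hs0 hs1 R
      _ = ((listsLen n (θ' + 2)).card:ℝ) ^ 2 * ((16:ℝ) * R * (n * d) / (s * s)) ^ R := by
          rw [Finset.sum_const, nsmul_eq_mul, Finset.card_product]; push_cast; ring
      _ ≤ _ := by
          apply mul_le_mul_of_nonneg_right _ (by positivity)
          apply pow_le_pow_left₀ (by positivity)
          exact_mod_cast card_listsLen_le n (θ' + 2)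

end U

end FPP

namespace FPP

section U2
variable {n d : ℕ}

lemma UU.mono {G : SimpleGraph (Fin n)} {w : W n} {K : ℕ} {t t' : ℝ} (h : UU G w K t) (htt : t ≤ t') :
    UU G w K t' := by
  intro l l' a1 a2 a3 a4
  obtain ⟨R, b1, b2, b3⟩ := h l l' a1 a2 a3 a4
  exact ⟨R, b1, b2, b3.trans htt⟩

lemma time_bound {κ D lam h ℓ A : ℝ} (hκ : 0 < κ) (hκ1 : κ ≤ 1) (hD : 1 ≤ D) (hl1 : D - κ / 150 ≤ lam)
    (hl2 : lam ≤ D) (hh : 0 ≤ h) (hA : A ≤ 2 + (1 + 3 / 100 * κ) * ℓ) (hl : 2 * (3 * h * D + 2) ≤ κ * ℓ) (hℓ : 0 ≤ ℓ) :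
    A / lam + 3 * h ≤ (1 + κ) * ℓ / D := by
  have hlam : 0 < lam := by linarith
  have hD0 : 0 < D := by linarith
  set x := ℓ / D with hx
  have hx0 : 0 ≤ x := by positivity
  have hℓx : ℓ = D * x := by rw [hx]; field_simp
  have e : (1 + κ) * ℓ / D = (1 + κ) * x := by rw [hx]; ring
  rw [e, ← le_sub_iff_add_le, div_le_iff₀ hlam]
  refine hA.trans ?_
  have h1 : (D - κ / 150) * ((1 + κ) * x) ≤ lam * ((1 + κ) * x) := by gcongr
  have h2 : lam * (3 * h) ≤ D * (3 * h) := by gcongr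
  have hxl : x ≤ ℓ := by rw [hℓx]; nlinarith
  have h3 : κ * (1 + κ) * x ≤ κ * 2 * ℓ := by gcongr; linarith
  have h4 : κ * ℓ = κ * (D * x) := by rw [hℓx]
  have h5 : 0 ≤ h * D := by positivity
  have h6 : 0 ≤ κ * ℓ := by positivity
  linarith

set_option maxHeartbeats 2000000 in
lemma U_ev (hd : 3 ≤ d) {κ : ℝ} (hκ : 0 < κ) (hκ1 : κ ≤ 1) : ∃ K : ℕ, 2 ≤ K ∧ ∀ η : ℝ, 0 < η →
    ∀ᶠ n : ℕ in atTop, PPr n d (fun G w => ¬ UU G w K ((1 + κ) * Real.log n / (d - 2))) ≤ η := by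
  have hd3 : (3:ℝ) ≤ d := by exact_mod_cast hd
  have hdp : (0:ℝ) < d := by linarith
  set δ : ℝ := κ / 100 with hδ
  have hδ0 : 0 < δ := by positivity
  set ε : ℝ := κ / (100 * d) with hε
  have hε0 : 0 < ε := by positivity
  have hεd : 100 * d * ε = κ := by rw [hε]; field_simp
  set θ' : ℕ := ⌈700 * d / κ⌉₊ with hθ
  have hθ1 : 700 * d / κ ≤ θ' := Nat.le_ceil _
  have hθκ : 700 * d ≤ θ' * κ := by rwa [div_le_iff₀ hκ] at hθ1
  have hθ0 : (0:ℝ) < θ' := lt_of_lt_of_le (by positivity) hθ1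
  refine ⟨θ' + 2, by omega, fun η hη => ?_⟩
  -- the constant h
  obtain ⟨h, hh8, hhc⟩ : ∃ h : ℝ, 8 ≤ h ∧ (d:ℝ) ^ 2 * 2 ^ d * Real.exp (-(h * ε)) ≤ Real.exp (-1) := by
    set c : ℝ := (d:ℝ) ^ 2 * 2 ^ d with hc
    have hc0 : 0 < c := by positivity
    refine ⟨max 8 ((Real.log c + 1) / ε), le_max_left _ _, ?_⟩
    have h1 : Real.log c + 1 ≤ max 8 ((Real.log c + 1) / ε) * ε := by
      rw [← div_le_iff₀ hε0]; exact le_max_right _ _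
    calc c * Real.exp (-(max 8 ((Real.log c + 1) / ε) * ε)) ≤ c * Real.exp (-(Real.log c + 1)) := by gcongr
      _ = Real.exp (Real.log c) * Real.exp (-(Real.log c + 1)) := by rw [Real.exp_log hc0]
      _ = Real.exp (-1) := by rw [← Real.exp_add]; congr 1; ring
  set c : ℝ := 1 / 2 + δ with hc
  set R : ℕ := ⌈(2 * (θ' + 2) + 1) / (2 * δ)⌉₊ with hR
  have hRδ : (2 * (θ' + 2) + 1 : ℝ) ≤ R * (2 * δ) := by
    rw [← div_le_iff₀ (by positivity)]; exact Nat.le_ceil _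
  set lam : ℝ := d - 2 - 2 * ε with hlam
  have hε150 : 2 * ε ≤ κ / 150 := by
    have := mul_le_mul_of_nonneg_right hd3 hε0.le
    linarith
  have hlam0 : 0 < lam := by rw [hlam]; linarith
  set M : ℕ → ℕ := fun n => ⌈Real.exp (c * Real.log n)⌉₊ with hM
  have hη5 : 0 < η / 5 := by positivity
  have pa := PA_ev (d := d) (by omega) ε hε0 (by linarith) (θ' + 2) (by
      push_cast
      have : ε * θ' * (100 * d) ≥ 700 * d := by
        have : ε * θ' * (100 * d) = θ' * κ := by rw [← hεd]; ring
        linarith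
      have h7 : 7 ≤ ε * θ' := le_of_mul_le_mul_right (by linarith : 7 * (100 * (d:ℝ)) ≤ ε * θ' * (100 * d)) (by positivity)
      linarith) (fun n => (d + 1) * M n) (by
      filter_upwards [ev_poly (2 * (d + 1)) 0 (b := 0.15) (ε := 1) (by norm_num) one_pos, ev_log 1] with n h1 h2
      simp only [pow_zero, mul_one] at h1
      set ℓ := Real.log n
      have e1 : (M n : ℝ) ≤ 2 * Real.exp (c * ℓ) := by
        have := (Nat.ceil_lt_add_one (Real.exp_pos (c * ℓ)).le).le
        have h3 : 1 ≤ Real.exp (c * ℓ) := Real.one_le_exp (by positivity)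
        simp only [hM]; linarith
      push_cast
      calc ((d:ℝ) + 1) * M n ≤ (d + 1) * (2 * Real.exp (c * ℓ)) := by gcongr
        _ ≤ (d + 1) * (2 * Real.exp (-(0.15 * ℓ) + 2 / 3 * ℓ)) := by
            gcongr; rw [hc, hδ]
            have := mul_le_mul_of_nonneg_right hκ1 (zero_le_one.trans h2)
            linarith
        _ = 2 * (d + 1) * Real.exp (-(0.15 * ℓ)) * Real.exp (2 / 3 * ℓ) := by rw [Real.exp_add]; ring
        _ ≤ 1 * Real.exp (2 / 3 * ℓ) := by gcongr
        _ = _ := one_mul _) (η / 5) hη5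
  have a1 := ev_poly 24 0 (b := 1) one_pos hη5
  have a2 := ev_poly 1 0 (b := 1) one_pos hη5
  have a3 := ev_poly (d ^ (θ' + 1)) 0 (b := 2) two_pos hη5
  have a4 := ev_poly ((1024 * R * d ^ 3) ^ R) 0 (b := 1) one_pos hη5
  have a5 := ev_poly (64 * d ^ 2) 0 (b := 2 * δ) (ε := 1) (by positivity) one_pos
  filter_upwards [pa, a1, a2, a3, a4, a5, ev_log 1, ev_log (2 * (θ' + 2)), ev_log (64 * d * (d * d + 2 * d)),
    ev_log (2 * (3 * h * (d - 2) + 2) / κ), eventually_gt_atTop 0] with n pa a1 a2 a3 a4 a5 b1 b2 b3 b4 hn0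
  simp only [pow_zero, mul_one, one_mul] at a1 a2 a3 a4 a5
  have hnp : (0:ℝ) < n := by exact_mod_cast hn0
  set ℓ := Real.log n with hℓ
  have hne : (n:ℝ) = Real.exp ℓ := (Real.exp_log hnp).symm
  have hℓ0 : 0 ≤ ℓ := by linarith
  have m1 : Real.exp (c * ℓ) ≤ M n := Nat.le_ceil _
  have m2 : (M n : ℝ) ≤ 2 * Real.exp (c * ℓ) := by
    have := (Nat.ceil_lt_add_one (Real.exp_pos (c * ℓ)).le).le
    have h3 : 1 ≤ Real.exp (c * ℓ) := Real.one_le_exp (by positivity)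
    simp only [hM]; linarith
  set m := M n with hm
  have m3 : ℓ / 2 ≤ m := by
    have := Real.add_one_le_exp (c * ℓ)
    have : c * ℓ = ℓ / 2 + δ * ℓ := by rw [hc]; ring
    have : 0 ≤ δ * ℓ := by positivity
    linarith
  have hm0 : (0:ℝ) < m := lt_of_lt_of_le (Real.exp_pos _) m1
  have hd2 : (9:ℝ) ≤ d * d := by nlinarith
  have hbig : (8 * d : ℝ) ≤ m := by
    have h1 : (d:ℝ) * 15 ≤ d * (d * d + 2 * d) := by gcongr; linarith
    linarith
  set s := m / (4 * d) with hs
  have hs4 : 4 * d * s ≤ m := Nat.mul_div_le _ _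
  have hs8 : (m : ℝ) / (8 * d) ≤ s := by
    have h1 : m < 4 * d * s + 4 * d := by
      have := Nat.lt_mul_div_succ m (show 0 < 4 * d by omega)
      rw [← hs] at this; linarith
    have h2 : (m:ℝ) ≤ 4 * d * s + 4 * d := by exact_mod_cast h1.le
    rw [div_le_iff₀ (by positivity)]
    linarith
  have hsm : (4 * (d * d + 2 * d) : ℝ) ≤ s := by
    refine le_trans ?_ hs8
    rw [le_div_iff₀ (by positivity)]
    linarith
  have hsm' : 4 * (d * d + 2 * d) ≤ s := by exact_mod_cast hsm
  have hs0 : 0 < s := by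
    have : 0 < d * d := by positivity
    omega
  have hs0r : (0:ℝ) < s := by exact_mod_cast hs0
  have hss : (n:ℝ) / (s * s) ≤ 64 * d ^ 2 * Real.exp (-(2 * δ * ℓ)) := by
    rw [div_le_iff₀ (by positivity)]
    have h1 : Real.exp (c * ℓ) / (8 * d) ≤ s := le_trans (by gcongr) hs8
    have h2 : Real.exp (c * ℓ) / (8 * d) * (Real.exp (c * ℓ) / (8 * d)) ≤ s * s := by gcongr
    calc (n:ℝ) = 64 * d ^ 2 * Real.exp (-(2 * δ * ℓ)) * (Real.exp (c * ℓ) / (8 * d) * (Real.exp (c * ℓ) / (8 * d))) := by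
          have : Real.exp ℓ = Real.exp (-(2 * δ * ℓ)) * (Real.exp (c * ℓ) * Real.exp (c * ℓ)) := by
            rw [← Real.exp_add, ← Real.exp_add]; congr 1; rw [hc]; ring
          rw [hne, this]; field_simp; ring
      _ ≤ _ := by gcongr
  have hnss : (n:ℝ) ≤ s * s := by
    have := hss.trans a5
    rwa [div_le_one (by positivity)] at this
  set T := (Real.log m + 3 / θ' * ℓ) / lam with hT
  have hU := U_bound (n := n) hd hε0 (by linarith) θ' m s R h T (by
      have : ((θ' + 2 : ℕ) : ℝ) ≤ m := by push_cast; linarith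
      exact_mod_cast this) (by exact_mod_cast hbig) hs4 hs0 hsm' (by exact_mod_cast hnss) hh8 hhc
  have hlogm : Real.log m ≤ 1 + c * ℓ := by
    calc Real.log m ≤ Real.log (2 * Real.exp (c * ℓ)) := Real.log_le_log hm0 m2
      _ = Real.log 2 + c * ℓ := by rw [Real.log_mul (by norm_num) (Real.exp_pos _).ne', Real.log_exp]
      _ ≤ _ := by have := Real.log_two_lt_d9; linarith
  have htime : 2 * T + 3 * h ≤ (1 + κ) * ℓ / (d - 2) := by
    have e : 2 * T = (2 * Real.log m + 6 / θ' * ℓ) / lam := by rw [hT]; ring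
    rw [e]
    apply time_bound hκ hκ1 (by linarith) (by rw [hlam]; linarith) (by rw [hlam]; linarith) (by linarith) _ _ hℓ0
    · have h6 : 6 / (θ':ℝ) ≤ κ / 100 := by
        rw [div_le_iff₀ hθ0]; linarith
      have : 6 / (θ':ℝ) * ℓ ≤ κ / 100 * ℓ := by gcongr
      rw [hc, hδ] at hlogm
      linarith
    · rw [div_le_iff₀ hκ] at b4; linarith
  refine le_trans (PPr_mono ?_) (hU.trans ?_)
  · intro G hG w hw hn hu
    exact hn (hu.mono htime)
  have t1 : (n:ℝ) * Real.exp (-m) ≤ η / 5 := by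
    refine le_trans ?_ a1
    have h1 := Real.pow_div_factorial_le_exp (m:ℝ) hm0.le 4
    have h2 : Real.exp (2 * ℓ) ≤ (m:ℝ) ^ 4 := by
      calc Real.exp (2 * ℓ) ≤ Real.exp (c * ℓ) ^ 4 := by
            rw [← Real.exp_nat_mul]; apply Real.exp_le_exp.2; push_cast
            rw [hc]
            have := mul_nonneg hδ0.le hℓ0
            linarith
        _ ≤ _ := by gcongr
    have h3 : Real.exp (2 * ℓ) ≤ 24 * Real.exp m := by
      have : ((4).factorial : ℝ) = 24 := by norm_num [Nat.factorial]
      rw [this, div_le_iff₀ (by norm_num)] at h1; linarith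
    rw [Real.exp_neg, hne, ← div_eq_mul_inv, div_le_iff₀ (Real.exp_pos _)]
    calc Real.exp ℓ = Real.exp (-ℓ) * Real.exp (2 * ℓ) := by rw [← Real.exp_add]; congr 1; ring
      _ ≤ Real.exp (-ℓ) * (24 * Real.exp m) := by gcongr
      _ = _ := by ring
  have t2 : Real.exp (-((s:ℝ) * s)) ≤ η / 5 := by
    refine le_trans ?_ a2
    apply Real.exp_le_exp.2
    have := Real.log_le_sub_one_of_pos hnp
    linarith
  have t3 : (n:ℝ) * d ^ (θ' + 1) * (Real.exp (-(lam * θ' * T)) * (m:ℝ) ^ θ') ≤ η / 5 := by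
    refine le_trans (le_of_eq ?_) a3
    have e1 : lam * θ' * T = θ' * Real.log m + 3 * ℓ := by
      rw [hT]; field_simp
    have e2 : Real.exp (-(lam * θ' * T)) * (m:ℝ) ^ θ' = Real.exp (-(3 * ℓ)) := by
      have : (m:ℝ) ^ θ' = Real.exp (θ' * Real.log m) := by
        rw [Real.exp_nat_mul, Real.exp_log hm0]
      rw [this, e1, ← Real.exp_add]; congr 1; ring
    rw [e2, hne]
    have : Real.exp (-(2 * ℓ)) = Real.exp ℓ * Real.exp (-(3 * ℓ)) := by
      rw [← Real.exp_add]; congr 1; ring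
    rw [this]; ring
  have t4 : ((n:ℝ) ^ (θ' + 2)) ^ 2 * (16 * R * (n * d) / (s * s)) ^ R ≤ η / 5 := by
    refine le_trans ?_ a4
    have e1 : 16 * R * (n * d) / (s * s) ≤ (1024 * R * d ^ 3) * Real.exp (-(2 * δ * ℓ)) := by
      calc 16 * R * (n * d) / (s * s) = 16 * R * d * ((n:ℝ) / (s * s)) := by ring
        _ ≤ 16 * R * d * (64 * d ^ 2 * Real.exp (-(2 * δ * ℓ))) := by gcongr
        _ = _ := by ring
    have e2 : ((n:ℝ) ^ (θ' + 2)) ^ 2 = Real.exp ((2 * (θ' + 2)) * ℓ) := by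
      rw [← pow_mul, hne, ← Real.exp_nat_mul]; congr 1; push_cast; ring
    calc ((n:ℝ) ^ (θ' + 2)) ^ 2 * (16 * R * (n * d) / (s * s)) ^ R
        ≤ ((n:ℝ) ^ (θ' + 2)) ^ 2 * ((1024 * R * d ^ 3) * Real.exp (-(2 * δ * ℓ))) ^ R := by gcongr
      _ = (1024 * R * d ^ 3) ^ R * (Real.exp ((2 * (θ' + 2)) * ℓ) * Real.exp (R * (-(2 * δ * ℓ)))) := by
          rw [mul_pow, e2, Real.exp_nat_mul _ R]; ring
      _ ≤ (1024 * R * d ^ 3) ^ R * Real.exp (-ℓ) := by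
          apply mul_le_mul_of_nonneg_left _ (by positivity)
          rw [← Real.exp_add]; apply Real.exp_le_exp.2
          have := mul_le_mul_of_nonneg_right hRδ hℓ0
          linarith
  linarith

end U2

end FPP

namespace FPP

section upper
variable {n d : ℕ}

lemma geo_central {G : SimpleGraph (Fin n)} {w : W n} (hw : ∀ e, 0 ≤ w e) {l : List (Fin n)} {k K : ℕ} {t : ℝ}
    (hl : IsP G l) (hg : Geo G w l) (hlen : l.length = k + 1) (hk : 2 * K ≤ k) (hU : UU G w K t) :
    wt w ((l.drop K).take (k + 1 - 2 * K)) ≤ t := by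
  set A := l.take K with hA
  set C := (l.drop K).take (k + 1 - 2 * K) with hC
  set B := (l.drop K).drop (k + 1 - 2 * K) with hB
  have hsplit : l = A ++ (C ++ B) := by
    rw [hA, hC, hB, List.take_append_drop, List.take_append_drop]
  have hAl : A.length = K := by rw [hA, List.length_take, hlen]; omega
  have hBl : B.length = K := by rw [hB, List.length_drop, List.length_drop, hlen]; omega
  obtain ⟨R, h1, ⟨a, ha, b, hb, hc⟩, h2⟩ := hU A B (hl.infix ⟨[], C ++ B, by rw [hsplit]; simp⟩)
    (hl.infix ⟨A ++ C, [], by rw [hsplit]; simp⟩) hAl hBl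
  rw [List.mem_toFinset] at ha hb
  obtain ⟨A1, A2, hA'⟩ := List.append_of_mem ha
  obtain ⟨B1, B2, hB'⟩ := List.append_of_mem hb
  have hσ : (a :: (A2 ++ C ++ B1 ++ [b])) <:+: l := by
    refine ⟨A1, B2, ?_⟩
    rw [hsplit, hA', hB']; simp
  have hcs : Conn (a :: (A2 ++ C ++ B1 ++ [b])) a b := by
    refine ⟨rfl, ?_⟩
    exact List.getLast?_concat (l := a :: (A2 ++ C ++ B1))
  have h3 := hg _ hσ a b hcs R h1 hc
  refine (wt_infix hw ?_).trans (h3.trans h2)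
  exact ⟨a :: A2, B1 ++ [b], by simp⟩

lemma upper_bound (K k : ℕ) (hK : 2 ≤ K) (hk : 2 * K ≤ k) (t : ℝ) (St : Finset (Fin n)) :
    PPr n d (fun G w => ∃ v ∈ St, ∃ j, k ≤ hopCount G w v j) ≤
      PPr n d (fun G w => ¬ UU G w K t) + St.card * NN d k * pL (k - 2 * K) t := by
  refine (PPr_le_sum (E2 := fun G w => ∃ l ∈ Pa G k St, wt w ((l.reverse.drop K).take (k + 1 - 2 * K)) ≤ t) ?_).trans
    (add_le_add le_rfl ?_)
  · rintro G hG w hw ⟨v, hv, j, hj⟩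
    by_cases hU : UU G w K t
    · right
      obtain ⟨l, h1, h2, h3, h4⟩ := exists_geo hw (by omega : 0 < k) hj
      refine ⟨l.reverse, ?_, ?_⟩
      · rw [mem_Pa]
        refine ⟨by simp [h3], h1.reverse, v, hv, ?_⟩
        cases l with
        | nil => simp at h2
        | cons x l =>
          simp only [List.head?_cons, Option.some.injEq] at h2
          subst h2
          exact ⟨l.reverse, by simp⟩
      · rw [List.reverse_reverse]
        exact geo_central hw h1 h4 h3 hk hU
    · left; exact hU
  · have hp := pL_nonneg (k - 2 * K) t
    apply PPr_le_of_forall (by positivity)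
    intro G hG
    refine (real_exists_le (Pa G k St) (fun l => {w | wt w ((l.reverse.drop K).take (k + 1 - 2 * K)) ≤ t})).trans ?_
    calc _ ≤ ∑ l ∈ Pa G k St, pL (k - 2 * K) t := by
          apply Finset.sum_le_sum
          intro l hl
          rw [mem_Pa] at hl
          obtain ⟨a1, a2, -⟩ := hl
          set C := (l.reverse.drop K).take (k + 1 - 2 * K) with hC
          have hCl : C.length = k + 1 - 2 * K := by
            rw [hC, List.length_take, List.length_drop, List.length_reverse, a1]; omega
          have hCn : C.Nodup := by
            have := a2.reverse.2
            exact ((List.take_sublist _ _).trans (List.drop_sublist _ _)).nodup this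
          have := mu_real_sum (nodup_edgesL hCn) t
          rw [length_edgesL, hCl] at this
          have e : k + 1 - 2 * K - 1 = k - 2 * K := by omega
          rw [e] at this
          exact this.le
      _ = (Pa G k St).card * pL (k - 2 * K) t := by simp
      _ ≤ _ := by
          gcongr
          exact_mod_cast card_Pa_le hG k St

set_option maxHeartbeats 1000000 in
lemma upper_gen (hd : 3 ≤ d) {α γ ε : ℝ} (hα : ((d:ℝ) - 1) / (d - 2) < α) (hγ : γ < ff d α) (hε : 0 < ε) :
    ∀ᶠ n : ℕ in atTop, ∀ St : Finset (Fin n), (St.card : ℝ) ≤ Real.exp (γ * Real.log n) →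
      PPr n d (fun G w => ∃ v ∈ St, ∃ j, α * Real.log n ≤ hopCount G w v j) ≤ ε := by
  have hd3 : (3:ℝ) ≤ d := by exact_mod_cast hd
  have hD : (0:ℝ) < d - 2 := by linarith
  have hD1 : (0:ℝ) < d - 1 := by linarith
  have hα0 : 0 < α := lt_trans (by positivity) hα
  have hαD : (d:ℝ) - 1 < α * (d - 2) := by rwa [div_lt_iff₀ hD] at hα
  set ν := ff d α - γ with hν
  have hν0 : 0 < ν := by linarith
  set κ := min 1 (ν / (2 * α)) with hκ
  have hκ0 : 0 < κ := lt_min one_pos (by positivity)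
  have hκ1 : κ ≤ 1 := min_le_left _ _
  have hκν : κ * α ≤ ν / 2 := by
    have : κ ≤ ν / (2 * α) := min_le_right _ _
    rw [le_div_iff₀ (by positivity)] at this; linarith
  obtain ⟨K, hK, hU⟩ := U_ev hd hκ0 hκ1
  set θ := α * (d - 2) - 1 with hθ
  have hθ0 : 0 < θ := by linarith
  set Cc : ℝ := (d - 1) * (1 + θ) ^ (2 * K) with hCc
  filter_upwards [hU (ε / 2) (by positivity), ev_poly Cc 0 (b := ν / 2) (by positivity) (half_pos hε),
    ev_log 1, ev_log (2 * K / α)] with n u1 u2 b1 b2 St hSt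
  set ℓ := Real.log n with hℓ
  have hℓ0 : 0 ≤ ℓ := by linarith
  set k := ⌈α * ℓ⌉₊ with hk
  have hkα : α * ℓ ≤ k := Nat.le_ceil _
  have hkK : 2 * K ≤ k := by
    have : (2 * K : ℝ) ≤ k := by
      refine le_trans ?_ hkα
      rw [div_le_iff₀ hα0] at b2; linarith
    exact_mod_cast this
  set t := (1 + κ) * ℓ / (d - 2) with ht
  have hb := upper_bound (n := n) (d := d) K k hK hkK t St
  have hpre : PPr n d (fun G w => ∃ v ∈ St, ∃ j, α * ℓ ≤ hopCount G w v j) ≤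
      PPr n d (fun G w => ∃ v ∈ St, ∃ j, k ≤ hopCount G w v j) := by
    apply PPr_mono
    rintro G hG w hw ⟨v, hv, j, hj⟩
    exact ⟨v, hv, j, Nat.ceil_le.2 hj⟩
  refine hpre.trans (hb.trans ?_)
  have hmain : St.card * NN d k * pL (k - 2 * K) t ≤ ε / 2 := by
    refine le_trans ?_ u2
    have hch := pL_chernoff hθ0.le (k - 2 * K) t
    have hNN := NN_le_pow hd k
    have hpl := pL_nonneg (k - 2 * K) t
    set ρ : ℝ := (d - 1) / (1 + θ) with hρ
    have hρ0 : 0 < ρ := by positivity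
    have e1 : (d - 1 : ℝ) ^ (k + 1) * (1 / (1 + θ)) ^ (k - 2 * K) = Cc * ρ ^ k := by
      have : (1 + θ) ^ k = (1 + θ) ^ (k - 2 * K) * (1 + θ) ^ (2 * K) := by
        rw [← pow_add]; congr 1; omega
      rw [hCc, hρ, div_pow, div_pow, this]
      field_simp
      ring
    have hlogρ : Real.log ρ = - Real.log (((d : ℝ) - 2) * α / ((d : ℝ) - 1)) := by
      rw [← Real.log_inv, inv_div, hρ, hθ]; congr 2; ring
    have hlogneg : Real.log ρ ≤ 0 := by
      apply Real.log_nonpos hρ0.le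
      rw [hρ, div_le_one (by positivity), hθ]; linarith
    have e2 : ρ ^ k ≤ Real.exp (α * ℓ * Real.log ρ) := by
      rw [← Real.exp_log (show 0 < ρ ^ k by positivity), Real.log_pow]
      apply Real.exp_le_exp.2
      nlinarith
    have hCc0 : 0 < Cc := by positivity
    calc St.card * NN d k * pL (k - 2 * K) t
        ≤ Real.exp (γ * ℓ) * (d - 1) ^ (k + 1) * (Real.exp (θ * t) * (1 / (1 + θ)) ^ (k - 2 * K)) := by gcongr
      _ = Real.exp (γ * ℓ) * Real.exp (θ * t) * (Cc * ρ ^ k) := by rw [← e1]; ring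
      _ ≤ Real.exp (γ * ℓ) * Real.exp (θ * t) * (Cc * Real.exp (α * ℓ * Real.log ρ)) := by gcongr
      _ = Cc * Real.exp (γ * ℓ + θ * t + α * ℓ * Real.log ρ) := by rw [Real.exp_add, Real.exp_add]; ring
      _ ≤ Cc * Real.exp (-(ν / 2 * ℓ)) := by
          gcongr
          have e3 : θ * t = (α - 1 / (d - 2)) * (1 + κ) * ℓ := by
            rw [hθ, ht]; field_simp
          have e4 : γ = α * Real.log (((d : ℝ) - 2) * α / ((d : ℝ) - 1)) - α + 1 / ((d : ℝ) - 2) - ν := by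
            rw [hν]; unfold ff; ring
          rw [e3, hlogρ, e4]
          have h5 : 0 ≤ 1 / ((d:ℝ) - 2) * κ * ℓ := by positivity
          have h6 : κ * α * ℓ ≤ ν / 2 * ℓ := by gcongr
          nlinarith
      _ = _ := by simp
  linarith

end upper

end FPP

namespace FPP

section final
variable {n d : ℕ}

lemma ff_lt (hd : 3 ≤ d) {α β : ℝ} (hα : ((d:ℝ) - 1) / (d - 2) < α) (hαβ : α < β) : ff d α < ff d β := by
  have hd3 : (3:ℝ) ≤ d := by exact_mod_cast hd
  have hD : (0:ℝ) < d - 2 := by linarith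
  have hD1 : (0:ℝ) < d - 1 := by linarith
  have hα0 : 0 < α := lt_trans (by positivity) hα
  have hβ0 : 0 < β := hα0.trans hαβ
  have hαD : (d:ℝ) - 1 < α * (d - 2) := by rwa [div_lt_iff₀ hD] at hα
  have h1 : 0 < Real.log (((d : ℝ) - 2) * α / ((d : ℝ) - 1)) := by
    apply Real.log_pos
    rw [one_lt_div hD1]; linarith
  have h2 : Real.log (((d : ℝ) - 2) * β / ((d : ℝ) - 1)) =
      Real.log (((d : ℝ) - 2) * α / ((d : ℝ) - 1)) - Real.log (α / β) := by
    rw [← Real.log_div (by positivity) (by positivity)]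
    congr 1; field_simp
  have h3 := Real.log_le_sub_one_of_pos (show 0 < α / β by positivity)
  have h4 : β * Real.log (α / β) ≤ α - β := by
    calc β * Real.log (α / β) ≤ β * (α / β - 1) := by gcongr
      _ = α - β := by field_simp
  unfold ff
  rw [h2]
  nlinarith

lemma exists_lower (hd : 3 ≤ d) {α ε : ℝ} (hα : ((d:ℝ) - 1) / (d - 2) < α) (hε : 0 < ε) :
    ∃ α0, 0 < α0 ∧ α - ε ≤ α0 ∧ ff d α0 < ff d α := by
  have hd3 : (3:ℝ) ≤ d := by exact_mod_cast hd
  have hD : (0:ℝ) < d - 2 := by linarith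
  have hD1 : (0:ℝ) < d - 1 := by linarith
  have hq : 0 < ((d:ℝ) - 1) / (d - 2) := by positivity
  set q := ((d:ℝ) - 1) / (d - 2) with hqd
  have h1 : q < max (α - ε) ((q + α) / 2) := lt_of_lt_of_le (by linarith) (le_max_right _ _)
  refine ⟨max (α - ε) ((q + α) / 2), by linarith, le_max_left _ _, ff_lt hd h1 (max_lt (by linarith) (by linarith))⟩

/-- combining the two tails -/
lemma combine {ι : Type*} [Fintype ι] [Nonempty ι] {α α0 ε δ : ℝ} (hα0 : α - ε ≤ α0)
    (hℓ : 0 < Real.log n) (p : ι → Fin n × Fin n)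
    (h1 : PPr n d (fun G w => ∀ i, (hopCount G w (p i).1 (p i).2 : ℝ) < α0 * Real.log n) ≤ δ / 2)
    (h2 : PPr n d (fun G w => ∃ i, (α + ε) * Real.log n ≤ hopCount G w (p i).1 (p i).2) ≤ δ / 2) :
    fppMeasure n d {x | ε < |((Finset.univ.sup fun i : ι =>
                    hopCount x.1 x.2 (p i).1 (p i).2 : ℕ) : ℝ) / Real.log n - α|} ≤ ENNReal.ofReal δ := by
  refine (fpp_le (d := d) (fun G w => ε < |((Finset.univ.sup fun i : ι =>
                    hopCount G w (p i).1 (p i).2 : ℕ) : ℝ) / Real.log n - α|)).trans (ENNReal.ofReal_le_ofReal ?_)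
  refine (PPr_le_sum ?_).trans ((add_le_add h1 h2).trans (by linarith))
  intro G hG w hw h
  rw [lt_abs] at h
  rcases h with h | h
  · right
    obtain ⟨i, -, hi⟩ := Finset.exists_mem_eq_sup (Finset.univ : Finset ι) Finset.univ_nonempty
      (fun i : ι => hopCount G w (p i).1 (p i).2)
    refine ⟨i, ?_⟩
    rw [hi] at h
    have : α + ε < (hopCount G w (p i).1 (p i).2 : ℝ) / Real.log n := by linarith
    rw [lt_div_iff₀ hℓ] at this
    exact this.le
  · left
    intro i
    have h3 : hopCount G w (p i).1 (p i).2 ≤ Finset.univ.sup fun i : ι => hopCount G w (p i).1 (p i).2 :=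
      Finset.le_sup (f := fun i : ι => hopCount G w (p i).1 (p i).2) (Finset.mem_univ i)
    have h4 : (hopCount G w (p i).1 (p i).2 : ℝ) ≤
        ((Finset.univ.sup fun i : ι => hopCount G w (p i).1 (p i).2 : ℕ) : ℝ) := by exact_mod_cast h3
    have h5 : ((Finset.univ.sup fun i : ι => hopCount G w (p i).1 (p i).2 : ℕ) : ℝ) / Real.log n < α0 := by linarith
    rw [div_lt_iff₀ hℓ] at h5
    linarith

lemma main_i (hd : 3 ≤ d) {α ε δ : ℝ} (hα : ((d:ℝ) - 1) / (d - 2) < α) (hf : ff d α = 0) (hε : 0 < ε) (hδ : 0 < δ) :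
    ∀ᶠ n : ℕ in atTop, ∀ h : 0 < n, fppMeasure n d
              {x | ε < |((Finset.univ.sup fun j : Fin n =>
                    hopCount x.1 x.2 (⟨0, h⟩ : Fin n) j : ℕ) : ℝ) / Real.log n - α|} ≤ ENNReal.ofReal δ := by
  obtain ⟨α0, a1, a2, a3⟩ := exists_lower hd hα hε
  have hup := ff_lt hd hα (show α < α + ε by linarith)
  filter_upwards [lower_i hd a1 (by linarith) (half_pos hδ),
    upper_gen hd (α := α + ε) (γ := 0) (by linarith) (by linarith) (half_pos hδ), ev_log 1] with n l1 u1 b1 h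
  haveI : Nonempty (Fin n) := ⟨⟨0, h⟩⟩
  refine combine (d := d) a2 (by linarith) (fun j : Fin n => (⟨0, h⟩, j)) (l1 h) (le_trans (PPr_mono ?_) (u1 {⟨0, h⟩} (by simp)))
  rintro G hG w hw ⟨j, hj⟩
  exact ⟨⟨0, h⟩, by simp, j, hj⟩

lemma main_ii (hd : 3 ≤ d) {α ε δ : ℝ} (hα : ((d:ℝ) - 1) / (d - 2) < α) (hf : ff d α = 1) (hε : 0 < ε) (hδ : 0 < δ) :
    ∀ᶠ n : ℕ in atTop, fppMeasure n d
              {x | ε < |((Finset.univ.sup fun ij : Fin n × Fin n =>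
                    hopCount x.1 x.2 ij.1 ij.2 : ℕ) : ℝ) / Real.log n - α|} ≤ ENNReal.ofReal δ := by
  obtain ⟨α0, a1, a2, a3⟩ := exists_lower hd hα hε
  have hup := ff_lt hd hα (show α < α + ε by linarith)
  filter_upwards [lower_ii hd a1 (by linarith) (half_pos hδ),
    upper_gen hd (α := α + ε) (γ := 1) (by linarith) (by linarith) (half_pos hδ), ev_log 1, eventually_gt_atTop 0] with n l1 u1 b1 h
  haveI : Nonempty (Fin n) := ⟨⟨0, h⟩⟩
  have hnp : (0:ℝ) < n := by exact_mod_cast h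
  refine combine (d := d) a2 (by linarith) (fun ij : Fin n × Fin n => ij) (le_trans (PPr_mono ?_) l1)
    (le_trans (PPr_mono ?_) (u1 Finset.univ (by simp [Real.exp_log hnp])))
  · intro G hG w hw hh i j
    exact hh (i, j)
  · rintro G hG w hw ⟨ij, hj⟩
    exact ⟨ij.1, by simp, ij.2, hj⟩

lemma final (d : ℕ) (hd : 3 ≤ d) (αstar αhat : ℝ)
    (hαstar : αstar ∈ Set.Ioi (((d : ℝ) - 1) / ((d : ℝ) - 2)) ∧
      αstar * Real.log (((d : ℝ) - 2) * αstar / ((d : ℝ) - 1)) - αstar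
        + 1 / ((d : ℝ) - 2) = 0)
    (hαhat : αhat ∈ Set.Ioi (((d : ℝ) - 1) / ((d : ℝ) - 2)) ∧
      αhat * Real.log (((d : ℝ) - 2) * αhat / ((d : ℝ) - 1)) - αhat
        + 1 / ((d : ℝ) - 2) = 1) :
    ∀ ε : ℝ, 0 < ε →
      (Tendsto
        (fun n : ℕ =>
          if h : 0 < n then
            fppMeasure n d
              {x | ε < |((Finset.univ.sup fun j : Fin n =>
                    hopCount x.1 x.2 (⟨0, h⟩ : Fin n) j : ℕ) : ℝ) / Real.log n - αstar|}
          else 0)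
        (atTop ⊓ Filter.principal {n : ℕ | Even (d * n) ∧ d + 1 ≤ n}) (nhds 0)) ∧
      (Tendsto
        (fun n : ℕ =>
          fppMeasure n d
            {x | ε < |((Finset.univ.sup fun ij : Fin n × Fin n =>
                  hopCount x.1 x.2 ij.1 ij.2 : ℕ) : ℝ) / Real.log n - αhat|})
        (atTop ⊓ Filter.principal {n : ℕ | Even (d * n) ∧ d + 1 ≤ n}) (nhds 0)) := by
  intro ε hε
  have key : ∀ η : ℝ≥0∞, 0 < η → ∃ δ : ℝ, 0 < δ ∧ ENNReal.ofReal δ ≤ η := by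
    intro η hη
    obtain ⟨r, h1, h2⟩ := ENNReal.lt_iff_exists_nnreal_btwn.1 hη
    exact ⟨r, by exact_mod_cast h1, by rw [ENNReal.ofReal_coe_nnreal]; exact h2.le⟩
  constructor
  · refine Tendsto.mono_left ?_ inf_le_left
    rw [ENNReal.tendsto_nhds_zero]
    intro η hη
    obtain ⟨δ, hδ, hδη⟩ := key η hη
    filter_upwards [main_i hd hαstar.1 hαstar.2 hε hδ] with n hn
    split_ifs with h
    · exact (hn h).trans hδη
    · exact zero_le
  · refine Tendsto.mono_left ?_ inf_le_left
    rw [ENNReal.tendsto_nhds_zero]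
    intro η hη
    obtain ⟨δ, hδ, hδη⟩ := key η hη
    filter_upwards [main_ii hd hαhat.1 hαhat.2 hε hδ] with n hn
    exact hn.trans hδη

end final

end FPP

/-- Fix `d ≥ 3` and let `α*`, `α̂` be the unique solutions in
`((d−1)/(d−2),∞)` of `f(α)=0`, `f(α)=1`, where
`f(α) = α·log((d−2)α/(d−1)) − α + 1/(d−2)`. For a uniformly random simple `d`-regular graph
on `{1,…,n}` with i.i.d. rate-one exponential edge weights, as `n → ∞` (along `n` with `d·n`
even and `n ≥ d+1`): (i) `max_j |π(1,j)|/log n → α*` in probability, and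
(ii) `max_{i,j} |π(i,j)|/log n → α̂` in probability. -/
theorem stmt19 (d : ℕ) (hd : 3 ≤ d) (αstar αhat : ℝ)
    (hαstar : αstar ∈ Set.Ioi (((d : ℝ) - 1) / ((d : ℝ) - 2)) ∧
      αstar * Real.log (((d : ℝ) - 2) * αstar / ((d : ℝ) - 1)) - αstar
        + 1 / ((d : ℝ) - 2) = 0)
    (hαhat : αhat ∈ Set.Ioi (((d : ℝ) - 1) / ((d : ℝ) - 2)) ∧
      αhat * Real.log (((d : ℝ) - 2) * αhat / ((d : ℝ) - 1)) - αhat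
        + 1 / ((d : ℝ) - 2) = 1) :
    ∀ ε : ℝ, 0 < ε →
      (Tendsto
        (fun n : ℕ =>
          if h : 0 < n then
            fppMeasure n d
              {x | ε < |((Finset.univ.sup fun j : Fin n =>
                    hopCount x.1 x.2 (⟨0, h⟩ : Fin n) j : ℕ) : ℝ) / Real.log n - αstar|}
          else 0)
        (atTop ⊓ Filter.principal {n : ℕ | Even (d * n) ∧ d + 1 ≤ n}) (nhds 0)) ∧
      (Tendsto
        (fun n : ℕ =>
          fppMeasure n d
            {x | ε < |((Finset.univ.sup fun ij : Fin n × Fin n =>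
                  hopCount x.1 x.2 ij.1 ij.2 : ℕ) : ℝ) / Real.log n - αhat|})
        (atTop ⊓ Filter.principal {n : ℕ | Even (d * n) ∧ d + 1 ≤ n}) (nhds 0)) := by
  exact FPP.final d hd αstar αhat hαstar hαhat

end
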